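/- The sum of the degrees of the complex irreducible characters of U(m, F_{q²}) equals (q+1)·q²·(q³+1)·q⁴·(q⁵+1) ⋯ (q^m + (1−(−1)^m)/2), i.e. the product over i = 1,…,m of (q^i + 1) for odd i and q^i for even i. -/

import Mathlib

namespace UCS

/-- `R` restricts to a representation of the subgroup `G`. -/
structure IsRepOn {A : Type} [Group A] (G : Subgroup A) {X : Type} [AddCommGroup X] [Module ℂ X]
    (R : A → X →ₗ[ℂ] X) : Prop where
  one : R 1 = 1
  mul : ∀ x ∈ G, ∀ y ∈ G, R (x * y) = R x * R y

/-- stable subspaces -/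
def Stab {A : Type} [Group A] (G : Subgroup A) {X : Type} [AddCommGroup X] [Module ℂ X]
    (R : A → X →ₗ[ℂ] X) (W : Submodule ℂ X) : Prop :=
  ∀ g ∈ G, ∀ x ∈ W, R g x ∈ W

/-- irreducibility (the zero space is allowed) -/
def IrrOn {A : Type} [Group A] (G : Subgroup A) {X : Type} [AddCommGroup X] [Module ℂ X]
    (R : A → X →ₗ[ℂ] X) : Prop :=
  ∀ W : Submodule ℂ X, Stab G R W → W = ⊥ ∨ W = ⊤

/-- twisted invariant forms -/
def Inv {A : Type} [Group A] (G : Subgroup A) (c : A) {X : Type} [AddCommGroup X] [Module ℂ X]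
    (R : A → X →ₗ[ℂ] X) (B : X →ₗ[ℂ] X →ₗ[ℂ] ℂ) : Prop :=
  ∀ g ∈ G, ∀ x y, B (R g x) (R (c * g * c⁻¹) y) = B x y

/-- There is no skew twisted-invariant form on an irreducible representation. -/
def NoSkew {A : Type} [Group A] (G : Subgroup A) (c : A) : Prop :=
  ∀ (X : Type) [AddCommGroup X] [Module ℂ X] [FiniteDimensional ℂ X]
    (R : A → X →ₗ[ℂ] X), IsRepOn G R → IrrOn G R →
    ∀ B : X →ₗ[ℂ] X →ₗ[ℂ] ℂ, Inv G c R B → (∀ x y, B x y = - B y x) → B = 0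

/-- `c` is an involution normalizing `G`. -/
structure Nrm {A : Type} [Group A] (G : Subgroup A) (c : A) : Prop where
  sq : c * c = 1
  mem : ∀ g ∈ G, c * g * c⁻¹ ∈ G

section basics

variable {A : Type} [Group A] {G : Subgroup A} {c : A} {X : Type} [AddCommGroup X] [Module ℂ X]
    {R : A → X →ₗ[ℂ] X}

theorem Nrm.inv_eq (h : Nrm G c) : c⁻¹ = c := inv_eq_of_mul_eq_one_left h.sq

theorem Nrm.twice (h : Nrm G c) (g : A) : c * (c * g * c⁻¹) * c⁻¹ = g := by
  rw [h.inv_eq]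
  calc c * (c * g * c) * c = (c * c) * g * (c * c) := by group
    _ = g := by rw [h.sq]; group

theorem IsRepOn.mono (h : IsRepOn G R) {H : Subgroup A} (hH : H ≤ G) : IsRepOn H R :=
  ⟨h.one, fun x hx y hy => h.mul x (hH hx) y (hH hy)⟩

theorem IsRepOn.mul_apply (h : IsRepOn G R) {x y : A} (hx : x ∈ G) (hy : y ∈ G) (v : X) :
    R (x * y) v = R x (R y v) := by rw [h.mul x hx y hy]; rfl

theorem IsRepOn.inv_apply (h : IsRepOn G R) {x : A} (hx : x ∈ G) (v : X) :
    R x⁻¹ (R x v) = v := by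
  rw [← h.mul_apply (G.inv_mem hx) hx, inv_mul_cancel, h.one]; rfl

theorem IsRepOn.apply_inv (h : IsRepOn G R) {x : A} (hx : x ∈ G) (v : X) :
    R x (R x⁻¹ v) = v := by
  rw [← h.mul_apply hx (G.inv_mem hx), mul_inv_cancel, h.one]; rfl

theorem Inv.left (h : Inv G c R B) (hR : IsRepOn G R) (hc : Nrm G c) {g : A} (hg : g ∈ G)
    (x y : X) : B (R g x) y = B x (R (c * g⁻¹ * c⁻¹) y) := by
  have h1 := h g hg x (R (c * g⁻¹ * c⁻¹) y)
  rw [← h1]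
  have : c * g⁻¹ * c⁻¹ = (c * g * c⁻¹)⁻¹ := by group
  rw [this, hR.apply_inv (hc.mem g hg)]

theorem Inv.right (h : Inv G c R B) (hR : IsRepOn G R) (hc : Nrm G c) {g : A} (hg : g ∈ G)
    (x y : X) : B x (R g y) = B (R (c * g⁻¹ * c⁻¹) x) y := by
  rw [h.left hR hc (hc.mem _ (G.inv_mem hg))]
  have : c * (c * g⁻¹ * c⁻¹)⁻¹ * c⁻¹ = c * (c * g * c⁻¹) * c⁻¹ := by group
  rw [this, hc.twice]

theorem Inv.mono (h : Inv G c R B) {H : Subgroup A} (hH : H ≤ G) : Inv H c R B :=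
  fun g hg => h g (hH hg)

open Classical in
/-- restriction to a subspace (junk when not stable) -/
noncomputable def resR (R : A → X →ₗ[ℂ] X) (Y : Submodule ℂ X) (g : A) : Y →ₗ[ℂ] Y :=
  if h : ∀ x ∈ Y, R g x ∈ Y then (R g).restrict h else 0

theorem resR_apply {Y : Submodule ℂ X} {g : A} (h : ∀ x ∈ Y, R g x ∈ Y) (y : Y) :
    (resR R Y g y : X) = R g y := by
  unfold resR; rw [dif_pos h]; rfl

theorem IsRepOn.res (h : IsRepOn G R) {Y : Submodule ℂ X} (hY : Stab G R Y) :
    IsRepOn G (resR R Y) := by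
  constructor
  · ext y
    rw [resR_apply (hY 1 G.one_mem), h.one]; rfl
  · intro x hx y hy
    ext v
    rw [resR_apply (hY _ (G.mul_mem hx hy)), h.mul_apply hx hy]
    change _ = ((resR R Y x (resR R Y y v) : Y) : X)
    rw [resR_apply (hY _ hx), resR_apply (hY _ hy)]

/-- minimal stable subspaces -/
structure MinStab (G : Subgroup A) (R : A → X →ₗ[ℂ] X) (Y : Submodule ℂ X) : Prop where
  ne : Y ≠ ⊥
  stab : Stab G R Y
  min : ∀ W : Submodule ℂ X, Stab G R W → W ≤ Y → W = ⊥ ∨ W = Y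

theorem exists_minStab [FiniteDimensional ℂ X] (Y0 : Submodule ℂ X) (h0 : Y0 ≠ ⊥)
    (hs : Stab G R Y0) : ∃ Y ≤ Y0, MinStab G R Y := by
  classical
  let P : ℕ → Prop := fun n => ∃ Y ≤ Y0, Y ≠ ⊥ ∧ Stab G R Y ∧ Module.finrank ℂ Y = n
  have hP : ∃ n, P n := ⟨_, Y0, le_rfl, h0, hs, rfl⟩
  obtain ⟨Y, hY, hne, hst, hfr⟩ := Nat.find_spec hP
  refine ⟨Y, hY, hne, hst, fun W hW hWY => ?_⟩
  by_cases hW0 : W = ⊥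
  · exact Or.inl hW0
  · right
    have h1 : Nat.find hP ≤ Module.finrank ℂ W :=
      Nat.find_min' hP ⟨W, hWY.trans hY, hW0, hW, rfl⟩
    exact Submodule.eq_of_le_of_finrank_le hWY (by omega)

theorem MinStab.irr {Y : Submodule ℂ X} (h : MinStab G R Y) : IrrOn G (resR R Y) := by
  intro W hW
  have h1 : Stab G R (W.map Y.subtype) := by
    rintro g hg x ⟨w, hw, rfl⟩
    refine ⟨resR R Y g w, hW g hg w hw, ?_⟩
    exact resR_apply (h.stab g hg) w
  rcases h.min _ h1 (Submodule.map_subtype_le Y W) with h2 | h2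
  · left
    rw [eq_bot_iff]
    intro w hw
    have : (w : X) ∈ W.map Y.subtype := ⟨w, hw, rfl⟩
    rw [h2, Submodule.mem_bot] at this
    simpa using this
  · right
    have : W.map Y.subtype = (⊤ : Submodule ℂ Y).map Y.subtype := by rw [h2]; simp
    exact Submodule.map_injective_of_injective Y.injective_subtype this

theorem NoSkew.isotropic (hN : NoSkew G c) [FiniteDimensional ℂ X] (hR : IsRepOn G R)
    (hc : Nrm G c)
    {Y : Submodule ℂ X} (h : MinStab G R Y) (B : X →ₗ[ℂ] X →ₗ[ℂ] ℂ)
    (hB : ∀ g ∈ G, ∀ x ∈ Y, ∀ y ∈ Y, B (R g x) (R (c * g * c⁻¹) y) = B x y)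
    (hs : ∀ x ∈ Y, ∀ y ∈ Y, B x y = - B y x) : ∀ x ∈ Y, ∀ y ∈ Y, B x y = 0 := by
  have := hN Y (resR R Y) (hR.res h.stab) h.irr (B.compl₁₂ Y.subtype Y.subtype) ?_ ?_
  · intro x hx y hy
    have h2 := LinearMap.congr_fun (LinearMap.congr_fun this ⟨x, hx⟩) ⟨y, hy⟩
    simpa using h2
  · intro g hg x y
    simp only [LinearMap.compl₁₂_apply, Submodule.subtype_apply]
    rw [resR_apply (h.stab g hg), resR_apply (h.stab _ (hc.mem g hg))]
    exact hB g hg x x.2 y y.2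
  · intro x y
    simp only [LinearMap.compl₁₂_apply, Submodule.subtype_apply]
    exact hs x x.2 y y.2

theorem NoSkew.exists_isotropic (hN : NoSkew G c) [FiniteDimensional ℂ X] (hR : IsRepOn G R)
    (hc : Nrm G c) (Y0 : Submodule ℂ X) (h0 : Y0 ≠ ⊥) (hst : Stab G R Y0)
    (B : X →ₗ[ℂ] X →ₗ[ℂ] ℂ)
    (hB : ∀ g ∈ G, ∀ x ∈ Y0, ∀ y ∈ Y0, B (R g x) (R (c * g * c⁻¹) y) = B x y)
    (hs : ∀ x ∈ Y0, ∀ y ∈ Y0, B x y = - B y x) :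
    ∃ Y ≤ Y0, MinStab G R Y ∧ ∀ x ∈ Y, ∀ y ∈ Y, B x y = 0 := by
  obtain ⟨Y, hY, hm⟩ := exists_minStab Y0 h0 hst
  exact ⟨Y, hY, hm, hN.isotropic hR hc hm B (fun g hg x hx y hy => hB g hg x (hY hx) y (hY hy))
    (fun x hx y hy => hs x (hY hx) y (hY hy))⟩

/-- the stable subspace generated by `Y` -/
def gen (G : Subgroup A) (R : A → X →ₗ[ℂ] X) (Y : Submodule ℂ X) : Submodule ℂ X :=
  Submodule.span ℂ {z | ∃ g ∈ G, ∃ x ∈ Y, z = R g x}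

theorem gen_stab (hR : IsRepOn G R) (Y : Submodule ℂ X) : Stab G R (gen G R Y) := by
  intro g hg x hx
  unfold gen at hx ⊢
  induction hx using Submodule.span_induction with
  | mem x hx =>
    obtain ⟨k, hk, y, hy, rfl⟩ := hx
    exact Submodule.subset_span ⟨g * k, G.mul_mem hg hk, y, hy, (hR.mul_apply hg hk y).symm⟩
  | zero => simp
  | add x y _ _ hx hy => rw [map_add]; exact Submodule.add_mem _ hx hy
  | smul a x _ hx => rw [map_smul]; exact Submodule.smul_mem _ _ hx

theorem le_gen (hR : IsRepOn G R) (Y : Submodule ℂ X) : Y ≤ gen G R Y := fun y hy =>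
  Submodule.subset_span ⟨1, G.one_mem, y, hy, by rw [hR.one]; rfl⟩

theorem eq_zero_of_gen (hR : IsRepOn G R) (hI : IrrOn G R) (hc : Nrm G c) (B : X →ₗ[ℂ] X →ₗ[ℂ] ℂ)
    (hB : Inv G c R B) (Y : Submodule ℂ X) (hY : Y ≠ ⊥)
    (h : ∀ g ∈ G, ∀ x ∈ Y, ∀ y ∈ Y, B (R g x) y = 0) : B = 0 := by
  have htop : gen G R Y = ⊤ := by
    rcases hI _ (gen_stab hR Y) with h1 | h1
    · exact absurd (le_bot_iff.1 (h1 ▸ le_gen hR Y)) hY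
    · exact h1
  have key : ∀ x ∈ gen G R Y, ∀ y ∈ gen G R Y, B x y = 0 := by
    intro x hx y hy
    unfold gen at hx hy
    induction hx using Submodule.span_induction with
    | zero => simp
    | add x x' _ _ hx hx' => simp [hx, hx']
    | smul a x _ hx => simp [hx]
    | mem x hx =>
      obtain ⟨g, hg, x, hx, rfl⟩ := hx
      induction hy using Submodule.span_induction with
      | zero => simp
      | add y y' _ _ h1 h2 => simp [h1, h2]
      | smul a y _ h1 => simp [h1]
      | mem y hy =>
        obtain ⟨k, hk, y, hy, rfl⟩ := hy
        rw [hB.right hR hc hk, ← hR.mul_apply (hc.mem _ (G.inv_mem hk)) hg]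
        exact h _ (G.mul_mem (hc.mem _ (G.inv_mem hk)) hg) x hx y hy
  ext x y
  exact key x (htop ▸ Submodule.mem_top) y (htop ▸ Submodule.mem_top)

/-- pulling back along a surjection -/
theorem NoSkew.transfer {A' : Type} [Group A'] {G' : Subgroup A'} {c' : A'}
    (hN : NoSkew G c) (f : A → A') (f1 : f 1 = 1)
    (fm : ∀ x ∈ G, ∀ y ∈ G, f (x * y) = f x * f y)
    (fs : ∀ y ∈ G', ∃ x ∈ G, f x = y)
    (fG : ∀ x ∈ G, f x ∈ G')
    (fc : ∀ x ∈ G, f (c * x * c⁻¹) = c' * f x * c'⁻¹) : NoSkew G' c' := by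
  intro X _ _ _ R hR hI B hB hs
  refine hN X (fun x => R (f x)) ⟨by simp [f1, hR.one], fun x hx y hy => ?_⟩ ?_ B ?_ hs
  · show R (f (x * y)) = _
    rw [fm x hx y hy, hR.mul _ (fG x hx) _ (fG y hy)]
  · intro W hW
    apply hI W
    intro g hg x hx
    obtain ⟨k, hk, rfl⟩ := fs g hg
    exact hW k hk x hx
  · intro g hg x y
    show B (R (f g) x) (R (f (c * g * c⁻¹)) y) = _
    rw [fc g hg]
    exact hB _ (fG g hg) x y

/-- abelian groups -/
theorem noSkew_comm (h : ∀ x ∈ G, ∀ y ∈ G, x * y = y * x) : NoSkew G c := by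
  intro X _ _ _ R hR hI B hB hs
  have hBx : ∀ x, B x x = 0 := fun x => by
    have := hs x x
    linear_combination this / 2
  rcases subsingleton_or_nontrivial X with hX | hX
  · ext x y
    rw [Subsingleton.elim x 0]; simp
  have hsc : ∀ g ∈ G, ∃ a : ℂ, ∀ x, R g x = a • x := by
    intro g hg
    obtain ⟨a, ha⟩ := Module.End.exists_eigenvalue (R g)
    refine ⟨a, ?_⟩
    have hst : Stab G R (Module.End.eigenspace (R g) a) := by
      intro k hk x hx
      rw [Module.End.mem_eigenspace_iff] at hx ⊢
      rw [← hR.mul_apply hg hk, h g hg k hk, hR.mul_apply hk hg, hx, map_smul]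
    rcases hI _ hst with h1 | h1
    · exact absurd h1 ha
    · intro x
      exact Module.End.mem_eigenspace_iff.1 (h1 ▸ Submodule.mem_top)
  obtain ⟨v, hv⟩ := exists_ne (0 : X)
  have : Submodule.span ℂ {v} = ⊤ := by
    refine (hI _ ?_).resolve_left (by simpa using hv)
    intro g hg x hx
    obtain ⟨a, ha⟩ := hsc g hg
    rw [ha]; exact Submodule.smul_mem _ _ hx
  ext x y
  obtain ⟨a, rfl⟩ := Submodule.mem_span_singleton.1 (this ▸ Submodule.mem_top : x ∈ Submodule.span ℂ {v})
  obtain ⟨b, rfl⟩ := Submodule.mem_span_singleton.1 (this ▸ Submodule.mem_top : y ∈ Submodule.span ℂ {v})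
  simp [hBx v]

/-- commuting products -/
theorem noSkew_prod {G1 G2 : Subgroup A} (h1 : NoSkew G1 c) (h2 : NoSkew G2 c)
    (hc1 : Nrm G1 c) (hc2 : Nrm G2 c) (le1 : G1 ≤ G) (le2 : G2 ≤ G)
    (hcom : ∀ x ∈ G1, ∀ y ∈ G2, x * y = y * x)
    (hgen : ∀ g ∈ G, ∃ x ∈ G1, ∃ y ∈ G2, g = x * y) : NoSkew G c := by
  intro X _ _ _ R hR hI B hB hs
  rcases subsingleton_or_nontrivial X with hX | hX
  · ext x y
    rw [Subsingleton.elim x 0]; simp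
  obtain ⟨M, -, hM⟩ := exists_minStab (G := G1) (R := R) ⊤ top_ne_bot (fun _ _ _ _ => trivial)
  have hR1 := hR.mono le1
  have hR2 := hR.mono le2
  -- the action of `G2` on `Hom(M, X)`
  let S : A → (M →ₗ[ℂ] X) →ₗ[ℂ] (M →ₗ[ℂ] X) := fun g => (LinearMap.compRight ℂ (R g))
  have S_apply : ∀ g φ m, S g φ m = R g (φ m) := fun g φ m => rfl
  have hS : IsRepOn G2 S := by
    constructor
    · ext φ m; rw [S_apply, hR.one]; rfl
    · intro x hx y hy
      ext φ m
      rw [S_apply, hR2.mul_apply hx hy]; rfl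
  let Z : Submodule ℂ (M →ₗ[ℂ] X) :=
    { carrier := {φ | ∀ g ∈ G1, ∀ m : M, φ (resR R M g m) = R g (φ m)}
      zero_mem' := by intro g hg m; simp
      add_mem' := by
        intro a b ha hb g hg m
        simp [ha g hg m, hb g hg m]
      smul_mem' := by
        intro a b hb g hg m
        simp [hb g hg m] }
  have hZst : Stab G2 S Z := by
    intro g hg φ hφ k hk m
    rw [S_apply, S_apply, hφ k hk m, ← hR.mul_apply (le2 hg) (le1 hk), ← hcom k hk g hg,
      hR.mul_apply (le1 hk) (le2 hg)]
  have hZne : Z ≠ ⊥ := by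
    intro h0
    have hmem : M.subtype ∈ Z := by
      intro g hg m
      simp only [Submodule.subtype_apply]
      exact resR_apply (hM.stab g hg) m
    rw [h0, Submodule.mem_bot] at hmem
    apply hM.ne
    rw [eq_bot_iff]
    intro x hx
    have := LinearMap.congr_fun hmem ⟨x, hx⟩
    simpa using this
  obtain ⟨N, hNZ, hN⟩ := exists_minStab Z hZne hZst
  have step1 : ∀ m : M, ∀ φ ∈ N, ∀ φ' ∈ N, B (φ m) (φ' m) = 0 := by
    intro m
    let ev : (M →ₗ[ℂ] X) →ₗ[ℂ] X := LinearMap.applyₗ m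
    have := h2.isotropic hS hc2 hN (B.compl₁₂ ev ev) ?_ ?_
    · exact this
    · intro g hg φ _ φ' _
      exact hB g (le2 hg) (φ m) (φ' m)
    · intro φ _ φ' _
      exact hs _ _
  have step2 : ∀ φ ∈ N, ∀ φ' ∈ N, ∀ m m' : M, B (φ m) (φ' m') = 0 := by
    intro φ hφ φ' hφ' m m'
    have := h1 M (resR R M) (hR1.res hM.stab) hM.irr (B.compl₁₂ φ φ') ?_ ?_
    · have h3 := LinearMap.congr_fun (LinearMap.congr_fun this m) m'
      simpa using h3
    · intro g hg x y
      simp only [LinearMap.compl₁₂_apply]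
      rw [hNZ hφ g hg, hNZ hφ' _ (hc1.mem g hg)]
      exact hB g (le1 hg) _ _
    · intro x y
      simp only [LinearMap.compl₁₂_apply]
      have h3 := step1 (x + y) φ hφ φ' hφ'
      simp only [map_add, LinearMap.add_apply, step1 x φ hφ φ' hφ', step1 y φ hφ φ' hφ'] at h3
      linear_combination h3
  let Y : Submodule ℂ X := Submodule.span ℂ {z | ∃ φ ∈ N, ∃ m : M, z = φ m}
  have hYne : Y ≠ ⊥ := by
    intro h0
    apply hN.ne
    rw [eq_bot_iff]
    intro φ hφ
    rw [Submodule.mem_bot]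
    ext m
    have : φ m ∈ Y := Submodule.subset_span ⟨φ, hφ, m, rfl⟩
    rw [h0, Submodule.mem_bot] at this
    simpa using this
  have hYst : Stab G R Y := by
    intro g hg x hx
    obtain ⟨k, hk, l, hl, rfl⟩ := hgen g hg
    rw [hR.mul_apply (le1 hk) (le2 hl)]
    induction hx using Submodule.span_induction with
    | zero => simp
    | add x y _ _ hx hy => rw [map_add, map_add]; exact Submodule.add_mem _ hx hy
    | smul a x _ hx => rw [map_smul, map_smul]; exact Submodule.smul_mem _ _ hx
    | mem x hx =>
      obtain ⟨φ, hφ, m, rfl⟩ := hx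
      have e1 : R l (φ m) = S l φ m := rfl
      have e2 := hN.stab l hl φ hφ
      rw [e1, ← hNZ e2 k hk m]
      exact Submodule.subset_span ⟨_, e2, _, rfl⟩
  have hYtop := (hI Y hYst).resolve_left hYne
  have key : ∀ x ∈ Y, ∀ y ∈ Y, B x y = 0 := by
    intro x hx y hy
    induction hx using Submodule.span_induction with
    | zero => simp
    | add x x' _ _ hx hx' => simp [hx, hx']
    | smul a x _ hx => simp [hx]
    | mem x hx =>
      obtain ⟨φ, hφ, m, rfl⟩ := hx
      induction hy using Submodule.span_induction with
      | zero => simp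
      | add y y' _ _ h1 h2 => simp [h1, h2]
      | smul a y _ h1 => simp [h1]
      | mem y hy =>
        obtain ⟨φ', hφ', m', rfl⟩ := hy
        exact step2 φ hφ φ' hφ' m m'
  ext x y
  exact key x (hYtop ▸ Submodule.mem_top) y (hYtop ▸ Submodule.mem_top)

end basics

end UCS

set_option linter.unusedSectionVars false
namespace UCS

section traces

variable {X : Type} [AddCommGroup X] [Module ℂ X] [FiniteDimensional ℂ X]

theorem trace_compl {A : Type} [Group A] {R : A → X →ₗ[ℂ] X} {p q : Submodule ℂ X} (h : IsCompl p q) {g : A}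
    (hp : ∀ x ∈ p, R g x ∈ p) (hq : ∀ x ∈ q, R g x ∈ q) :
    LinearMap.trace ℂ X (R g) = LinearMap.trace ℂ p (resR R p g) +
      LinearMap.trace ℂ q (resR R q g) := by
  rw [← LinearMap.trace_prodMap', ← LinearMap.trace_conj' _ (Submodule.prodEquivOfIsCompl p q h)]
  congr 1
  ext x
  obtain ⟨y, rfl⟩ := (Submodule.prodEquivOfIsCompl p q h).surjective x
  rw [LinearEquiv.conj_apply]
  simp [resR_apply hp, resR_apply hq]

theorem trace_swap {f : X →ₗ[ℂ] X} {p q : Submodule ℂ X} (h : IsCompl p q)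
    (hp : ∀ x ∈ p, f x ∈ q) (hq : ∀ x ∈ q, f x ∈ p) : LinearMap.trace ℂ X f = 0 := by
  have key : ∀ (p q : Submodule ℂ X) (h : IsCompl p q), (∀ x ∈ p, f x ∈ q) →
      LinearMap.trace ℂ X (f * p.projection q h) = 0 := by
    intro p q h hp
    have e1 : p.projection q h * p.projection q h = p.projection q h :=
      Submodule.isIdempotentElem_projection h
    rw [← e1, ← mul_assoc, LinearMap.trace_mul_comm]
    have : p.projection q h * (f * p.projection q h) = 0 := by
      ext x
      simp only [Module.End.mul_apply, LinearMap.zero_apply]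
      rw [Submodule.projection_apply_eq_zero_iff]
      exact hp _ (Submodule.projection_apply_mem h x)
    rw [this, map_zero]
  have e2 : f = f * p.projection q h + f * q.projection p h.symm := by
    ext x
    simp only [LinearMap.add_apply, Module.End.mul_apply]
    rw [← map_add, Submodule.projection_add_projection_eq_self]
  rw [e2, map_add, key p q h hp, key q p h.symm hq, add_zero]

theorem trace_pairing {Y : Type} [AddCommGroup Y] [Module ℂ Y] [FiniteDimensional ℂ Y]
    (B : X →ₗ[ℂ] Y →ₗ[ℂ] ℂ) (h1 : ∀ x, (∀ y, B x y = 0) → x = 0)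
    (h2 : ∀ y, (∀ x, B x y = 0) → y = 0) (f : X →ₗ[ℂ] X) (f' : Y →ₗ[ℂ] Y)
    (h : ∀ x y, B (f x) y = B x (f' y)) : LinearMap.trace ℂ X f = LinearMap.trace ℂ Y f' := by
  have i1 : Function.Injective B := by
    rw [injective_iff_map_eq_zero]
    intro x hx
    exact h1 x (fun y => by rw [hx]; rfl)
  have i2 : Function.Injective B.flip := by
    rw [injective_iff_map_eq_zero]
    intro x hx
    exact h2 x (fun y => by rw [← LinearMap.flip_apply, hx]; rfl)
  have d1 := LinearMap.finrank_le_finrank_of_injective i1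
  have d2 := LinearMap.finrank_le_finrank_of_injective i2
  have d3 : Module.finrank ℂ (Y →ₗ[ℂ] ℂ) = Module.finrank ℂ Y := Subspace.dual_finrank_eq
  have d4 : Module.finrank ℂ (X →ₗ[ℂ] ℂ) = Module.finrank ℂ X := Subspace.dual_finrank_eq
  let e : X ≃ₗ[ℂ] Module.Dual ℂ Y := LinearMap.linearEquivOfInjective B i1
    (by change _ = Module.finrank ℂ (Y →ₗ[ℂ] ℂ); omega)
  rw [← LinearMap.trace_conj' f e, ← LinearMap.trace_transpose' f']
  congr 1
  rw [LinearEquiv.conj_apply]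
  ext φ y
  obtain ⟨x, rfl⟩ := e.surjective φ
  simp only [LinearMap.comp_apply, LinearEquiv.coe_coe, LinearEquiv.symm_apply_apply,
    Module.Dual.transpose_apply]
  exact h x y

theorem trace_pairing_res {A : Type} [Group A] {R : A → X →ₗ[ℂ] X} (B : X →ₗ[ℂ] X →ₗ[ℂ] ℂ)
    {p q : Submodule ℂ X} (h1 : ∀ x ∈ p, (∀ y ∈ q, B x y = 0) → x = 0)
    (h2 : ∀ y ∈ q, (∀ x ∈ p, B x y = 0) → y = 0) {g g' : A}
    (hp : ∀ x ∈ p, R g x ∈ p) (hq : ∀ x ∈ q, R g' x ∈ q)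
    (h : ∀ x y, B (R g x) y = B x (R g' y)) :
    LinearMap.trace ℂ p (resR R p g) = LinearMap.trace ℂ q (resR R q g') := by
  apply trace_pairing (B.compl₁₂ p.subtype q.subtype)
  · intro x hx
    have := h1 x x.2 (fun y hy => hx ⟨y, hy⟩)
    exact_mod_cast this
  · intro x hx
    have := h2 x x.2 (fun y hy => hx ⟨y, hy⟩)
    exact_mod_cast this
  · intro x y
    simp only [LinearMap.compl₁₂_apply, Submodule.subtype_apply]
    rw [resR_apply hp, resR_apply hq, h]

end traces

section chars

variable {A : Type} [Group A] [Finite A] {G : Subgroup A} {c : A} {X : Type} [AddCommGroup X]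
  [Module ℂ X] {R : A → X →ₗ[ℂ] X}

/-- the elements of a subgroup as a finset -/
noncomputable def els (G : Subgroup A) : Finset A := (Set.toFinite (G : Set A)).toFinset

theorem mem_els {x : A} : x ∈ els G ↔ x ∈ G := by simp [els]

theorem sum_els {M : Type} [AddCommMonoid M] [Fintype G] (f : A → M) :
    ∑ x ∈ els G, f x = ∑ x : G, f x := by
  symm
  apply Finset.sum_bij (fun (x : G) _ => (x : A))
  · intro x _; exact mem_els.2 x.2
  · intro x _ y _ h; exact Subtype.ext h
  · intro x hx; exact ⟨⟨x, mem_els.1 hx⟩, Finset.mem_univ _, rfl⟩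
  · intro x _; rfl

theorem card_els : (els G).card = Nat.card G := by
  have : Fintype G := Fintype.ofFinite G
  rw [Finset.card_eq_sum_ones, sum_els, Nat.card_eq_fintype_card]; simp

/-- as a Mathlib representation -/
def IsRepOn.toRep (h : IsRepOn G R) : Representation ℂ G X where
  toFun g := R g
  map_one' := h.one
  map_mul' x y := h.mul x x.2 y y.2

theorem IrrOn.isIrr (hI : IrrOn G R) (h : IsRepOn G R) [Nontrivial X] :
    h.toRep.IsIrreducible := by
  refine { toNontrivial := ?_, eq_bot_or_eq_top := ?_ }
  ·
    refine ⟨⟨⊥, ⊤, fun h0 => ?_⟩⟩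
    have h1 := congrArg Subrepresentation.toSubmodule h0
    exact bot_ne_top (α := Submodule ℂ X) h1
  ·
    intro W
    rcases hI W.toSubmodule (fun g hg x hx => W.apply_mem_toSubmodule ⟨g, hg⟩ hx) with h1 | h1
    · left; exact Subrepresentation.toSubmodule_injective h1
    · right; exact Subrepresentation.toSubmodule_injective h1

theorem norm_char [FiniteDimensional ℂ X] [Nontrivial X] (h : IsRepOn G R) (hI : IrrOn G R) :
    ∑ g ∈ els G, LinearMap.trace ℂ X (R g) * LinearMap.trace ℂ X (R g⁻¹) = Nat.card G := by
  have : Fintype G := Fintype.ofFinite G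
  have hne : (Nat.card G : ℂ) ≠ 0 := by exact_mod_cast Nat.card_pos.ne'
  let _ : Invertible (Nat.card G : ℂ) := invertibleOfNonzero hne
  have := hI.isIrr h
  have h1 := Representation.char_orthonormal h.toRep h.toRep
  rw [if_pos ⟨Representation.Equiv.refl _⟩] at h1
  rw [sum_els]
  rw [inv_mul_eq_iff_eq_mul₀ hne] at h1
  rw [mul_one] at h1
  exact h1

/-- Maschke -/
theorem exists_compl (h : IsRepOn G R) (W : Submodule ℂ X) (hW : Stab G R W) :
    ∃ W' : Submodule ℂ X, Stab G R W' ∧ IsCompl W W' := by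
  obtain ⟨q, hq⟩ := W.exists_isCompl
  have hne : (Nat.card G : ℂ) ≠ 0 := by exact_mod_cast Nat.card_pos.ne'
  let P : X →ₗ[ℂ] X := (Nat.card G : ℂ)⁻¹ • ∑ g ∈ els G, R g⁻¹ * W.projection q hq * R g
  have P_apply : ∀ x, P x = (Nat.card G : ℂ)⁻¹ • ∑ g ∈ els G, R g⁻¹ (W.projection q hq (R g x)) := by
    intro x
    simp [P, LinearMap.sum_apply]
  have P_mem : ∀ x, P x ∈ W := by
    intro x
    rw [P_apply]
    apply W.smul_mem
    apply W.sum_mem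
    intro g hg
    exact hW _ (G.inv_mem (mem_els.1 hg)) _ (Submodule.projection_apply_mem hq _)
  have P_id : ∀ x ∈ W, P x = x := by
    intro x hx
    rw [P_apply]
    rw [Finset.sum_congr rfl (g := fun _ => x)]
    · rw [Finset.sum_const, card_els, ← Nat.cast_smul_eq_nsmul ℂ, smul_smul, inv_mul_cancel₀ hne,
        one_smul]
    · intro g hg
      rw [mem_els] at hg
      rw [Submodule.projection_apply_of_mem_left hq (hW g hg x hx), h.inv_apply hg]
  have P_com : ∀ k ∈ G, ∀ x, P (R k x) = R k (P x) := by
    intro k hk x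
    rw [P_apply, P_apply, map_smul, map_sum]
    congr 1
    apply Finset.sum_bij (fun g _ => g * k)
    · intro g hg; rw [mem_els] at *; exact G.mul_mem hg hk
    · intro a _ b _ hab; exact mul_right_cancel hab
    · intro b hb
      rw [mem_els] at hb
      exact ⟨b * k⁻¹, mem_els.2 (G.mul_mem hb (G.inv_mem hk)), by group⟩
    · intro g hg
      rw [mem_els] at hg
      rw [mul_inv_rev, h.mul_apply hg hk, h.mul_apply (G.inv_mem hk) (G.inv_mem hg),
        h.apply_inv hk]
  refine ⟨LinearMap.ker P, ?_, ?_⟩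
  · intro g hg x hx
    rw [LinearMap.mem_ker] at hx ⊢
    rw [P_com g hg, hx, map_zero]
  · rw [isCompl_iff, Submodule.disjoint_def, codisjoint_iff, eq_top_iff]
    refine ⟨fun x hx hx' => ?_, fun x _ => ?_⟩
    · rw [← P_id x hx]; exact hx'
    · rw [Submodule.mem_sup]
      refine ⟨P x, P_mem x, x - P x, ?_, by abel⟩
      rw [LinearMap.mem_ker, map_sub, P_id _ (P_mem x), sub_self]

/-- radical of a form -/
theorem nondeg_of_irr (hR : IsRepOn G R) (hI : IrrOn G R) (hc : Nrm G c) {B : X →ₗ[ℂ] X →ₗ[ℂ] ℂ}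
    (hB : Inv G c R B) (h0 : B ≠ 0) : ∀ x, (∀ y, B x y = 0) → x = 0 := by
  have hst : Stab G R (LinearMap.ker B) := by
    intro g hg x hx
    rw [LinearMap.mem_ker] at hx ⊢
    ext y
    rw [hB.left hR hc hg, hx]; rfl
  rcases hI _ hst with h1 | h1
  · intro x hx
    have : x ∈ LinearMap.ker B := by
      rw [LinearMap.mem_ker]; ext y; exact hx y
    rw [h1] at this
    simpa using this
  · exact absurd (LinearMap.ker_eq_top.1 h1) h0

/-- a nondegenerate skew form on the restriction to `H` splits the character -/
theorem split_skew [FiniteDimensional ℂ X] (hN : NoSkew G c) (hR : IsRepOn G R) (hc : Nrm G c)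
    (B : X →ₗ[ℂ] X →ₗ[ℂ] ℂ) (hB : Inv G c R B) (hs : ∀ x y, B x y = - B y x)
    (hnd : ∀ x, (∀ y, B x y = 0) → x = 0) :
    ∃ W : Submodule ℂ X, Stab G R W ∧ ∀ g ∈ G, LinearMap.trace ℂ X (R g) =
      LinearMap.trace ℂ W (resR R W g) + LinearMap.trace ℂ W (resR R W (c * g⁻¹ * c⁻¹)) := by
  classical
  let P : ℕ → Prop := fun n => ∃ W : Submodule ℂ X, Stab G R W ∧ (∀ x ∈ W, ∀ y ∈ W, B x y = 0) ∧
    Module.finrank ℂ X - Module.finrank ℂ W = n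
  have hP : ∃ n, P n := ⟨_, ⊥, by
    intro g _ x hx
    rw [Submodule.mem_bot] at *
    rw [hx, map_zero], by
    intro x hx y _
    rw [Submodule.mem_bot] at hx
    rw [hx]; simp, rfl⟩
  obtain ⟨W, hW, hiso, hfr⟩ := Nat.find_spec hP
  have hmax : ∀ W' : Submodule ℂ X, Stab G R W' → (∀ x ∈ W', ∀ y ∈ W', B x y = 0) → W ≤ W' →
      W' = W := by
    intro W' h1 h2 h3
    have h4 := Nat.find_min' hP ⟨W', h1, h2, rfl⟩
    have h5 := Submodule.finrank_le W'
    have h6 := Submodule.finrank_le W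
    exact (Submodule.eq_of_le_of_finrank_le h3 (by omega)).symm
  -- the orthogonal
  let T : Submodule ℂ X :=
    { carrier := {x | ∀ y ∈ W, B x y = 0}
      zero_mem' := by intro y _; simp
      add_mem' := by intro a b ha hb y hy; simp [ha y hy, hb y hy]
      smul_mem' := by intro a b hb y hy; simp [hb y hy] }
  have hT : Stab G R T := by
    intro g hg x hx y hy
    rw [hB.left hR hc hg]
    exact hx _ (hW _ (hc.mem _ (G.inv_mem hg)) y hy)
  have hWT : W ≤ T := fun x hx y hy => hiso x hx y hy
  obtain ⟨W1, hW1, hcompl⟩ := exists_compl hR W hW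
  have hTW : ∀ x ∈ T, x ∈ W := by
    by_contra hcon
    push Not at hcon
    obtain ⟨x, hxT, hxW⟩ := hcon
    have hne : T ⊓ W1 ≠ ⊥ := by
      intro h0
      have hx : x ∈ W ⊔ W1 := hcompl.sup_eq_top ▸ Submodule.mem_top
      obtain ⟨w, hw, w1, hw1, rfl⟩ := Submodule.mem_sup.1 hx
      have : w1 ∈ T ⊓ W1 := by
        refine ⟨?_, hw1⟩
        have := T.sub_mem hxT (hWT hw)
        simpa using this
      rw [h0, Submodule.mem_bot] at this
      rw [this, add_zero] at hxW
      exact hxW hw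
    have hst : Stab G R (T ⊓ W1) := fun g hg x hx => ⟨hT g hg x hx.1, hW1 g hg x hx.2⟩
    obtain ⟨Y, hY, hm, hYiso⟩ := hN.exists_isotropic hR hc _ hne hst B
      (fun g hg x _ y _ => hB g hg x y) (fun x _ y _ => hs x y)
    have := hmax (W ⊔ Y) ?_ ?_ le_sup_left
    · apply hm.ne
      have h1 : Y ≤ W := this ▸ le_sup_right
      have h2 : Y ≤ W ⊓ W1 := le_inf h1 (hY.trans inf_le_right)
      rw [hcompl.inf_eq_bot] at h2
      exact le_bot_iff.1 h2
    · intro g hg x hx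
      obtain ⟨a, ha, b, hb, rfl⟩ := Submodule.mem_sup.1 hx
      rw [map_add]
      exact Submodule.add_mem_sup (hW g hg a ha) (hm.stab g hg b hb)
    · intro x hx y hy
      obtain ⟨a, ha, b, hb, rfl⟩ := Submodule.mem_sup.1 hx
      obtain ⟨a', ha', b', hb', rfl⟩ := Submodule.mem_sup.1 hy
      have e1 := hiso a ha a' ha'
      have e2 := (hY hb).1 a' ha'
      have e3 := (hY hb').1 a ha
      have e4 := hYiso b hb b' hb'
      have e5 := hs a b'
      simp only [map_add, LinearMap.add_apply, e1, e2, e5, e3, e4]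
      simp
  refine ⟨W, hW, fun g hg => ?_⟩
  have hg' := hc.mem _ (G.inv_mem hg)
  rw [trace_compl hcompl (hW g hg) (hW1 g hg)]
  congr 1
  apply trace_pairing_res B _ _ (hW1 g hg) (hW _ hg') (fun x y => hB.left hR hc hg x y)
  · intro x hx hy
    have h1 : x ∈ W ⊓ W1 := ⟨hTW x hy, hx⟩
    rw [hcompl.inf_eq_bot] at h1
    simpa using h1
  · intro y hy hx
    apply hnd
    intro x
    have hx' : x ∈ W ⊔ W1 := hcompl.sup_eq_top ▸ Submodule.mem_top
    obtain ⟨w, hw, w1, hw1, rfl⟩ := Submodule.mem_sup.1 hx'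
    rw [map_add, hiso y hy w hw, hs, hx w1 hw1]; simp

theorem trace_conj_rep (hR : IsRepOn G R) {x y : A} (hx : x ∈ G) (hy : y ∈ G) :
    LinearMap.trace ℂ X (R (y * x * y⁻¹)) = LinearMap.trace ℂ X (R x) := by
  rw [hR.mul _ (G.mul_mem hy hx) _ (G.inv_mem hy), LinearMap.trace_mul_comm,
    ← hR.mul _ (G.inv_mem hy) _ (G.mul_mem hy hx)]
  congr 2; group

theorem noSkew_index2 {K H : Subgroup A} (hKH : K ≤ H) (hN : NoSkew K c) (hcK : Nrm K c)
    (hcH : Nrm H c) (hK : ∀ h ∈ H, ∀ k ∈ K, h * k * h⁻¹ ∈ K) (x0 : A) (hx0 : x0 ∈ H)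
    (hx : ∀ h ∈ H, h ∈ K ∨ x0⁻¹ * h ∈ K)
    (hdual : ∀ k ∈ K, ∃ y ∈ K, y * k * y⁻¹ = c * k⁻¹ * c⁻¹) : NoSkew H c := by
  by_cases hxK : x0 ∈ K
  · have : K = H := le_antisymm hKH (fun h hh => by
      rcases hx h hh with h1 | h1
      · exact h1
      · have := K.mul_mem hxK h1
        simpa using this)
    rwa [← this]
  have hsq : x0 * x0 ∈ K := by
    rcases hx _ (H.mul_mem hx0 hx0) with h1 | h1
    · exact h1
    · rw [inv_mul_cancel_left] at h1
      exact absurd h1 hxK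
  intro X _ _ _ R hR hI B hB hs
  by_contra hB0
  have hnt : Nontrivial X := by
    by_contra hX
    rw [not_nontrivial_iff_subsingleton] at hX
    apply hB0
    ext x y
    rw [Subsingleton.elim x 0]; simp
  have hnd := nondeg_of_irr hR hI hcH hB hB0
  have hRK := hR.mono hKH
  obtain ⟨Y, -, hY, hiso⟩ := hN.exists_isotropic hRK hcK ⊤ top_ne_bot (fun _ _ _ _ => trivial) B
    (fun g hg x _ y _ => hB g (hKH hg) x y) (fun x _ y _ => hs x y)
  let Y1 := Y.map (R x0)
  have hx0y : ∀ y ∈ Y, R x0 y ∈ Y1 := fun y hy => ⟨y, hy, rfl⟩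
  have hx0y1 : ∀ y ∈ Y1, R x0 y ∈ Y := by
    rintro _ ⟨y, hy, rfl⟩
    rw [← hR.mul_apply hx0 hx0]
    exact hY.stab _ hsq y hy
  have hY1 : Stab K R Y1 := by
    rintro k hk _ ⟨y, hy, rfl⟩
    refine ⟨R (x0⁻¹ * k * x0) y, hY.stab _ ?_ y hy, ?_⟩
    · have := hK x0⁻¹ (H.inv_mem hx0) k hk
      simpa using this
    · rw [← hR.mul_apply hx0, ← hR.mul_apply (hKH hk) hx0]
      · congr 2; group
      · exact H.mul_mem (H.mul_mem (H.inv_mem hx0) (hKH hk)) hx0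
  -- elements off `K`
  have hoff : ∀ h ∈ H, h ∉ K → ∃ k ∈ K, h = x0 * k := by
    intro h hh hk
    refine ⟨x0⁻¹ * h, (hx h hh).resolve_left hk, by group⟩
  have hstab_of : ∀ Z : Submodule ℂ X, Stab K R Z → (∀ z ∈ Z, R x0 z ∈ Z) → Stab H R Z := by
    intro Z h1 h2 h hh z hz
    by_cases hhK : h ∈ K
    · exact h1 h hhK z hz
    · obtain ⟨k, hk, rfl⟩ := hoff h hh hhK
      rw [hR.mul_apply hx0 (hKH hk)]
      exact h2 _ (h1 k hk z hz)
  rcases hY.min (Y ⊓ Y1) (fun k hk z hz => ⟨hY.stab k hk z hz.1, hY1 k hk z hz.2⟩) inf_le_left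
    with hIntr | hIntr
  · have htop : Y ⊔ Y1 = ⊤ := by
      refine (hI _ (hstab_of _ ?_ ?_)).resolve_left (fun h0 => hY.ne ?_)
      · intro k hk z hz
        obtain ⟨a, ha, b, hb, rfl⟩ := Submodule.mem_sup.1 hz
        rw [map_add]
        exact Submodule.add_mem_sup (hY.stab k hk a ha) (hY1 k hk b hb)
      · intro z hz
        obtain ⟨a, ha, b, hb, rfl⟩ := Submodule.mem_sup.1 hz
        rw [map_add, add_comm]
        exact Submodule.add_mem_sup (hx0y1 b hb) (hx0y a ha)
      · exact le_bot_iff.1 (h0 ▸ le_sup_left)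
    have hcompl : IsCompl Y Y1 := ⟨disjoint_iff.2 hIntr, codisjoint_iff.2 htop⟩
    have hY1iso : ∀ x ∈ Y1, ∀ y ∈ Y1, B x y = 0 := by
      rintro _ ⟨x, hx, rfl⟩ _ ⟨y, hy, rfl⟩
      rw [hB.left hR hcH hx0, ← hR.mul_apply (hcH.mem _ (H.inv_mem hx0)) hx0]
      set z := c * x0⁻¹ * c⁻¹ * x0 with hz
      have hzH : z ∈ H := H.mul_mem (hcH.mem _ (H.inv_mem hx0)) hx0
      have hzK : z ∈ K := by
        by_contra hcon
        obtain ⟨k, hk, hk'⟩ := hoff z hzH hcon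
        have h1 : c * x0⁻¹ * c⁻¹ = x0 * k * x0⁻¹ := by rw [← hk', hz]; group
        have h2 := hcK.mem _ (hK x0 hx0 k hk)
        rw [← h1, hcK.twice] at h2
        exact hxK (by simpa using K.inv_mem h2)
      exact hiso x hx _ (hY.stab z hzK y hy)
    have htr : ∀ k ∈ K, LinearMap.trace ℂ X (R k) = 2 * LinearMap.trace ℂ Y (resR R Y k) := by
      intro k hk
      have hk' := hcK.mem _ (K.inv_mem hk)
      rw [trace_compl hcompl (hY.stab k hk) (hY1 k hk)]
      have e1 : LinearMap.trace ℂ Y1 (resR R Y1 k) =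
          LinearMap.trace ℂ Y (resR R Y (c * k⁻¹ * c⁻¹)) := by
        apply trace_pairing_res B _ _ (hY1 k hk) (hY.stab _ hk')
          (fun x y => hB.left hR hcH (hKH hk) x y)
        · intro x hx hy
          apply hnd
          intro y
          obtain ⟨w, hw, w1, hw1, rfl⟩ := Submodule.mem_sup.1
            (htop ▸ Submodule.mem_top : y ∈ Y ⊔ Y1)
          rw [map_add, hy w hw, hY1iso x hx w1 hw1, add_zero]
        · intro x hx hy
          apply hnd
          intro y
          obtain ⟨w, hw, w1, hw1, rfl⟩ := Submodule.mem_sup.1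
            (htop ▸ Submodule.mem_top : y ∈ Y ⊔ Y1)
          rw [map_add, hiso x hx w hw, hs, hy w1 hw1]; simp
      obtain ⟨y, hy, hyk⟩ := hdual k hk
      rw [e1, ← hyk, trace_conj_rep (hRK.res hY.stab) hk hy]
      ring
    have hYnt : Nontrivial Y := Submodule.nontrivial_iff_ne_bot.2 hY.ne
    have n1 := norm_char hR hI
    have n2 := norm_char (hRK.res hY.stab) hY.irr
    have hsub : els K ⊆ els H := fun x hx => mem_els.2 (hKH (mem_els.1 hx))
    rw [← Finset.sum_subset hsub] at n1
    · rw [Finset.sum_congr rfl (g := fun k => 4 * (LinearMap.trace ℂ Y (resR R Y k) *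
        LinearMap.trace ℂ Y (resR R Y k⁻¹)))] at n1
      · rw [← Finset.mul_sum, n2] at n1
        have hcard : Nat.card H ≤ 2 * Nat.card K := by
          classical
          rw [← card_els, ← card_els]
          have : els H ⊆ els K ∪ (els K).image (fun k => x0 * k) := by
            intro h hh
            rw [Finset.mem_union, Finset.mem_image]
            by_cases hhK : h ∈ K
            · left; exact mem_els.2 hhK
            · right
              obtain ⟨k, hk, rfl⟩ := hoff h (mem_els.1 hh) hhK
              exact ⟨k, mem_els.2 hk, rfl⟩
          calc (els H).card ≤ _ := Finset.card_le_card this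
            _ ≤ _ := Finset.card_union_le _ _
            _ ≤ (els K).card + (els K).card := Nat.add_le_add_left Finset.card_image_le _
            _ = _ := by ring
        have hpos : 0 < Nat.card K := Nat.card_pos
        have : 4 * Nat.card K = Nat.card H := by exact_mod_cast n1
        omega
      · intro k hk
        rw [mem_els] at hk
        rw [htr k hk, htr _ (K.inv_mem hk)]
        ring
    · intro h hh hhK
      rw [mem_els] at hh hhK
      obtain ⟨k, hk, rfl⟩ := hoff h hh hhK
      have : LinearMap.trace ℂ X (R (x0 * k)) = 0 := by
        apply trace_swap hcompl
        · intro y hy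
          rw [hR.mul_apply hx0 (hKH hk)]
          exact hx0y _ (hY.stab k hk y hy)
        · intro y hy
          rw [hR.mul_apply hx0 (hKH hk)]
          exact hx0y1 _ (hY1 k hk y hy)
      rw [this, zero_mul]
  · have hle : Y ≤ Y1 := by rw [← hIntr]; exact inf_le_right
    have heq : Y = Y1 := Submodule.eq_of_le_of_finrank_le hle (Submodule.finrank_map_le _ _)
    have htop := (hI Y (hstab_of Y hY.stab (fun z hz => by
      have := hx0y z hz
      rwa [← heq] at this))).resolve_left hY.ne
    apply hB0
    ext x y
    exact hiso x (htop ▸ Submodule.mem_top) y (htop ▸ Submodule.mem_top)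

end chars

end UCS

set_option linter.unusedSectionVars false
namespace UCS

/-- algebraic integers -/
def AI (z : ℂ) : Prop := IsIntegral ℤ z

theorem AI.add {x y : ℂ} (hx : AI x) (hy : AI y) : AI (x + y) := IsIntegral.add hx hy
theorem AI.mul {x y : ℂ} (hx : AI x) (hy : AI y) : AI (x * y) := IsIntegral.mul hx hy
theorem AI.int (n : ℤ) : AI (n : ℂ) := isIntegral_algebraMap (R := ℤ) (A := ℂ) (x := n)
theorem AI.nat (n : ℕ) : AI (n : ℂ) := by exact_mod_cast AI.int n
theorem AI.sum {ι : Type*} {s : Finset ι} {f : ι → ℂ} (h : ∀ i ∈ s, AI (f i)) : AI (∑ i ∈ s, f i) :=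
  IsIntegral.sum (R := ℤ) f h

theorem AI.odd_ne {M : ℕ} (hM : Odd M) {b : ℂ} (hb : AI b) : (M : ℂ) ≠ 2 * b := by
  intro h
  have h1 : b = algebraMap ℚ ℂ ((M : ℚ) / 2) := by
    simp; linear_combination -h / 2
  rw [h1] at hb
  have h2 : IsIntegral ℤ ((M : ℚ) / 2) :=
    (isIntegral_algebraMap_iff (algebraMap ℚ ℂ).injective).1 hb
  obtain ⟨n, hn⟩ := IsIntegrallyClosed.isIntegral_iff.1 h2
  have h3 : (n : ℚ) * 2 = M := by
    have : (n : ℚ) = M / 2 := by simpa using hn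
    rw [this]; ring
  have h4 : n * 2 = (M : ℤ) := by exact_mod_cast h3
  obtain ⟨k, hk⟩ := hM
  omega

theorem ai_trace {X : Type} [AddCommGroup X] [Module ℂ X] [FiniteDimensional ℂ X]
    (N : Module.End ℂ X) (k : ℕ) (hk : 0 < k) (h : N ^ (k + 1) = N) :
    AI (LinearMap.trace ℂ X N) := by
  rw [Module.End.trace_eq_sum_roots_charpoly_of_splits (IsAlgClosed.splits _)]
  apply IsIntegral.multiset_sum
  intro l hl
  have h1 : N.HasEigenvalue l := by
    rw [Module.End.hasEigenvalue_iff_isRoot_charpoly]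
    exact (Polynomial.mem_roots'.1 hl).2
  obtain ⟨v, hv⟩ := h1.exists_hasEigenvector
  have h2 : l ^ (k + 1) = l := by
    have e1 := hv.pow_apply (k + 1)
    rw [h, hv.apply_eq_smul] at e1
    have := sub_eq_zero.2 e1
    rw [← sub_smul, smul_eq_zero] at this
    rcases this with h3 | h3
    · exact (sub_eq_zero.1 h3).symm
    · exact absurd h3 hv.2
  refine ⟨Polynomial.X ^ (k + 1) - Polynomial.X, ?_, ?_⟩
  · apply Polynomial.monic_X_pow_sub
    rw [Polynomial.degree_X]; exact_mod_cast Nat.succ_lt_succ hk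
  · simp [h2]

section
variable {A : Type} [Group A] [Finite A] {G : Subgroup A} {X : Type} [AddCommGroup X]
  [Module ℂ X] [FiniteDimensional ℂ X] {R : A → X →ₗ[ℂ] X}

theorem IsRepOn.pow (h : IsRepOn G R) {g : A} (hg : g ∈ G) (n : ℕ) : R (g ^ n) = R g ^ n := by
  induction n with
  | zero => simp [h.one]
  | succ n ih => rw [pow_succ, h.mul _ (G.pow_mem hg n) _ hg, ih, pow_succ]

theorem ai_avg (h : IsRepOn G R) {g : A} (hg : g ∈ G) (D : Subgroup A) (hD : D ≤ G)
    (hcom : ∀ v ∈ D, g * v = v * g) :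
    ∃ α, AI α ∧ ∑ v ∈ els D, LinearMap.trace ℂ X (R (g * v)) = Nat.card D * α := by
  have hne : (Nat.card D : ℂ) ≠ 0 := by exact_mod_cast Nat.card_pos.ne'
  let e : Module.End ℂ X := (Nat.card D : ℂ)⁻¹ • ∑ v ∈ els D, R v
  have he1 : ∀ v ∈ D, R v * e = e := by
    intro v hv
    simp only [e, mul_smul_comm, Finset.mul_sum]
    congr 1
    apply Finset.sum_bij (fun w _ => v * w)
    · intro w hw; rw [mem_els] at *; exact D.mul_mem hv hw
    · intro a _ b _ hab; exact mul_left_cancel hab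
    · intro b hb
      rw [mem_els] at hb
      exact ⟨v⁻¹ * b, mem_els.2 (D.mul_mem (D.inv_mem hv) hb), by group⟩
    · intro w hw
      rw [mem_els] at hw
      rw [h.mul _ (hD hv) _ (hD hw)]
  have he : e * e = e := by
    conv_lhs => enter [1]; simp only [e]
    rw [smul_mul_assoc, Finset.sum_mul, Finset.sum_congr rfl (fun v hv => he1 v (mem_els.1 hv)),
      Finset.sum_const, card_els, ← Nat.cast_smul_eq_nsmul ℂ, smul_smul, inv_mul_cancel₀ hne,
        one_smul]
  have hge : Commute (R g) e := by
    show R g * e = e * R g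
    simp only [e, mul_smul_comm, smul_mul_assoc, Finset.mul_sum, Finset.sum_mul]
    congr 1
    apply Finset.sum_congr rfl
    intro v hv
    rw [mem_els] at hv
    rw [← h.mul _ hg _ (hD hv), ← h.mul _ (hD hv) _ hg, hcom v hv]
  refine ⟨LinearMap.trace ℂ X (R g * e), ?_, ?_⟩
  · apply ai_trace _ (orderOf g) (orderOf_pos g)
    rw [hge.mul_pow, ← h.pow hg, pow_succ, pow_orderOf_eq_one, one_mul]
    congr 1
    exact IsIdempotentElem.pow_succ_eq _ he
  · simp only [e, mul_smul_comm, map_smul]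
    rw [smul_eq_mul, Finset.mul_sum, map_sum]
    field_simp
    apply Finset.sum_congr rfl
    intro v hv
    rw [h.mul _ hg _ (hD (mem_els.1 hv))]

theorem ai_char (h : IsRepOn G R) {g : A} (hg : g ∈ G) : AI (LinearMap.trace ℂ X (R g)) := by
  apply ai_trace _ (orderOf g) (orderOf_pos g)
  rw [← h.pow hg, pow_succ, pow_orderOf_eq_one, one_mul]

/-- products of two characters -/
theorem ai_avg2 {Y : Type} [AddCommGroup Y] [Module ℂ Y] [FiniteDimensional ℂ Y]
    {R' : A → Y →ₗ[ℂ] Y}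
    (h : IsRepOn G R) (h' : IsRepOn G R') {g : A} (hg : g ∈ G) (D : Subgroup A) (hD : D ≤ G)
    (hcom : ∀ v ∈ D, g * v = v * g) :
    ∃ α, AI α ∧ ∑ v ∈ els D, LinearMap.trace ℂ X (R (g * v)) * LinearMap.trace ℂ Y (R' (g * v))
      = Nat.card D * α := by
  have hT : IsRepOn G (fun x => TensorProduct.map (R x) (R' x)) := by
    constructor
    · show TensorProduct.map (R 1) (R' 1) = _
      rw [h.one, h'.one]; exact TensorProduct.map_one
    · intro x hx y hy
      show TensorProduct.map (R _) (R' _) = _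
      rw [h.mul x hx y hy, h'.mul x hx y hy]; exact TensorProduct.map_mul _ _ _ _
  obtain ⟨α, h1, h2⟩ := ai_avg hT hg D hD hcom
  refine ⟨α, h1, ?_⟩
  rw [← h2]
  apply Finset.sum_congr rfl
  intro v _
  rw [LinearMap.trace_tensorProduct']

/-- the dual representation -/
theorem dual_rep (h : IsRepOn G R) : IsRepOn G (fun x => Module.Dual.transpose (R := ℂ) (R x⁻¹)) := by
  constructor
  · ext φ x
    simp only [inv_one, h.one, Module.Dual.transpose_apply]
    rfl
  · intro x hx y hy
    ext φ v
    simp only [mul_inv_rev, Module.Dual.transpose_apply, LinearMap.comp_apply, Module.End.mul_apply]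
    rw [h.mul_apply (G.inv_mem hy) (G.inv_mem hx)]

end

/-- sums over orbits -/
theorem orbit_sum {D Ω : Type} [Group D] [Finite D] [MulAction D Ω] [Fintype Ω] (f : Ω → ℂ)
    (hf : ∀ (d : D) w, f (d • w) = f w)
    (h : ∀ w, ∃ α, AI α ∧ f w = Nat.card (MulAction.stabilizer D w) * α) :
    ∃ β, AI β ∧ ∑ w, f w = Nat.card D * β := by
  classical
  choose α h1 h2 using h
  have : Fintype D := Fintype.ofFinite D
  let O := Quotient (MulAction.orbitRel D Ω)
  have : Fintype O := Fintype.ofFinite O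
  refine ⟨∑ o : O, α o.out, AI.sum (fun o _ => h1 _), ?_⟩
  rw [← Finset.sum_fiberwise_of_maps_to (g := fun w => (Quotient.mk _ w : O)) (t := Finset.univ)
    (fun _ _ => Finset.mem_univ _), Finset.mul_sum]
  apply Finset.sum_congr rfl
  intro o _
  have hmem : ∀ w, (Quotient.mk _ w : O) = o ↔ w ∈ MulAction.orbit D o.out := by
    intro w
    rw [← MulAction.orbitRel_apply, ← Quotient.eq (r := MulAction.orbitRel D Ω), Quotient.out_eq]
  rw [Finset.sum_congr rfl (g := fun _ => f o.out)]
  · rw [Finset.sum_const, h2 o.out, nsmul_eq_mul, ← mul_assoc]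
    congr 1
    norm_cast
    have e1 := MulAction.card_orbit_mul_card_stabilizer_eq_card_group D o.out
    rw [← Nat.card_eq_fintype_card, ← Nat.card_eq_fintype_card, ← Nat.card_eq_fintype_card] at e1
    rw [← e1]
    congr 1
    rw [← Nat.subtype_card]
    intro w
    simp [hmem]
  · intro w hw
    rw [Finset.mem_filter] at hw
    obtain ⟨d, hd⟩ := (hmem w).1 hw.2
    rw [← hd]; exact hf d _

section syl
open scoped Pointwise
variable {Γ : Type} [Group Γ] [Finite Γ]

/-- number of Sylow 2-subgroups through `v` -/
noncomputable def sN (v : Γ) : ℕ := Nat.card {Q : Sylow 2 Γ // v ∈ Q}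

theorem sN_aut (φ : MulAut Γ) (v : Γ) : sN (φ v) = sN v := by
  unfold sN
  refine Nat.card_congr (Equiv.symm (Equiv.subtypeEquiv (MulAction.toPerm φ) ?_))
  intro Q
  show v ∈ Q ↔ φ v ∈ (φ • Q : Sylow 2 Γ)
  have : φ v ∈ (φ • Q : Sylow 2 Γ) ↔ φ • v ∈ φ • (Q : Subgroup Γ) := Iff.rfl
  rw [this, Subgroup.smul_mem_pointwise_smul_iff]; rfl

theorem sN_inv (v : Γ) : sN v⁻¹ = sN v := by
  unfold sN
  simp only [inv_mem_iff]

theorem smul_eq_iff_mem {v : Γ} (hv : ∃ k, v ^ 2 ^ k = 1) (Q : Sylow 2 Γ) : v • Q = Q ↔ v ∈ Q := by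
  obtain ⟨k, hk⟩ := hv
  have h2 : IsPGroup 2 (Subgroup.zpowers v) := by
    apply IsPGroup.of_card (n := _)
    rotate_left
    · exact ((Nat.dvd_prime_pow Nat.prime_two).1 (orderOf_dvd_of_pow_eq_one hk)).choose
    · rw [Nat.card_zpowers]
      exact ((Nat.dvd_prime_pow Nat.prime_two).1 (orderOf_dvd_of_pow_eq_one hk)).choose_spec.2
  have h3 := h2.sylow_mem_fixedPoints_iff (Q := Q)
  rw [Subgroup.zpowers_le] at h3
  rw [Sylow.smul_eq_iff_mem_normalizer]
  rw [← Subgroup.zpowers_le, ← Subgroup.sylow_mem_fixedPoints_iff]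
  exact h3

theorem sN_odd {v : Γ} (hv : ∃ k, v ^ 2 ^ k = 1) : Odd (sN v) := by
  obtain ⟨k, hk⟩ := hv
  have h2 : IsPGroup 2 (Subgroup.zpowers v) := by
    apply IsPGroup.of_card (n := _)
    rotate_left
    · exact ((Nat.dvd_prime_pow Nat.prime_two).1 (orderOf_dvd_of_pow_eq_one hk)).choose
    · rw [Nat.card_zpowers]
      exact ((Nat.dvd_prime_pow Nat.prime_two).1 (orderOf_dvd_of_pow_eq_one hk)).choose_spec.2
  have h4 := h2.card_modEq_card_fixedPoints (Sylow 2 Γ)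
  have h5 := card_sylow_modEq_one 2 Γ
  have h6 : Nat.card (MulAction.fixedPoints (Subgroup.zpowers v) (Sylow 2 Γ)) = sN v := by
    unfold sN
    apply Nat.card_congr
    apply Equiv.subtypeEquivRight
    intro Q
    rw [h2.sylow_mem_fixedPoints_iff, Subgroup.zpowers_le]; rfl
  rw [h6] at h4
  have := h4.symm.trans h5
  rw [Nat.odd_iff]
  exact this

theorem sN_zero {v : Γ} (hv : ¬ ∃ k, v ^ 2 ^ k = 1) : sN v = 0 := by
  unfold sN
  rw [Nat.card_eq_zero]
  left
  refine ⟨fun ⟨Q, hQ⟩ => hv ?_⟩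
  obtain ⟨k, hk⟩ := Q.isPGroup' ⟨v, hQ⟩
  exact ⟨k, by simpa using congrArg Subtype.val hk⟩

theorem sN_cast (v : Γ) [Fintype (Sylow 2 Γ)] [∀ Q : Sylow 2 Γ, Decidable (v ∈ Q)] :
    (sN v : ℂ) = ∑ Q : Sylow 2 Γ, if v ∈ Q then 1 else 0 := by
  unfold sN
  rw [Finset.sum_boole, Nat.card_eq_fintype_card, Fintype.card_subtype]

theorem sN_sum (Φ : Γ → ℂ) (hΦ : ∀ x v, Φ (x * v * x⁻¹) = Φ v) (P : Sylow 2 Γ) [Fintype Γ] :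
    ∑ v, sN v * Φ v = Nat.card (Sylow 2 Γ) * ∑ v ∈ els (P : Subgroup Γ), Φ v := by
  classical
  have : Fintype (Sylow 2 Γ) := Fintype.ofFinite _
  simp only [sN_cast, Finset.sum_mul]
  rw [Finset.sum_comm, Nat.card_eq_fintype_card, ← nsmul_eq_mul, Fintype.card, ← Finset.sum_const]
  apply Finset.sum_congr rfl
  intro Q _
  obtain ⟨x, hx⟩ := MulAction.exists_smul_eq Γ P Q
  simp only [ite_mul, one_mul, zero_mul]
  rw [← Finset.sum_filter]
  symm
  have hm : ∀ v, v ∈ P ↔ x * v * x⁻¹ ∈ Q := by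
    intro v
    rw [← hx]
    have : x * v * x⁻¹ ∈ x • P ↔ MulAut.conj x • v ∈ MulAut.conj x • (P : Subgroup Γ) := Iff.rfl
    rw [this, Subgroup.smul_mem_pointwise_smul_iff]; rfl
  apply Finset.sum_bij (fun v _ => x * v * x⁻¹)
  · intro v hv
    rw [Finset.mem_filter]
    exact ⟨Finset.mem_univ _, (hm v).1 (mem_els.1 hv)⟩
  · intro a _ b _ hab
    exact mul_left_cancel (mul_right_cancel hab)
  · intro b hb
    rw [Finset.mem_filter] at hb
    refine ⟨x⁻¹ * b * x, mem_els.2 ((hm _).2 ?_), by group⟩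
    have : x * (x⁻¹ * b * x) * x⁻¹ = b := by group
    rw [this]; exact hb.2
  · intro v _
    exact (hΦ x v).symm

/-- averages over subgroups of `P` are algebraic integers -/
def Avg (P : Subgroup Γ) (Φ : Γ → ℂ) : Prop :=
  (∀ x ∈ P, ∀ v ∈ P, Φ (x * v * x⁻¹) = Φ v) ∧
  ∀ D ≤ P, ∃ α, AI α ∧ ∑ v ∈ els D, Φ v = Nat.card D * α

theorem sN_step (P : Sylow 2 Γ) (Φ : Γ → ℂ) (h : Avg (P : Subgroup Γ) Φ) :
    Avg (P : Subgroup Γ) (fun v => sN v * Φ v) := by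
  classical
  have : Fintype (Sylow 2 Γ) := Fintype.ofFinite _
  refine ⟨fun x hx v hv => ?_, fun D hD => ?_⟩
  · simp only
    rw [h.1 x hx v hv]
    congr 2
    exact sN_aut (MulAut.conj x) v
  · have h2 : ∀ v ∈ D, ∃ k, v ^ 2 ^ k = 1 := by
      intro v hv
      obtain ⟨k, hk⟩ := P.isPGroup' ⟨v, hD hv⟩
      exact ⟨k, by simpa using congrArg Subtype.val hk⟩
    let f : Sylow 2 Γ → ℂ := fun Q => ∑ v ∈ els (D ⊓ (Q : Subgroup Γ)), Φ v
    have hstab : ∀ Q : Sylow 2 Γ, ∀ d : D, d ∈ MulAction.stabilizer D Q ↔ (d : Γ) ∈ Q := by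
      intro Q d
      rw [MulAction.mem_stabilizer_iff, ← smul_eq_iff_mem (h2 d d.2) Q]; rfl
    have hf1 : ∀ (d : D) w, f (d • w) = f w := by
      intro d Q
      simp only [f]
      symm
      apply Finset.sum_bij (fun v _ => (d : Γ) * v * (d : Γ)⁻¹)
      · intro v hv
        rw [mem_els] at hv ⊢
        refine ⟨D.mul_mem (D.mul_mem d.2 hv.1) (D.inv_mem d.2), ?_⟩
        have : (d : Γ) * v * (d : Γ)⁻¹ ∈ ((d • Q : Sylow 2 Γ) : Subgroup Γ) ↔
          MulAut.conj (d : Γ) • v ∈ MulAut.conj (d : Γ) • (Q : Subgroup Γ) := Iff.rfl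
        apply this.2
        rw [Subgroup.smul_mem_pointwise_smul_iff]; exact hv.2
      · intro a _ b _ hab
        exact mul_left_cancel (mul_right_cancel hab)
      · intro b hb
        rw [mem_els] at hb
        refine ⟨(d : Γ)⁻¹ * b * d, mem_els.2 ⟨?_, ?_⟩, by group⟩
        · exact D.mul_mem (D.mul_mem (D.inv_mem d.2) hb.1) d.2
        · have : (d : Γ) * ((d : Γ)⁻¹ * b * d) * (d : Γ)⁻¹ ∈ ((d • Q : Sylow 2 Γ) : Subgroup Γ) ↔
            MulAut.conj (d : Γ) • ((d : Γ)⁻¹ * b * d) ∈ MulAut.conj (d : Γ) • (Q : Subgroup Γ) :=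
              Iff.rfl
          rw [Subgroup.smul_mem_pointwise_smul_iff] at this
          apply this.1
          have e : (d : Γ) * ((d : Γ)⁻¹ * b * d) * (d : Γ)⁻¹ = b := by group
          rw [e]; exact hb.2
      · intro v hv
        rw [mem_els] at hv
        exact (h.1 d (hD d.2) v (hD hv.1)).symm
    have hf2 : ∀ w, ∃ α, AI α ∧ f w = Nat.card (MulAction.stabilizer D w) * α := by
      intro Q
      obtain ⟨α, h3, h4⟩ := h.2 (D ⊓ (Q : Subgroup Γ)) (inf_le_left.trans hD)
      refine ⟨α, h3, ?_⟩
      simp only [f]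
      rw [h4]
      congr 2
      apply Nat.card_congr
      exact
        { toFun := fun v => ⟨⟨v, v.2.1⟩, (hstab Q _).2 v.2.2⟩
          invFun := fun v => ⟨v.1, v.1.2, (hstab Q _).1 v.2⟩
          left_inv := fun v => rfl
          right_inv := fun v => rfl }
    obtain ⟨β, hβ, hsum⟩ := orbit_sum (D := D) f hf1 hf2
    · refine ⟨β, hβ, ?_⟩
      rw [← hsum]
      simp only [sN_cast, Finset.sum_mul, f]
      rw [Finset.sum_comm]
      apply Finset.sum_congr rfl
      intro Q _
      simp only [ite_mul, one_mul, zero_mul]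
      rw [← Finset.sum_filter]
      apply Finset.sum_congr _ (fun _ _ => rfl)
      ext v
      rw [Finset.mem_filter, mem_els, mem_els]; rfl

theorem sN_steps (P : Sylow 2 Γ) (Φ : Γ → ℂ) (h : Avg (P : Subgroup Γ) Φ) (n : ℕ) :
    Avg (P : Subgroup Γ) (fun v => (sN v : ℂ) ^ n * Φ v) := by
  induction n with
  | zero => simpa using h
  | succ n ih =>
    have := sN_step P _ ih
    simpa only [pow_succ', mul_assoc] using this

theorem odd_pow_two_pow {s : ℕ} (hs : Odd s) (j : ℕ) : ∃ t : ℤ, (1 : ℤ) - s ^ 2 ^ j = 2 ^ (j + 1) * t := by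
  induction j with
  | zero =>
    obtain ⟨k, rfl⟩ := hs
    exact ⟨-k, by push_cast; ring⟩
  | succ j ih =>
    obtain ⟨t, ht⟩ := ih
    refine ⟨t * (1 - 2 ^ j * t), ?_⟩
    have h1 : (s : ℤ) ^ 2 ^ (j + 1) = (s ^ 2 ^ j) ^ 2 := by rw [← pow_mul, pow_succ 2 j]
    have h2 : (s : ℤ) ^ 2 ^ j = 1 - 2 ^ (j + 1) * t := by linear_combination -ht
    rw [h1, h2]; ring

open Classical in
/-- the local statement -/
theorem brauer_local [Fintype Γ] (P : Sylow 2 Γ) (Φ : Γ → ℂ) (hΦ : ∀ x v, Φ (x * v * x⁻¹) = Φ v)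
    (hIntr : ∀ v, AI (Φ v))
    (hE : ∀ n, ∃ α, AI α ∧ ∑ v ∈ els (P : Subgroup Γ), (sN v : ℂ) ^ n * Φ v = 2 * Nat.card P * α) :
    ∃ α, AI α ∧ ∑ v with (∃ k, v ^ 2 ^ k = 1), Φ v = 2 * Nat.card P * α := by
  obtain ⟨j, hj⟩ := IsPGroup.iff_card.1 P.isPGroup'
  obtain ⟨α, h1, h2⟩ := hE (2 ^ j - 1)
  have h3 := sN_sum (fun v => (sN v : ℂ) ^ (2 ^ j - 1) * Φ v) (fun x v => by
    rw [hΦ, show sN (x * v * x⁻¹) = sN v from sN_aut (MulAut.conj x) v]) P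
  rw [h2] at h3
  have h4 : ∀ v : Γ, ∃ β, AI β ∧ ((∃ k, v ^ 2 ^ k = 1) →
      (1 - (sN v : ℂ) ^ 2 ^ j) * Φ v = 2 * 2 ^ j * β) := by
    intro v
    by_cases hv : ∃ k, v ^ 2 ^ k = 1
    · obtain ⟨t, ht⟩ := odd_pow_two_pow (sN_odd hv) j
      refine ⟨t * Φ v, (AI.int t).mul (hIntr v), fun _ => ?_⟩
      have : (1 : ℂ) - (sN v : ℂ) ^ 2 ^ j = 2 ^ (j + 1) * t := by exact_mod_cast ht
      rw [this]; ring
    · exact ⟨0, by simpa using AI.int 0, fun h => absurd h hv⟩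
  choose β hβ1 hβ2 using h4
  refine ⟨(∑ v with (∃ k, v ^ 2 ^ k = 1), β v) + Nat.card (Sylow 2 Γ) * α,
    (AI.sum (fun v _ => hβ1 v)).add ((AI.nat _).mul h1), ?_⟩
  have h5 : ∑ v, (sN v : ℂ) * ((sN v : ℂ) ^ (2 ^ j - 1) * Φ v) =
      ∑ v with (∃ k, v ^ 2 ^ k = 1), (sN v : ℂ) ^ 2 ^ j * Φ v := by
    rw [Finset.sum_filter]
    apply Finset.sum_congr rfl
    intro v _
    have hpos : 2 ^ j = (2 ^ j - 1) + 1 := by have := Nat.two_pow_pos j; omega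
    split_ifs with hv
    · rw [← mul_assoc, ← pow_succ', ← hpos]
    · rw [sN_zero hv]; simp
  rw [h5] at h3
  have h6 : ∑ v with (∃ k, v ^ 2 ^ k = 1), Φ v = ∑ v with (∃ k, v ^ 2 ^ k = 1), (2 * 2 ^ j * β v)
      + ∑ v with (∃ k, v ^ 2 ^ k = 1), (sN v : ℂ) ^ 2 ^ j * Φ v := by
    rw [← Finset.sum_add_distrib]
    apply Finset.sum_congr rfl
    intro v hv
    rw [← hβ2 v (Finset.mem_filter.1 hv).2]; ring
  have hj' : (Nat.card P : ℂ) = 2 ^ j := by exact_mod_cast hj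
  rw [h6, h3, ← Finset.mul_sum, hj']; ring

end syl

end UCS

set_option linter.unusedSectionVars false
namespace UCS

open scoped Pointwise

section brauer

variable {A : Type} [Group A] [Finite A]

/-- centralizers -/
def Cen (G : Subgroup A) (g : A) : Subgroup A := G ⊓ Subgroup.centralizer {g}

theorem mem_Cen {G : Subgroup A} {g v : A} : v ∈ Cen G g ↔ v ∈ G ∧ v * g = g * v := by
  unfold Cen
  rw [Subgroup.mem_inf, Subgroup.mem_centralizer_singleton_iff]

/-- conjugation as an automorphism -/
def conjAut (C : Subgroup A) (c : A) (h : Nrm C c) : MulAut C where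
  toFun v := ⟨c * v * c⁻¹, h.mem v v.2⟩
  invFun v := ⟨c * v * c⁻¹, h.mem v v.2⟩
  left_inv v := Subtype.ext (h.twice v)
  right_inv v := Subtype.ext (h.twice v)
  map_mul' x y := Subtype.ext (by simp)

theorem conjAut_sq (C : Subgroup A) (c : A) (h : Nrm C c) : conjAut C c h * conjAut C c h = 1 := by
  ext v
  exact h.twice v

theorem exists_fixed_syl (C : Subgroup A) (c : A) (h : Nrm C c) :
    ∃ Q : Sylow 2 C, ∀ v ∈ Q, conjAut C c h v ∈ Q := by
  have h2 : IsPGroup 2 (Subgroup.zpowers (conjAut C c h)) := by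
    have h3 : orderOf (conjAut C c h) ∣ 2 ^ 1 := by
      apply orderOf_dvd_of_pow_eq_one
      rw [pow_one, pow_two, conjAut_sq]
    obtain ⟨k, -, hk⟩ := (Nat.dvd_prime_pow Nat.prime_two).1 h3
    exact IsPGroup.of_card (n := k) (by rw [Nat.card_zpowers, hk])
  obtain ⟨Q, hQ⟩ := h2.nonempty_fixed_point_of_prime_not_dvd_card (Sylow 2 C) (not_dvd_card_sylow 2 C)
  refine ⟨Q, fun v hv => ?_⟩
  have h4 : conjAut C c h • Q = Q := hQ ⟨_, Subgroup.mem_zpowers _⟩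
  have h5 : conjAut C c h • v ∈ conjAut C c h • (Q : Subgroup C) :=
    (Subgroup.smul_mem_pointwise_smul_iff).2 hv
  rw [← h4]
  exact h5

theorem sum_els_map {C : Subgroup A} (D : Subgroup C) (f : A → ℂ) :
    ∑ v ∈ els D, f v = ∑ v ∈ els (D.map C.subtype), f v := by
  apply Finset.sum_bij (fun (v : C) _ => (v : A))
  · intro v hv
    rw [mem_els] at *
    exact ⟨v, hv, rfl⟩
  · intro a _ b _ hab; exact Subtype.ext hab
  · intro b hb
    obtain ⟨v, hv, rfl⟩ := mem_els.1 hb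
    exact ⟨v, mem_els.2 hv, rfl⟩
  · intro _ _; rfl

theorem card_map {C : Subgroup A} (D : Subgroup C) : Nat.card (D.map C.subtype) = Nat.card D :=
  Subgroup.card_map_of_injective C.subtype_injective

open Classical in
/-- Brauer-type reduction, local piece -/
theorem brauer_piece {G : Subgroup A} {c : A} (hc : Nrm G c) {X : Type} [AddCommGroup X]
    [Module ℂ X] [FiniteDimensional ℂ X] {R : A → X →ₗ[ℂ] X} (hR : IsRepOn G R)
    (B : X →ₗ[ℂ] X →ₗ[ℂ] ℂ) (hB : Inv G c R B) (hs : ∀ x y, B x y = - B y x)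
    (hnd : ∀ x, (∀ y, B x y = 0) → x = 0)
    (g : A) (hg : g ∈ G) (H : Subgroup A) (c' : A) (P0 : Sylow 2 (Cen G g))
    (hH : H ≤ G) (hgH : g ∈ H) (hPH : (P0 : Subgroup (Cen G g)).map (Cen G g).subtype ≤ H)
    (hc' : c' * c⁻¹ ∈ G) (hcH : Nrm H c') (hcg : c' * g * c'⁻¹ = g⁻¹) (hN : NoSkew H c')
    [Fintype (Cen G g)] :
    ∃ α, AI α ∧ ∑ v : Cen G g with (∃ k, v ^ 2 ^ k = 1),
      LinearMap.trace ℂ X (R (g * v)) * LinearMap.trace ℂ X (R (g * v)⁻¹) = 2 * Nat.card P0 * α := by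
  -- c' normalizes G and the centralizers
  have hcG : Nrm G c' := by
    refine ⟨hcH.sq, fun x hx => ?_⟩
    have : c' * x * c'⁻¹ = (c' * c⁻¹) * (c * x * c⁻¹) * (c' * c⁻¹)⁻¹ := by group
    rw [this]
    exact G.mul_mem (G.mul_mem hc' (hc.mem x hx)) (G.inv_mem hc')
  have hcen : ∀ K : Subgroup A, Nrm K c' → Nrm (Cen K g) c' := by
    intro K hK
    refine ⟨hK.sq, fun x hx => ?_⟩
    rw [mem_Cen] at *
    refine ⟨hK.mem x hx.1, ?_⟩
    have e1 : g = c' * g⁻¹ * c'⁻¹ := by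
      have : c' * g⁻¹ * c'⁻¹ = (c' * g * c'⁻¹)⁻¹ := by group
      rw [this, hcg, inv_inv]
    have e2 : x * g⁻¹ = g⁻¹ * x := by
      calc x * g⁻¹ = g⁻¹ * (g * x) * g⁻¹ := by group
        _ = g⁻¹ * (x * g) * g⁻¹ := by rw [hx.2]
        _ = g⁻¹ * x := by group
    calc c' * x * c'⁻¹ * g = c' * x * c'⁻¹ * (c' * g⁻¹ * c'⁻¹) := by rw [← e1]
      _ = c' * (x * g⁻¹) * c'⁻¹ := by group
      _ = c' * (g⁻¹ * x) * c'⁻¹ := by rw [e2]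
      _ = (c' * g⁻¹ * c'⁻¹) * (c' * x * c'⁻¹) := by group
      _ = g * (c' * x * c'⁻¹) := by rw [← e1]
  -- a Sylow subgroup normalized by c'
  obtain ⟨Q, hQ⟩ := exists_fixed_syl (Cen H g) c' (hcen H hcH)
  have hle : Cen H g ≤ Cen G g := fun x hx => by
    rw [mem_Cen] at *; exact ⟨hH hx.1, hx.2⟩
  let Q1 : Subgroup (Cen G g) := ((Q : Subgroup (Cen H g)).map (Cen H g).subtype).subgroupOf (Cen G g)
  have hQ1le : (Q : Subgroup (Cen H g)).map (Cen H g).subtype ≤ Cen G g := by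
    rintro _ ⟨v, _, rfl⟩
    exact hle v.2
  have hQ1card : Nat.card Q1 = Nat.card Q := by
    rw [← card_map (Q : Subgroup (Cen H g))]
    exact Nat.card_congr (Subgroup.subgroupOfEquivOfLe hQ1le).toEquiv
  have hP0le : (P0 : Subgroup (Cen G g)).map (Cen G g).subtype ≤ Cen H g := by
    intro x hx
    have h1 := hPH hx
    obtain ⟨v, hv, rfl⟩ := hx
    exact mem_Cen.2 ⟨h1, (mem_Cen.1 v.2).2⟩
  have hfac : (Nat.card (Cen H g)).factorization 2 = (Nat.card (Cen G g)).factorization 2 := by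
    apply le_antisymm
    · exact (Nat.factorization_le_iff_dvd Nat.card_pos.ne' Nat.card_pos.ne').2
        (Subgroup.card_dvd_of_le hle) 2
    · have h1 := Subgroup.card_dvd_of_le hP0le
      rw [card_map, P0.card_eq_multiplicity] at h1
      exact (Nat.prime_two.pow_dvd_iff_le_factorization Nat.card_pos.ne').1 h1
  let P : Sylow 2 (Cen G g) := Sylow.ofCard Q1 (by rw [hQ1card, Q.card_eq_multiplicity, hfac])
  have hPmem : ∀ v : Cen G g, v ∈ P ↔ ∃ w ∈ Q, (w : A) = v := by
    intro v
    have : v ∈ P ↔ v ∈ Q1 := Iff.rfl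
    rw [this, Subgroup.mem_subgroupOf]
    constructor
    · rintro ⟨w, hw, hw'⟩; exact ⟨w, hw, hw'⟩
    · rintro ⟨w, hw, hw'⟩; exact ⟨w, hw, hw'⟩
  have hPP0 : Nat.card P = Nat.card P0 := by
    rw [P.card_eq_multiplicity, P0.card_eq_multiplicity]
  have hPH' : ∀ v ∈ P, (v : A) ∈ H := by
    intro v hv
    obtain ⟨w, hw, hw'⟩ := (hPmem v).1 hv
    rw [← hw']; exact (mem_Cen.1 w.2).1
  let φ := conjAut (Cen G g) c' (hcen G hcG)
  have hφ : ∀ v, ((φ v : Cen G g) : A) = c' * v * c'⁻¹ := fun v => rfl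
  have hPφ : ∀ v ∈ P, φ v ∈ P := by
    intro v hv
    obtain ⟨w, hw, hw'⟩ := (hPmem v).1 hv
    rw [hPmem]
    refine ⟨_, hQ w hw, ?_⟩
    rw [hφ, ← hw']; rfl
  -- the split
  have hy := hc'
  set y := c' * c⁻¹ with hydef
  have hRH := hR.mono hH
  let B' : X →ₗ[ℂ] X →ₗ[ℂ] ℂ := B.compl₁₂ LinearMap.id (R y⁻¹)
  have hB'a : ∀ x z, B' x z = B x (R y⁻¹ z) := fun x z => rfl
  have hB' : Inv G c' R B' := by
    intro k hk x z
    rw [hB'a, hB'a, ← hR.mul_apply (G.inv_mem hy) (hcG.mem k hk)]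
    have : y⁻¹ * (c' * k * c'⁻¹) = (c * k * c⁻¹) * y⁻¹ := by rw [hydef]; group
    rw [this, hR.mul_apply (hc.mem k hk) (G.inv_mem hy), hB k hk]
  have hs' : ∀ x z, B' x z = - B' z x := by
    intro x z
    rw [hB'a, hB'a, hs x, hB.left hR hc (G.inv_mem hy), inv_inv]
    have h1 : c * y * c⁻¹ = y⁻¹ := by
      rw [hydef, mul_inv_rev, inv_inv, hcH.inv_eq, hc.inv_eq]
      calc c * (c' * c) * c = c * c' * (c * c) := by group
        _ = c * c' := by rw [hc.sq, mul_one]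
    rw [h1]
  have hnd' : ∀ x, (∀ z, B' x z = 0) → x = 0 := by
    intro x hx
    apply hnd
    intro z
    have := hx (R y z)
    rw [hB'a, hR.inv_apply hy] at this
    exact this
  obtain ⟨W, hW, hsplit⟩ := split_skew hN hRH hcH B' (fun k hk => hB' k (hH hk)) hs' hnd'
  have hRW := hRH.res hW
  set a : A → ℂ := fun x => LinearMap.trace ℂ W (resR R W x) with ha
  set χ : A → ℂ := fun x => LinearMap.trace ℂ X (R x) with hχ
  have hsplit' : ∀ x ∈ H, χ x = a x + a (c' * x⁻¹ * c'⁻¹) := hsplit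
  have haconj : ∀ x ∈ H, ∀ z ∈ H, a (z * x * z⁻¹) = a x := fun x hx z hz => trace_conj_rep hRW hx hz
  let Ψ1 : Cen G g → ℂ := fun v => a (g * v) * a ((g * v)⁻¹)
  let Ψ2 : Cen G g → ℂ := fun v => a (g * v) * a (c' * (g * v) * c'⁻¹)
  have hgv : ∀ v : Cen G g, g * v = v * g := fun v => ((mem_Cen.1 v.2).2).symm
  have hconj : ∀ x v : Cen G g, g * ((x * v * x⁻¹ : Cen G g) : A) = x * (g * v) * (x : A)⁻¹ := by
    intro x v
    push_cast
    calc g * ((x : A) * v * (x : A)⁻¹) = (g * x) * v * (x : A)⁻¹ := by group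
      _ = (x * g) * v * (x : A)⁻¹ := by rw [hgv]
      _ = _ := by group
  have hΨ1 : Avg (P : Subgroup (Cen G g)) Ψ1 := by
    constructor
    · intro x hx v hv
      have h1 := H.mul_mem hgH (hPH' v hv)
      simp only [Ψ1]
      rw [hconj, haconj _ h1 _ (hPH' x hx)]
      congr 1
      have : (x * (g * v) * (x : A)⁻¹)⁻¹ = x * (g * v)⁻¹ * (x : A)⁻¹ := by group
      rw [this, haconj _ (H.inv_mem h1) _ (hPH' x hx)]
    · intro D hD
      have hD' : D.map (Cen G g).subtype ≤ H := by
        rintro _ ⟨v, hv, rfl⟩; exact hPH' v (hD hv)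
      obtain ⟨α, h1, h2⟩ := ai_avg2 hRW (dual_rep hRW) hgH (D.map (Cen G g).subtype) hD' (by
        rintro _ ⟨v, hv, rfl⟩; exact hgv v)
      refine ⟨α, h1, ?_⟩
      rw [card_map, ← sum_els_map D] at h2
      rw [← h2]
      apply Finset.sum_congr rfl
      intro v _
      rw [LinearMap.trace_transpose']
  have hΨ2 : Avg (P : Subgroup (Cen G g)) Ψ2 := by
    constructor
    · intro x hx v hv
      have h1 := H.mul_mem hgH (hPH' v hv)
      simp only [Ψ2]
      rw [hconj, haconj _ h1 _ (hPH' x hx)]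
      congr 1
      have : c' * (x * (g * v) * (x : A)⁻¹) * c'⁻¹ =
        (c' * x * c'⁻¹) * (c' * (g * v) * c'⁻¹) * (c' * x * c'⁻¹)⁻¹ := by group
      rw [this, haconj _ (hcH.mem _ h1) _ (hcH.mem _ (hPH' x hx))]
    · intro D hD
      have hD' : D.map (Cen G g).subtype ≤ H := by
        rintro _ ⟨v, hv, rfl⟩; exact hPH' v (hD hv)
      have hRW2 : IsRepOn H (fun x => resR R W (c' * x * c'⁻¹)) := by
        constructor
        · show resR R W (c' * 1 * c'⁻¹) = 1
          rw [mul_one, mul_inv_cancel]; exact hRW.one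
        · intro x hx z hz
          show resR R W (c' * (x * z) * c'⁻¹) = _
          rw [← hRW.mul _ (hcH.mem x hx) _ (hcH.mem z hz)]
          congr 1; group
      obtain ⟨α, h1, h2⟩ := ai_avg2 hRW hRW2 hgH (D.map (Cen G g).subtype) hD' (by
        rintro _ ⟨v, hv, rfl⟩; exact hgv v)
      refine ⟨α, h1, ?_⟩
      rw [card_map, ← sum_els_map D] at h2
      rw [← h2]
  rw [← hPP0]
  apply brauer_local P (fun v : Cen G g => χ (g * v) * χ (g * v)⁻¹)
  · intro x v
    have h1 : g * (v : A) ∈ G := G.mul_mem hg (mem_Cen.1 v.2).1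
    have hx := (mem_Cen.1 x.2).1
    show χ (g * ((x * v * x⁻¹ : Cen G g) : A)) * χ (g * ((x * v * x⁻¹ : Cen G g) : A))⁻¹ = _
    rw [hconj]
    have : (x * (g * v) * (x : A)⁻¹)⁻¹ = x * (g * v)⁻¹ * (x : A)⁻¹ := by group
    rw [this]
    simp only [hχ]
    rw [trace_conj_rep hR h1 hx, trace_conj_rep hR (G.inv_mem h1) hx]
  · intro v
    have h1 : g * (v : A) ∈ G := G.mul_mem hg (mem_Cen.1 v.2).1
    exact (ai_char hR h1).mul (ai_char hR (G.inv_mem h1))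
  · intro n
    obtain ⟨α1, h1, h2⟩ := (sN_steps P _ hΨ1 n).2 _ le_rfl
    obtain ⟨α2, h3, h4⟩ := (sN_steps P _ hΨ2 n).2 _ le_rfl
    refine ⟨α1 + α2, h1.add h3, ?_⟩
    -- the substitution
    let τ : Cen G g → Cen G g := fun v => φ v⁻¹
    have hτ : ∀ f : Cen G g → ℂ, ∑ v ∈ els (P : Subgroup (Cen G g)), (sN v : ℂ) ^ n * f (τ v) =
        ∑ v ∈ els (P : Subgroup (Cen G g)), (sN v : ℂ) ^ n * f v := by
      intro f
      have hττ : ∀ v, τ (τ v) = v := by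
        intro v
        simp only [τ, map_inv, inv_inv]
        exact Subtype.ext (hcG.twice v)
      have hτP : ∀ v ∈ P, τ v ∈ P := fun v hv => hPφ _ (inv_mem hv)
      apply Finset.sum_bij (fun v _ => τ v)
      · intro v hv
        rw [mem_els] at *
        exact hτP v hv
      · intro v _ w _ hvw
        rw [← hττ v, hvw, hττ]
      · intro v hv
        rw [mem_els] at *
        exact ⟨τ v, mem_els.2 (hτP v hv), hττ v⟩
      · intro v _
        simp only [τ, sN_aut, sN_inv]
    have e1 := hτ Ψ1
    have e2 := hτ Ψ2
    rw [h2] at e1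
    rw [h4] at e2
    have e3 : ∀ v ∈ els (P : Subgroup (Cen G g)), (sN v : ℂ) ^ n * (χ (g * v) * χ (g * v)⁻¹) =
        (sN v : ℂ) ^ n * Ψ1 v + (sN v : ℂ) ^ n * Ψ2 v + (sN v : ℂ) ^ n * Ψ1 (τ v)
          + (sN v : ℂ) ^ n * Ψ2 (τ v) := by
      intro v hv
      have hvH := hPH' v (mem_els.1 hv)
      have h5 : g * (v : A) ∈ H := H.mul_mem hgH hvH
      rw [hsplit' _ h5, hsplit' _ (H.inv_mem h5)]
      have hg' : c' * g⁻¹ * c'⁻¹ = g := by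
        have : c' * g⁻¹ * c'⁻¹ = (c' * g * c'⁻¹)⁻¹ := by group
        rw [this, hcg, inv_inv]
      have e4 : g * ((τ v : Cen G g) : A) = c' * (g * v)⁻¹ * c'⁻¹ := by
        rw [hgv (τ v)]
        show c' * (v : A)⁻¹ * c'⁻¹ * g = _
        calc c' * (v : A)⁻¹ * c'⁻¹ * g = c' * (v : A)⁻¹ * c'⁻¹ * (c' * g⁻¹ * c'⁻¹) := by rw [hg']
          _ = _ := by group
      simp only [Ψ1, Ψ2]
      rw [e4, hcH.twice]
      have e5 : (c' * (g * (v : A))⁻¹ * c'⁻¹)⁻¹ = c' * (g * v) * c'⁻¹ := by group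
      rw [e5, inv_inv]
      ring
    rw [Finset.sum_congr rfl e3, Finset.sum_add_distrib, Finset.sum_add_distrib,
      Finset.sum_add_distrib, h2, h4, e1, e2]
    ring

/-- the odd-order elements -/
def OddEl (G : Subgroup A) : Type := {g : A // g ∈ G ∧ Odd (orderOf g)}

noncomputable instance (G : Subgroup A) : Fintype (OddEl G) := by
  unfold OddEl; exact Fintype.ofFinite _

theorem orderOf_conj' (d g : A) : orderOf (d * g * d⁻¹) = orderOf g := by
  have := orderOf_injective (MulAut.conj d).toMonoidHom (MulAut.conj d).injective g
  simpa using this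

instance (G : Subgroup A) : MulAction G (OddEl G) where
  smul d w := ⟨d * w.1 * (d : A)⁻¹, G.mul_mem (G.mul_mem d.2 w.2.1) (G.inv_mem d.2), by
    rw [orderOf_conj']; exact w.2.2⟩
  one_smul w := Subtype.ext (by show (1 : A) * w.1 * (1 : A)⁻¹ = w.1; group)
  mul_smul x y w := Subtype.ext (by
    show ((x : A) * y) * w.1 * ((x : A) * y)⁻¹ = x * (y * w.1 * (y : A)⁻¹) * (x : A)⁻¹; group)

theorem oddEl_smul (G : Subgroup A) (d : G) (w : OddEl G) : (d • w).1 = d * w.1 * (d : A)⁻¹ := rfl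

/-- Brauer-type reduction -/
theorem noSkew_brauer {G : Subgroup A} {c : A} (hc : Nrm G c)
    (hyp : ∀ g ∈ G, Odd (orderOf g) → ∀ P : Subgroup A, P ≤ Cen G g → IsPGroup 2 P →
      ∃ (H : Subgroup A) (c' : A), H ≤ G ∧ g ∈ H ∧ P ≤ H ∧ c' * c⁻¹ ∈ G ∧ Nrm H c' ∧
        c' * g * c'⁻¹ = g⁻¹ ∧ NoSkew H c') : NoSkew G c := by
  classical
  have : Fintype A := Fintype.ofFinite A
  intro X _ _ _ R hR hI B hB hs
  by_contra hB0
  have hnt : Nontrivial X := by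
    by_contra hX
    rw [not_nontrivial_iff_subsingleton] at hX
    apply hB0
    ext x y
    rw [Subsingleton.elim x 0]; simp
  have hnd := nondeg_of_irr hR hI hc hB hB0
  set F : A → ℂ := fun x => LinearMap.trace ℂ X (R x) * LinearMap.trace ℂ X (R x⁻¹) with hF
  have hFconj : ∀ x ∈ G, ∀ y ∈ G, F (y * x * y⁻¹) = F x := by
    intro x hx y hy
    simp only [hF]
    have : (y * x * y⁻¹)⁻¹ = y * x⁻¹ * y⁻¹ := by group
    rw [this, trace_conj_rep hR hx hy, trace_conj_rep hR (G.inv_mem hx) hy]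
  obtain ⟨r, M, hM2, hcard⟩ := Nat.exists_eq_pow_mul_and_not_dvd (n := Nat.card G) Nat.card_pos.ne'
    2 (by norm_num)
  have hMo : Odd M := Nat.not_even_iff_odd.1 (fun h => hM2 h.two_dvd)
  have hMpos : 0 < M := hMo.pos
  -- the inner sums
  let T : A → Finset A := fun g => (els G).filter (fun v => v * g = g * v ∧ ∃ k, v ^ 2 ^ k = 1)
  have hT : ∀ g v, v ∈ T g ↔ v ∈ G ∧ v * g = g * v ∧ ∃ k, v ^ 2 ^ k = 1 := by
    intro g v
    simp only [T, Finset.mem_filter, mem_els]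
  let f : OddEl G → ℂ := fun w => M / 2 * ∑ v ∈ T w.1, F (w.1 * v)
  obtain ⟨β, hβ, hsum⟩ := orbit_sum (D := G) f (by
    intro d w
    simp only [f]
    congr 1
    symm
    rw [oddEl_smul]
    apply Finset.sum_bij (fun v _ => (d : A) * v * (d : A)⁻¹)
    · intro v hv
      rw [hT] at hv ⊢
      obtain ⟨h1, h2, k, hk⟩ := hv
      refine ⟨G.mul_mem (G.mul_mem d.2 h1) (G.inv_mem d.2), ?_, k, ?_⟩
      · calc (d : A) * v * (d : A)⁻¹ * (d * w.1 * (d : A)⁻¹) = d * (v * w.1) * (d : A)⁻¹ := by group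
          _ = d * (w.1 * v) * (d : A)⁻¹ := by rw [h2]
          _ = _ := by group
      · rw [conj_pow, hk]; group
    · intro a _ b _ hab
      exact mul_left_cancel (mul_right_cancel hab)
    · intro b hb
      rw [hT] at hb
      obtain ⟨h1, h2, k, hk⟩ := hb
      refine ⟨(d : A)⁻¹ * b * d, (hT _ _).2 ⟨G.mul_mem (G.mul_mem (G.inv_mem d.2) h1) d.2, ?_, k, ?_⟩,
        by group⟩
      · calc (d : A)⁻¹ * b * d * w.1 = (d : A)⁻¹ * (b * (d * w.1 * (d : A)⁻¹)) * d := by group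
          _ = (d : A)⁻¹ * ((d * w.1 * (d : A)⁻¹) * b) * d := by rw [h2]
          _ = _ := by group
      · have := conj_pow (a := (d : A)⁻¹) (b := b) (i := 2 ^ k)
        rw [inv_inv] at this
        rw [this, hk]; group
    · intro v hv
      rw [hT] at hv
      have : (d : A) * w.1 * (d : A)⁻¹ * (d * v * (d : A)⁻¹) = d * (w.1 * v) * (d : A)⁻¹ := by group
      rw [this, hFconj _ (G.mul_mem w.2.1 hv.1) _ d.2]) (by
    intro w
    let P0 : Sylow 2 (Cen G w.1) := default
    obtain ⟨H, c', h1, h2, h3, h4, h5, h6, h7⟩ := hyp w.1 w.2.1 w.2.2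
      ((P0 : Subgroup (Cen G w.1)).map (Cen G w.1).subtype) (by
        rintro _ ⟨v, _, rfl⟩; exact v.2) (P0.isPGroup'.map _)
    obtain ⟨α, hα, hsum⟩ := brauer_piece hc hR B hB hs hnd w.1 w.2.1 H c' P0 h1 h2 h3 h4 h5 h6 h7
    have hst : Nat.card (MulAction.stabilizer G w) = Nat.card (Cen G w.1) := by
      have hmem : ∀ d : G, d ∈ MulAction.stabilizer G w ↔ (d : A) ∈ Cen G w.1 := by
        intro d
        rw [MulAction.mem_stabilizer_iff, mem_Cen]
        constructor
        · intro h
          have h' := congrArg Subtype.val h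
          rw [oddEl_smul] at h'
          refine ⟨d.2, ?_⟩
          calc (d : A) * w.1 = (d * w.1 * (d : A)⁻¹) * d := by group
            _ = w.1 * d := by rw [h']
        · intro h
          apply Subtype.ext
          rw [oddEl_smul, h.2]; group
      apply Nat.card_congr
      exact
        { toFun := fun v => ⟨v, (hmem v.1).1 v.2⟩
          invFun := fun v => ⟨⟨v, (mem_Cen.1 v.2).1⟩, (hmem _).2 v.2⟩
          left_inv := fun v => rfl
          right_inv := fun v => rfl }
    -- |C| = |P0| * odd and odd ∣ M
    have hidx : Nat.card (Cen G w.1) = Nat.card P0 * (P0 : Subgroup (Cen G w.1)).index :=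
      (Subgroup.card_mul_index _).symm
    have hdvd : (P0 : Subgroup (Cen G w.1)).index ∣ M := by
      have h8 : (P0 : Subgroup (Cen G w.1)).index ∣ 2 ^ r * M := by
        rw [← hcard]
        exact (Dvd.intro_left _ hidx.symm).trans (Subgroup.card_dvd_of_le inf_le_left)
      refine Nat.Coprime.dvd_of_dvd_mul_left ?_ h8
      apply Nat.Coprime.pow_right
      rw [Nat.coprime_comm, Nat.Prime.coprime_iff_not_dvd Nat.prime_two]
      exact P0.not_dvd_index
    obtain ⟨t, ht⟩ := hdvd
    refine ⟨t * α, (AI.nat _).mul hα, ?_⟩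
    simp only [f]
    have e1 : ∑ v ∈ T w.1, F (w.1 * v) = 2 * Nat.card P0 * α := by
      rw [← hsum]
      symm
      apply Finset.sum_bij (fun (v : Cen G w.1) _ => (v : A))
      · intro v hv
        obtain ⟨k, hk⟩ := (Finset.mem_filter.1 hv).2
        rw [hT]
        exact ⟨(mem_Cen.1 v.2).1, (mem_Cen.1 v.2).2, k, by simpa using congrArg Subtype.val hk⟩
      · intro a _ b _ hab; exact Subtype.ext hab
      · intro b hb
        obtain ⟨h1, h2, k, hk⟩ := (hT _ _).1 hb
        exact ⟨⟨b, mem_Cen.2 ⟨h1, h2⟩⟩, Finset.mem_filter.2 ⟨Finset.mem_univ _, k,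
          Subtype.ext (by simpa using hk)⟩, rfl⟩
      · intro v _; rfl
    rw [e1, hst, hidx, ht]
    push_cast
    ring)
  -- the decomposition of elements
  have htot := norm_char hR hI
  obtain ⟨e, he1, he2⟩ := Nat.chineseRemainder (n := 2 ^ r) (m := M)
    ((Nat.coprime_two_left.2 hMo).pow_left r) 0 1
  have he1' : 2 ^ r ∣ e := (Nat.modEq_zero_iff_dvd).1 he1
  have hord : ∀ y ∈ G, y ^ (2 ^ r * M) = 1 := by
    intro y hy
    rw [← hcard]
    have : (⟨y, hy⟩ : G) ^ Nat.card G = 1 := pow_card_eq_one'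
    exact congrArg Subtype.val this
  have hodd : ∀ y ∈ G, Odd (orderOf y) → y ^ e = y := by
    intro y hy ho
    have h1 : orderOf y ∣ M := by
      refine Nat.Coprime.dvd_of_dvd_mul_left ?_ (orderOf_dvd_of_pow_eq_one (hord y hy))
      apply Nat.Coprime.pow_right
      exact Nat.coprime_two_right.2 ho
    have h2 := pow_eq_pow_iff_modEq (x := y) (n := e) (m := 1)
    rw [pow_one] at h2
    exact h2.2 (he2.of_dvd h1)
  have htwo : ∀ v ∈ G, (∃ k, v ^ 2 ^ k = 1) → v ^ e = 1 := by
    rintro v hv ⟨k, hk⟩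
    obtain ⟨j, -, hj⟩ := (Nat.dvd_prime_pow Nat.prime_two).1 (orderOf_dvd_of_pow_eq_one hk)
    have h1 : orderOf v ∣ 2 ^ r := by
      refine Nat.Coprime.dvd_of_dvd_mul_right ?_ (orderOf_dvd_of_pow_eq_one (hord v hv))
      rw [hj]
      exact (Nat.coprime_two_left.2 hMo).pow_left j
    exact orderOf_dvd_iff_pow_eq_one.1 (h1.trans he1')
  have hpo : ∀ y ∈ G, Odd (orderOf (y ^ e)) := by
    intro y hy
    obtain ⟨t, ht⟩ := he1'
    have : (y ^ e) ^ M = 1 := by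
      rw [← pow_mul, ht, show 2 ^ r * t * M = 2 ^ r * M * t by ring, pow_mul, hord y hy, one_pow]
    exact hMo.of_dvd_nat (orderOf_dvd_of_pow_eq_one this)
  have hp2 : ∀ y ∈ G, ((y ^ e)⁻¹ * y) ^ 2 ^ r = 1 := by
    intro y hy
    have hcm : Commute ((y ^ e)⁻¹) y := ((Commute.refl y).pow_left e).inv_left
    rw [hcm.mul_pow, inv_pow, ← pow_mul]
    have h2 := pow_eq_pow_iff_modEq (x := y) (n := e * 2 ^ r) (m := 2 ^ r)
    rw [h2.2, inv_mul_cancel]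
    have h3 : e * 2 ^ r ≡ 1 * 2 ^ r [MOD M * 2 ^ r] := Nat.ModEq.mul_right' _ he2
    rw [one_mul] at h3
    refine h3.of_dvd ?_
    rw [mul_comm]
    exact orderOf_dvd_of_pow_eq_one (hord y hy)
  have hdecomp : ∑ y ∈ els G, F y = ∑ w : OddEl G, ∑ v ∈ T w.1, F (w.1 * v) := by
    rw [Finset.sum_sigma']
    symm
    apply Finset.sum_bij (fun (p : (_ : OddEl G) × A) _ => p.1.1 * p.2)
    · rintro ⟨w, v⟩ hp
      have hv := (hT _ _).1 (Finset.mem_sigma.1 hp).2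
      rw [mem_els]
      exact G.mul_mem w.2.1 hv.1
    · have hrec : ∀ (w : OddEl G), ∀ v ∈ T w.1, (w.1 * v) ^ e = w.1 := by
        intro w v hv
        obtain ⟨h1, h2, h3⟩ := (hT _ _).1 hv
        have hcm : Commute w.1 v := h2.symm
        rw [hcm.mul_pow, hodd _ w.2.1 w.2.2, htwo v h1 h3, mul_one]
      rintro ⟨w, v⟩ hp ⟨w', v'⟩ hp' heq
      have h1 := hrec w v (Finset.mem_sigma.1 hp).2
      have h2 := hrec w' v' (Finset.mem_sigma.1 hp').2
      simp only at heq
      have h3 : w = w' := Subtype.ext (by rw [← h1, heq, h2])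
      subst h3
      have h4 := mul_left_cancel heq
      subst h4
      rfl
    · intro y hy
      rw [mem_els] at hy
      refine ⟨⟨⟨y ^ e, G.pow_mem hy e, hpo y hy⟩, (y ^ e)⁻¹ * y⟩, ?_, by simp⟩
      rw [Finset.mem_sigma]
      refine ⟨Finset.mem_univ _, (hT _ _).2 ⟨G.mul_mem (G.inv_mem (G.pow_mem hy e)) hy, ?_, r, hp2 y hy⟩⟩
      show (y ^ e)⁻¹ * y * y ^ e = y ^ e * ((y ^ e)⁻¹ * y)
      rw [mul_inv_cancel_left, mul_assoc, ← pow_succ', pow_succ, inv_mul_cancel_left]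
    · intro _ _; rfl
  have hne : (Nat.card G : ℂ) ≠ 0 := by exact_mod_cast Nat.card_pos.ne'
  refine AI.odd_ne hMo hβ ?_
  have e1 : ∑ w, f w = M / 2 * (Nat.card G : ℂ) := by
    simp only [f]
    rw [← Finset.mul_sum, ← hdecomp, htot]
  rw [e1] at hsum
  have e2 : (Nat.card G : ℂ) * M = Nat.card G * (2 * β) := by linear_combination 2 * hsum
  exact mul_left_cancel₀ hne e2

end brauer

end UCS

set_option linter.unusedSectionVars false
namespace UCS

section decomposition

variable {Γ : Type} [Group Γ] [Finite Γ]

/-- irreducible characters -/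
def IrrChar (Γ : Type) [Group Γ] : Set (Γ → ℂ) :=
  {f | ∃ (X : Type) (_ : AddCommGroup X) (_ : Module ℂ X) (_ : FiniteDimensional ℂ X)
    (_ : Nontrivial X) (R : Γ → X →ₗ[ℂ] X), IsRepOn ⊤ R ∧ IrrOn ⊤ R ∧
      f = fun g => LinearMap.trace ℂ X (R g)}

/-- characters given by simple objects -/
def SimpChar (Γ : Type) [Group Γ] : Set (Γ → ℂ) :=
  {f | ∃ V : FDRep ℂ Γ, CategoryTheory.Simple V ∧ f = V.character}

theorem sum_els_top [Fintype Γ] {M : Type} [AddCommMonoid M] (f : Γ → M) :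
    ∑ g ∈ els (⊤ : Subgroup Γ), f g = ∑ g, f g := by
  congr 1
  ext x; simp [mem_els]

theorem irr_sub_simp : IrrChar Γ ⊆ SimpChar Γ := by
  rintro f ⟨X, _, _, _, _, R, hR, hI, rfl⟩
  have : Fintype Γ := Fintype.ofFinite Γ
  have hne : (Nat.card Γ : ℂ) ≠ 0 := by exact_mod_cast Nat.card_pos.ne'
  let ρ : Representation ℂ Γ X :=
    { toFun := R, map_one' := hR.one, map_mul' := fun x y => hR.mul x trivial y trivial }
  refine ⟨FDRep.of ρ, ?_, rfl⟩
  rw [FDRep.simple_iff_char_is_norm_one]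
  have := norm_char hR hI
  rw [sum_els_top] at this
  rw [Subgroup.card_top] at this
  exact this

theorem char_mem_closure : ∀ (n : ℕ) (X : Type) [AddCommGroup X] [Module ℂ X]
    [FiniteDimensional ℂ X] (R : Γ → X →ₗ[ℂ] X), IsRepOn ⊤ R → Module.finrank ℂ X = n →
    (fun g => LinearMap.trace ℂ X (R g)) ∈ AddSubmonoid.closure (IrrChar Γ) := by
  intro n
  induction n using Nat.strong_induction_on with
  | _ n ih =>
    intro X _ _ _ R hR hn
    rcases subsingleton_or_nontrivial X with hX | hX
    · convert AddSubmonoid.zero_mem (AddSubmonoid.closure (IrrChar Γ)) using 1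
      ext g
      have : R g = 0 := by ext x; exact Subsingleton.elim _ _
      simp [this]
    · by_cases hI : IrrOn ⊤ R
      · exact AddSubmonoid.subset_closure ⟨X, _, _, ‹_›, hX, R, hR, hI, rfl⟩
      · unfold IrrOn at hI
        push Not at hI
        obtain ⟨W, hW, h1, h2⟩ := hI
        obtain ⟨W', hW', hc⟩ := exists_compl hR W hW
        have e := Submodule.finrank_add_eq_of_isCompl hc
        have p1 : 0 < Module.finrank ℂ W := by
          rw [Nat.pos_iff_ne_zero]; intro h; exact h1 (Submodule.finrank_eq_zero.1 h)
        have p2 : 0 < Module.finrank ℂ W' := by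
          rw [Nat.pos_iff_ne_zero]; intro h
          have := Submodule.finrank_eq_zero.1 h
          rw [this] at hc
          exact h2 (by simpa using hc.sup_eq_top)
        have a1 := ih _ (by omega) W (resR R W) (hR.res hW) rfl
        have a2 := ih _ (by omega) W' (resR R W') (hR.res hW') rfl
        have := AddSubmonoid.add_mem _ a1 a2
        convert this using 1
        ext g
        exact trace_compl hc (hW g trivial) (hW' g trivial)

/-- the scalar product -/
noncomputable def ip [Fintype Γ] (f χ : Γ → ℂ) : ℂ := (Nat.card Γ : ℂ)⁻¹ * ∑ g, f g * χ g⁻¹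

theorem ip_simp [Fintype Γ] {f χ : Γ → ℂ} (hf : f ∈ SimpChar Γ) (hχ : χ ∈ SimpChar Γ) :
    (f = χ → ip f χ = 1) ∧ (f ≠ χ → ip f χ = 0) := by
  have hne : (Nat.card Γ : ℂ) ≠ 0 := by exact_mod_cast Nat.card_pos.ne'
  let _ : Invertible (Nat.card Γ : ℂ) := invertibleOfNonzero hne
  obtain ⟨V, hV, rfl⟩ := hf
  obtain ⟨W, hW, rfl⟩ := hχ
  constructor
  · intro h
    unfold ip
    rw [← h, FDRep.char_orthonormal V V, if_pos ⟨CategoryTheory.Iso.refl _⟩]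
  · intro h
    unfold ip
    rw [FDRep.char_orthonormal V W, if_neg]
    rintro ⟨i⟩
    exact h (FDRep.char_iso i)

theorem simp_finite : (SimpChar Γ).Finite := by
  have : Fintype Γ := Fintype.ofFinite Γ
  have hli : LinearIndependent ℂ (fun f : SimpChar Γ => (f : Γ → ℂ)) := by
    rw [linearIndependent_iff']
    intro s g hs i hi
    have h1 : ip (∑ j ∈ s, g j • (j : Γ → ℂ)) i = 0 := by rw [hs]; simp [ip]
    have h2 : ip (∑ j ∈ s, g j • (j : Γ → ℂ)) i = ∑ j ∈ s, g j * ip (j : Γ → ℂ) (i : Γ → ℂ) := by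
      unfold ip
      simp only [Finset.sum_apply, Pi.smul_apply, smul_eq_mul, Finset.sum_mul, Finset.mul_sum]
      rw [Finset.sum_comm]
      refine Finset.sum_congr rfl fun _ _ => Finset.sum_congr rfl fun _ _ => by ring
    rw [h2, Finset.sum_eq_single i, (ip_simp i.2 i.2).1 rfl, mul_one] at h1
    · exact h1
    · intro b _ hb
      rw [(ip_simp b.2 i.2).2 (fun h => hb (Subtype.ext h)), mul_zero]
    · intro h; exact absurd hi h
  have := hli.finite
  exact Set.toFinite _

theorem closure_expand [Fintype Γ] (f : Γ → ℂ) (hf : f ∈ AddSubmonoid.closure (IrrChar Γ)) :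
    f = ∑ χ ∈ (simp_finite (Γ := Γ)).toFinset, ip f χ • χ := by
  classical
  induction hf using AddSubmonoid.closure_induction with
  | mem x hx =>
    rw [Finset.sum_eq_single x]
    · rw [(ip_simp (irr_sub_simp hx) (irr_sub_simp hx)).1 rfl, one_smul]
    · intro b hb hb'
      rw [(ip_simp (irr_sub_simp hx) (by simpa using hb)).2 (Ne.symm hb'), zero_smul]
    · intro h
      exact absurd (by simpa using irr_sub_simp hx) h
  | zero => simp [ip]
  | add x y _ _ hx hy =>
    conv_lhs => rw [hx, hy]
    rw [← Finset.sum_add_distrib]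
    refine Finset.sum_congr rfl fun χ _ => ?_
    rw [← add_smul]
    congr 1
    simp [ip, add_mul, mul_add, Finset.sum_add_distrib]

theorem simp_eq_irr : SimpChar Γ = IrrChar Γ := by
  have : Fintype Γ := Fintype.ofFinite Γ
  refine Set.Subset.antisymm ?_ irr_sub_simp
  intro f hf
  by_contra hn
  have h0 : ∀ y ∈ AddSubmonoid.closure (IrrChar Γ), ip y f = 0 := by
    intro y hy
    induction hy using AddSubmonoid.closure_induction with
    | mem x hx => exact (ip_simp (irr_sub_simp hx) hf).2 (fun h => hn (h ▸ hx))
    | zero => simp [ip]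
    | add x y _ _ hx hy =>
      have : ip (x + y) f = ip x f + ip y f := by
        simp [ip, add_mul, mul_add, Finset.sum_add_distrib]
      rw [this, hx, hy, add_zero]
  have h1 := (ip_simp hf hf).1 rfl
  rw [h0] at h1
  · exact zero_ne_one h1
  · obtain ⟨V, hV, rfl⟩ := hf
    exact char_mem_closure _ V (fun g => V.ρ g) ⟨map_one _, fun x _ y _ => map_mul _ x y⟩ rfl

open Classical in
/-- column orthogonality at the identity -/
theorem regular_sum (x : Γ) : ∑ χ ∈ (simp_finite (Γ := Γ)).toFinset, χ 1 * χ x =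
    if x = 1 then (Nat.card Γ : ℂ) else 0 := by
  classical
  have : Fintype Γ := Fintype.ofFinite Γ
  let R : Γ → (Γ → ℂ) →ₗ[ℂ] (Γ → ℂ) := fun g => LinearMap.funLeft ℂ ℂ (fun y => g⁻¹ * y)
  have hR : IsRepOn (⊤ : Subgroup Γ) R := by
    constructor
    · refine LinearMap.ext fun f => ?_
      ext z; simp [R]
    · intro x _ y _
      ext f z
      simp [R, LinearMap.funLeft, mul_assoc]
  have htr : ∀ g, LinearMap.trace ℂ _ (R g) = if g = 1 then (Nat.card Γ : ℂ) else 0 := by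
    intro g
    rw [LinearMap.trace_eq_matrix_trace ℂ (Pi.basisFun ℂ Γ), Matrix.trace]
    simp only [Matrix.diag_apply, LinearMap.toMatrix_apply, Pi.basisFun_apply, Pi.basisFun_repr,
      R, LinearMap.funLeft_apply, Pi.single_apply]
    simp [Nat.card_eq_fintype_card]
  have h := closure_expand _ (char_mem_closure _ _ R hR rfl)
  have h2 := congrFun h x
  simp only [htr] at h2
  rw [h2, Finset.sum_apply]
  refine Finset.sum_congr rfl fun χ _ => ?_
  simp only [Pi.smul_apply, smul_eq_mul]
  congr 1
  have hne : (Nat.card Γ : ℂ) ≠ 0 := by exact_mod_cast Nat.card_pos.ne'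
  simp [ip]

end decomposition

section frobeniusSchur

variable {A : Type} [Group A] [Finite A] {G : Subgroup A} {c : A} {X : Type} [AddCommGroup X]
  [Module ℂ X] [FiniteDimensional ℂ X] {R : A → X →ₗ[ℂ] X}

/-- averaging an operator -/
theorem schur_avg [Nontrivial X] (hR : IsRepOn G R) (hI : IrrOn G R) (M : X →ₗ[ℂ] X) (v : X) :
    ∑ g ∈ els G, R g⁻¹ (M (R g v)) =
      ((Nat.card G : ℂ) * LinearMap.trace ℂ X M / Module.finrank ℂ X) • v := by
  have hn : (Module.finrank ℂ X : ℂ) ≠ 0 := by exact_mod_cast Module.finrank_pos.ne'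
  let T : X →ₗ[ℂ] X := ∑ g ∈ els G, R g⁻¹ * M * R g
  have hT : ∀ v, T v = ∑ g ∈ els G, R g⁻¹ (M (R g v)) := by
    intro v; simp [T, LinearMap.sum_apply]
  have hcomm : ∀ x ∈ G, ∀ v, T (R x v) = R x (T v) := by
    intro x hx v
    rw [hT, hT, map_sum]
    refine Finset.sum_bij (fun g _ => g * x) ?_ ?_ ?_ ?_
    · intro g hg; exact mem_els.2 (G.mul_mem (mem_els.1 hg) hx)
    · intro a _ b _ h; exact mul_right_cancel h
    · intro b hb; exact ⟨b * x⁻¹, mem_els.2 (G.mul_mem (mem_els.1 hb) (G.inv_mem hx)), by group⟩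
    · intro g hg
      have hg := mem_els.1 hg
      rw [← hR.mul_apply hx (G.inv_mem (G.mul_mem hg hx)), hR.mul_apply hg hx]
      congr 2; group
  obtain ⟨μ, hμ⟩ := Module.End.exists_eigenvalue T
  have hst : Stab G R (Module.End.eigenspace T μ) := by
    intro g hg x hx
    rw [Module.End.mem_eigenspace_iff] at hx ⊢
    rw [hcomm g hg, hx, map_smul]
  have htop : Module.End.eigenspace T μ = ⊤ := by
    rcases hI _ hst with h | h
    · exact absurd h hμ
    · exact h
  have hs : T = μ • 1 := by
    ext x
    have : x ∈ Module.End.eigenspace T μ := by rw [htop]; trivial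
    rw [Module.End.mem_eigenspace_iff] at this
    simpa using this
  have htr : LinearMap.trace ℂ X T = Nat.card G * LinearMap.trace ℂ X M := by
    simp only [T, map_sum]
    rw [Finset.sum_congr rfl (g := fun _ => LinearMap.trace ℂ X M)]
    · rw [Finset.sum_const, card_els, nsmul_eq_mul]
    · intro g hg
      have hg := mem_els.1 hg
      rw [LinearMap.trace_mul_comm, ← mul_assoc, ← hR.mul _ hg _ (G.inv_mem hg), mul_inv_cancel,
        hR.one, one_mul]
  rw [hs, map_smul, LinearMap.trace_one, smul_eq_mul] at htr
  rw [← hT, hs, ← htr]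
  simp [hn]

theorem exists_inv_form [Nontrivial X] (hR : IsRepOn G R) (hI : IrrOn G R) (hc : Nrm G c)
    (hreal : ∀ g ∈ G, ∃ y ∈ G, y * g * y⁻¹ = c * g⁻¹ * c⁻¹) :
    ∃ B : X →ₗ[ℂ] X →ₗ[ℂ] ℂ, B ≠ 0 ∧ Inv G c R B := by
  have : Fintype G := Fintype.ofFinite G
  have hne : (Nat.card G : ℂ) ≠ 0 := by exact_mod_cast Nat.card_pos.ne'
  let _ : Invertible (Nat.card G : ℂ) := invertibleOfNonzero hne
  have hcg : ∀ g ∈ G, c * g⁻¹ * c⁻¹ ∈ G := fun g hg => hc.mem _ (G.inv_mem hg)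
  let ρ : Representation ℂ G X := hR.toRep
  let σ : Representation ℂ G (Module.Dual ℂ X) :=
    { toFun := fun g => Module.Dual.transpose (R := ℂ) (R (c * (g : A)⁻¹ * c⁻¹))
      map_one' := by
        ext φ x
        simp [hR.one, Module.Dual.transpose_apply]
      map_mul' := by
        intro x y
        ext φ v
        have : c * (x * y : A)⁻¹ * c⁻¹ = (c * (y : A)⁻¹ * c⁻¹) * (c * (x : A)⁻¹ * c⁻¹) := by group
        simp only [Subgroup.coe_mul, this, Module.Dual.transpose_apply, LinearMap.comp_apply,
          Module.End.mul_apply]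
        rw [hR.mul_apply (hcg _ y.2) (hcg _ x.2)] }
  have hchar : ∀ g, σ.character g = ρ.character g := by
    intro g
    obtain ⟨y, hy, h⟩ := hreal g g.2
    have h1 : σ.character g = LinearMap.trace ℂ X (R (c * (g : A)⁻¹ * c⁻¹)) :=
      LinearMap.trace_transpose' _
    rw [h1, ← h]
    exact trace_conj_rep hR g.2 hy
  have h1 := Representation.card_inv_mul_sum_char_mul_char_eq_finrank ρ σ
  have h2 := norm_char hR hI
  rw [sum_els] at h2
  have h3 : ∑ g : G, σ.character g * ρ.character g⁻¹ = Nat.card G := by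
    simp only [hchar]; exact h2
  rw [h3, inv_mul_cancel₀ hne] at h1
  have h4 : Module.finrank ℂ (ρ.IntertwiningMap σ) ≠ 0 := by
    intro h; rw [h] at h1; simp at h1
  obtain ⟨φ, hφ⟩ : ∃ φ : ρ.IntertwiningMap σ, φ ≠ 0 := by
    by_contra hcon
    push Not at hcon
    have : Subsingleton (ρ.IntertwiningMap σ) := ⟨fun a b => by rw [hcon a, hcon b]⟩
    exact h4 (Module.finrank_zero_of_subsingleton)
  refine ⟨φ.toLinearMap, ?_, ?_⟩
  · intro h
    apply hφ
    exact Representation.IntertwiningMap.toLinearMap_injective _ _ (by simpa using h)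
  · intro g hg x y
    have e : φ (ρ ⟨g, hg⟩ x) = σ ⟨g, hg⟩ (φ x) := φ.isIntertwining _ _ _ _
    change φ (R g x) _ = φ x y
    have e' : φ (R g x) = σ ⟨g, hg⟩ (φ x) := e
    rw [e']
    change φ x (R (c * g⁻¹ * c⁻¹) (R (c * g * c⁻¹) y)) = _
    rw [← hR.mul_apply (hcg g hg) (hc.mem g hg)]
    have : c * g⁻¹ * c⁻¹ * (c * g * c⁻¹) = 1 := by group
    rw [this, hR.one]; rfl

theorem fs_one [Nontrivial X] (hR : IsRepOn G R) (hI : IrrOn G R) (hc : Nrm G c)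
    (hreal : ∀ g ∈ G, ∃ y ∈ G, y * g * y⁻¹ = c * g⁻¹ * c⁻¹) (hN : NoSkew G c) :
    ∑ g ∈ els G, LinearMap.trace ℂ X (R ((c * g * c⁻¹) * g)) = Nat.card G := by
  classical
  obtain ⟨B, hB0, hB⟩ := exists_inv_form hR hI hc hreal
  have hfl : ∀ g ∈ G, ∀ x y, B (R (c * g * c⁻¹) x) (R g y) = B x y := by
    intro g hg x y
    have := hB _ (hc.mem g hg) x y
    rwa [hc.twice] at this
  have hsym : ∀ x y, B x y = B y x := by
    have := hN X R hR hI (B - B.flip) (by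
      intro g hg x y
      simp only [LinearMap.sub_apply, LinearMap.flip_apply]
      rw [hB g hg, hfl g hg]) (by intro x y; simp)
    intro x y
    have h := congrArg (fun f => f x y) this
    simpa [sub_eq_zero] using h
  have hnd := nondeg_of_irr hR hI hc hB hB0
  have hnd' : (B : LinearMap.BilinForm ℂ X).Nondegenerate := by
    refine ⟨hnd, ?_⟩
    intro y hy
    apply hnd y
    intro x; rw [hsym]; exact hy x
  let b := Module.finBasis ℂ X
  let b' := LinearMap.BilinForm.dualBasis B hnd' b
  have hdual : ∀ i j, B (b' i) (b j) = if j = i then 1 else 0 := by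
    intro i j
    exact LinearMap.BilinForm.apply_dualBasis_left hnd' b i j
  have hrep : ∀ i w, B (b' i) w = b.repr w i := by
    intro i w
    have h7 := congrArg (fun z => B (b' i) z) (b.sum_repr w)
    simp only [map_sum, map_smul, hdual, smul_eq_mul, mul_ite, mul_one, mul_zero,
      Finset.sum_ite_eq', Finset.mem_univ, if_true] at h7
    exact h7.symm
  have hexp : ∀ w, ∑ i, B (b' i) w • b i = w := by
    intro w
    conv_rhs => rw [← b.sum_repr w]
    refine Finset.sum_congr rfl fun i _ => ?_
    congr 1
    exact hrep i w
  have htr : ∀ f : X →ₗ[ℂ] X, LinearMap.trace ℂ X f = ∑ i, B (b' i) (f (b i)) := by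
    intro f
    rw [LinearMap.trace_eq_matrix_trace ℂ b, Matrix.trace]
    refine Finset.sum_congr rfl fun i _ => ?_
    rw [Matrix.diag_apply, LinearMap.toMatrix_apply]
    exact (hrep i _).symm
  have hn : (Module.finrank ℂ X : ℂ) ≠ 0 := by exact_mod_cast (ne_of_gt Module.finrank_pos)
  have hrank : ∀ x y v : X, ∑ g ∈ els G, B y (R g v) • R g⁻¹ x =
      ((Nat.card G : ℂ) * B y x / Module.finrank ℂ X) • v := by
    intro x y v
    have := schur_avg hR hI ((B y).smulRight x) v
    simp only [LinearMap.smulRight_apply, map_smul] at this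
    rw [this]
    congr 3
    rw [htr]
    simp only [LinearMap.smulRight_apply, map_smul, smul_eq_mul]
    have h5 := congrArg (fun z => B z x) (hexp y)
    conv_rhs => rw [← hexp x]
    simp only [map_sum, map_smul, smul_eq_mul]
    refine Finset.sum_congr rfl fun i _ => by ring
  have h1 : ∀ g ∈ els G, LinearMap.trace ℂ X (R ((c * g * c⁻¹) * g)) =
      ∑ i, ∑ j, B (B (b' j) (R g (b i)) • R g⁻¹ (b' i)) (b j) := by
    intro g hg
    have hg := mem_els.1 hg
    rw [htr]
    refine Finset.sum_congr rfl fun i _ => ?_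
    rw [hR.mul_apply (hc.mem g hg) hg]
    have e := hB g hg (R g⁻¹ (b' i)) (R g (b i))
    rw [hR.apply_inv hg] at e
    rw [e]
    conv_lhs => rw [← hexp (R g (b i))]
    simp only [map_sum, map_smul, smul_eq_mul, LinearMap.smul_apply]
  rw [Finset.sum_congr rfl h1, Finset.sum_comm]
  have h2 : ∀ i, ∑ g ∈ els G, ∑ j, B (B (b' j) (R g (b i)) • R g⁻¹ (b' i)) (b j) =
      ∑ j, ((Nat.card G : ℂ) * B (b' j) (b' i) / Module.finrank ℂ X) * B (b i) (b j) := by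
    intro i
    rw [Finset.sum_comm]
    refine Finset.sum_congr rfl fun j _ => ?_
    have := congrArg (fun z => B z (b j)) (hrank (b' i) (b' j) (b i))
    simp only [map_sum, map_smul, LinearMap.sum_apply, LinearMap.smul_apply, smul_eq_mul] at this ⊢
    exact this
  rw [Finset.sum_congr rfl (fun i _ => h2 i), Finset.sum_comm]
  have h3 : ∀ j, ∑ i, ((Nat.card G : ℂ) * B (b' j) (b' i) / Module.finrank ℂ X) * B (b i) (b j) =
      (Nat.card G : ℂ) / Module.finrank ℂ X := by
    intro j
    have e := congrArg (fun z => B z (b j)) (hexp (b' j))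
    simp only [map_sum, map_smul, LinearMap.sum_apply, LinearMap.smul_apply, smul_eq_mul, hdual,
      if_true] at e
    calc _ = (Nat.card G : ℂ) / Module.finrank ℂ X * ∑ i, B (b' i) (b' j) * B (b i) (b j) := by
          rw [Finset.mul_sum]
          refine Finset.sum_congr rfl fun i _ => ?_
          rw [hsym (b' j)]; ring
      _ = _ := by rw [e, mul_one]
  rw [Finset.sum_congr rfl (fun j _ => h3 j)]
  simp only [Finset.sum_const, Finset.card_univ, Fintype.card_fin, nsmul_eq_mul]
  field_simp

theorem degree_sum {Γ : Type} [Group Γ] [Finite Γ] (e : Γ ≃* G) (hc : Nrm G c)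
    (hreal : ∀ g ∈ G, ∃ y ∈ G, y * g * y⁻¹ = c * g⁻¹ * c⁻¹) (hN : NoSkew G c) :
    ∑ᶠ f ∈ SimpChar Γ, f 1 = (Nat.card {g : A // g ∈ G ∧ (c * g * c⁻¹) * g = 1} : ℂ) := by
  classical
  have : Fintype Γ := Fintype.ofFinite Γ
  have hne : (Nat.card Γ : ℂ) ≠ 0 := by exact_mod_cast Nat.card_pos.ne'
  have h0 : ∑ᶠ f ∈ SimpChar Γ, f 1 = ∑ f ∈ (simp_finite (Γ := Γ)).toFinset, f 1 := by
    exact finsum_mem_eq_finite_toFinset_sum _ simp_finite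
  rw [h0]
  let τ : Γ → Γ := fun g => e.symm ⟨(c * (e g : A) * c⁻¹) * (e g : A), G.mul_mem (hc.mem _ (e g).2) (e g).2⟩
  have hτ : ∀ g, (e (τ g) : A) = (c * (e g : A) * c⁻¹) * (e g : A) := by
    intro g; simp [τ]
  have h1 : ∀ f ∈ (simp_finite (Γ := Γ)).toFinset, ∑ g, f (τ g) = Nat.card Γ := by
    intro f hf
    rw [Set.Finite.mem_toFinset, simp_eq_irr] at hf
    obtain ⟨X, _, _, _, _, R, hR, hI, rfl⟩ := hf
    let R' : A → X →ₗ[ℂ] X := fun a => if h : a ∈ G then R (e.symm ⟨a, h⟩) else 0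
    have hR'a : ∀ g : Γ, R' (e g) = R g := by
      intro g
      have : (e g : A) ∈ G := (e g).2
      simp [R', this]
    have hR' : IsRepOn G R' := by
      constructor
      · have := hR'a 1
        rw [map_one] at this
        rw [← hR.one, ← this]; rfl
      · intro x hx y hy
        obtain ⟨a, ha⟩ := e.surjective ⟨x, hx⟩
        obtain ⟨b, hb⟩ := e.surjective ⟨y, hy⟩
        have ha' : x = e a := by rw [ha]
        have hb' : y = e b := by rw [hb]
        have : x * y = e (a * b) := by rw [ha', hb', map_mul]; rfl
        rw [this, hR'a, ha', hb', hR'a, hR'a]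
        exact hR.mul a trivial b trivial
    have hI' : IrrOn G R' := by
      intro W hW
      apply hI W
      intro g _ x hx
      rw [← hR'a]
      exact hW _ (e g).2 x hx
    have := fs_one hR' hI' hc hreal hN
    have ff : Fintype G := Fintype.ofFinite G
    rw [sum_els, ← Nat.card_congr e.toEquiv] at this
    rw [← this]
    refine Fintype.sum_equiv e.toEquiv _ _ ?_
    intro g
    change _ = LinearMap.trace ℂ X (R' ((c * (e g : A) * c⁻¹) * (e g : A)))
    rw [← hτ, hR'a]
  have h2 : ∑ g : Γ, ∑ f ∈ (simp_finite (Γ := Γ)).toFinset, f 1 * f (τ g) =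
      (Nat.card Γ : ℂ) * ∑ f ∈ (simp_finite (Γ := Γ)).toFinset, f 1 := by
    rw [Finset.sum_comm, Finset.mul_sum]
    refine Finset.sum_congr rfl fun f hf => ?_
    rw [← Finset.mul_sum, h1 f hf, mul_comm]
  have h3 : ∀ g : Γ, ∑ f ∈ (simp_finite (Γ := Γ)).toFinset, f 1 * f (τ g) =
      if τ g = 1 then (Nat.card Γ : ℂ) else 0 := fun g => regular_sum _
  simp only [h3] at h2
  rw [← Finset.sum_filter, Finset.sum_const, nsmul_eq_mul, mul_comm] at h2
  have h4 := mul_left_cancel₀ hne h2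
  rw [← h4]
  congr 1
  rw [← Fintype.card_subtype, ← Nat.card_eq_fintype_card]
  refine Nat.card_congr ⟨fun g => ⟨e g.1, (e g.1).2, ?_⟩, fun a => ⟨e.symm ⟨a.1, a.2.1⟩, ?_⟩, ?_, ?_⟩
  · rw [← hτ, g.2, map_one]; rfl
  · apply e.injective
    apply Subtype.ext
    rw [hτ, map_one]
    simpa using a.2.2
  · intro g; simp
  · intro a; simp

end frobeniusSchur
end UCS

set_option linter.unusedSectionVars false
namespace UCS

/-- additive automorphisms, as a multiplicative group -/
def AA (V : Type) [AddCommGroup V] := V ≃+ V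

section AA
variable {V : Type} [AddCommGroup V]

instance : EquivLike (AA V) V V := inferInstanceAs (EquivLike (V ≃+ V) V V)

instance : AddEquivClass (AA V) V V := inferInstanceAs (AddEquivClass (V ≃+ V) V V)

instance : Group (AA V) where
  mul f g := (AddEquiv.trans g f : V ≃+ V)
  one := AddEquiv.refl V
  inv f := AddEquiv.symm f
  mul_assoc _ _ _ := rfl
  one_mul _ := rfl
  mul_one _ := rfl
  inv_mul_cancel f := AddEquiv.self_trans_symm f

theorem AA.ext {f g : AA V} (hfg : ∀ v, f v = g v) : f = g := AddEquiv.ext hfg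

instance [Finite V] : Finite (AA V) := DFunLike.finite _

theorem AA.mul_apply (f g : AA V) (v : V) : (f * g) v = f (g v) := rfl

theorem AA.one_apply (v : V) : (1 : AA V) v = v := rfl

theorem AA.inj (f : AA V) : Function.Injective f := EquivLike.injective f

theorem AA.inv_apply_self (f : AA V) (v : V) : f⁻¹ (f v) = v := by
  rw [← AA.mul_apply, inv_mul_cancel, AA.one_apply]

theorem AA.apply_inv_self (f : AA V) (v : V) : f (f⁻¹ v) = v := by
  rw [← AA.mul_apply, mul_inv_cancel, AA.one_apply]

end AA

/-- Hermitian space with a commuting family of unitary operators of order prime to the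
characteristic. -/
structure Sp {F : Type} [CommRing F] [StarRing F] {V : Type} [AddCommGroup V] [Module F V] {ι : Type}
    (h : V → V → F) (t : ι → Module.End F V) : Prop where
  add_left : ∀ v v' w, h (v + v') w = h v w + h v' w
  smul_left : ∀ (a : F) v w, h (a • v) w = a * h v w
  herm : ∀ v w, h w v = star (h v w)
  nd : ∀ v, (∀ w, h v w = 0) → v = 0
  tun : ∀ i v w, h (t i v) (t i w) = h v w
  tcomm : ∀ i j, t i * t j = t j * t i
  tper : ∀ i, ∃ n : ℕ, (n : F) ≠ 0 ∧ t i ^ n = 1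

/-- The unitary group commuting with the family. -/
def U {F : Type} [CommRing F] [StarRing F] {V : Type} [AddCommGroup V] [Module F V] {ι : Type}
    (h : V → V → F) (t : ι → Module.End F V) : Subgroup (AA V) where
  carrier := {g | (∀ (a : F) v, g (a • v) = a • g v) ∧ (∀ v w, h (g v) (g w) = h v w) ∧
    ∀ i v, g (t i v) = t i (g v)}
  one_mem' := ⟨fun _ _ => rfl, fun _ _ => rfl, fun _ _ => rfl⟩
  mul_mem' := by
    rintro x y ⟨h1, h2, h3⟩ ⟨k1, k2, k3⟩
    refine ⟨fun a v => ?_, fun v w => ?_, fun i v => ?_⟩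
    · simp only [AA.mul_apply, k1, h1]
    · simp only [AA.mul_apply, k2, h2]
    · simp only [AA.mul_apply, k3, h3]
  inv_mem' := by
    rintro x ⟨h1, h2, h3⟩
    refine ⟨fun a v => ?_, fun v w => ?_, fun i v => ?_⟩
    · apply x.inj; rw [h1, AA.apply_inv_self, AA.apply_inv_self]
    · rw [← h2, AA.apply_inv_self, AA.apply_inv_self]
    · apply x.inj; rw [h3, AA.apply_inv_self, AA.apply_inv_self]

/-- antiunitary involutions -/
structure Anti {F : Type} [CommRing F] [StarRing F] {V : Type} [AddCommGroup V] [Module F V] {ι : Type}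
    (h : V → V → F) (t : ι → Module.End F V) (c : AA V) : Prop where
  sq : ∀ v, c (c v) = v
  smul : ∀ (a : F) v, c (a • v) = star a • c v
  iso : ∀ v w, h (c v) (c w) = star (h v w)
  tinv : ∀ i v, t i (c (t i v)) = c v

/-- adjoint operators -/
def Adj {F : Type} [CommRing F] {V : Type} [AddCommGroup V] [Module F V]
    (h : V → V → F) (f fa : Module.End F V) : Prop := ∀ v w, h (f v) w = h v (fa w)

/-- the algebra generated by the family -/
def Alg {F : Type} [CommRing F] {V : Type} [AddCommGroup V] [Module F V] {ι : Type}
    (t : ι → Module.End F V) : Subalgebra F (Module.End F V) := Algebra.adjoin F (Set.range t)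

section basicSp

variable {F : Type} [CommRing F] [StarRing F] {V : Type} [AddCommGroup V] [Module F V]
  {ι : Type} {h : V → V → F} {t : ι → Module.End F V}

theorem mem_U {g : AA V} : g ∈ U h t ↔ (∀ (a : F) v, g (a • v) = a • g v) ∧
    (∀ v w, h (g v) (g w) = h v w) ∧ ∀ i v, g (t i v) = t i (g v) := Iff.rfl

variable (H : Sp h t)
include H

theorem Sp.add_right (v w w' : V) : h v (w + w') = h v w + h v w' := by
  rw [H.herm (w + w') v, H.add_left, star_add, ← H.herm, ← H.herm]

theorem Sp.smul_right (a : F) (v w : V) : h v (a • w) = star a * h v w := by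
  rw [H.herm (a • w) v, H.smul_left, star_mul', ← H.herm]

theorem Sp.zero_left (w : V) : h 0 w = 0 := by
  have := H.add_left 0 0 w
  simpa using this

theorem Sp.zero_right (w : V) : h w 0 = 0 := by
  rw [H.herm 0 w, H.zero_left, star_zero]

theorem Sp.neg_left (v w : V) : h (-v) w = - h v w := by
  have := H.add_left v (-v) w
  rw [add_neg_cancel, H.zero_left] at this
  exact (neg_eq_of_add_eq_zero_right this.symm).symm

theorem Sp.neg_right (v w : V) : h v (-w) = - h v w := by
  rw [H.herm (-w) v, H.neg_left, star_neg, ← H.herm]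

theorem Sp.sub_left (v v' w : V) : h (v - v') w = h v w - h v' w := by
  rw [sub_eq_add_neg, H.add_left, H.neg_left, sub_eq_add_neg]

theorem Sp.sub_right (w v v' : V) : h w (v - v') = h w v - h w v' := by
  rw [sub_eq_add_neg, H.add_right, H.neg_right, sub_eq_add_neg]

theorem Sp.nd_right (v : V) (hv : ∀ w, h w v = 0) : v = 0 := by
  apply H.nd
  intro w
  rw [H.herm w v, hv, star_zero]

theorem Adj.symm {f f' : Module.End F V} (hf : Adj h f f') : Adj h f' f := by
  intro v w
  rw [H.herm w (f' v), ← hf, ← H.herm]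

theorem Adj.unique {f f' f'' : Module.End F V} (hf : Adj h f f') (hf' : Adj h f f'') : f' = f'' := by
  ext w
  rw [← sub_eq_zero]
  apply H.nd_right
  intro v
  rw [H.sub_right, ← hf, ← hf', sub_self]

theorem Adj.add {f f' g g' : Module.End F V} (hf : Adj h f f') (hg : Adj h g g') :
    Adj h (f + g) (f' + g') := by
  intro v w
  simp only [LinearMap.add_apply, H.add_left, H.add_right, hf v w, hg v w]

theorem Adj.smul {f f' : Module.End F V} (hf : Adj h f f') (a : F) :
    Adj h (a • f) (star a • f') := by
  intro v w
  simp only [LinearMap.smul_apply, H.smul_left, H.smul_right, hf v w, star_star]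

theorem Adj.algebraMap (a : F) :
    Adj h (algebraMap F (Module.End F V) a) (algebraMap F (Module.End F V) (star a)) := by
  intro v w
  simp only [Module.algebraMap_end_apply, H.smul_left, H.smul_right, star_star]

omit H in
theorem Adj.mul {f f' g g' : Module.End F V} (hf : Adj h f f') (hg : Adj h g g') :
    Adj h (f * g) (g' * f') := by
  intro v w
  simp only [Module.End.mul_apply, hf _ w, hg v _]

omit H in
theorem Adj.one : Adj h (1 : Module.End F V) 1 := fun _ _ => rfl

omit H in
theorem Adj.pow {f f' : Module.End F V} (hf : Adj h f f') (n : ℕ) : Adj h (f ^ n) (f' ^ n) := by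
  induction n with
  | zero => exact Adj.one
  | succ n ih => rw [pow_succ, pow_succ']; exact ih.mul hf

omit H in
theorem mem_alg (i : ι) : t i ∈ Alg t := Algebra.subset_adjoin ⟨i, rfl⟩

theorem alg_comm {x y : Module.End F V} (hx : x ∈ Alg t) (hy : y ∈ Alg t) : x * y = y * x := by
  refine Algebra.commute_of_mem_adjoin_of_forall_mem_commute (s := Set.range t) hy ?_ |>.symm.eq |>.symm
  rintro b ⟨i, rfl⟩
  refine (Algebra.commute_of_mem_adjoin_of_forall_mem_commute (s := Set.range t) hx ?_).symm
  rintro b ⟨j, rfl⟩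
  exact H.tcomm _ _

theorem Sp.tpos (i : ι) : ∃ n : ℕ, (n + 1 : F) ≠ 0 ∧ t i ^ n * t i = 1 ∧ t i * t i ^ n = 1 := by
  obtain ⟨n, hn, h1⟩ := H.tper i
  cases n with
  | zero => simp at hn
  | succ n =>
    refine ⟨n, by simpa using hn, ?_, ?_⟩
    · rw [← pow_succ, h1]
    · rw [← pow_succ', h1]

theorem Sp.tinj (i : ι) : Function.Injective (t i) := by
  obtain ⟨n, -, h1, -⟩ := H.tpos i
  intro v w hvw
  have e : ∀ v, (t i ^ n) (t i v) = v := fun v => by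
    rw [← Module.End.mul_apply, h1]; rfl
  rw [← e v, ← e w, hvw]

theorem alg_adj {x : Module.End F V} (hx : x ∈ Alg t) : ∃ x' ∈ Alg t, Adj h x x' ∧
    ∀ c, Anti h t c → ∀ v, c (x v) = x' (c v) := by
  induction hx using Algebra.adjoin_induction with
  | mem x hx =>
    obtain ⟨i, rfl⟩ := hx
    obtain ⟨n, -, h1, h2⟩ := H.tpos i
    refine ⟨t i ^ n, Subalgebra.pow_mem _ (mem_alg i) n, ?_, ?_⟩
    · intro v w
      rw [← H.tun i v, ← Module.End.mul_apply, h2]; rfl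
    · intro c hc v
      apply H.tinj i
      rw [hc.tinv, ← Module.End.mul_apply, h2]; rfl
  | algebraMap r =>
    refine ⟨_, Subalgebra.algebraMap_mem _ (star r), Adj.algebraMap H r, ?_⟩
    intro c hc v
    simp only [Module.algebraMap_end_apply, hc.smul]
  | add x y _ _ hx hy =>
    obtain ⟨x', m1, a1, c1⟩ := hx
    obtain ⟨y', m2, a2, c2⟩ := hy
    refine ⟨x' + y', Subalgebra.add_mem _ m1 m2, Adj.add H a1 a2, ?_⟩
    intro c hc v
    simp only [LinearMap.add_apply, map_add, c1 c hc, c2 c hc]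
  | mul x y _ _ hx hy =>
    obtain ⟨x', m1, a1, c1⟩ := hx
    obtain ⟨y', m2, a2, c2⟩ := hy
    refine ⟨y' * x', Subalgebra.mul_mem _ m2 m1, Adj.mul a1 a2, ?_⟩
    intro c hc v
    rw [alg_comm H m2 m1]
    simp only [Module.End.mul_apply, c1 c hc, c2 c hc]

omit H in
/-- elements of `U` are linear and commute with the algebra -/
theorem U.comm {g : AA V} (hg : g ∈ U h t) {x : Module.End F V} (hx : x ∈ Alg t) (v : V) :
    g (x v) = x (g v) := by
  induction hx using Algebra.adjoin_induction generalizing v with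
  | mem x hx =>
    obtain ⟨i, rfl⟩ := hx
    exact hg.2.2 i v
  | algebraMap r => simp only [Module.algebraMap_end_apply, hg.1]
  | add x y _ _ hx hy => simp only [LinearMap.add_apply, map_add, hx, hy]
  | mul x y _ _ hx hy => simp only [Module.End.mul_apply, hx, hy]

omit H in
/-- an element of `U` as a linear map -/
def toE (g : AA V) (hg : ∀ (a : F) v, g (a • v) = a • g v) : Module.End F V where
  toFun := g
  map_add' := map_add g
  map_smul' := hg

theorem Anti.nrm {c : AA V} (hc : Anti h t c) : Nrm (U h t) c := by
  have hi : c⁻¹ = c := inv_eq_of_mul_eq_one_left (AA.ext hc.sq)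
  refine ⟨AA.ext hc.sq, ?_⟩
  intro g hg
  rw [hi]
  refine ⟨fun a v => ?_, fun v w => ?_, fun i v => ?_⟩
  · simp only [AA.mul_apply, hc.smul, hg.1, star_star]
  · simp only [AA.mul_apply, hc.iso, hg.2.1, star_star]
  · simp only [AA.mul_apply]
    obtain ⟨x', m, -, hx⟩ := alg_adj H (mem_alg (t := t) i)
    rw [hx c hc, U.comm hg m]
    have e : ∀ w, c (x' w) = t i (c w) := by
      intro w
      have := hx c hc (c w)
      rw [hc.sq] at this
      rw [← this, hc.sq]
    rw [e]

theorem Anti.mul_mem {c c' : AA V} (hc : Anti h t c) (hc' : Anti h t c') : c' * c⁻¹ ∈ U h t := by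
  have hi : c⁻¹ = c := inv_eq_of_mul_eq_one_left (AA.ext hc.sq)
  rw [hi]
  refine ⟨fun a v => ?_, fun v w => ?_, fun i v => ?_⟩
  · simp only [AA.mul_apply, hc.smul, hc'.smul, star_star]
  · simp only [AA.mul_apply, hc.iso, hc'.iso, star_star]
  · simp only [AA.mul_apply]
    obtain ⟨x', m, -, hx⟩ := alg_adj H (mem_alg (t := t) i)
    rw [hx c hc]
    have := hx c' hc' (c' (c v))
    rw [hc'.sq] at this
    rw [← hc'.sq (t i _), this]

end basicSp

section per
variable {F : Type} [Field F] [StarRing F] [Finite F] {V : Type} [AddCommGroup V] [Module F V]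
  {ι : Type} {h : V → V → F} {t : ι → Module.End F V}

theorem exists_pow_card {F : Type} [Field F] [Finite F] (p : ℕ) [CharP F p] [Fact p.Prime]  :
    ∃ r : ℕ, 0 < r ∧ ∀ x : F, x ^ p ^ r = x := by
  have : Fintype F := Fintype.ofFinite F
  obtain ⟨n, -, hn⟩ := FiniteField.card F p
  exact ⟨n, n.2, fun x => by rw [← hn, FiniteField.pow_card]⟩

theorem pow_pow_iter {M : Type} [Monoid M] {x : M} {p k : ℕ} (hx : x ^ p ^ k = x) (j : ℕ) :
    x ^ p ^ (k * j) = x := by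
  induction j with
  | zero => simp
  | succ j ih => rw [Nat.mul_succ, pow_add, pow_mul, ih, hx]

theorem alg_per (H : Sp h t) (p : ℕ) [CharP F p] [Fact p.Prime] {x : Module.End F V} (hx : x ∈ Alg t) :
    ∃ k : ℕ, 0 < k ∧ x ^ p ^ k = x := by
  induction hx using Algebra.adjoin_induction with
  | mem x hx =>
    obtain ⟨i, rfl⟩ := hx
    obtain ⟨n, hn, h1⟩ := H.tper i
    have hcop : Nat.Coprime p n := by
      rw [Nat.Prime.coprime_iff_not_dvd Fact.out]
      intro hd
      exact hn ((CharP.cast_eq_zero_iff F p n).2 hd)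
    have hn0 : 0 < n := by
      rcases Nat.eq_zero_or_pos n with rfl | h; · simp at hn
      · exact h
    refine ⟨n.totient, Nat.totient_pos.2 hn0, ?_⟩
    have h2 := Nat.ModEq.pow_totient hcop
    have hp1 : 1 ≤ p ^ n.totient := Nat.one_le_pow _ _ (Fact.out : p.Prime).pos
    obtain ⟨j, hj⟩ := (Nat.modEq_iff_dvd' hp1).1 h2.symm
    rw [show p ^ n.totient = n * j + 1 by omega, pow_succ, pow_mul, h1, one_pow, one_mul]
  | algebraMap r =>
    obtain ⟨k, hk, h1⟩ := exists_pow_card (F := F) p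
    exact ⟨k, hk, by rw [← map_pow, h1]⟩
  | add x y hx' hy' hx hy =>
    obtain ⟨k, hk, h1⟩ := hx
    obtain ⟨l, hl, h2⟩ := hy
    refine ⟨k * l, Nat.mul_pos hk hl, ?_⟩
    have hc : Commute x y := alg_comm H hx' hy'
    rcases subsingleton_or_nontrivial V with hV | hV
    · ext v; exact Subsingleton.elim _ _
    have : CharP (Module.End F V) p := charP_of_injective_algebraMap
      (FaithfulSMul.algebraMap_injective F (Module.End F V)) p
    rw [add_pow_char_pow_of_commute p _ hc, pow_pow_iter h1, mul_comm k l,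
      pow_pow_iter h2]
  | mul x y hx' hy' hx hy =>
    obtain ⟨k, hk, h1⟩ := hx
    obtain ⟨l, hl, h2⟩ := hy
    refine ⟨k * l, Nat.mul_pos hk hl, ?_⟩
    have hc : Commute x y := alg_comm H hx' hy'
    rw [hc.mul_pow, pow_pow_iter h1, mul_comm k l, pow_pow_iter h2]

theorem exists_tr_one {F : Type} [Field F] [StarRing F] (ha : ∃ a : F, star a ≠ a) : ∃ b : F, b + star b = 1 := by
  have key : ∀ x : F, x + star x ≠ 0 → ∃ b : F, b + star b = 1 := by
    intro x hx
    refine ⟨x / (x + star x), ?_⟩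
    rw [star_div₀, star_add, star_star, add_comm (star x) x, ← add_div, div_self hx]
  by_cases h2 : (1 : F) + 1 = 0
  · obtain ⟨a, ha⟩ := ha
    apply key a
    intro h0
    apply ha
    have : a + a = 0 := by rw [← mul_one a, ← mul_add, h2, mul_zero]
    have h3 : a + star a = a + a := by rw [h0, this]
    exact add_left_cancel h3
  · apply key 1
    rwa [star_one]

/-- there is no self-adjoint idempotent in the algebra -/
def NoIdem (h : V → V → F) (t : ι → Module.End F V) : Prop :=
  ∀ e ∈ Alg t, Adj h e e → e * e = e → e = 0 ∨ e = 1

/-- self-adjoint elements are zero or invertible -/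
theorem NoIdem.qe (H : Sp h t) (hN : NoIdem h t) {x : Module.End F V} (hx : x ∈ Alg t)
    (ha : Adj h x x) : x = 0 ∨ ∃ y ∈ Alg t, Adj h y y ∧ x * y = 1 ∧ y * x = 1 := by
  obtain ⟨p, hp⟩ := CharP.exists F
  have : Fact p.Prime := ⟨CharP.char_is_prime F p⟩
  obtain ⟨k, hk, h1⟩ := alg_per H p hx
  have hge : 2 ≤ p ^ k := le_trans (Fact.out : p.Prime).two_le (Nat.le_self_pow hk.ne' p)
  obtain ⟨n, hn⟩ := Nat.exists_eq_add_of_le hge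
  have e1 : x ^ (n + 1) * x = x := by rw [← pow_succ]; rw [show n + 1 + 1 = p ^ k by omega, h1]
  have hid : x ^ (n + 1) * x ^ (n + 1) = x ^ (n + 1) := by
    conv_lhs => rw [pow_succ' x n, mul_assoc, ← mul_assoc (x ^ n), ← pow_succ, ← mul_assoc, ← pow_succ', pow_succ, e1]
    conv_rhs => rw [pow_succ']
  rcases hN _ (Subalgebra.pow_mem _ hx _) (ha.pow _) hid with h0 | h0
  · left; rw [h0, zero_mul] at e1; exact e1.symm
  · right
    exact ⟨x ^ n, Subalgebra.pow_mem _ hx _, ha.pow _, by rw [← pow_succ', h0], by rw [← pow_succ, h0]⟩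

end per

end UCS

set_option linter.unusedSectionVars false
namespace UCS

section glue

variable {F : Type} [CommRing F] {V : Type} [AddCommGroup V] [Module F V] {W W' : Submodule F V}

/-- gluing automorphisms of complementary submodules -/
noncomputable def glue (hc : IsCompl W W') (f : AA W) (g : AA W') : AA V :=
  ((W.prodEquivOfIsCompl W' hc).symm.toAddEquiv.trans
    (AddEquiv.prodCongr f g)).trans (W.prodEquivOfIsCompl W' hc).toAddEquiv

theorem glue_apply (hc : IsCompl W W') (f : AA W) (g : AA W') (w : W) (w' : W') :
    glue hc f g (w + w') = f w + g w' := by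
  have e : (W.prodEquivOfIsCompl W' hc).symm ((w : V) + w') = (w, w') := by
    rw [LinearEquiv.symm_apply_eq]; simp
  show (W.prodEquivOfIsCompl W' hc) ((AddEquiv.prodCongr f g)
    ((W.prodEquivOfIsCompl W' hc).symm ((w : V) + w'))) = _
  rw [e]
  show (W.prodEquivOfIsCompl W' hc) (f w, g w') = _
  simp

theorem glue_left (hc : IsCompl W W') (f : AA W) (g : AA W') (w : W) :
    glue hc f g w = f w := by
  have := glue_apply hc f g w 0
  simpa using this

theorem glue_right (hc : IsCompl W W') (f : AA W) (g : AA W') (w : W') :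
    glue hc f g w = g w := by
  have := glue_apply hc f g 0 w
  simpa using this

theorem decomp (hc : IsCompl W W') (v : V) : ∃ (w : W) (w' : W'), v = w + w' := by
  have : v ∈ W ⊔ W' := by rw [hc.sup_eq_top]; trivial
  obtain ⟨w, hw, w', hw', e⟩ := Submodule.mem_sup.1 this
  exact ⟨⟨w, hw⟩, ⟨w', hw'⟩, e.symm⟩

theorem glue_ext (hc : IsCompl W W') {f g : AA V} (h1 : ∀ w : W, f w = g w)
    (h2 : ∀ w : W', f w = g w) : f = g := by
  apply AA.ext
  intro v
  obtain ⟨w, w', rfl⟩ := decomp hc v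
  rw [map_add, map_add, h1, h2]

theorem glue_mul (hc : IsCompl W W') (f f' : AA W) (g g' : AA W') :
    glue hc (f * f') (g * g') = glue hc f g * glue hc f' g' := by
  apply glue_ext hc
  · intro w; simp only [AA.mul_apply, glue_left]
  · intro w; simp only [AA.mul_apply, glue_right]

theorem glue_one (hc : IsCompl W W') : glue hc 1 1 = 1 := by
  apply glue_ext hc
  · intro w; simp only [AA.one_apply, glue_left]
  · intro w; simp only [AA.one_apply, glue_right]

theorem glue_inv (hc : IsCompl W W') (f : AA W) (g : AA W') :
    (glue hc f g)⁻¹ = glue hc f⁻¹ g⁻¹ := by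
  apply inv_eq_of_mul_eq_one_left
  rw [← glue_mul, inv_mul_cancel, inv_mul_cancel, glue_one]

theorem exists_res [Finite V] (g : AA V) (hg : ∀ w ∈ W, g w ∈ W) :
    ∃ f : AA W, ∀ w : W, (f w : V) = g w := by
  let φ : W →+ W := { toFun := fun w => ⟨g w, hg w w.2⟩
                      map_zero' := by ext; simp
                      map_add' := fun a b => by ext; simp }
  have hφ : Function.Bijective φ := by
    apply Finite.injective_iff_bijective.1
    intro a b hab
    exact Subtype.ext (g.inj (congrArg Subtype.val hab))
  exact ⟨AddEquiv.ofBijective φ hφ, fun w => rfl⟩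

theorem exists_glue [Finite V] (hc : IsCompl W W') (g : AA V) (hg : ∀ w ∈ W, g w ∈ W)
    (hg' : ∀ w ∈ W', g w ∈ W') : ∃ f f', g = glue hc f f' := by
  obtain ⟨f, hf⟩ := exists_res g hg
  obtain ⟨f', hf'⟩ := exists_res g hg'
  refine ⟨f, f', glue_ext hc ?_ ?_⟩
  · intro w; rw [glue_left, hf]
  · intro w; rw [glue_right, hf']

variable [StarRing F] {ι : Type}

/-- restricted form -/
def rs (W : Submodule F V) (h : V → V → F) : W → W → F := fun a b => h a b

/-- restricted operators -/
def rt {t : ι → Module.End F V} (hW : ∀ i, ∀ w ∈ W, t i w ∈ W) : ι → Module.End F W :=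
  fun i => (t i).restrict (hW i)

/-- orthogonal decompositions -/
structure Spl (h : V → V → F) (t : ι → Module.End F V) (W W' : Submodule F V) : Prop where
  compl : IsCompl W W'
  orth : ∀ w ∈ W, ∀ w' ∈ W', h w w' = 0
  st : ∀ i, ∀ w ∈ W, t i w ∈ W
  st' : ∀ i, ∀ w ∈ W', t i w ∈ W'

variable {h : V → V → F} {t : ι → Module.End F V}

theorem Spl.symm (H : Sp h t) (S : Spl h t W W') : Spl h t W' W :=
  ⟨S.compl.symm, fun w hw w' hw' => by rw [H.herm w' w, S.orth _ hw' _ hw, star_zero], S.st', S.st⟩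

theorem Spl.hadd (H : Sp h t) (S : Spl h t W W') (a b : W) (a' b' : W') :
    h (a + a') (b + b') = rs W h a b + rs W' h a' b' := by
  rw [H.add_left, H.add_right, H.add_right, S.orth a a.2 b' b'.2,
    (S.symm H).orth a' a'.2 b b.2]
  simp [rs]

theorem rt_pow (hW : ∀ i, ∀ w ∈ W, t i w ∈ W) (i : ι) (n : ℕ) (w : W) :
    (((rt hW i) ^ n) w : V) = (t i ^ n) w := by
  induction n with
  | zero => rfl
  | succ n ih => rw [pow_succ', pow_succ', Module.End.mul_apply, Module.End.mul_apply, ← ih]; rfl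

theorem Spl.sp (H : Sp h t) (S : Spl h t W W') : Sp (rs W h) (rt S.st) where
  add_left _ _ _ := H.add_left _ _ _
  smul_left _ _ _ := H.smul_left _ _ _
  herm _ _ := H.herm _ _
  nd v hv := by
    apply Subtype.ext
    apply H.nd
    intro w
    obtain ⟨a, b, rfl⟩ := decomp S.compl w
    rw [H.add_right, S.orth v v.2 b b.2, add_zero]
    exact hv a
  tun i v w := H.tun i _ _
  tcomm i j := by
    ext w
    exact LinearMap.congr_fun (H.tcomm i j) (w : V)
  tper i := by
    obtain ⟨n, hn, h1⟩ := H.tper i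
    refine ⟨n, hn, ?_⟩
    ext w
    rw [rt_pow, h1]; rfl

theorem Spl.glue_mem (H : Sp h t) (S : Spl h t W W') {f : AA W} {g : AA W'} :
    glue S.compl f g ∈ U h t ↔ f ∈ U (rs W h) (rt S.st) ∧ g ∈ U (rs W' h) (rt S.st') := by
  constructor
  · intro hg
    refine ⟨⟨fun a v => ?_, fun v w => ?_, fun i v => ?_⟩, fun a v => ?_, fun v w => ?_, fun i v => ?_⟩
    · have := hg.1 a v
      rw [glue_left, ← Submodule.coe_smul, glue_left] at this
      exact Subtype.ext this
    · have := hg.2.1 v w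
      rw [glue_left, glue_left] at this
      exact this
    · have := hg.2.2 i v
      rw [glue_left] at this
      apply Subtype.ext
      rw [← glue_left S.compl f g]
      exact this
    · have := hg.1 a v
      rw [glue_right, ← Submodule.coe_smul, glue_right] at this
      exact Subtype.ext this
    · have := hg.2.1 v w
      rw [glue_right, glue_right] at this
      exact this
    · have := hg.2.2 i v
      rw [glue_right] at this
      apply Subtype.ext
      rw [← glue_right S.compl f g]
      exact this
  · rintro ⟨h1, h2⟩
    refine ⟨fun a v => ?_, fun v w => ?_, fun i v => ?_⟩
    · obtain ⟨x, y, rfl⟩ := decomp S.compl v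
      rw [smul_add, ← Submodule.coe_smul, ← Submodule.coe_smul, glue_apply, glue_apply, h1.1, h2.1,
        smul_add]; rfl
    · obtain ⟨x, y, rfl⟩ := decomp S.compl v
      obtain ⟨x', y', rfl⟩ := decomp S.compl w
      rw [glue_apply, glue_apply, S.hadd H, S.hadd H, h1.2.1, h2.2.1]
    · obtain ⟨x, y, rfl⟩ := decomp S.compl v
      have e : t i ((x : V) + y) = (rt S.st i x : V) + rt S.st' i y := map_add _ _ _
      have e' : t i ((f x : V) + g y) = (rt S.st i (f x) : V) + rt S.st' i (g y) := map_add _ _ _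
      rw [e, glue_apply, glue_apply, e', h1.2.2, h2.2.2]

theorem Spl.glue_anti (H : Sp h t) (S : Spl h t W W') {f : AA W} {g : AA W'}
    (h1 : Anti (rs W h) (rt S.st) f) (h2 : Anti (rs W' h) (rt S.st') g) :
    Anti h t (glue S.compl f g) := by
  refine ⟨fun v => ?_, fun a v => ?_, fun v w => ?_, fun i v => ?_⟩
  · obtain ⟨x, y, rfl⟩ := decomp S.compl v
    rw [glue_apply, glue_apply, h1.sq, h2.sq]
  · obtain ⟨x, y, rfl⟩ := decomp S.compl v
    rw [smul_add, ← Submodule.coe_smul, ← Submodule.coe_smul, glue_apply, glue_apply, h1.smul,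
      h2.smul, smul_add]; rfl
  · obtain ⟨x, y, rfl⟩ := decomp S.compl v
    obtain ⟨x', y', rfl⟩ := decomp S.compl w
    rw [glue_apply, glue_apply, S.hadd H, S.hadd H, h1.iso, h2.iso, star_add]
  · obtain ⟨x, y, rfl⟩ := decomp S.compl v
    have e : t i ((x : V) + y) = (rt S.st i x : V) + rt S.st' i y := map_add _ _ _
    rw [e, glue_apply, glue_apply, map_add, ← h1.tinv i x, ← h2.tinv i y]; rfl

theorem Spl.anti_res (S : Spl h t W W') {f : AA W} {g : AA W'}
    (hA : Anti h t (glue S.compl f g)) : Anti (rs W h) (rt S.st) f := by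
  refine ⟨fun v => ?_, fun a v => ?_, fun v w => ?_, fun i v => ?_⟩
  · have := hA.sq v
    rw [glue_left, glue_left] at this
    exact Subtype.ext this
  · have := hA.smul a v
    rw [glue_left, ← Submodule.coe_smul, glue_left] at this
    exact Subtype.ext this
  · have := hA.iso v w
    rw [glue_left, glue_left] at this
    exact this
  · have := hA.tinv i v
    have e : t i (v : V) = (rt S.st i v : V) := rfl
    rw [glue_left, e, glue_left] at this
    exact Subtype.ext this

theorem Spl.anti_res' (S : Spl h t W W') {f : AA W} {g : AA W'}
    (hA : Anti h t (glue S.compl f g)) : Anti (rs W' h) (rt S.st') g := by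
  refine ⟨fun v => ?_, fun a v => ?_, fun v w => ?_, fun i v => ?_⟩
  · have := hA.sq v
    rw [glue_right, glue_right] at this
    exact Subtype.ext this
  · have := hA.smul a v
    rw [glue_right, ← Submodule.coe_smul, glue_right] at this
    exact Subtype.ext this
  · have := hA.iso v w
    rw [glue_right, glue_right] at this
    exact this
  · have := hA.tinv i v
    have e : t i (v : V) = (rt S.st' i v : V) := rfl
    rw [glue_right, e, glue_right] at this
    exact Subtype.ext this

/-- glued subgroup -/
noncomputable def GS (hc : IsCompl W W') (A : Subgroup (AA W)) (B : Subgroup (AA W')) :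
    Subgroup (AA V) where
  carrier := {g | ∃ a ∈ A, ∃ b ∈ B, g = glue hc a b}
  one_mem' := ⟨1, one_mem _, 1, one_mem _, (glue_one hc).symm⟩
  mul_mem' := by
    rintro _ _ ⟨a, ha, b, hb, rfl⟩ ⟨a', ha', b', hb', rfl⟩
    exact ⟨a * a', mul_mem ha ha', b * b', mul_mem hb hb', (glue_mul ..).symm⟩
  inv_mem' := by
    rintro _ ⟨a, ha, b, hb, rfl⟩
    exact ⟨a⁻¹, inv_mem ha, b⁻¹, inv_mem hb, glue_inv ..⟩

theorem noSkew_GS (hc : IsCompl W W') {A : Subgroup (AA W)} {B : Subgroup (AA W')} {a : AA W}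
    {b : AA W'} (hA : NoSkew A a) (hB : NoSkew B b) (na : Nrm A a) (nb : Nrm B b) :
    NoSkew (GS hc A B) (glue hc a b) := by
  have cj : ∀ x y, glue hc a b * glue hc x y * (glue hc a b)⁻¹ =
      glue hc (a * x * a⁻¹) (b * y * b⁻¹) := by
    intro x y; rw [glue_inv, ← glue_mul, ← glue_mul]
  have sq : glue hc a b * glue hc a b = 1 := by rw [← glue_mul, na.sq, nb.sq, glue_one]
  have hb1 : b * 1 * b⁻¹ = 1 := by simp
  have ha1 : a * 1 * a⁻¹ = 1 := by simp
  refine noSkew_prod (G1 := GS hc A ⊥) (G2 := GS hc ⊥ B) ?_ ?_ ⟨sq, ?_⟩ ⟨sq, ?_⟩ ?_ ?_ ?_ ?_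
  · refine hA.transfer (fun x => glue hc x 1) (glue_one hc) ?_ ?_ ?_ ?_
    · intro x _ y _; show _ = glue hc x 1 * glue hc y 1; rw [← glue_mul, mul_one]
    · rintro _ ⟨x, hx, y, hy, rfl⟩; rw [Subgroup.mem_bot] at hy; exact ⟨x, hx, by rw [hy]⟩
    · intro x hx; exact ⟨x, hx, 1, one_mem _, rfl⟩
    · intro x hx; show _ = glue hc a b * glue hc x 1 * (glue hc a b)⁻¹; rw [cj, hb1]
  · refine hB.transfer (fun x => glue hc 1 x) (glue_one hc) ?_ ?_ ?_ ?_
    · intro x _ y _; show _ = glue hc 1 x * glue hc 1 y; rw [← glue_mul, mul_one]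
    · rintro _ ⟨x, hx, y, hy, rfl⟩; rw [Subgroup.mem_bot] at hx; exact ⟨y, hy, by rw [hx]⟩
    · intro x hx; exact ⟨1, one_mem _, x, hx, rfl⟩
    · intro x hx; show _ = glue hc a b * glue hc 1 x * (glue hc a b)⁻¹; rw [cj, ha1]
  · rintro _ ⟨x, hx, y, hy, rfl⟩
    rw [Subgroup.mem_bot] at hy
    rw [cj, hy, hb1]; exact ⟨_, na.mem x hx, 1, one_mem _, rfl⟩
  · rintro _ ⟨x, hx, y, hy, rfl⟩
    rw [Subgroup.mem_bot] at hx
    rw [cj, hx, ha1]; exact ⟨1, one_mem _, _, nb.mem y hy, rfl⟩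
  · rintro _ ⟨x, hx, y, hy, rfl⟩
    rw [Subgroup.mem_bot] at hy
    exact ⟨x, hx, 1, one_mem _, by rw [hy]⟩
  · rintro _ ⟨x, hx, y, hy, rfl⟩
    rw [Subgroup.mem_bot] at hx
    exact ⟨1, one_mem _, y, hy, by rw [hx]⟩
  · rintro _ ⟨x, hx, y, hy, rfl⟩ _ ⟨x', hx', y', hy', rfl⟩
    rw [Subgroup.mem_bot] at hy hx'
    rw [← glue_mul, ← glue_mul, hy, hx', mul_one, mul_one, one_mul, one_mul]
  · rintro _ ⟨x, hx, y, hy, rfl⟩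
    exact ⟨_, ⟨x, hx, 1, one_mem _, rfl⟩, _, ⟨1, one_mem _, y, hy, rfl⟩, by
      rw [← glue_mul, mul_one, one_mul]⟩

theorem Nrm_GS (hc : IsCompl W W') {A : Subgroup (AA W)} {B : Subgroup (AA W')} {a : AA W}
    {b : AA W'} (na : Nrm A a) (nb : Nrm B b) : Nrm (GS hc A B) (glue hc a b) := by
  refine ⟨by rw [← glue_mul, na.sq, nb.sq, glue_one], ?_⟩
  rintro _ ⟨x, hx, y, hy, rfl⟩
  rw [glue_inv, ← glue_mul, ← glue_mul]
  exact ⟨_, na.mem x hx, _, nb.mem y hy, rfl⟩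

theorem Spl.GS_le (H : Sp h t) (S : Spl h t W W') :
    GS S.compl (U (rs W h) (rt S.st)) (U (rs W' h) (rt S.st')) ≤ U h t := by
  rintro _ ⟨x, hx, y, hy, rfl⟩
  exact (S.glue_mem H).2 ⟨hx, hy⟩

theorem NoSkew.twist {A : Type} [Group A] {G : Subgroup A} {c c' : A} (hN : NoSkew G c)
    (hc : Nrm G c) (hc' : Nrm G c') (hz : c' * c⁻¹ ∈ G) : NoSkew G c' := by
  intro X _ _ _ R hR hI B hB hs
  set z := c' * c⁻¹ with hzd
  have ec' : c' = z * c := by rw [hzd]; group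
  have e1 : c' * z * c'⁻¹ = z⁻¹ := by
    rw [hzd, hc.inv_eq, hc'.inv_eq, mul_inv_rev, hc.inv_eq, hc'.inv_eq, ← mul_assoc, hc'.sq, one_mul]
  have hsw : ∀ x y, B (R z x) y = B x (R z y) := by
    intro x y
    have := hB z hz x (R z y)
    rw [e1, hR.inv_apply hz] at this
    exact this
  have h0 := hN X R hR hI (B.compl₂ (R z)) ?_ ?_
  · ext x y
    have := LinearMap.congr_fun₂ h0 x (R z⁻¹ y)
    rw [LinearMap.compl₂_apply, hR.apply_inv hz] at this
    simpa using this
  · intro g hg x y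
    rw [LinearMap.compl₂_apply, LinearMap.compl₂_apply, ← hB g hg x,
      ← hR.mul_apply hz (hc.mem g hg), ← hR.mul_apply (hc'.mem g hg) hz]
    congr 3
    rw [ec']; group
  · intro x y
    rw [LinearMap.compl₂_apply, LinearMap.compl₂_apply, ← hsw x y, hs]

end glue
end UCS

set_option linter.unusedSectionVars false
namespace UCS

/-- additive involutions as automorphisms -/
def AA.ofInvol {V : Type} [AddCommGroup V] (f : V → V) (hadd : ∀ v w, f (v + w) = f v + f w)
    (hinv : ∀ v, f (f v) = v) : AA V :=
  (⟨⟨f, f, hinv, hinv⟩, hadd⟩ : V ≃+ V)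

theorem AA.ofInvol_apply {V : Type} [AddCommGroup V] (f : V → V) (hadd : ∀ v w, f (v + w) = f v + f w)
    (hinv : ∀ v, f (f v) = v) (v : V) : AA.ofInvol f hadd hinv v = f v := rfl

theorem card_lt_of_ne_top {R V : Type} [Ring R] [AddCommGroup V] [Module R V] [Finite V]
    {W : Submodule R V} (hW : W ≠ ⊤) : Nat.card W < Nat.card V := by
  have h1 : (W : Set V) ⊂ Set.univ := by
    refine ⟨Set.subset_univ _, fun h => hW ?_⟩
    exact Submodule.eq_top_iff'.2 fun x => h trivial
  have := Set.ncard_lt_ncard h1 (Set.toFinite _)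
  rwa [Set.ncard_univ] at this

section split

variable {F : Type} [CommRing F] [StarRing F] {V : Type} [AddCommGroup V] [Module F V]
  {ι : Type} {h : V → V → F} {t : ι → Module.End F V}

theorem Spl.of_idem (H : Sp h t) {e : Module.End F V} (he : e ∈ Alg t) (ha : Adj h e e)
    (hi : e * e = e) : Spl h t (LinearMap.range e) (LinearMap.ker e) where
  compl := by
    have := LinearMap.isCompl_of_proj (p := LinearMap.range e) (f := e.rangeRestrict) (by
      rintro ⟨_, v, rfl⟩
      apply Subtype.ext
      exact LinearMap.congr_fun hi v)
    rwa [LinearMap.ker_rangeRestrict] at this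
  orth := by
    rintro _ ⟨v, rfl⟩ w hw
    rw [ha, LinearMap.mem_ker.1 hw, H.zero_right]
  st := by
    rintro i _ ⟨v, rfl⟩
    exact ⟨t i v, LinearMap.congr_fun (alg_comm H he (mem_alg i)) v⟩
  st' := by
    intro i v hv
    rw [LinearMap.mem_ker] at hv ⊢
    have := LinearMap.congr_fun (alg_comm H he (mem_alg i)) v
    simp only [Module.End.mul_apply] at this
    rw [this, hv, map_zero]

/-- orthogonal complement -/
def Sp.perp (H : Sp h t) (W : Submodule F V) : Submodule F V where
  carrier := {v | ∀ w ∈ W, h w v = 0}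
  zero_mem' := fun w _ => H.zero_right w
  add_mem' := fun {a b} ha hb w hw => by rw [H.add_right, ha w hw, hb w hw, add_zero]
  smul_mem' := fun a v hv w hw => by rw [H.smul_right, hv w hw, mul_zero]

theorem Sp.mem_perp (H : Sp h t) {W : Submodule F V} {v : V} :
    v ∈ H.perp W ↔ ∀ w ∈ W, h w v = 0 := Iff.rfl

theorem Sp.perp_st (H : Sp h t) {W : Submodule F V} {i : ι} (hW : ∀ w ∈ W, t i w ∈ W) :
    ∀ v ∈ H.perp W, t i v ∈ H.perp W := by
  intro v hv w hw
  obtain ⟨n, -, h1, h2⟩ := H.tpos i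
  have e : w = t i ((t i ^ n) w) := by rw [← Module.End.mul_apply, h2]; rfl
  have hp : ∀ n : ℕ, (t i ^ n) w ∈ W := by
    intro n
    induction n with
    | zero => exact hw
    | succ n ih => rw [pow_succ', Module.End.mul_apply]; exact hW _ ih
  rw [e, H.tun]
  exact hv _ (hp n)

theorem Spl.of_nondeg {F : Type} [Field F] [StarRing F] {V : Type} [AddCommGroup V] [Module F V]
    [Finite V] {ι : Type} {h : V → V → F} {t : ι → Module.End F V} (H : Sp h t) {W : Submodule F V}
    (hW : ∀ i, ∀ w ∈ W, t i w ∈ W) (hnd : ∀ v ∈ W, (∀ w ∈ W, h w v = 0) → v = 0) :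
    Spl h t W (H.perp W) := by
  have hd : Disjoint W (H.perp W) := by
    rw [Submodule.disjoint_def]
    exact fun v hv hv' => hnd v hv hv'
  refine ⟨⟨hd, ?_⟩, fun w hw v hv => hv w hw, hW, fun i => H.perp_st (hW i)⟩
  rw [codisjoint_iff, Submodule.eq_top_iff']
  intro v
  let f : V → Module.Dual F W := fun v =>
    { toFun := fun w => h w v
      map_add' := fun a b => H.add_left _ _ _
      map_smul' := fun a b => H.smul_left _ _ _ }
  let e : W ≃ₗ[F] Module.Dual F W := (Module.finBasis F W).toDualEquiv
  have hinj : Function.Injective (fun w : W => e.symm (f w)) := by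
    intro a b hab
    have h1 : f a = f b := e.symm.injective hab
    rw [← sub_eq_zero]
    apply Subtype.ext
    apply hnd _ (a - b).2
    intro w hw
    have := LinearMap.congr_fun h1 ⟨w, hw⟩
    show h w (a - b : V) = 0
    rw [H.sub_right, sub_eq_zero]
    exact this
  obtain ⟨w, hw⟩ := (Finite.injective_iff_surjective.1 hinj) (e.symm (f v))
  have hw' : f w = f v := e.symm.injective hw
  rw [Submodule.mem_sup]
  refine ⟨w, w.2, v - w, ?_, by abel⟩
  intro x hx
  rw [H.sub_right, sub_eq_zero]
  exact (LinearMap.congr_fun hw' ⟨x, hx⟩).symm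

theorem noSkew_idem [Finite V] (H : Sp h t) {e : Module.End F V} (he : e ∈ Alg t) (ha : Adj h e e)
    (S : Spl h t (LinearMap.range e) (LinearMap.ker e))
    (h1 : ∀ c, Anti (rs _ h) (rt S.st) c → NoSkew (U (rs _ h) (rt S.st)) c)
    (h2 : ∀ c, Anti (rs _ h) (rt S.st') c → NoSkew (U (rs _ h) (rt S.st')) c)
    {c : AA V} (hc : Anti h t c) : NoSkew (U h t) c := by
  have hce : ∀ v, c (e v) = e (c v) := by
    obtain ⟨x', -, a, b⟩ := alg_adj H he
    rw [Adj.unique H ha a]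
    intro v
    rw [← b c hc]
    rw [Adj.unique H ha a]
  have key : ∀ g : AA V, (∀ v, g (e v) = e (g v)) → ∃ f f', g = glue S.compl f f' := by
    intro g hg
    apply exists_glue
    · rintro _ ⟨v, rfl⟩; exact ⟨g v, (hg v).symm⟩
    · intro v hv
      rw [LinearMap.mem_ker] at hv ⊢
      rw [← hg, hv, map_zero]
  obtain ⟨f, f', rfl⟩ := key c hce
  have a1 := S.anti_res hc
  have a2 := S.anti_res' hc
  have hEq : U h t = GS S.compl (U (rs _ h) (rt S.st)) (U (rs _ h) (rt S.st')) := by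
    apply le_antisymm _ (S.GS_le H)
    intro g hg
    obtain ⟨x, y, rfl⟩ := key g (U.comm hg he)
    rw [S.glue_mem H] at hg
    exact ⟨x, hg.1, y, hg.2, rfl⟩
  rw [hEq]
  exact noSkew_GS _ (h1 _ a1) (h2 _ a2) (a1.nrm (S.sp H)) (a2.nrm ((S.symm H).sp H))

end split

section adjoin
variable {F : Type} [CommRing F] [StarRing F] {V : Type} [AddCommGroup V] [Module F V]
  {ι : Type} {h : V → V → F} {t : ι → Module.End F V}

/-- adjoining an operator -/
def ad (t : ι → Module.End F V) (s : Module.End F V) : Option ι → Module.End F V :=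
  fun o => o.elim s t

theorem toE_pow (g : AA V) (hg : ∀ (a : F) v, g (a • v) = a • g v) (n : ℕ) (v : V) :
    ((toE g hg) ^ n) v = (g ^ n) v := by
  induction n generalizing v with
  | zero => rfl
  | succ n ih => rw [pow_succ', pow_succ', Module.End.mul_apply, ih, AA.mul_apply]; rfl

theorem Sp.ad (H : Sp h t) {g : AA V} (hg : g ∈ U h t) (hn : ∃ n : ℕ, (n : F) ≠ 0 ∧ g ^ n = 1) :
    Sp h (ad t (toE g hg.1)) where
  add_left := H.add_left
  smul_left := H.smul_left
  herm := H.herm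
  nd := H.nd
  tun := by
    rintro (_ | i) v w
    · exact hg.2.1 v w
    · exact H.tun i v w
  tcomm := by
    have key : ∀ i, toE g hg.1 * t i = t i * toE g hg.1 := by
      intro i; ext v; exact hg.2.2 i v
    rintro (_ | i) (_ | j)
    · rfl
    · exact key j
    · exact (key i).symm
    · exact H.tcomm i j
  tper := by
    rintro (_ | i)
    · obtain ⟨n, h0, h1⟩ := hn
      refine ⟨n, h0, ?_⟩
      ext v
      show ((toE g hg.1) ^ n) v = v
      rw [toE_pow, h1, AA.one_apply]
    · exact H.tper i

theorem mem_U_ad {g : AA V} (hg : ∀ (a : F) v, g (a • v) = a • g v) {x : AA V} :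
    x ∈ U h (ad t (toE g hg)) ↔ x ∈ U h t ∧ x * g = g * x := by
  constructor
  · intro hx
    exact ⟨⟨hx.1, hx.2.1, fun i => hx.2.2 (some i)⟩, AA.ext fun v => hx.2.2 none v⟩
  · rintro ⟨hx, hc⟩
    refine ⟨hx.1, hx.2.1, ?_⟩
    rintro (_ | i) v
    · exact DFunLike.congr_fun hc v
    · exact hx.2.2 i v

theorem anti_ad {g : AA V} (hg : ∀ (a : F) v, g (a • v) = a • g v) {c : AA V} :
    Anti h (ad t (toE g hg)) c ↔ Anti h t c ∧ c * g * c⁻¹ = g⁻¹ := by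
  constructor
  · intro hc
    refine ⟨⟨hc.sq, hc.smul, hc.iso, fun i => hc.tinv (some i)⟩, ?_⟩
    have h1 : g * c * g = c := AA.ext fun v => hc.tinv none v
    rw [eq_inv_iff_mul_eq_one, ← mul_left_cancel_iff (a := g), mul_one,
      ← mul_right_cancel_iff (a := c)]
    have hcc : c⁻¹ * g * c = c * g * c⁻¹ := by
      rw [inv_eq_of_mul_eq_one_left (AA.ext hc.sq : c * c = 1)]
    calc g * (c * g * c⁻¹ * g) * c = (g * c * g) * (c⁻¹ * g * c) := by group
      _ = g * c := by rw [h1, hcc]; rw [← mul_assoc, ← mul_assoc,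
                        show c * c = 1 from AA.ext hc.sq, one_mul,
                        inv_eq_of_mul_eq_one_left (AA.ext hc.sq : c * c = 1)]
  · rintro ⟨hc, hi⟩
    refine ⟨hc.sq, hc.smul, hc.iso, ?_⟩
    rintro (_ | i) v
    · show g (c (g v)) = c v
      have : g * c * g = c := by
        have e : c * g = g⁻¹ * c := by rw [← hi]; group
        rw [mul_assoc, e]; group
      exact DFunLike.congr_fun this v
    · exact hc.tinv i v

end adjoin
end UCS

set_option linter.unusedSectionVars false
namespace UCS

section cgen
variable {F : Type} [Field F] [StarRing F] {V : Type} [AddCommGroup V] [Module F V]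
  {ι : Type} {h : V → V → F} {t : ι → Module.End F V} {π : Module.End F V}

/-- the algebra generated by the family and one more operator -/
def AlgP (t : ι → Module.End F V) (π : Module.End F V) : Subalgebra F (Module.End F V) :=
  Algebra.adjoin F (insert π (Set.range t))

theorem algP_ge : Alg t ≤ AlgP t π := Algebra.adjoin_mono (Set.subset_insert _ _)

theorem pi_mem : π ∈ AlgP t π := Algebra.subset_adjoin (Set.mem_insert _ _)

variable (H : Sp h t) (hπt : ∀ i, π * t i = t i * π)
include H hπt

theorem algP_comm {x y : Module.End F V} (hx : x ∈ AlgP t π) (hy : y ∈ AlgP t π) :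
    x * y = y * x := by
  have key : ∀ a ∈ insert π (Set.range t), ∀ b ∈ insert π (Set.range t), Commute a b := by
    rintro a (rfl | ⟨i, rfl⟩) b (rfl | ⟨j, rfl⟩)
    · rfl
    · exact hπt j
    · exact (hπt i).symm
    · exact H.tcomm i j
  refine (Algebra.commute_of_mem_adjoin_of_forall_mem_commute (s := insert π (Set.range t)) hy ?_)
  intro b hb
  refine (Algebra.commute_of_mem_adjoin_of_forall_mem_commute (s := insert π (Set.range t)) hx ?_).symm
  intro a ha
  exact key _ hb _ ha

theorem algP_adj (ha : Adj h π π) {x : Module.End F V} (hx : x ∈ AlgP t π) :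
    ∃ x' ∈ AlgP t π, Adj h x x' := by
  induction hx using Algebra.adjoin_induction with
  | mem x hx =>
    rcases hx with rfl | ⟨i, rfl⟩
    · exact ⟨x, pi_mem, ha⟩
    · obtain ⟨x', m, a, -⟩ := alg_adj H (mem_alg (t := t) i)
      exact ⟨x', algP_ge m, a⟩
  | algebraMap r => exact ⟨_, Subalgebra.algebraMap_mem _ (star r), Adj.algebraMap H r⟩
  | add x y _ _ hx hy =>
    obtain ⟨x', m1, a1⟩ := hx
    obtain ⟨y', m2, a2⟩ := hy
    exact ⟨x' + y', Subalgebra.add_mem _ m1 m2, Adj.add H a1 a2⟩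
  | mul x y _ _ hx hy =>
    obtain ⟨x', m1, a1⟩ := hx
    obtain ⟨y', m2, a2⟩ := hy
    exact ⟨y' * x', Subalgebra.mul_mem _ m2 m1, Adj.mul a1 a2⟩

theorem algP_dec {x : Module.End F V} (hx : x ∈ AlgP t π) :
    ∃ l ∈ Alg t, ∃ r ∈ AlgP t π, x = l + π * r := by
  induction hx using Algebra.adjoin_induction with
  | mem x hx =>
    rcases hx with rfl | ⟨i, rfl⟩
    · exact ⟨0, zero_mem _, 1, one_mem _, by simp⟩
    · exact ⟨t i, mem_alg i, 0, zero_mem _, by simp⟩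
  | algebraMap r => exact ⟨_, Subalgebra.algebraMap_mem _ r, 0, zero_mem _, by simp⟩
  | add x y _ _ hx hy =>
    obtain ⟨l, m1, r, n1, rfl⟩ := hx
    obtain ⟨l', m2, r', n2, rfl⟩ := hy
    exact ⟨l + l', add_mem m1 m2, r + r', add_mem n1 n2, by rw [mul_add]; abel⟩
  | mul x y hx' hy' hx hy =>
    obtain ⟨l, m1, r, n1, rfl⟩ := hx
    obtain ⟨l', m2, r', n2, rfl⟩ := hy
    refine ⟨l * l', mul_mem m1 m2, l * r' + r * (l' + π * r'), ?_, ?_⟩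
    · exact add_mem (mul_mem (algP_ge m1) n2) (mul_mem n1 hy')
    · have e : l * (π * r') = π * (l * r') := by
        rw [← mul_assoc, ← mul_assoc, algP_comm H hπt (algP_ge m1) pi_mem]
      rw [add_mul, mul_add, e, mul_add, mul_assoc π r, mul_assoc π r, mul_add, mul_add, mul_add]; abel

theorem algP_dec_sa {b : F} (hb : b + star b = 1) (ha : Adj h π π) {x : Module.End F V}
    (hx : x ∈ AlgP t π) (hxa : Adj h x x) :
    ∃ l ∈ Alg t, Adj h l l ∧ ∃ r ∈ AlgP t π, Adj h r r ∧ x = l + π * r := by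
  obtain ⟨l, m, r, n, hxe⟩ := algP_dec H hπt hx
  obtain ⟨l', m', al, -⟩ := alg_adj H m
  obtain ⟨r', n', ar⟩ := algP_adj H hπt ha n
  have e2 : x = l' + π * r' := by
    have h1 : Adj h x (l' + r' * π) := by
      rw [hxe]; exact Adj.add H al (Adj.mul ha ar)
    rw [Adj.unique H hxa h1, algP_comm H hπt n' pi_mem]
  refine ⟨b • l + star b • l', add_mem (Subalgebra.smul_mem _ m _) (Subalgebra.smul_mem _ m' _), ?_,
    b • r + star b • r', add_mem (Subalgebra.smul_mem _ n _) (Subalgebra.smul_mem _ n' _), ?_, ?_⟩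
  · have := Adj.add H (Adj.smul H al b) (Adj.smul H (Adj.symm H al) (star b))
    rwa [star_star, add_comm (star b • l')] at this
  · have := Adj.add H (Adj.smul H ar b) (Adj.smul H (Adj.symm H ar) (star b))
    rwa [star_star, add_comm (star b • r')] at this
  · have : x = b • x + star b • x := by rw [← add_smul, hb, one_smul]
    rw [mul_add, mul_smul_comm, mul_smul_comm]
    nth_rw 1 [this]
    nth_rw 1 [hxe]
    nth_rw 1 [e2]
    rw [smul_add, smul_add]; abel

theorem algP_claim [Finite F] {b : F} (hb : b + star b = 1) (ha : Adj h π π) (hN : NoIdem h t) {k : ℕ}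
    (hk : π ^ k = 0) :
    ∀ j i : ℕ, i + j + 1 = k → ∀ x ∈ AlgP t π, Adj h x x → π ^ i * x ≠ 0 →
      ∃ r ∈ AlgP t π, r * (π ^ i * x) = π ^ (k - 1) := by
  intro j
  induction j with
  | zero =>
    intro i hi x hx hxa h0
    obtain ⟨l, ml, al, r, mr, ar, rfl⟩ := algP_dec_sa H hπt hb ha hx hxa
    have e1 : π ^ i * (l + π * r) = π ^ i * l := by
      rw [mul_add, ← mul_assoc, ← pow_succ, show i + 1 = k by omega, hk, zero_mul, add_zero]
    rcases hN.qe H ml al with rfl | ⟨y, my, -, h1, h2⟩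
    · rw [e1, mul_zero] at h0; exact absurd rfl h0
    · refine ⟨y, algP_ge my, ?_⟩
      rw [e1, ← mul_assoc, algP_comm H hπt (algP_ge my) (Subalgebra.pow_mem _ pi_mem i), mul_assoc,
        h2, mul_one]
      congr 1; omega
  | succ j ih =>
    intro i hi x hx hxa h0
    obtain ⟨l, ml, al, r, mr, ar, rfl⟩ := algP_dec_sa H hπt hb ha hx hxa
    rcases hN.qe H ml al with rfl | ⟨y, my, -, h1, h2⟩
    · rw [zero_add, ← mul_assoc, ← pow_succ] at h0 ⊢
      exact ih (i + 1) (by omega) r mr ar h0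
    · -- invertible
      have mz : y * (π * r) ∈ AlgP t π := mul_mem (algP_ge my) (mul_mem pi_mem mr)
      have hnil : (y * (π * r)) ^ k = 0 := by
        have c1 : Commute π r := algP_comm H hπt pi_mem mr
        have c2 : Commute y (π * r) := algP_comm H hπt (algP_ge my) (mul_mem pi_mem mr)
        rw [c2.mul_pow, c1.mul_pow, hk, zero_mul, mul_zero]
      set z := y * (π * r) with hz
      have hg := mul_neg_geom_sum (-z) k
      rw [neg_pow, hnil, mul_zero, sub_zero] at hg
      have hgc : (∑ m ∈ Finset.range k, (-z) ^ m) ∈ AlgP t π :=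
        sum_mem fun m _ => pow_mem (neg_mem mz) m
      have hl : l + π * r = l * (1 - -z) := by
        rw [hz, sub_neg_eq_add, mul_add, ← mul_assoc l y, h1, one_mul, mul_one]
      refine ⟨π ^ (j + 1) * (y * ∑ m ∈ Finset.range k, (-z) ^ m),
        mul_mem (pow_mem pi_mem _) (mul_mem (algP_ge my) hgc), ?_⟩
      set w := ∑ m ∈ Finset.range k, (-z) ^ m with hw
      have e : y * w * (l * (1 - -z)) = 1 := by
        rw [algP_comm H hπt (algP_ge my) hgc, mul_assoc, ← mul_assoc y, h2, one_mul]
        rw [algP_comm H hπt hgc (sub_mem (one_mem _) (neg_mem mz)), hg]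
      rw [hl]
      have c3 : y * w * π ^ i = π ^ i * (y * w) := algP_comm H hπt (mul_mem (algP_ge my) hgc)
        (pow_mem pi_mem i)
      calc π ^ (j + 1) * (y * w) * (π ^ i * (l * (1 - -z)))
          = π ^ (j + 1) * (y * w * π ^ i) * (l * (1 - -z)) := by noncomm_ring
        _ = π ^ (j + 1) * π ^ i * (y * w * (l * (1 - -z))) := by rw [c3]; noncomm_ring
        _ = π ^ (k - 1) := by rw [e, mul_one, ← pow_add]; congr 1; omega

omit hπt in
theorem exists_vec (hst : ∃ a : F, star a ≠ a) {ν : Module.End F V} (ha : Adj h ν ν) (h0 : ν ≠ 0) :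
    ∃ e, h (ν e) e ≠ 0 := by
  by_contra hcon
  push Not at hcon
  apply h0
  have h1 : ∀ x y, h (ν x) y + star (h (ν x) y) = 0 := by
    intro x y
    have := hcon (x + y)
    rw [map_add, H.add_left, H.add_right, H.add_right, hcon, hcon, zero_add, add_zero] at this
    rw [← H.herm, ← ha y x]; exact this
  obtain ⟨a, haa⟩ := hst
  ext x
  apply H.nd
  intro y
  have e1 := h1 x y
  have e2 := h1 (a • x) y
  rw [map_smul, H.smul_left, star_mul'] at e2
  have e3 : (a - star a) * h (ν x) y = 0 := by linear_combination e2 - star a * e1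
  rcases mul_eq_zero.1 e3 with h3 | h3
  · exact absurd (sub_eq_zero.1 h3).symm haa
  · exact h3

theorem cyc [Finite F] [Nontrivial V] (hst : ∃ a : F, star a ≠ a) (ha : Adj h π π) (hN : NoIdem h t)
    (hnil : IsNilpotent π) :
    ∃ W : Submodule F V, W ≠ ⊥ ∧ ∃ hW : ∀ i, ∀ w ∈ W, t i w ∈ W, (∀ w ∈ W, π w ∈ W) ∧
      (∀ v ∈ W, (∀ w ∈ W, h w v = 0) → v = 0) ∧
      ∃ c : AA W, Anti (rs W h) (rt hW) c ∧ ∀ v w : W, (w : V) = π v → (c w : V) = π (c v) := by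
  obtain ⟨b, hb⟩ := exists_tr_one hst
  obtain ⟨k, hk, hkm⟩ : ∃ k, π ^ (k + 1) = 0 ∧ π ^ k ≠ 0 := by
    have h0 : ∃ n, π ^ n = 0 := hnil
    classical
    have hpos : Nat.find h0 ≠ 0 := by
      intro h00
      have := Nat.find_spec h0
      rw [h00, pow_zero] at this
      exact one_ne_zero this
    obtain ⟨k, hk⟩ := Nat.exists_eq_succ_of_ne_zero hpos
    refine ⟨k, ?_, Nat.find_min h0 (by omega)⟩
    have := Nat.find_spec h0
    rwa [hk] at this
  obtain ⟨e, he⟩ := exists_vec H hst (ha.pow k) hkm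
  have key : ∀ s ∈ AlgP t π, (∀ r ∈ AlgP t π, h (s (r e)) e = 0) → s = 0 := by
    -- first self-adjoint elements
    have sa : ∀ s ∈ AlgP t π, Adj h s s → (∀ r ∈ AlgP t π, h (s (r e)) e = 0) → s = 0 := by
      intro s hs hsa hz
      by_contra h0
      obtain ⟨r, mr, hr⟩ := algP_claim H hπt hb ha hN hk k 0 (by omega) s hs hsa (by simpa using h0)
      apply he
      rw [pow_zero, one_mul, Nat.add_sub_cancel] at hr
      rw [← hr, algP_comm H hπt mr hs]
      exact hz r mr
    intro s hs hz
    obtain ⟨s', ms', as'⟩ := algP_adj H hπt ha hs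
    have hz' : ∀ r ∈ AlgP t π, h (s' (r e)) e = 0 := by
      intro r mr
      obtain ⟨r', mr', ar'⟩ := algP_adj H hπt ha mr
      rw [Adj.symm H as', H.herm (s e), ← Adj.symm H ar', ← Module.End.mul_apply,
        algP_comm H hπt mr' hs, Module.End.mul_apply, hz r' mr', star_zero]
    have h1 : ∀ a : F, a • s + star a • s' = 0 := by
      intro a
      apply sa _ (add_mem (Subalgebra.smul_mem _ hs _) (Subalgebra.smul_mem _ ms' _))
      · have := Adj.add H (Adj.smul H as' a) (Adj.smul H (Adj.symm H as') (star a))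
        rwa [star_star, add_comm (star a • s')] at this
      · intro r mr
        rw [LinearMap.add_apply, LinearMap.smul_apply, LinearMap.smul_apply, H.add_left, H.smul_left,
          H.smul_left, hz r mr, hz' r mr]; simp
    obtain ⟨a, haa⟩ := hst
    have e1 := h1 1
    rw [one_smul, star_one, one_smul] at e1
    have e2 := h1 a
    rw [← neg_eq_of_add_eq_zero_right e1, smul_neg, ← sub_eq_add_neg, ← sub_smul] at e2
    rcases smul_eq_zero.1 e2 with h3 | h3
    · exact absurd (sub_eq_zero.1 h3).symm haa
    · exact h3
  have inj : ∀ s ∈ AlgP t π, s e = 0 → s = 0 := by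
    intro s hs h0
    apply key s hs
    intro r mr
    rw [← Module.End.mul_apply, algP_comm H hπt hs mr, Module.End.mul_apply, h0, map_zero, H.zero_left]
  have inj2 : ∀ s ∈ AlgP t π, ∀ r ∈ AlgP t π, s e = r e → s = r := by
    intro s hs r hr hsr
    rw [← sub_eq_zero]
    apply inj _ (sub_mem hs hr)
    rw [LinearMap.sub_apply, hsr, sub_self]
  let W : Submodule F V :=
    { carrier := {v | ∃ s ∈ AlgP t π, s e = v}
      zero_mem' := ⟨0, zero_mem _, rfl⟩
      add_mem' := by
        rintro _ _ ⟨s, hs, rfl⟩ ⟨r, hr, rfl⟩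
        exact ⟨s + r, add_mem hs hr, rfl⟩
      smul_mem' := by
        rintro a _ ⟨s, hs, rfl⟩
        exact ⟨a • s, Subalgebra.smul_mem _ hs a, rfl⟩ }
  have hWi : ∀ x ∈ AlgP t π, ∀ w ∈ W, x w ∈ W := by
    rintro x hx _ ⟨s, hs, rfl⟩
    exact ⟨x * s, mul_mem hx hs, rfl⟩
  have hW : ∀ i, ∀ w ∈ W, t i w ∈ W := fun i => hWi _ (algP_ge (mem_alg i))
  have hch : ∀ w : W, ∃ s ∈ AlgP t π, s e = w := fun w => w.2
  choose σ hσ hσe using hch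
  have hσu : ∀ (w : W) s, s ∈ AlgP t π → s e = w → σ w = s := fun w s hs he' =>
    inj2 _ (hσ w) _ hs (by rw [hσe, he'])
  have hst' : ∀ s : AlgP t π, ∃ s' ∈ AlgP t π, Adj h s s' := fun s => algP_adj H hπt ha s.2
  choose τ hτ hτa using hst'
  have hτu : ∀ (s : AlgP t π) s', Adj h s s' → τ s = s' := fun s s' a =>
    Adj.unique H (hτa s) a
  let f : W → W := fun w => ⟨τ ⟨σ w, hσ w⟩ e, _, hτ _, rfl⟩
  have hf : ∀ (w : W) s s', s ∈ AlgP t π → s e = w → Adj h s s' → (f w : V) = s' e := by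
    intro w s s' hs hse ha'
    show τ ⟨σ w, hσ w⟩ e = s' e
    rw [hτu _ s']
    show Adj h (σ w) s'
    rw [hσu w s hs hse]; exact ha'
  have rep : ∀ w : W, ∃ s s', s ∈ AlgP t π ∧ s' ∈ AlgP t π ∧ Adj h s s' ∧ (w : V) = s e ∧
      (f w : V) = s' e := fun w =>
    ⟨σ w, τ ⟨σ w, hσ w⟩, hσ w, hτ _, hτa ⟨σ w, hσ w⟩, (hσe w).symm, rfl⟩
  have fadd : ∀ v w, f (v + w) = f v + f w := by
    intro v w
    obtain ⟨s, s', m, m', a, e1, e2⟩ := rep v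
    obtain ⟨r, r', n, n', a', e3, e4⟩ := rep w
    apply Subtype.ext
    rw [hf (v + w) (s + r) (s' + r') (add_mem m n) (by simp [e1, e3]) (Adj.add H a a')]
    simp [e2, e4]
  have finv : ∀ v, f (f v) = v := by
    intro v
    obtain ⟨s, s', m, m', a, e1, e2⟩ := rep v
    apply Subtype.ext
    rw [hf (f v) s' s m' e2.symm (Adj.symm H a), e1]
  refine ⟨W, ?_, hW, hWi _ pi_mem, ?_, AA.ofInvol f fadd finv, ⟨finv, ?_, ?_, ?_⟩, ?_⟩
  · intro h0
    have : e ∈ W := ⟨1, one_mem _, rfl⟩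
    rw [h0, Submodule.mem_bot] at this
    apply he
    rw [this, H.zero_right]
  · rintro _ ⟨s, hs, rfl⟩ hz
    rw [key s hs]; · rfl
    intro r mr
    obtain ⟨r', mr', ar'⟩ := algP_adj H hπt ha mr
    rw [← Module.End.mul_apply, algP_comm H hπt hs mr, Module.End.mul_apply, ar', H.herm (r' e),
      hz _ ⟨r', mr', rfl⟩, star_zero]
  · intro a v
    obtain ⟨s, s', m, m', ad, e1, e2⟩ := rep v
    apply Subtype.ext
    rw [AA.ofInvol_apply, hf (a • v) (a • s) (star a • s') (Subalgebra.smul_mem _ m a) (by simp [e1])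
      (Adj.smul H ad a)]
    rw [AA.ofInvol_apply, Submodule.coe_smul, e2]; rfl
  · intro v w
    obtain ⟨s, s', m, m', ad, e1, e2⟩ := rep v
    obtain ⟨r, r', n, n', ad', e3, e4⟩ := rep w
    show h (f v) (f w) = star (h v w)
    rw [e1, e2, e3, e4, ← H.herm, ← ad', ← Module.End.mul_apply, algP_comm H hπt n m', Module.End.mul_apply,
      Adj.symm H ad]
  · intro i v
    obtain ⟨s, s', m, m', ad, e1, e2⟩ := rep v
    obtain ⟨x', mx, ax, -⟩ := alg_adj H (mem_alg (t := t) i)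
    apply Subtype.ext
    show t i (f (rt hW i v)) = f v
    rw [hf (rt hW i v) (t i * s) (s' * x') (mul_mem (algP_ge (mem_alg i)) m) (by rw [Module.End.mul_apply, ← e1]; rfl)
      (Adj.mul ax ad), e2, algP_comm H hπt m' (algP_ge mx), ← Module.End.mul_apply, ← mul_assoc]
    have : t i * x' = 1 := by
      apply LinearMap.ext
      intro w
      apply sub_eq_zero.1
      apply H.nd_right
      intro u
      obtain ⟨n, -, h1, h2⟩ := H.tpos i
      have eu : u = t i ((t i ^ n) u) := by rw [← Module.End.mul_apply, h2]; rfl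
      rw [H.sub_right, eu, Module.End.mul_apply, H.tun, ← ax, sub_eq_zero]; rfl
    rw [this, one_mul]
  · intro v w hw
    obtain ⟨s, s', m, m', ad, e1, e2⟩ := rep v
    rw [AA.ofInvol_apply, AA.ofInvol_apply, hf w (π * s) (s' * π) (mul_mem pi_mem m) (by rw [hw, e1]; rfl)
      (Adj.mul ha ad), e2, algP_comm H hπt m' pi_mem]; rfl

omit H hπt in
theorem restrict_pow {W : Submodule F V} (hW : ∀ w ∈ W, π w ∈ W) (n : ℕ) (w : W) :
    (((π.restrict hW) ^ n) w : V) = (π ^ n) w := by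
  induction n with
  | zero => rfl
  | succ n ih => rw [pow_succ', pow_succ', Module.End.mul_apply, Module.End.mul_apply, ← ih]; rfl

end cgen

theorem cgen {F : Type} [Field F] [StarRing F] [Finite F] (hst : ∃ a : F, star a ≠ a) (N : ℕ) :
    ∀ (V : Type) [AddCommGroup V] [Module F V] [Finite V] (ι : Type) (h : V → V → F)
      (t : ι → Module.End F V) (π : Module.End F V), Sp h t → (∀ i, π * t i = t i * π) →
      Adj h π π → IsNilpotent π → Nat.card V = N →
      ∃ c, Anti h t c ∧ ∀ v, c (π v) = π (c v) := by
  induction N using Nat.strong_induction_on with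
  | _ N ih =>
  intro V _ _ _ ι h t π H hπt ha hnil hN
  rcases subsingleton_or_nontrivial V with hV | hV
  · exact ⟨1, ⟨fun _ => rfl, fun _ _ => Subsingleton.elim _ _,
      fun v w => by rw [Subsingleton.elim v 0, map_zero, H.zero_left, H.zero_left, star_zero],
      fun _ _ => Subsingleton.elim _ _⟩, fun v => Subsingleton.elim _ _⟩
  -- reduction of one piece
  have piece : ∀ W W' : Submodule F V, ∀ S : Spl h t W W', W ≠ ⊤ → (∀ w ∈ W, π w ∈ W) →
      ∃ c, Anti (rs W h) (rt S.st) c ∧ ∀ v w : W, (w : V) = π v → (c w : V) = π (c v) := by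
    intro W W' S hW hπ
    obtain ⟨n, hn⟩ := hnil
    obtain ⟨c, hc, hcπ⟩ := ih (Nat.card W) (hN ▸ card_lt_of_ne_top hW) W ι (rs W h) (rt S.st)
      (π.restrict hπ) (S.sp H) (fun i => by ext w; exact LinearMap.congr_fun (hπt i) (w : V))
      (fun v w => ha v w) ⟨n, by ext w; rw [restrict_pow, hn]; rfl⟩ rfl
    refine ⟨c, hc, fun v w hw => ?_⟩
    have : w = π.restrict hπ v := Subtype.ext hw
    rw [this, hcπ]; rfl
  have fin : ∀ W W' : Submodule F V, ∀ S : Spl h t W W', (∀ w ∈ W, π w ∈ W) → (∀ w ∈ W', π w ∈ W') →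
      (∃ c, Anti (rs W h) (rt S.st) c ∧ ∀ v w : W, (w : V) = π v → (c w : V) = π (c v)) →
      (∃ c, Anti (rs W' h) (rt S.st') c ∧ ∀ v w : W', (w : V) = π v → (c w : V) = π (c v)) →
      ∃ c, Anti h t c ∧ ∀ v, c (π v) = π (c v) := by
    rintro W W' S hπ hπ' ⟨c, hc, hcπ⟩ ⟨c', hc', hcπ'⟩
    refine ⟨_, S.glue_anti H hc hc', fun v => ?_⟩
    obtain ⟨x, y, rfl⟩ := decomp S.compl v
    have e : π ((x : V) + y) = ((⟨π x, hπ x x.2⟩ : W) : V) + ((⟨π y, hπ' y y.2⟩ : W') : V) :=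
      map_add _ _ _
    rw [e, glue_apply, glue_apply, map_add, hcπ x _ rfl, hcπ' y _ rfl]
  by_cases hNI : NoIdem h t
  · obtain ⟨W, hW0, hW, hWπ, hnd, hex⟩ := cyc H hπt hst ha hNI hnil
    have S := Spl.of_nondeg H hW hnd
    have hπ' : ∀ w ∈ H.perp W, π w ∈ H.perp W := by
      intro v hv w hw
      rw [← ha]; exact hv _ (hWπ w hw)
    refine fin W _ S hWπ hπ' hex (piece _ _ (S.symm H) ?_ hπ')
    intro htop
    apply hW0
    have := S.compl.inf_eq_bot
    rwa [htop, inf_top_eq] at this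
  · unfold NoIdem at hNI
    push Not at hNI
    obtain ⟨e, he, hea, hei, h0, h1⟩ := hNI
    have S := Spl.of_idem H he hea hei
    have hc : ∀ v, π (e v) = e (π v) := fun v =>
      LinearMap.congr_fun (algP_comm H hπt pi_mem (algP_ge he)) v
    have p1 : ∀ w ∈ LinearMap.range e, π w ∈ LinearMap.range e := by
      rintro _ ⟨v, rfl⟩; exact ⟨π v, (hc v).symm⟩
    have p2 : ∀ w ∈ LinearMap.ker e, π w ∈ LinearMap.ker e := by
      intro v hv
      rw [LinearMap.mem_ker] at hv ⊢
      rw [← hc, hv, map_zero]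
    refine fin _ _ S p1 p2 (piece _ _ S ?_ p1) (piece _ _ (S.symm H) ?_ p2)
    · intro htop
      apply h1
      ext v
      obtain ⟨w, rfl⟩ : v ∈ LinearMap.range e := by rw [htop]; trivial
      exact LinearMap.congr_fun hei w
    · intro htop
      exact h0 (LinearMap.ker_eq_top.1 htop)

end UCS

set_option linter.unusedSectionVars false
namespace UCS

/-- Jordan decomposition in a finite group -/
theorem jordan {A : Type} [Group A] [Finite A] (p : ℕ) [Fact p.Prime] (g : A) :
    ∃ i j a m : ℕ, g = g ^ i * g ^ j ∧ ¬ p ∣ m ∧ (g ^ i) ^ m = 1 ∧ (g ^ j) ^ p ^ a = 1 := by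
  obtain ⟨a, m, hm, ho⟩ := Nat.exists_eq_pow_mul_and_not_dvd (orderOf_pos g).ne' p
    (Fact.out : p.Prime).ne_one
  have hcop : Nat.Coprime m (p ^ a) :=
    (((Nat.Prime.coprime_iff_not_dvd Fact.out).2 hm).pow_left a).symm
  obtain ⟨i, hi1, hi2⟩ := Nat.chineseRemainder hcop 1 0
  obtain ⟨j, hj1, hj2⟩ := Nat.chineseRemainder hcop 0 1
  refine ⟨i, j, a, m, ?_, hm, ?_, ?_⟩
  · rw [← pow_add]
    nth_rw 1 [← pow_one g]
    rw [pow_eq_pow_iff_modEq, ho, mul_comm, ← Nat.modEq_and_modEq_iff_modEq_mul hcop]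
    exact ⟨(hi1.add hj1).symm, (hi2.add hj2).symm⟩
  · rw [← pow_mul, ← orderOf_dvd_iff_pow_eq_one, ho]
    exact Nat.mul_dvd_mul ((Nat.modEq_zero_iff_dvd).1 hi2) dvd_rfl
  · rw [← pow_mul, ← orderOf_dvd_iff_pow_eq_one, ho, mul_comm]
    exact Nat.mul_dvd_mul ((Nat.modEq_zero_iff_dvd).1 hj1) dvd_rfl

theorem exists_inverting {F : Type} [Field F] [StarRing F] [Finite F] (hst : ∃ a : F, star a ≠ a)
    {V : Type} [AddCommGroup V] [Module F V] [Finite V] {ι : Type} {h : V → V → F}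
    {t : ι → Module.End F V} (H : Sp h t) {k : AA V} (hk : k ∈ U h t) :
    ∃ c, Anti h t c ∧ c * k * c⁻¹ = k⁻¹ := by
  obtain ⟨p, hp⟩ := CharP.exists F
  have : Fact p.Prime := ⟨CharP.char_is_prime F p⟩
  obtain ⟨i, j, a, m, hij, hpm, h1, h2⟩ := jordan p k
  set s := k ^ i with hs
  set u := k ^ j with hu
  have hsU : s ∈ U h t := pow_mem hk i
  have huU : u ∈ U h t := pow_mem hk j
  have hm0 : (m : F) ≠ 0 := fun h => hpm ((CharP.cast_eq_zero_iff F p m).1 h)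
  have H' := H.ad hsU ⟨m, hm0, h1⟩
  have hus : u * s = s * u := by rw [hs, hu, ← pow_add, ← pow_add, add_comm]
  have huU' : u ∈ U h (ad t (toE s hsU.1)) := (mem_U_ad _).2 ⟨huU, hus⟩
  obtain ⟨b, hb⟩ := hst
  set E := toE u huU.1 with hE
  have hEv : ∀ v, E v = u v := fun v => rfl
  have hn : IsNilpotent (E - 1) := by
    rcases subsingleton_or_nontrivial V with hV | hV
    · exact ⟨1, by ext; exact Subsingleton.elim _ _⟩
    have : CharP (Module.End F V) p := charP_of_injective_algebraMap
      (FaithfulSMul.algebraMap_injective F (Module.End F V)) p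
    refine ⟨p ^ a, ?_⟩
    rw [sub_pow_char_pow_of_commute p _ (Commute.one_right E), one_pow, sub_eq_zero]
    ext v
    rw [toE_pow, h2]; rfl
  have hd : star b - b ≠ 0 := sub_ne_zero.2 hb
  have hDu : ∀ x y : F, x + y ≠ 0 → IsUnit (algebraMap F (Module.End F V) x + y • E) := by
    intro x y hxy
    have e : algebraMap F (Module.End F V) x + y • E = (x + y) • (1 + ((x + y)⁻¹ * y) • (E - 1)) := by
      rw [smul_add, smul_smul, mul_inv_cancel_left₀ hxy, Algebra.algebraMap_eq_smul_one]
      module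
    rw [e]
    have h3 : IsNilpotent (((x + y)⁻¹ * y) • (E - 1)) := hn.smul _
    exact IsUnit.smul (Units.mk0 _ hxy) h3.isUnit_one_add
  set D := algebraMap F (Module.End F V) (star b) + (-b) • E with hD
  obtain ⟨Du, hDe⟩ := hDu (star b) (-b) (by rwa [← sub_eq_add_neg])
  rw [← hD] at hDe
  have hcED : Commute (E - 1) D := by
    rw [hD]
    refine Commute.add_right ?_ ?_
    · exact (Algebra.commutes _ _).symm
    · exact ((Commute.refl E).sub_left (Commute.one_left E)).smul_right _
  rw [← hDe] at hcED
  have hcinv : Commute (E - 1) ((Du⁻¹ : (Module.End F V)ˣ) : Module.End F V) := hcED.units_inv_right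
  set π : Module.End F V := (E - 1) * ((Du⁻¹ : (Module.End F V)ˣ) : Module.End F V) with hπ
  have hπD : π * D = E - 1 := by
    rw [hπ, ← hDe, mul_assoc, Units.inv_mul, mul_one]
  have hπDv : ∀ x, π (D x) = u x - x := fun x => LinearMap.congr_fun hπD x
  have hDv : ∀ x, D x = star b • x - b • u x := by
    intro x
    rw [hD, LinearMap.add_apply, Module.algebraMap_end_apply, LinearMap.smul_apply, hEv, neg_smul,
      ← sub_eq_add_neg]
  have hDs : ∀ v, ∃ x, D x = v := fun v =>
    ⟨((Du⁻¹ : (Module.End F V)ˣ) : Module.End F V) v, by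
      rw [← hDe, ← Module.End.mul_apply, Units.mul_inv]; rfl⟩
  have hadj : Adj h π π := by
    intro v w
    obtain ⟨x, rfl⟩ := hDs v
    obtain ⟨y, rfl⟩ := hDs w
    rw [hπDv, hπDv, hDv, hDv]
    simp only [H.sub_left, H.sub_right, H.smul_left, H.smul_right, star_star, huU.2.1]
    ring
  have hnilπ : IsNilpotent π := hcinv.isNilpotent_mul_right hn
  have hcomm : ∀ o, π * ad t (toE s hsU.1) o = ad t (toE s hsU.1) o * π := by
    intro o
    apply LinearMap.ext
    intro v
    obtain ⟨x, rfl⟩ := hDs v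
    show π (ad t (toE s hsU.1) o (D x)) = ad t (toE s hsU.1) o (π (D x))
    rw [hπDv]
    have e : ad t (toE s hsU.1) o (D x) = D (ad t (toE s hsU.1) o x) := by
      rw [hDv, hDv, map_sub, map_smul, map_smul, huU'.2.2]
    rw [e, hπDv, huU'.2.2, map_sub]
  obtain ⟨c, hc, hcπ⟩ := cgen ⟨b, hb⟩ _ V _ h _ π H' hcomm hadj hnilπ rfl
  obtain ⟨hc1, hc2⟩ := (anti_ad _).1 hc
  refine ⟨c, hc1, ?_⟩
  have hcu : c * u * c⁻¹ = u⁻¹ := by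
    have rel : ∀ v, u v + b • π (u v) = v + star b • π v := by
      intro v
      have := hπDv v
      rw [hDv, map_sub, map_smul, map_smul] at this
      have h3 : u v = v + (star b • π v - b • π (u v)) := by rw [this]; abel
      nth_rw 1 [h3]; abel
    have inj : ∀ v w, v + b • π v = w + b • π w → v = w := by
      intro v w hvw
      have hu1 : IsUnit (1 + b • π) := (hnilπ.smul b).isUnit_one_add
      obtain ⟨y, hy⟩ := hu1
      have h3 : (y : Module.End F V) v = (y : Module.End F V) w := by rw [hy]; exact hvw
      have h4 : ∀ z, ((y⁻¹ : (Module.End F V)ˣ) : Module.End F V) ((y : Module.End F V) z) = z := by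
        intro z; rw [← Module.End.mul_apply, Units.inv_mul]; rfl
      rw [← h4 v, h3, h4]
    have h5 : u * c * u = c := by
      apply AA.ext
      intro v
      rw [AA.mul_apply, AA.mul_apply]
      apply inj
      rw [rel]
      have := congrArg c (rel v)
      simp only [map_add, hc1.smul, star_star, hcπ] at this
      exact this
    have : c * u = u⁻¹ * c := by nth_rw 2 [← h5]; group
    rw [this]; group
  rw [hij]
  calc c * (s * u) * c⁻¹ = (c * s * c⁻¹) * (c * u * c⁻¹) := by group
    _ = (s * u)⁻¹ := by rw [hc2, hcu, ← hus, mul_inv_rev]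

theorem exists_real {F : Type} [Field F] [StarRing F] [Finite F] (hst : ∃ a : F, star a ≠ a)
    {V : Type} [AddCommGroup V] [Module F V] [Finite V] {ι : Type} {h : V → V → F}
    {t : ι → Module.End F V} (H : Sp h t) {c : AA V} (hc : Anti h t c) {k : AA V} (hk : k ∈ U h t) :
    ∃ y ∈ U h t, y * k * y⁻¹ = c * k⁻¹ * c⁻¹ := by
  obtain ⟨c', hc', h1⟩ := exists_inverting hst H hk
  refine ⟨c * c'⁻¹, hc'.mul_mem H hc, ?_⟩
  have hi : c'⁻¹ = c' := inv_eq_of_mul_eq_one_left (AA.ext hc'.sq)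
  rw [← h1, hi, mul_inv_rev, hi]; group

end UCS

set_option linter.unusedSectionVars false
namespace UCS

/-- operators satisfying the Heisenberg relations (characteristic two) -/
structure Hs {V X : Type} [AddCommGroup V] [AddCommGroup X] [Module ℂ X]
    (ρ : V → Module.End ℂ X) (κ : V → V → ℂ) : Prop where
  two : ∀ u : V, u + u = 0
  zero : ρ 0 = 1
  mul : ∀ u v, ρ u * ρ v = κ u v • ρ (u + v)
  sq : ∀ u v, κ u v = 1 ∨ κ u v = -1
  nd : ∀ w, w ≠ 0 → ∃ y, κ y w ≠ κ w y

section weil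

variable {V X : Type} [AddCommGroup V] [AddCommGroup X] [Module ℂ X] [Nontrivial X]
    {ρ : V → Module.End ℂ X} {κ : V → V → ℂ} (H : Hs ρ κ)

include H

theorem Hs.sq' (u v : V) : κ u v * κ u v = 1 := by
  rcases H.sq u v with h | h <;> rw [h] <;> norm_num

/-- inverse operators -/
def Ri (ρ : V → Module.End ℂ X) (κ : V → V → ℂ) (u : V) : Module.End ℂ X := κ u u • ρ u

theorem Hs.mul_inv (u : V) : ρ u * Ri ρ κ u = 1 := by
  rw [Ri, mul_smul_comm, H.mul, smul_smul, H.sq', H.two, H.zero, one_smul]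

theorem Hs.inv_mul (u : V) : Ri ρ κ u * ρ u = 1 := by
  rw [Ri, smul_mul_assoc, H.mul, smul_smul, H.sq', H.two, H.zero, one_smul]

theorem Hs.ne (u : V) : ρ u ≠ 0 := by
  intro h
  have := H.mul_inv u
  rw [h, zero_mul] at this
  exact zero_ne_one this

theorem Hs.comm (y w : V) : ρ y * ρ w = (κ y w * κ w y) • (ρ w * ρ y) := by
  rw [H.mul, H.mul, smul_smul, mul_assoc, H.sq', mul_one, add_comm]

theorem Hs.conj (y w : V) : ρ y * ρ w * Ri ρ κ y = (κ y w * κ w y) • ρ w := by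
  rw [H.comm, smul_mul_assoc, mul_assoc, H.mul_inv, mul_one]

theorem Hs.chi_add (y z w : V) :
    κ (y + z) w * κ w (y + z) = (κ y w * κ w y) * (κ z w * κ w z) := by
  have e1 : ρ (y + z) * ρ w = (κ (y + z) w * κ w (y + z)) • (ρ w * ρ (y + z)) := H.comm _ _
  have e2 : ρ (y + z) = κ y z • (ρ y * ρ z) := by rw [H.mul, smul_smul, H.sq', one_smul]
  have e3 : ρ (y + z) * ρ w = ((κ y w * κ w y) * (κ z w * κ w z)) • (ρ w * ρ (y + z)) := by
    rw [e2, smul_mul_assoc, mul_assoc, H.comm z w, mul_smul_comm, ← mul_assoc, H.comm y w,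
      mul_smul_comm, smul_mul_assoc, smul_smul, smul_smul, smul_smul, mul_assoc (ρ w)]
    congr 1; ring
  rw [e3] at e1
  have h0 : ρ w * ρ (y + z) ≠ 0 := by
    rw [H.mul]
    exact smul_ne_zero (by rcases H.sq w (y + z) with h | h <;> rw [h] <;> norm_num) (H.ne _)
  exact (smul_left_injective ℂ h0 e1).symm

theorem Hs.chi_sum [Fintype V] [DecidableEq V] (w : V) :
    ∑ y, κ y w * κ w y = if w = 0 then (Fintype.card V : ℂ) else 0 := by
  split_ifs with hw
  · subst hw
    have : ∀ y, κ y 0 * κ 0 y = 1 := by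
      intro y
      have h1 := H.mul y 0
      have h2 := H.mul 0 y
      rw [H.zero, mul_one, add_zero] at h1
      rw [H.zero, one_mul, zero_add] at h2
      have e1 : (1 : ℂ) • ρ y = κ y 0 • ρ y := by rw [one_smul]; exact h1
      have e2 : (1 : ℂ) • ρ y = κ 0 y • ρ y := by rw [one_smul]; exact h2
      rw [← smul_left_injective ℂ (H.ne y) e1, ← smul_left_injective ℂ (H.ne y) e2, mul_one]
    simp [this]
  · obtain ⟨z, hz⟩ := H.nd w hw
    have h1 : κ z w * κ w z ≠ 1 := by
      intro h
      apply hz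
      calc κ z w = κ z w * (κ w z * κ w z) := by rw [H.sq', mul_one]
        _ = κ w z := by rw [← mul_assoc, h, one_mul]
    have h2 : ∑ y, κ y w * κ w y = (κ z w * κ w z) * ∑ y, κ y w * κ w y := by
      rw [Finset.mul_sum]
      rw [← Equiv.sum_comp (Equiv.addLeft z) (fun y => κ y w * κ w y)]
      apply Finset.sum_congr rfl
      intro y _
      show κ (z + y) w * κ w (z + y) = _
      rw [H.chi_add]
    have h3 : (1 - κ z w * κ w z) * ∑ y, κ y w * κ w y = 0 := by linear_combination h2
    rcases mul_eq_zero.1 h3 with h | h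
    · exact absurd (sub_eq_zero.1 h).symm h1
    · exact h

/-- an operator in the span commuting with everything is scalar, explicitly -/
theorem Hs.scalar [Fintype V] [DecidableEq V] {I : Type} [Fintype I] (s : I → ℂ) (w : I → V)
    (hc : ∀ y, ρ y * (∑ i, s i • ρ (w i)) = (∑ i, s i • ρ (w i)) * ρ y) :
    ∑ i, s i • ρ (w i) = (∑ i, if w i = 0 then s i else 0) • 1 := by
  have h1 : ∑ y : V, ρ y * (∑ i, s i • ρ (w i)) * Ri ρ κ y =
      (Fintype.card V : ℂ) • ∑ i, s i • ρ (w i) := by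
    have : ∀ y : V, ρ y * (∑ i, s i • ρ (w i)) * Ri ρ κ y = ∑ i, s i • ρ (w i) := by
      intro y
      rw [hc, mul_assoc, H.mul_inv, mul_one]
    rw [Finset.sum_congr rfl fun y _ => this y, Finset.sum_const, Finset.card_univ, ← Nat.cast_smul_eq_nsmul ℂ]
  have h2 : ∑ y : V, ρ y * (∑ i, s i • ρ (w i)) * Ri ρ κ y =
      (Fintype.card V : ℂ) • ((∑ i, if w i = 0 then s i else 0) • 1) := by
    have : ∀ y : V, ρ y * (∑ i, s i • ρ (w i)) * Ri ρ κ y =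
        ∑ i, (κ y (w i) * κ (w i) y) • s i • ρ (w i) := by
      intro y
      rw [Finset.mul_sum, Finset.sum_mul]
      apply Finset.sum_congr rfl
      intro i _
      rw [mul_smul_comm, smul_mul_assoc, H.conj, smul_comm]
    rw [Finset.sum_congr rfl fun y _ => this y, Finset.sum_comm, Finset.sum_smul, Finset.smul_sum]
    apply Finset.sum_congr rfl
    intro i _
    rw [← Finset.sum_smul, H.chi_sum]
    split_ifs with h0
    · rw [h0, H.zero]
    · rw [zero_smul, zero_smul, smul_zero]
  rw [h1] at h2
  have hV : (Fintype.card V : ℂ) ≠ 0 := by simp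
  exact (smul_right_injective _ hV) h2

/-- the unnormalized Weil operator -/
noncomputable def wb [Fintype V] (ρ : V → Module.End ℂ X) (κ : V → V → ℂ) (g : AA V) : Module.End ℂ X :=
  ∑ u, ρ (g u) * Ri ρ κ u

omit H in
theorem kinv {g : AA V} (hg : ∀ u v, κ (g u) (g v) = κ u v) (u v : V) : κ (g⁻¹ u) (g⁻¹ v) = κ u v := by
  rw [← hg, AA.apply_inv_self, AA.apply_inv_self]

theorem Hs.wb_comm [Fintype V] {g : AA V} (hg : ∀ u v, κ (g u) (g v) = κ u v) (y : V) :
    wb ρ κ g * ρ y = ρ (g y) * wb ρ κ g := by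
  have key : ∀ u, ρ (g y) * (ρ (g u) * Ri ρ κ u) = (ρ (g (y + u)) * Ri ρ κ (y + u)) * ρ y := by
    intro u
    have e1 : ρ (g y) * ρ (g u) = κ y u • ρ (g (y + u)) := by rw [H.mul, hg, map_add]
    have e2 : ρ y * ρ u = κ y u • ρ (y + u) := H.mul y u
    have e3 : Ri ρ κ u = κ y u • (Ri ρ κ (y + u) * ρ y) := by
      calc Ri ρ κ u = (Ri ρ κ (y + u) * ρ (y + u)) * Ri ρ κ u := by rw [H.inv_mul, one_mul]
        _ = κ y u • (Ri ρ κ (y + u) * (ρ y * ρ u) * Ri ρ κ u) := by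
          rw [e2, mul_smul_comm, smul_mul_assoc, smul_smul, H.sq', one_smul]
        _ = _ := by rw [mul_assoc, mul_assoc (ρ y), H.mul_inv, mul_one]
    rw [← mul_assoc, e1, e3, smul_mul_assoc, mul_smul_comm, smul_smul, H.sq', one_smul, mul_assoc]
  rw [wb, Finset.mul_sum, Finset.sum_mul, Finset.sum_congr rfl fun u _ => key u]
  exact (Equiv.sum_comp (Equiv.addLeft y) (fun u => ρ (g u) * Ri ρ κ u * ρ y)).symm

/-- scalar in front of a term -/
def ws (κ : V → V → ℂ) (g : AA V) (u : V) : ℂ := κ u u * κ (g u) u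

theorem Hs.term (g : AA V) (u : V) : ρ (g u) * Ri ρ κ u = ws κ g u • ρ (g u + u) := by
  rw [Ri, mul_smul_comm, H.mul, smul_smul, ws]

theorem Hs.wb_inv [Fintype V] {g : AA V} (hg : ∀ u v, κ (g u) (g v) = κ u v) :
    wb ρ κ g * wb ρ κ g⁻¹ = ((Nat.card V * Nat.card {u : V // g u = u} : ℕ) : ℂ) • 1 := by
  classical
  have hcom : ∀ y, ρ y * (wb ρ κ g * wb ρ κ g⁻¹) = (wb ρ κ g * wb ρ κ g⁻¹) * ρ y := by
    intro y
    rw [mul_assoc (wb ρ κ g), H.wb_comm (kinv hg), ← mul_assoc (wb ρ κ g), H.wb_comm hg,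
      AA.apply_inv_self, mul_assoc]
  have hexp : wb ρ κ g * wb ρ κ g⁻¹ = ∑ i : V × V, (ws κ g i.1 * ws κ g⁻¹ (g i.2) *
      κ (g i.1 + i.1) (i.2 + g i.2)) • ρ ((g i.1 + i.1) + (i.2 + g i.2)) := by
    rw [Fintype.sum_prod_type, wb, wb, Finset.sum_mul]
    apply Finset.sum_congr rfl
    intro u _
    rw [Finset.mul_sum, ← Equiv.sum_comp (EquivLike.toEquiv g : V ≃ V)]
    apply Finset.sum_congr rfl
    intro u' _
    show ρ (g u) * Ri ρ κ u * (ρ (g⁻¹ (g u')) * Ri ρ κ (g u')) = _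
    rw [H.term, H.term, AA.inv_apply_self, smul_mul_smul_comm, H.mul, smul_smul]
  rw [hexp, H.scalar]
  swap
  · rw [← hexp]; exact hcom
  congr 1
  have hval : ∀ i : V × V, (g i.1 + i.1) + (i.2 + g i.2) = 0 → (ws κ g i.1 * ws κ g⁻¹ (g i.2) *
      κ (g i.1 + i.1) (i.2 + g i.2)) = 1 := by
    rintro ⟨u, u'⟩ h0
    dsimp only at h0 ⊢
    -- `z = u + u'` is fixed
    have hz : g (u + u') = u + u' := by
      rw [map_add]
      have : (g u + g u') + (u + u') = 0 := by rw [← h0]; abel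
      calc g u + g u' = (g u + g u') + ((u + u') + (u + u')) := by rw [H.two, add_zero]
        _ = u + u' := by rw [← add_assoc, this, zero_add]
    have e1 : ρ (g u) * Ri ρ κ u * (ρ (g⁻¹ (g u')) * Ri ρ κ (g u')) =
      (ws κ g u * ws κ g⁻¹ (g u') * κ (g u + u) (u' + g u')) • 1 := by
      rw [H.term, H.term, AA.inv_apply_self, smul_mul_smul_comm, H.mul, smul_smul, h0, H.zero]
    have e2 : ρ (g u) * Ri ρ κ u * (ρ (g⁻¹ (g u')) * Ri ρ κ (g u')) = 1 := by
      rw [AA.inv_apply_self]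
      have a1 : Ri ρ κ u * ρ u' = (κ u u * κ u u') • ρ (u + u') := by
        rw [Ri, smul_mul_assoc, H.mul, smul_smul]
      have a2 : Ri ρ κ (g u) * ρ (g u') = (κ u u * κ u u') • ρ (u + u') := by
        rw [Ri, smul_mul_assoc, H.mul, smul_smul, hg, hg, ← map_add, hz]
      rw [mul_assoc, ← mul_assoc (Ri ρ κ u), a1, ← a2, ← mul_assoc, ← mul_assoc, H.mul_inv, one_mul,
        H.mul_inv]
    rw [e1] at e2
    have h5 : (ws κ g u * ws κ g⁻¹ (g u') * κ (g u + u) (u' + g u')) • (1 : Module.End ℂ X) =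
      (1 : ℂ) • 1 := by rw [e2, one_smul]
    exact smul_left_injective ℂ (one_ne_zero (α := Module.End ℂ X)) h5
  rw [Finset.sum_congr rfl (g := fun i : V × V => if (g i.1 + i.1) + (i.2 + g i.2) = 0 then (1 : ℂ) else 0)
    (fun i _ => by split_ifs with h0; · exact hval i h0
                   · rfl)]
  rw [Finset.sum_boole, ← Fintype.card_subtype, ← Nat.card_eq_fintype_card, ← Nat.card_prod]
  congr 1
  apply Nat.card_congr
  have hiff : ∀ u u' : V, (g u + u) + (u' + g u') = 0 ↔ g (u + u') = u + u' := by
    intro u u'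
    rw [map_add]
    have : (g u + u) + (u' + g u') = (g u + g u') - (u + u') := by
      have h2 : -(u + u') = u + u' := neg_eq_of_add_eq_zero_right (H.two _)
      rw [sub_eq_add_neg, h2]; abel
    rw [this, sub_eq_zero]
  exact
    { toFun := fun i => (i.1.1, ⟨i.1.1 + i.1.2, (hiff _ _).1 i.2⟩)
      invFun := fun j => ⟨(j.1, j.1 + j.2.1), (hiff _ _).2 (by
        rw [← add_assoc, H.two, zero_add]; exact j.2.2)⟩
      left_inv := by
        rintro ⟨⟨u, u'⟩, hu⟩
        apply Subtype.ext
        simp only [Prod.mk.injEq, true_and]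
        rw [← add_assoc, H.two, zero_add]
      right_inv := by
        rintro ⟨u, ⟨z, hz⟩⟩
        simp only [Prod.mk.injEq, true_and, Subtype.mk.injEq]
        rw [← add_assoc, H.two, zero_add] }

end weil
end UCS

set_option linter.unusedSectionVars false
namespace UCS

theorem dvd_card_of_free {N W : Type} [Group N] [Finite N] [MulAction N W] [Finite W] (S : Set W)
    (hS : ∀ (a : N), ∀ x ∈ S, a • x ∈ S) (hf : ∀ (a : N), ∀ x ∈ S, a • x = x → a = 1) :
    Nat.card N ∣ Nat.card S := by
  let P : SubMulAction N W := ⟨S, fun a {x} hx => hS a x hx⟩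
  have h1 : ∀ b : P, MulAction.stabilizer N b = ⊥ := by
    intro b
    rw [eq_bot_iff]
    intro a ha
    rw [MulAction.mem_stabilizer_iff] at ha
    rw [Subgroup.mem_bot]
    exact hf a b.1 b.2 (congrArg Subtype.val ha)
  have h2 := Nat.card_congr (MulAction.selfEquivOrbitsQuotientProd (G := N) (X := P) h1)
  rw [Nat.card_prod] at h2
  exact ⟨_, (h2.trans (mul_comm _ _) :)⟩

section tri
variable {V X : Type} [AddCommGroup V] [AddCommGroup X] [Module ℂ X] [Nontrivial X]
    {ρ : V → Module.End ℂ X} {κ : V → V → ℂ}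

/-- coefficient of a product of three terms -/
def sg (κ : V → V → ℂ) (g1 g2 g3 : AA V) (u : V × V × V) : ℂ :=
  ws κ g1 u.1 * ws κ g2 u.2.1 * ws κ g3 u.2.2 * κ (g1 u.1 + u.1) (g2 u.2.1 + u.2.1) *
    κ (g1 u.1 + u.1 + (g2 u.2.1 + u.2.1)) (g3 u.2.2 + u.2.2)

/-- exponent of a product of three terms -/
def se (g1 g2 g3 : AA V) (u : V × V × V) : V :=
  g1 u.1 + u.1 + (g2 u.2.1 + u.2.1) + (g3 u.2.2 + u.2.2)

variable (H : Hs ρ κ)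
include H

theorem Hs.triple_term (g1 g2 g3 : AA V) (u : V × V × V) :
    (ρ (g1 u.1) * Ri ρ κ u.1) * (ρ (g2 u.2.1) * Ri ρ κ u.2.1) * (ρ (g3 u.2.2) * Ri ρ κ u.2.2) =
      sg κ g1 g2 g3 u • ρ (se g1 g2 g3 u) := by
  rw [H.term, H.term, H.term, smul_mul_smul_comm, H.mul, smul_smul, smul_mul_smul_comm, H.mul, smul_smul,
    sg, se]
  congr 1; ring

theorem Hs.sg_sq (g1 g2 g3 : AA V) (u : V × V × V) : sg κ g1 g2 g3 u = 1 ∨ sg κ g1 g2 g3 u = -1 := by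
  have hm : ∀ a b : ℂ, (a = 1 ∨ a = -1) → (b = 1 ∨ b = -1) → (a * b = 1 ∨ a * b = -1) := by
    rintro a b (rfl | rfl) (rfl | rfl) <;> norm_num
  unfold sg ws
  exact hm _ _ (hm _ _ (hm _ _ (hm _ _ (hm _ _ (H.sq _ _) (H.sq _ _)) (hm _ _ (H.sq _ _) (H.sq _ _)))
    (hm _ _ (H.sq _ _) (H.sq _ _))) (H.sq _ _)) (H.sq _ _)

/-- the scalar of a triple product -/
noncomputable def gs [Fintype V] [DecidableEq V] (κ : V → V → ℂ) (g1 g2 g3 : AA V) : ℂ :=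
  ∑ u : V × V × V, if se g1 g2 g3 u = 0 then sg κ g1 g2 g3 u else 0

theorem Hs.triple [Fintype V] [DecidableEq V] {g1 g2 g3 : AA V} (k1 : ∀ u v, κ (g1 u) (g1 v) = κ u v)
    (k2 : ∀ u v, κ (g2 u) (g2 v) = κ u v) (k3 : ∀ u v, κ (g3 u) (g3 v) = κ u v) (h1 : g1 * g2 * g3 = 1) :
    wb ρ κ g1 * wb ρ κ g2 * wb ρ κ g3 = gs κ g1 g2 g3 • 1 := by
  have hexp : wb ρ κ g1 * wb ρ κ g2 * wb ρ κ g3 =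
      ∑ u : V × V × V, sg κ g1 g2 g3 u • ρ (se g1 g2 g3 u) := by
    simp only [← H.triple_term]
    rw [wb, wb, wb, Finset.sum_mul_sum, Finset.sum_mul_sum, Fintype.sum_prod_type]
    apply Finset.sum_congr rfl
    intro u1 _
    rw [Fintype.sum_prod_type, Finset.sum_comm]
    rw [Finset.sum_comm]
    conv_rhs => rw [Finset.sum_comm]
    apply Finset.sum_congr rfl
    intro u3 _
    rw [Finset.sum_mul]
  rw [hexp, H.scalar]
  · rfl
  · rw [← hexp]
    intro y
    symm
    rw [mul_assoc, H.wb_comm k3, ← mul_assoc, mul_assoc (wb ρ κ g1), H.wb_comm k2, ← mul_assoc,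
      H.wb_comm k1, ← AA.mul_apply, ← AA.mul_apply, ← mul_assoc, h1, AA.one_apply]
    simp only [mul_assoc]

theorem Hs.gs_inv [Fintype V] [DecidableEq V] (g1 g2 g3 : AA V) :
    gs κ g3⁻¹ g2⁻¹ g1⁻¹ = gs κ g1 g2 g3 := by
  unfold gs
  let e : V × V × V ≃ V × V × V :=
    { toFun := fun u => (g3 u.2.2, g2 u.2.1, g1 u.1)
      invFun := fun u => (g1⁻¹ u.2.2, g2⁻¹ u.2.1, g3⁻¹ u.1)
      left_inv := fun u => by simp [AA.inv_apply_self]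
      right_inv := fun u => by simp [AA.apply_inv_self] }
  rw [← Equiv.sum_comp e]
  apply Finset.sum_congr rfl
  rintro ⟨u1, u2, u3⟩ _
  have he : se g3⁻¹ g2⁻¹ g1⁻¹ (e (u1, u2, u3)) = se g1 g2 g3 (u1, u2, u3) := by
    simp only [se, e, Equiv.coe_fn_mk, AA.inv_apply_self]; abel
  rw [he]
  split_ifs with h0
  · have t1 := H.triple_term g1 g2 g3 (u1, u2, u3)
    have t2 := H.triple_term g3⁻¹ g2⁻¹ g1⁻¹ (e (u1, u2, u3))
    rw [he, h0, H.zero] at t2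
    rw [h0, H.zero] at t1
    simp only [e, Equiv.coe_fn_mk, AA.inv_apply_self] at t1 t2
    have t3 : ∀ a b : V, (ρ a * Ri ρ κ b) * (ρ b * Ri ρ κ a) = 1 := by
      intro a b
      rw [mul_assoc, ← mul_assoc (Ri ρ κ b), H.inv_mul, one_mul, H.mul_inv]
    have t4 : (ρ (g1 u1) * Ri ρ κ u1) * (ρ (g2 u2) * Ri ρ κ u2) * (ρ (g3 u3) * Ri ρ κ u3) *
      ((ρ u3 * Ri ρ κ (g3 u3)) * (ρ u2 * Ri ρ κ (g2 u2)) * (ρ u1 * Ri ρ κ (g1 u1))) = 1 := by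
      generalize hA : ρ (g1 u1) * Ri ρ κ u1 = A
      generalize hB : ρ (g2 u2) * Ri ρ κ u2 = B
      generalize hC : ρ (g3 u3) * Ri ρ κ u3 = C
      generalize hA' : ρ u1 * Ri ρ κ (g1 u1) = A'
      generalize hB' : ρ u2 * Ri ρ κ (g2 u2) = B'
      generalize hC' : ρ u3 * Ri ρ κ (g3 u3) = C'
      have a1 : A * A' = 1 := by rw [← hA, ← hA', t3]
      have a2 : B * B' = 1 := by rw [← hB, ← hB', t3]
      have a3 : C * C' = 1 := by rw [← hC, ← hC', t3]
      calc A * B * C * (C' * B' * A') = A * (B * (C * C') * B') * A' := by simp only [mul_assoc]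
        _ = 1 := by rw [a3, mul_one, a2, mul_one, a1]
    rw [t1, t2, smul_mul_smul_comm, one_mul] at t4
    have t5 := smul_left_injective ℂ (one_ne_zero (α := Module.End ℂ X)) (t4.trans (one_smul ℂ _).symm)
    rcases H.sg_sq g1 g2 g3 (u1, u2, u3) with h | h
    · rw [h, one_mul] at t5; rw [h]; exact t5
    · rw [h] at t5; rw [h]
      have : sg κ g3⁻¹ g2⁻¹ g1⁻¹ (g3 u3, g2 u2, g1 u1) = -1 := by linear_combination -t5
      exact this
  · rfl

theorem fix_inv (g : AA V) : Nat.card {u : V // g⁻¹ u = u} = Nat.card {u : V // g u = u} := by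
  apply Nat.card_congr
  apply Equiv.subtypeEquivRight
  intro u
  constructor
  · intro h; conv_lhs => rw [← h]
    rw [AA.apply_inv_self]
  · intro h; conv_lhs => rw [← h]
    rw [AA.inv_apply_self]

/-- normalizing factor -/
noncomputable def nu (q : ℕ) (g : AA V) : ℂ :=
  (-(q : ℂ)) ^ Nat.log (q ^ 2) (Nat.card V * Nat.card {u : V // g u = u})

/-- the integrality hypotheses -/
structure Gd (N : Type) [Group N] [DistribMulAction N V] (q : ℕ) (κ : V → V → ℂ) (g : AA V) : Prop where
  k : ∀ u v, κ (g u) (g v) = κ u v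
  n : ∀ (a : N) u, g (a • u) = a • g u
  c : ∃ k, Nat.card V * Nat.card {u : V // g u = u} = (q ^ 2) ^ k

variable {N : Type} [Group N] [Finite N] [DistribMulAction N V] {q : ℕ}

theorem Gd.inv {g : AA V} (hg : Gd N q κ g) : Gd N q κ g⁻¹ := by
  refine ⟨kinv hg.k, fun a u => ?_, ?_⟩
  · apply g.inj
    rw [AA.apply_inv_self, hg.n, AA.apply_inv_self]
  · rw [fix_inv H]; exact hg.c

theorem nu_sq (hq : 2 ≤ q) {g : AA V} (hg : Gd N q κ g) :
    ((Nat.card V * Nat.card {u : V // g u = u} : ℕ) : ℂ) = nu q g * nu q g := by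
  obtain ⟨k, hk⟩ := hg.c
  rw [nu, hk, Nat.log_pow (by nlinarith), ← pow_add, ← two_mul, pow_mul, neg_sq, ← pow_mul]
  push_cast
  rw [← pow_mul]

theorem nu_inv (g : AA V) : nu q g⁻¹ = nu q g := by
  rw [nu, fix_inv H, nu]

theorem nu_ne (hq : 2 ≤ q) (g : AA V) : nu q g ≠ 0 := by
  rw [nu]
  apply pow_ne_zero
  rw [neg_ne_zero]
  exact_mod_cast (by omega : q ≠ 0)

theorem Hs.gs_val [Fintype V] [DecidableEq V] (hq : 2 ≤ q) (hN : Nat.card N = q + 1)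
    (hk : ∀ (a : N) u v, κ (a • u) (a • v) = κ u v) (hf : ∀ (a : N) (u : V), a • u = u → u ≠ 0 → a = 1)
    {g1 g2 g3 : AA V} (k1 : Gd N q κ g1) (k2 : Gd N q κ g2) (k3 : Gd N q κ g3) (h1 : g1 * g2 * g3 = 1) :
    gs κ g1 g2 g3 = nu q g1 * nu q g2 * nu q g3 := by
  have hsq : gs κ g1 g2 g3 * gs κ g1 g2 g3 =
      (nu q g1 * nu q g2 * nu q g3) * (nu q g1 * nu q g2 * nu q g3) := by
    have e1 := H.triple k1.k k2.k k3.k h1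
    have h2 : g3⁻¹ * g2⁻¹ * g1⁻¹ = 1 := by
      have := congrArg (·⁻¹) h1
      simpa [mul_assoc] using this
    have e2 := H.triple (kinv k3.k) (kinv k2.k) (kinv k1.k) h2
    rw [H.gs_inv] at e2
    have e3 : (wb ρ κ g1 * wb ρ κ g2 * wb ρ κ g3) * (wb ρ κ g3⁻¹ * wb ρ κ g2⁻¹ * wb ρ κ g1⁻¹) =
        ((nu q g1 * nu q g2 * nu q g3) * (nu q g1 * nu q g2 * nu q g3)) • 1 := by
      have a1 := H.wb_inv k1.k
      have a2 := H.wb_inv k2.k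
      have a3 := H.wb_inv k3.k
      rw [nu_sq H hq k1] at a1
      rw [nu_sq H hq k2] at a2
      rw [nu_sq H hq k3] at a3
      calc _ = wb ρ κ g1 * (wb ρ κ g2 * (wb ρ κ g3 * wb ρ κ g3⁻¹) * wb ρ κ g2⁻¹) * wb ρ κ g1⁻¹ := by
            simp only [mul_assoc]
        _ = _ := by
          rw [a3, mul_smul_comm, mul_one, smul_mul_assoc, a2, mul_smul_comm, mul_smul_comm, mul_one,
            smul_mul_assoc, smul_mul_assoc, a1, smul_smul, smul_smul]
          congr 1; ring
    rw [e1, e2, smul_mul_smul_comm, one_mul] at e3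
    exact smul_left_injective ℂ (one_ne_zero (α := Module.End ℂ X)) e3
  -- the congruence
  have hz : ∃ z : ℤ, gs κ g1 g2 g3 = (z : ℂ) ∧ ((q + 1 : ℕ) : ℤ) ∣ z - 1 := by
    have se_smul : ∀ (a : N) u, se g1 g2 g3 (a • u) = a • se g1 g2 g3 u := by
      intro a u
      simp only [se, Prod.smul_fst, Prod.smul_snd, k1.n, k2.n, k3.n, smul_add]
    have sg_smul : ∀ (a : N) u, sg κ g1 g2 g3 (a • u) = sg κ g1 g2 g3 u := by
      intro a u
      simp only [sg, ws, Prod.smul_fst, Prod.smul_snd, k1.n, k2.n, k3.n, ← smul_add, hk]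
    have hdv : ∀ z : ℂ, q + 1 ∣ Nat.card {u : V × V × V | u ≠ 0 ∧ se g1 g2 g3 u = 0 ∧ sg κ g1 g2 g3 u = z} := by
      intro z
      rw [← hN]
      apply dvd_card_of_free (N := N)
      · rintro a u ⟨h1, h2, h3⟩
        refine ⟨?_, ?_, ?_⟩
        · rwa [Ne, smul_eq_zero_iff_eq]
        · rw [se_smul, h2, smul_zero]
        · rw [sg_smul, h3]
      · rintro a ⟨u1, u2, u3⟩ ⟨h1, h2, h3⟩ h4
        simp only [Prod.smul_mk, Prod.mk.injEq] at h4
        by_cases c1 : u1 = 0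
        · by_cases c2 : u2 = 0
          · by_cases c3 : u3 = 0
            · exact absurd (by rw [c1, c2, c3]; rfl) h1
            · exact hf a _ h4.2.2 c3
          · exact hf a _ h4.2.1 c2
        · exact hf a _ h4.1 c1
    have sg0 : sg κ g1 g2 g3 0 = 1 := by
      have k0 : κ 0 0 = 1 := by
        have := H.mul 0 0
        rw [H.zero, one_mul, add_zero, H.zero] at this
        exact (smul_left_injective ℂ (one_ne_zero (α := Module.End ℂ X))
          ((one_smul ℂ _).trans this)).symm
      simp [sg, ws, k0]
    have se0 : se g1 g2 g3 0 = 0 := by simp [se]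
    refine ⟨1 + Nat.card {u : V × V × V | u ≠ 0 ∧ se g1 g2 g3 u = 0 ∧ sg κ g1 g2 g3 u = 1} -
      Nat.card {u : V × V × V | u ≠ 0 ∧ se g1 g2 g3 u = 0 ∧ sg κ g1 g2 g3 u = -1}, ?_, ?_⟩
    · rw [gs]
      have hsplit : ∀ u : V × V × V, (if se g1 g2 g3 u = 0 then sg κ g1 g2 g3 u else 0) =
          (if u = 0 then (1 : ℂ) else 0) +
          (if u ≠ 0 ∧ se g1 g2 g3 u = 0 ∧ sg κ g1 g2 g3 u = 1 then (1 : ℂ) else 0) -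
          (if u ≠ 0 ∧ se g1 g2 g3 u = 0 ∧ sg κ g1 g2 g3 u = -1 then (1 : ℂ) else 0) := by
        intro u
        by_cases c1 : u = 0
        · subst c1
          simp [se0, sg0]
        · by_cases c2 : se g1 g2 g3 u = 0
          · rcases H.sg_sq g1 g2 g3 u with c3 | c3
            · norm_num [c1, c2, c3]
            · norm_num [c1, c2, c3]
          · simp [c1, c2]
      rw [Finset.sum_congr rfl fun u _ => hsplit u, Finset.sum_sub_distrib, Finset.sum_add_distrib,
        Finset.sum_boole, Finset.sum_boole, Finset.sum_boole]
      simp only [Nat.card_eq_fintype_card, Fintype.card_subtype, Set.coe_ofPred]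
      push_cast
      simp [Finset.filter_eq']
    · have d1 := Int.natCast_dvd_natCast.2 (hdv 1)
      have d2 := Int.natCast_dvd_natCast.2 (hdv (-1))
      have h6 := dvd_sub d1 d2
      rw [add_sub_assoc, add_sub_cancel_left]
      exact h6
  obtain ⟨z, hz1, hz2⟩ := hz
  rcases mul_self_eq_mul_self_iff.1 hsq with h | h
  · exact h
  · exfalso
    -- wrong sign contradicts the congruence
    have : ∃ n : ℕ, nu q g1 * nu q g2 * nu q g3 = (-(q : ℂ)) ^ n := by
      rw [nu, nu, nu, ← pow_add, ← pow_add]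
      exact ⟨_, rfl⟩
    obtain ⟨n, hn⟩ := this
    rw [hn, hz1] at h
    have h' : z = - (-(q : ℤ)) ^ n := by exact_mod_cast h
    have h3 : ((q + 1 : ℕ) : ℤ) ∣ (-(q : ℤ)) ^ n - 1 := by
      have := sub_dvd_pow_sub_pow (-(q : ℤ)) 1 n
      rw [one_pow] at this
      refine dvd_trans ⟨-1, ?_⟩ this
      push_cast; ring
    have h4 := dvd_add hz2 h3
    rw [h'] at h4
    have h5 : ((q + 1 : ℕ) : ℤ) ∣ 2 := by
      have h6 := (dvd_neg (a := ((q + 1 : ℕ) : ℤ))).2 h4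
      have h7 : -(-(-(q : ℤ)) ^ n - 1 + ((-(q : ℤ)) ^ n - 1)) = 2 := by ring
      rwa [h7] at h6
    have := Int.le_of_dvd (by norm_num) h5
    push_cast at this
    omega

/-- Weil operator -/
noncomputable def om [Fintype V] (q : ℕ) (ρ : V → Module.End ℂ X) (κ : V → V → ℂ) (g : AA V) :
    Module.End ℂ X := (nu q g)⁻¹ • wb ρ κ g

omit H in
theorem om_def [Fintype V] (g : AA V) : om q ρ κ g = (nu q g)⁻¹ • wb ρ κ g := rfl

theorem Hs.om_comm [Fintype V] {g : AA V} (hg : ∀ u v, κ (g u) (g v) = κ u v) (y : V) :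
    om q ρ κ g * ρ y = ρ (g y) * om q ρ κ g := by
  rw [om_def, smul_mul_assoc, H.wb_comm hg, mul_smul_comm]

theorem Hs.om_inv [Fintype V] (hq : 2 ≤ q) {g : AA V} (hg : Gd N q κ g) :
    om q ρ κ g * om q ρ κ g⁻¹ = 1 := by
  simp only [om_def]
  rw [smul_mul_smul_comm, H.wb_inv hg.k, nu_inv H, nu_sq H hq hg, smul_smul]
  have := nu_ne H hq g
  rw [← _root_.mul_inv, inv_mul_cancel₀ (mul_ne_zero this this), one_smul]

theorem Hs.om_mul [Fintype V] (hq : 2 ≤ q) (hN : Nat.card N = q + 1)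
    (hk : ∀ (a : N) u v, κ (a • u) (a • v) = κ u v) (hf : ∀ (a : N) (u : V), a • u = u → u ≠ 0 → a = 1)
    {g g' : AA V} (hg : Gd N q κ g) (hg' : Gd N q κ g') (hgg : Gd N q κ (g * g')) :
    om q ρ κ (g * g') = om q ρ κ g * om q ρ κ g' := by
  classical
  have e1 : om q ρ κ g * om q ρ κ g' * om q ρ κ (g * g')⁻¹ = 1 := by
    simp only [om_def]
    rw [smul_mul_smul_comm, smul_mul_smul_comm,
      H.triple hg.k hg'.k (hgg.inv H).k (mul_inv_cancel _),
      H.gs_val hq hN hk hf hg hg' (hgg.inv H) (mul_inv_cancel _), smul_smul,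
      ← _root_.mul_inv, ← _root_.mul_inv, inv_mul_cancel₀, one_smul]
    exact mul_ne_zero (mul_ne_zero (nu_ne H hq _) (nu_ne H hq _)) (nu_ne H hq _)
  have e2 := H.om_inv hq (hgg.inv H)
  rw [inv_inv] at e2
  calc om q ρ κ (g * g') = (om q ρ κ g * om q ρ κ g' * om q ρ κ (g * g')⁻¹) * om q ρ κ (g * g') := by
        rw [e1, one_mul]
    _ = om q ρ κ g * om q ρ κ g' := by rw [mul_assoc, e2, mul_one]

end tri
end UCS

set_option linter.unusedSectionVars false
namespace UCS

theorem exists_eig {X : Type} [AddCommGroup X] [Module ℂ X] [FiniteDimensional ℂ X]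
    (f : Module.End ℂ X) (W : Submodule ℂ X) (hW : W ≠ ⊥) (hf : ∀ x ∈ W, f x ∈ W) :
    ∃ μ : ℂ, ∃ x ∈ W, x ≠ 0 ∧ f x = μ • x := by
  have : Nontrivial W := (Submodule.nontrivial_iff_ne_bot).2 hW
  obtain ⟨μ, hμ⟩ := Module.End.exists_eigenvalue (f.restrict hf)
  obtain ⟨x, hx⟩ := hμ.exists_hasEigenvector
  refine ⟨μ, x.1, x.2, fun h => hx.2 (Subtype.ext h), ?_⟩
  have := congrArg Subtype.val hx.apply_eq_smul
  simpa using this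

theorem exists_joint {X I : Type} [AddCommGroup X] [Module ℂ X] [FiniteDimensional ℂ X] [Nontrivial X]
    (f : I → Module.End ℂ X) (hc : ∀ i j, f i * f j = f j * f i) (S : Finset I) :
    ∃ l : I → ℂ, ∃ x : X, x ≠ 0 ∧ ∀ i ∈ S, f i x = l i • x := by
  classical
  induction S using Finset.induction_on with
  | empty =>
    obtain ⟨x, hx⟩ := exists_ne (0 : X)
    exact ⟨fun _ => 0, x, hx, by simp⟩
  | insert i S hi ih =>
    obtain ⟨l, x, hx, hl⟩ := ih
    let W : Submodule ℂ X := ⨅ j ∈ S, LinearMap.ker (f j - l j • 1)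
    have hW : ∀ y, y ∈ W ↔ ∀ j ∈ S, f j y = l j • y := by
      intro y
      simp [W, Submodule.mem_iInf, sub_eq_zero]
    obtain ⟨μ, y, hy, hy0, hμ⟩ := exists_eig (f i) W (by
      rw [Submodule.ne_bot_iff]; exact ⟨x, (hW x).2 hl, hx⟩) (by
      intro y hy
      rw [hW] at hy ⊢
      intro j hj
      have := LinearMap.congr_fun (hc j i) y
      simp only [Module.End.mul_apply] at this
      rw [this, hy j hj, map_smul])
    refine ⟨Function.update l i μ, y, hy0, ?_⟩
    intro j hj
    rcases Finset.mem_insert.1 hj with rfl | hj'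
    · rw [Function.update_self, hμ]
    · rw [Function.update_of_ne (by rintro rfl; exact hi hj'), (hW y).1 hy j hj']

section kill
variable {V X : Type} [AddCommGroup V] [AddCommGroup X] [Module ℂ X] [Nontrivial X]
    {ρ : V → Module.End ℂ X} {κ : V → V → ℂ} (H : Hs ρ κ)
include H

theorem nu_conj (q : ℕ) (g c : AA V) : nu q (c * g * c⁻¹) = nu q g := by
  have : Nat.card {u : V // (c * g * c⁻¹) u = u} = Nat.card {u : V // g u = u} := by
    apply Nat.card_congr
    exact
      { toFun := fun u => ⟨c⁻¹ u.1, by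
          have := u.2
          simp only [AA.mul_apply] at this
          apply c.inj
          rw [this, AA.apply_inv_self]⟩
        invFun := fun u => ⟨c u.1, by
          simp only [AA.mul_apply]
          rw [AA.inv_apply_self, u.2]⟩
        left_inv := fun u => Subtype.ext (AA.apply_inv_self _ _)
        right_inv := fun u => Subtype.ext (AA.inv_apply_self _ _) }
  rw [nu, this, nu]

theorem Hs.wb_T [Fintype V] {T : Module.End ℂ X} {g g' : AA V} (hT : ∀ u, T * ρ u = ρ (g u) * T)
    (hg : ∀ u v, κ (g u) (g v) = κ u v) :
    T * wb ρ κ g' = wb ρ κ (g * g' * g⁻¹) * T := by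
  rw [wb, wb, Finset.mul_sum, Finset.sum_mul]
  rw [← Equiv.sum_comp (EquivLike.toEquiv g : V ≃ V) (fun u => ρ ((g * g' * g⁻¹) u) * Ri ρ κ u * T)]
  apply Finset.sum_congr rfl
  intro u _
  show _ = ρ ((g * g' * g⁻¹) (g u)) * Ri ρ κ (g u) * T
  rw [AA.mul_apply, AA.mul_apply, AA.inv_apply_self, ← mul_assoc, hT, mul_assoc, mul_assoc, Ri, Ri, hg,
    mul_smul_comm, hT, smul_mul_assoc]

theorem Hs.om_T [Fintype V] {q : ℕ} {T : Module.End ℂ X} {g g' : AA V} (hT : ∀ u, T * ρ u = ρ (g u) * T)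
    (hg : ∀ u v, κ (g u) (g v) = κ u v) :
    T * om q ρ κ g' = om q ρ κ (g * g' * g⁻¹) * T := by
  simp only [om_def]
  rw [mul_smul_comm, H.wb_T hT hg, nu_conj H, smul_mul_assoc]

variable {B : X →ₗ[ℂ] X →ₗ[ℂ] ℂ} {c : AA V}

theorem Hs.B_mv (hc2 : ∀ u, c (c u) = u) (hck : ∀ u v, κ (c u) (c v) = κ v u)
    (hB : ∀ u x y, B (ρ u x) (ρ (c u) y) = κ u u * B x y) (u : V) (x y : X) :
    B (ρ u x) y = B x (ρ (c u) y) := by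
  have h1 := hB u x (Ri ρ κ (c u) y)
  have h2 : ρ (c u) (Ri ρ κ (c u) y) = y := by
    rw [← Module.End.mul_apply, H.mul_inv]; rfl
  rw [h2] at h1
  rw [h1, Ri, hck, LinearMap.smul_apply, map_smul, smul_eq_mul, ← mul_assoc, H.sq', one_mul]

theorem Hs.B_wb [Fintype V] (hc2 : ∀ u, c (c u) = u) (hck : ∀ u v, κ (c u) (c v) = κ v u)
    (hB : ∀ u x y, B (ρ u x) (ρ (c u) y) = κ u u * B x y) {g : AA V}
    (hg : ∀ u v, κ (g u) (g v) = κ u v) (x y : X) :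
    B (wb ρ κ g x) y = B x (wb ρ κ (c * g * c⁻¹)⁻¹ y) := by
  have hmv := H.B_mv hc2 hck hB
  rw [wb, wb, LinearMap.sum_apply, LinearMap.sum_apply, map_sum, LinearMap.sum_apply, map_sum]
  rw [← Equiv.sum_comp (EquivLike.toEquiv (c * g) : V ≃ V)
    (fun u => B x ((ρ ((c * g * c⁻¹)⁻¹ u) * Ri ρ κ u) y))]
  apply Finset.sum_congr rfl
  intro u _
  show _ = B x ((ρ ((c * g * c⁻¹)⁻¹ ((c * g) u)) * Ri ρ κ ((c * g) u)) y)
  have e : (c * g * c⁻¹)⁻¹ ((c * g) u) = c u := by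
    rw [← AA.mul_apply]
    have : (c * g * c⁻¹)⁻¹ * (c * g) = c := by group
    rw [this]
  rw [e, AA.mul_apply, Module.End.mul_apply, Module.End.mul_apply, hmv, Ri, Ri, LinearMap.smul_apply,
    LinearMap.smul_apply, map_smul, map_smul, map_smul, LinearMap.smul_apply, hck, hg, hmv]

theorem Hs.B_om [Fintype V] {q : ℕ} {N : Type} [Group N] [Finite N] [DistribMulAction N V]
    (hq : 2 ≤ q) (hc2 : ∀ u, c (c u) = u) (hck : ∀ u v, κ (c u) (c v) = κ v u)
    (hB : ∀ u x y, B (ρ u x) (ρ (c u) y) = κ u u * B x y) {g : AA V}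
    (hg : Gd N q κ g) (hg' : Gd N q κ (c * g * c⁻¹)) (x y : X) :
    B (om q ρ κ g x) (om q ρ κ (c * g * c⁻¹) y) = B x y := by
  have h1 : ∀ x y, B (om q ρ κ g x) y = B x (om q ρ κ (c * g * c⁻¹)⁻¹ y) := by
    intro x y
    simp only [om_def, LinearMap.smul_apply, map_smul]
    rw [H.B_wb hc2 hck hB hg.k, nu_inv H, nu_conj H]
  have h2 := H.om_inv hq (hg'.inv H)
  rw [inv_inv] at h2
  rw [h1, ← Module.End.mul_apply, h2]; rfl

/-- the Heisenberg case -/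
theorem Hs.kill [Finite V] [FiniteDimensional ℂ X] {q : ℕ} {N : Type} [Group N] [Finite N]
    [DistribMulAction N V] (hq : 2 ≤ q) (hN : Nat.card N = q + 1)
    (hk : ∀ (a : N) u v, κ (a • u) (a • v) = κ u v) (hf : ∀ (a : N) (u : V), a • u = u → u ≠ 0 → a = 1)
    (hc2 : ∀ u, c (c u) = u) (hck : ∀ u v, κ (c u) (c v) = κ v u)
    (hB : ∀ u x y, B (ρ u x) (ρ (c u) y) = κ u u * B x y)
    (G : Subgroup (AA V)) (hG : ∀ g ∈ G, Gd N q κ g) (hcG : Nrm G c) (hNS : NoSkew G c)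
    (T : AA V → Module.End ℂ X) (hT : IsRepOn G T) (hTρ : ∀ g ∈ G, ∀ u, T g * ρ u = ρ (g u) * T g)
    (hBT : Inv G c T B) (hs : ∀ x y, B x y = - B y x)
    (hirr : ∀ W : Submodule ℂ X, (∀ u, ∀ x ∈ W, ρ u x ∈ W) → Stab G T W → W = ⊥ ∨ W = ⊤) : B = 0 := by
  classical
  have := Fintype.ofFinite V
  let P : AA V → Module.End ℂ X := fun g => om q ρ κ g⁻¹ * T g
  have om1 : om q ρ κ 1 = 1 := by
    have h1 := H.om_mul hq hN hk hf (hG 1 G.one_mem) (hG 1 G.one_mem)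
      (by rw [mul_one]; exact hG 1 G.one_mem)
    have h2 := H.om_inv hq (hG 1 G.one_mem)
    rw [mul_one] at h1
    rw [inv_one, ← h1] at h2
    exact h2
  have hP : IsRepOn G P := by
    constructor
    · simp only [P]
      rw [inv_one, hT.one, om1, one_mul]
    · intro g hg k hk'
      simp only [P]
      rw [hT.mul g hg k hk', mul_inv_rev]
      have e1 := H.om_mul hq hN hk hf (hG _ (G.inv_mem hg))
        (hG (g * k⁻¹ * g⁻¹) (G.mul_mem (G.mul_mem hg (G.inv_mem hk')) (G.inv_mem hg)))
        (hG _ (G.mul_mem (G.inv_mem hg) (G.mul_mem (G.mul_mem hg (G.inv_mem hk')) (G.inv_mem hg))))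
      have e2 : g⁻¹ * (g * k⁻¹ * g⁻¹) = k⁻¹ * g⁻¹ := by group
      rw [e2] at e1
      rw [e1]
      calc om q ρ κ g⁻¹ * om q ρ κ (g * k⁻¹ * g⁻¹) * (T g * T k)
          = om q ρ κ g⁻¹ * (om q ρ κ (g * k⁻¹ * g⁻¹) * T g) * T k := by simp only [mul_assoc]
        _ = _ := by
          rw [← H.om_T (hTρ g hg) (hG g hg).k]; simp only [mul_assoc]
  have hPρ : ∀ g ∈ G, ∀ u, P g * ρ u = ρ u * P g := by
    intro g hg u
    simp only [P]
    rw [mul_assoc, hTρ g hg, ← mul_assoc, H.om_comm (kinv (hG g hg).k), AA.inv_apply_self, mul_assoc]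
  have hBP : Inv G c P B := by
    intro g hg x y
    simp only [P]
    have e : (c * g * c⁻¹)⁻¹ = c * g⁻¹ * c⁻¹ := by group
    rw [e, Module.End.mul_apply, Module.End.mul_apply,
      H.B_om hq hc2 hck hB (hG _ (G.inv_mem hg)) (hG _ (hcG.mem _ (G.inv_mem hg))), hBT g hg]
  -- joint eigenspace
  obtain ⟨l, x0, hx0, hl⟩ := exists_joint (fun u : {u : V // c u = u} => ρ u.1) (by
    rintro ⟨u, hu⟩ ⟨v, hv⟩
    show ρ u * ρ v = ρ v * ρ u
    have := hck u v
    rw [hu, hv] at this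
    rw [H.mul, H.mul, this, add_comm]) Finset.univ
  let Y0 : Submodule ℂ X := ⨅ u : {u : V // c u = u}, LinearMap.ker (ρ u.1 - l u • 1)
  have hY0 : ∀ y, y ∈ Y0 ↔ ∀ u : {u : V // c u = u}, ρ u.1 y = l u • y := by
    intro y
    simp [Y0, Submodule.mem_iInf, sub_eq_zero]
  have hl2 : ∀ u, l u * l u = κ u.1 u.1 := by
    intro u
    have h1 : (ρ u.1 * ρ u.1) x0 = κ u.1 u.1 • x0 := by rw [H.mul, H.two, H.zero]; rfl
    rw [Module.End.mul_apply, hl u (Finset.mem_univ _), map_smul, hl u (Finset.mem_univ _), smul_smul] at h1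
    exact smul_left_injective ℂ hx0 h1
  obtain ⟨Y, hYY, hYm, hYi⟩ := hNS.exists_isotropic hP hcG Y0
    (by rw [Submodule.ne_bot_iff]; exact ⟨x0, (hY0 _).2 fun u => hl u (Finset.mem_univ _), hx0⟩)
    (by
      intro g hg x hx
      rw [hY0] at hx ⊢
      intro u
      have := LinearMap.congr_fun (hPρ g hg u.1) x
      simp only [Module.End.mul_apply] at this
      rw [← this, hx, map_smul]) B (fun g hg x _ y _ => hBP g hg x y) (fun x _ y _ => hs x y)
  have hχ : ∀ z, c z ≠ z → ∃ u, c u = u ∧ κ u z * κ z u ≠ 1 := by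
    intro z hz
    have hw : z + c z ≠ 0 := by
      intro h
      apply hz
      have : c z = z + (z + c z) := by rw [← add_assoc, H.two, zero_add]
      rw [this, h, add_zero]
    obtain ⟨y, hy⟩ := H.nd _ hw
    refine ⟨y + c y, by rw [map_add, hc2, add_comm], ?_⟩
    rw [H.chi_add]
    have e1 : κ (c y) z * κ z (c y) = κ (c z) y * κ y (c z) := by
      have a1 := hck y (c z)
      have a2 := hck (c z) y
      rw [hc2] at a1 a2
      rw [a1, a2]
    rw [e1]
    have e2 := H.chi_add z (c z) y
    intro h
    apply hy
    have h3 : κ y (z + c z) * κ (z + c z) y = 1 := by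
      rw [mul_comm, e2, ← h]; ring
    calc κ y (z + c z) = κ y (z + c z) * (κ (z + c z) y * κ (z + c z) y) := by rw [H.sq', mul_one]
      _ = _ := by rw [← mul_assoc, h3, one_mul]
  have hzero : ∀ z, ∀ x ∈ Y, ∀ y ∈ Y, B (ρ z x) y = 0 := by
    intro z x hx y hy
    have hx' := (hY0 x).1 (hYY hx)
    have hy' := (hY0 y).1 (hYY hy)
    by_cases hz : c z = z
    · rw [hx' ⟨z, hz⟩, map_smul, LinearMap.smul_apply, hYi x hx y hy, smul_zero]
    · obtain ⟨u, hu, hne⟩ := hχ z hz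
      have h1 := hB u (ρ z x) y
      have h2 : ρ u (ρ z x) = (κ u z * κ z u * l ⟨u, hu⟩) • ρ z x := by
        have := LinearMap.congr_fun (H.comm u z) x
        simp only [Module.End.mul_apply, LinearMap.smul_apply] at this
        rw [this, hx' ⟨u, hu⟩, map_smul, smul_smul]
      rw [h2, hu, hy' ⟨u, hu⟩, map_smul, map_smul, LinearMap.smul_apply, smul_eq_mul, smul_eq_mul,
        ← hl2 ⟨u, hu⟩] at h1
      have hln : l ⟨u, hu⟩ * l ⟨u, hu⟩ ≠ 0 := by
        rw [hl2]; rcases H.sq u u with h | h <;> rw [h] <;> norm_num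
      have h3 : (κ u z * κ z u - 1) * (l ⟨u, hu⟩ * l ⟨u, hu⟩) * B (ρ z x) y = 0 := by
        linear_combination h1
      rcases mul_eq_zero.1 h3 with h | h
      · exact absurd h (mul_ne_zero (sub_ne_zero.2 hne) hln)
      · exact h
  let Z : Submodule ℂ X := Submodule.span ℂ {w | ∃ u, ∃ y ∈ Y, w = ρ u y}
  have hZρ : ∀ u, ∀ x ∈ Z, ρ u x ∈ Z := by
    intro u x hx
    induction hx using Submodule.span_induction with
    | mem x hx =>
      obtain ⟨v, y, hy, rfl⟩ := hx
      rw [← Module.End.mul_apply, H.mul, LinearMap.smul_apply]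
      exact Z.smul_mem _ (Submodule.subset_span ⟨_, y, hy, rfl⟩)
    | zero => rw [map_zero]; exact Z.zero_mem
    | add a b _ _ ha hb => rw [map_add]; exact Z.add_mem ha hb
    | smul a b _ hb => rw [map_smul]; exact Z.smul_mem _ hb
  have hZom : ∀ g, ∀ x ∈ Z, om q ρ κ g x ∈ Z := by
    intro g x hx
    rw [om_def, LinearMap.smul_apply, wb, LinearMap.sum_apply]
    refine Z.smul_mem _ (Z.sum_mem fun u _ => ?_)
    rw [Module.End.mul_apply, Ri, LinearMap.smul_apply]
    exact hZρ _ _ (Z.smul_mem _ (hZρ _ _ hx))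
  have hYZ : Y ≤ Z := by
    intro y hy
    refine Submodule.subset_span ⟨0, y, hy, ?_⟩
    rw [H.zero]; rfl
  have hZT : Stab G T Z := by
    intro g hg x hx
    induction hx using Submodule.span_induction with
    | mem x hx =>
      obtain ⟨v, y, hy, rfl⟩ := hx
      rw [← Module.End.mul_apply, hTρ g hg, Module.End.mul_apply]
      apply hZρ
      have e : T g = om q ρ κ g * P g := by
        simp only [P]
        rw [← mul_assoc, H.om_inv hq (hG g hg), one_mul]
      rw [e, Module.End.mul_apply]
      exact hZom _ _ (hYZ (hYm.stab g hg y hy))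
    | zero => rw [map_zero]; exact Z.zero_mem
    | add a b _ _ ha hb => rw [map_add]; exact Z.add_mem ha hb
    | smul a b _ hb => rw [map_smul]; exact Z.smul_mem _ hb
  have hZt : Z = ⊤ := by
    rcases hirr Z hZρ hZT with h | h
    · exact absurd (le_bot_iff.1 (h ▸ hYZ)) hYm.ne
    · exact h
  have k1 : ∀ x ∈ Z, ∀ y ∈ Y, B x y = 0 := by
    intro x hx y hy
    induction hx using Submodule.span_induction with
    | mem x hx =>
      obtain ⟨v, w, hw, rfl⟩ := hx
      exact hzero v w hw y hy
    | zero => simp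
    | add a b _ _ ha hb => rw [map_add, LinearMap.add_apply, ha, hb, add_zero]
    | smul a b _ hb => rw [map_smul, LinearMap.smul_apply, hb, smul_zero]
  have k2 : ∀ x, ∀ y ∈ Z, B x y = 0 := by
    intro x y hy
    induction hy using Submodule.span_induction with
    | mem y hy =>
      obtain ⟨v, w, hw, rfl⟩ := hy
      have := H.B_mv hc2 hck hB (c v) x w
      rw [hc2] at this
      rw [← this]
      exact k1 _ (by rw [hZt]; trivial) w hw
    | zero => simp
    | add a b _ _ ha hb => rw [map_add, ha, hb, add_zero]
    | smul a b _ hb => rw [map_smul, hb, smul_zero]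
  ext x y
  exact k2 x y (by rw [hZt]; trivial)

end kill
end UCS

set_option linter.unusedSectionVars false
namespace UCS

/-- properties of the coefficient ring in characteristic two -/
structure LR (q : ℕ) (L : Type) [CommRing L] [StarRing L] : Prop where
  two : (1 : L) + 1 = 0
  nt : (1 : L) ≠ 0
  qf : ∀ x : L, star x = x → x = 0 ∨ ∃ y, x * y = 1
  tr : ∃ b : L, b + star b = 1
  hq : 2 ≤ q
  N : ∃ N : Subgroup Lˣ, Nat.card N = q + 1 ∧ (∀ a ∈ N, (a : L) * star (a : L) = 1) ∧
    ∀ a ∈ N, a ≠ 1 → ∃ y, ((a : L) - 1) * y = 1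
  card : ∀ (V : Type) [AddCommGroup V] [Module L V] [Finite V], ∃ k, Nat.card V = (q ^ 2) ^ k

section basicL
variable {q : ℕ} {L : Type} [CommRing L] [StarRing L] (hL : LR q L)
include hL

theorem LR.add_self (x : L) : x + x = 0 := by
  have : x + x = (1 + 1) * x := by ring
  rw [this, hL.two, zero_mul]

theorem LR.add_self' {V : Type} [AddCommGroup V] [Module L V] (x : V) : x + x = 0 := by
  have : x + x = (1 + 1 : L) • x := by rw [add_smul, one_smul]
  rw [this, hL.two, zero_smul]

theorem LR.neg (x : L) : -x = x := neg_eq_of_add_eq_zero_left (hL.add_self x)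

theorem LR.neg' {V : Type} [AddCommGroup V] [Module L V] (x : V) : -x = x :=
  neg_eq_of_add_eq_zero_left (hL.add_self' x)

theorem LR.star_inv {k y : L} (hk : star k = k) (hy : k * y = 1) : star y = y := by
  have h1 : k * star y = 1 := by
    have := congrArg star hy
    rwa [star_mul', hk, star_one] at this
  calc star y = (k * y) * star y := by rw [hy, one_mul]
    _ = y * (k * star y) := by ring
    _ = y := by rw [h1, mul_one]

theorem LR.tr_nd {r : L} (hr : r ≠ 0) : ∃ l, l * r + star (l * r) = 1 := by
  have h1 : ∃ l, l * r + star (l * r) ≠ 0 := by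
    by_contra! hcon
    have h2 := hcon 1
    rw [one_mul] at h2
    have h3 : star r = r := by
      have := eq_neg_of_add_eq_zero_right h2
      rw [this, hL.neg]
    rcases hL.qf r h3 with h4 | ⟨y, hy⟩
    · exact hr h4
    · obtain ⟨b, hb⟩ := hL.tr
      have := hcon (b * y)
      rw [mul_assoc, mul_comm y, hy, mul_one, hb] at this
      exact hL.nt this
  obtain ⟨l, hl⟩ := h1
  have hs : star (l * r + star (l * r)) = l * r + star (l * r) := by
    rw [star_add, star_star, add_comm]
  rcases hL.qf _ hs with h2 | ⟨y, hy⟩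
  · exact absurd h2 hl
  · refine ⟨y * l, ?_⟩
    rw [mul_assoc, star_mul', hL.star_inv hs hy, ← mul_add, mul_comm, hy]

variable {V : Type} [AddCommGroup V] [Module L V] {h : V → V → L} {t : Empty → Module.End L V}

theorem LR.unit_hvv (H : Sp h t) {v : V} (hv : h v v ≠ 0) : ∃ y, h v v * y = 1 ∧ star y = y := by
  rcases hL.qf _ (H.herm v v).symm with h1 | ⟨y, hy⟩
  · exact absurd h1 hv
  · exact ⟨y, hy, hL.star_inv (H.herm v v).symm hy⟩

end basicL

section proj
variable {L : Type} [CommRing L] [StarRing L]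
  {V : Type} [AddCommGroup V] [Module L V] {h : V → V → L} {t : Empty → Module.End L V}

theorem Spl.of_proj (H : Sp h t) {P : Module.End L V} (ha : Adj h P P)
    (hi : P * P = P) : Spl h t (LinearMap.range P) (LinearMap.ker P) where
  compl := by
    have := LinearMap.isCompl_of_proj (p := LinearMap.range P) (f := P.rangeRestrict) (by
      rintro ⟨_, v, rfl⟩
      apply Subtype.ext
      exact LinearMap.congr_fun hi v)
    rwa [LinearMap.ker_rangeRestrict] at this
  orth := by
    rintro _ ⟨v, rfl⟩ w hw
    rw [ha, LinearMap.mem_ker.1 hw, H.zero_right]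
  st := fun i => i.elim
  st' := fun i => i.elim

theorem exists_antiW {P : Module.End L V} (hi : P * P = P) (f : V → V)
    (hadd : ∀ x y, f (x + y) = f x + f y) (hs : ∀ (a : L) x, f (a • x) = star a • f x)
    (hP : ∀ x, P (f x) = f x) (hf : ∀ x, f (f x) = P x)
    (hh : ∀ x y, h (f x) (f y) = star (h (P x) (P y)))
    (st : ∀ (i : Empty), ∀ w ∈ LinearMap.range P, t i w ∈ LinearMap.range P) :
    ∃ c : AA (LinearMap.range P), Anti (rs _ h) (rt st) c ∧ ∀ w, (c w : V) = f w := by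
  have hw : ∀ w : LinearMap.range P, P w = w := by
    rintro ⟨_, x, rfl⟩
    exact LinearMap.congr_fun hi x
  refine ⟨AA.ofInvol (fun w => ⟨f w, f w, hP _⟩) ?_ ?_, ⟨?_, ?_, ?_, fun i => i.elim⟩, fun w => rfl⟩
  · intro x y; exact Subtype.ext (hadd _ _)
  · intro x; exact Subtype.ext ((hf _).trans (hw _))
  · intro x; exact Subtype.ext ((hf _).trans (hw _))
  · intro a x; exact Subtype.ext (hs _ _)
  · intro x y
    show h (f x) (f y) = star (h x y)
    rw [hh, hw, hw]

/-- rank one projection -/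
def aP (H : Sp h t) (v : V) (y : L) : Module.End L V where
  toFun x := (h x v * y) • v
  map_add' a b := by rw [H.add_left, add_mul, add_smul]
  map_smul' a b := by rw [H.smul_left, RingHom.id_apply, smul_smul, mul_assoc]

theorem aP_apply (H : Sp h t) (v : V) (y : L) (x : V) : aP H v y x = (h x v * y) • v := rfl

theorem aP_adj (H : Sp h t) {v : V} {y : L} (hy : star y = y) : Adj h (aP H v y) (aP H v y) := by
  intro x z
  rw [aP_apply, aP_apply, H.smul_left, H.smul_right, star_mul', hy, ← H.herm z v]
  ring

theorem aP_idem (H : Sp h t) {v : V} {y : L} (hv : h v v * y = 1) :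
    aP H v y * aP H v y = aP H v y := by
  ext x
  rw [Module.End.mul_apply, aP_apply, aP_apply, H.smul_left, mul_assoc, hv, mul_one]

theorem aP_self (H : Sp h t) {v : V} {y : L} (hv : h v v * y = 1) : aP H v y v = v := by
  rw [aP_apply, hv, one_smul]

theorem exists_antiA (H : Sp h t) {v : V} {y : L} (hv : h v v * y = 1) (hy : star y = y) 
    (st : ∀ (i : Empty), ∀ w ∈ LinearMap.range (aP H v y), t i w ∈ LinearMap.range (aP H v y)) :
    ∃ c : AA (LinearMap.range (aP H v y)), Anti (rs _ h) (rt st) c ∧ 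
      ∀ w, (c w : V) = star (h w v * y) • v := by
  have hvv : star (h v v) = h v v := (H.herm v v).symm
  refine exists_antiW (aP_idem H hv) (fun x => star (h x v * y) • v) ?_ ?_ ?_ ?_ ?_ st
  · intro a b; rw [H.add_left, add_mul, star_add, add_smul]
  · intro a b; rw [H.smul_left, mul_assoc, star_mul', smul_smul]
  · intro x; rw [map_smul, aP_self H hv]
  · intro x; rw [H.smul_left, mul_assoc, hv, mul_one, star_star, aP_apply]
  · intro a b
    rw [aP_apply, aP_apply, H.smul_left, H.smul_left, H.smul_right, H.smul_right, star_mul',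
      star_mul']
    simp only [star_mul', star_star, hvv]

/-- hyperbolic pairs -/
structure Hyp (h : V → V → L) (v f : V) : Prop where
  vv : h v v = 0
  ff : h f f = 0
  vf : h v f = 1

theorem Hyp.fv (H : Sp h t) {v f : V} (y : Hyp h v f) : h f v = 1 := by
  rw [H.herm v f, y.vf, star_one]

/-- rank two projection -/
def hP (H : Sp h t) (v f : V) : Module.End L V where
  toFun x := h x f • v + h x v • f
  map_add' a b := by rw [H.add_left, H.add_left, add_smul, add_smul]; abel
  map_smul' a b := by
    rw [H.smul_left, H.smul_left, RingHom.id_apply, smul_add, smul_smul, smul_smul]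

theorem hP_apply (H : Sp h t) (v f x : V) : hP H v f x = h x f • v + h x v • f := rfl

section hyp
variable (H : Sp h t) {v f : V} (y : Hyp h v f)
include y

theorem hP_adj : Adj h (hP H v f) (hP H v f) := by
  intro x z
  rw [hP_apply, hP_apply, H.add_left, H.add_right, H.smul_left, H.smul_left, H.smul_right,
    H.smul_right, ← H.herm z f, ← H.herm z v]
  ring

theorem hP_v : hP H v f v = v := by
  rw [hP_apply, y.vv, y.vf]; simp

theorem hP_f : hP H v f f = f := by
  rw [hP_apply, y.ff, y.fv H]; simp

theorem hP_idem : hP H v f * hP H v f = hP H v f := by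
  ext x
  rw [Module.End.mul_apply, hP_apply H v f x, map_add, map_smul, map_smul, hP_v H y, hP_f H y]

theorem hP_ker {x : V} : x ∈ LinearMap.ker (hP H v f) ↔ h x v = 0 ∧ h x f = 0 := by
  rw [LinearMap.mem_ker, hP_apply]
  constructor
  · intro e
    constructor
    · have := congrArg (fun z => h z v) e
      simpa only [H.add_left, H.smul_left, y.vv, y.fv H, mul_zero, zero_add, mul_one, H.zero_left]
        using this
    · have := congrArg (fun z => h z f) e
      simpa only [H.add_left, H.smul_left, y.ff, y.vf, mul_zero, add_zero, mul_one, H.zero_left]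
        using this
  · rintro ⟨a, b⟩; rw [a, b]; simp

theorem Hyp.spl : Spl h t (LinearMap.range (hP H v f)) (LinearMap.ker (hP H v f)) :=
  Spl.of_proj H (hP_adj H y) (hP_idem H y)

theorem exists_antiH  :
    ∃ c : AA (LinearMap.range (hP H v f)), Anti (rs _ h) (rt (y.spl H).st) c ∧ 
      ∀ w, (c w : V) = star (h w f) • v + star (h w v) • f := by
  have e1 : ∀ a b : L, h (a • v + b • f) f = a := by
    intro a b; rw [H.add_left, H.smul_left, H.smul_left, y.vf, y.ff]; ring
  have e2 : ∀ a b : L, h (a • v + b • f) v = b := by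
    intro a b; rw [H.add_left, H.smul_left, H.smul_left, y.vv, y.fv H]; ring
  refine exists_antiW (hP_idem H y) (fun x => star (h x f) • v + star (h x v) • f) ?_ ?_ ?_ ?_ ?_ 
    (y.spl H).st
  · intro a b; rw [H.add_left, H.add_left, star_add, star_add, add_smul, add_smul]; abel
  · intro a b; rw [H.smul_left, H.smul_left, star_mul', star_mul', smul_add, smul_smul, smul_smul]
  · intro x; rw [map_add, map_smul, map_smul, hP_v H y, hP_f H y]
  · intro x; rw [e1, e2, star_star, star_star, hP_apply]
  · intro a b
    simp only [hP_apply, H.add_left, H.add_right, H.smul_left, H.smul_right, y.vv, y.ff, y.vf,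
      y.fv H, star_star, star_add, star_mul', star_zero, star_one]

end hyp
end proj

section exist
variable {q : ℕ} {L : Type} [CommRing L] [StarRing L] (hL : LR q L)
include hL

theorem LR.exists_aniso {V : Type} [AddCommGroup V] [Module L V] {h : V → V → L}
    {t : Empty → Module.End L V} (H : Sp h t) {v : V} (hv : v ≠ 0) : ∃ x, h x x ≠ 0 := by
  by_contra! hcon
  apply hv
  apply H.nd
  intro w
  by_contra hr
  obtain ⟨l, hl⟩ := hL.tr_nd hr
  have := hcon (l • v + w)
  rw [H.add_left, H.add_right, H.add_right, hcon, hcon, H.herm (l • v) w, H.smul_left, zero_add, 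
    add_zero, hl] at this
  exact hL.nt this

theorem LR.exA : ∀ (n : ℕ) (V : Type) [AddCommGroup V] [Module L V] [Finite V] (h : V → V → L)
    (t : Empty → Module.End L V), Sp h t → Nat.card V = n → ∃ c, Anti h t c := by
  intro n
  induction n using Nat.strong_induction_on with
  | _ n ih =>
  intro V _ _ _ h t H hn
  by_cases h0 : ∃ v : V, v ≠ 0
  · obtain ⟨v, hv⟩ := h0
    obtain ⟨x, hx⟩ := hL.exists_aniso H hv
    obtain ⟨y, hy, hy'⟩ := hL.unit_hvv H hx
    have S := Spl.of_proj H (aP_adj H hy') (aP_idem H hy)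
    obtain ⟨c1, h1, -⟩ := exists_antiA H hy hy' S.st
    obtain ⟨c2, h2⟩ := ih _ (hn ▸ card_lt_of_ne_top (W := LinearMap.ker (aP H x y)) (by
      intro e
      have : x ∈ LinearMap.ker (aP H x y) := by rw [e]; trivial
      rw [LinearMap.mem_ker, aP_self H hy] at this
      rw [this, H.zero_left] at hx
      exact hx rfl)) _ _ _ ((S.symm H).sp H) rfl
    exact ⟨_, S.glue_anti H h1 h2⟩
  · push Not at h0
    exact ⟨1, fun v => rfl, fun a v => by rw [h0 v]; simp, fun v w => by
      rw [h0 v, AA.one_apply, H.zero_left, H.zero_left, star_zero], fun i => i.elim⟩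

variable {V : Type} [AddCommGroup V] [Module L V] [Finite V] {h : V → V → L}
    {t : Empty → Module.End L V} (H : Sp h t)
include H

theorem LR.exA_aniso {v : V} (hv : h v v ≠ 0) : ∃ c, Anti h t c ∧ c v = v := by
  obtain ⟨y, hy, hy'⟩ := hL.unit_hvv H hv
  have S := Spl.of_proj H (aP_adj H hy') (aP_idem H hy)
  obtain ⟨c1, h1, h1'⟩ := exists_antiA H hy hy' S.st
  obtain ⟨c2, h2⟩ := hL.exA _ _ _ _ ((S.symm H).sp H) rfl
  refine ⟨_, S.glue_anti H h1 h2, ?_⟩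
  have hm : v ∈ LinearMap.range (aP H v y) := ⟨v, aP_self H hy⟩
  have := glue_left S.compl c1 c2 ⟨v, hm⟩
  rw [h1'] at this
  rw [this]
  show star (h v v * y) • v = v
  rw [hy, star_one, one_smul]

theorem LR.exists_hyp {v : V} (hv : h v v = 0) (hp : ∀ l : L, l • v = 0 → l = 0) :
    ∃ f, Hyp h v f := by
  have h1 : ∃ w, h v w * star (h v w) ≠ 0 := by
    by_contra! hcon
    have h2 : ∀ w w', h v w * star (h v w') = 0 := by
      intro w w'
      by_contra hr
      obtain ⟨l, hl⟩ := hL.tr_nd hr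
      have := hcon (star l • w + w')
      rw [H.add_right, H.smul_right, star_add, star_star, add_mul, mul_add, mul_add, hcon w'] at this
      have e : l * h v w * star (l * h v w) = 0 := by
        rw [star_mul']
        calc _ = l * star l * (h v w * star (h v w)) := by ring
          _ = 0 := by rw [hcon, mul_zero]
      rw [e, zero_add, add_zero, mul_assoc] at this
      have e2 : h v w' * star (l * h v w) = star (l * (h v w * star (h v w'))) := by
        rw [star_mul', star_mul', star_mul', star_star]; ring
      rw [e2, hl] at this
      exact hL.nt this
    have h3 : ∀ w, h v w = 0 := by
      intro w
      have : star (h v w) = 0 := by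
        apply hp
        apply H.nd
        intro w'
        rw [H.smul_left, mul_comm, h2]
      rw [← star_star (h v w), this, star_zero]
    have := H.nd v h3
    exact hL.nt (hp 1 (by rw [this, smul_zero]))
  obtain ⟨w, hw⟩ := h1
  have hs : star (h v w * star (h v w)) = h v w * star (h v w) := by
    rw [star_mul', star_star, mul_comm]
  rcases hL.qf _ hs with h2 | ⟨y, hy⟩
  · exact absurd h2 hw
  obtain ⟨f, hf⟩ : ∃ f, h v f = 1 := ⟨star (y * star (h v w)) • w, by
    rw [H.smul_right, star_star, ← hy]; ring⟩
  have hf' : h f v = 1 := by rw [H.herm v f, hf, star_one]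
  obtain ⟨b, hb⟩ := hL.tr
  refine ⟨f + (b * h f f) • v, hv, ?_, ?_⟩
  · rw [H.add_left, H.add_right, H.add_right, H.smul_left, H.smul_left, H.smul_right, H.smul_right,
      hf, hf', hv, star_mul', ← H.herm f f]
    calc _ = h f f + (b + star b) * h f f := by ring
      _ = 0 := by rw [hb, one_mul, hL.add_self]
  · rw [H.add_right, H.smul_right, hv, hf, mul_zero, add_zero]

theorem LR.exA_hyp {v f : V} (y : Hyp h v f) : ∃ (cW : AA (LinearMap.range (hP H v f)))
    (c0 : AA (LinearMap.ker (hP H v f))), Anti (rs _ h) (rt (y.spl H).st') c0 ∧ 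
    Anti h t (glue (y.spl H).compl cW c0) ∧ glue (y.spl H).compl cW c0 v = v ∧ 
    glue (y.spl H).compl cW c0 f = f := by
  obtain ⟨c1, h1, h1'⟩ := exists_antiH H y
  obtain ⟨c2, h2⟩ := hL.exA _ _ _ _ (((y.spl H).symm H).sp H) rfl
  refine ⟨c1, c2, h2, (y.spl H).glue_anti H h1 h2, ?_, ?_⟩
  · have hm : v ∈ LinearMap.range (hP H v f) := ⟨v, hP_v H y⟩
    have := glue_left (y.spl H).compl c1 c2 ⟨v, hm⟩
    rw [h1'] at this
    rw [this]
    simp [y.vv, y.vf]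
  · have hm : f ∈ LinearMap.range (hP H v f) := ⟨f, hP_f H y⟩
    have := glue_left (y.spl H).compl c1 c2 ⟨f, hm⟩
    rw [h1'] at this
    rw [this]
    simp [y.ff, y.fv H]

end exist

section Et
variable {L : Type} [CommRing L] [StarRing L]
  {V : Type} [AddCommGroup V] [Module L V] {h : V → V → L} {t : Empty → Module.End L V}
  (H : Sp h t) {v f : V} (y : Hyp h v f)

/-- the fixer of a vector in the unitary group -/
def Fx (h : V → V → L) (t : Empty → Module.End L V) (v : V) : Subgroup (AA V) where
  carrier := {g | g ∈ U h t ∧ g v = v}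
  one_mem' := ⟨one_mem _, rfl⟩
  mul_mem' := by
    rintro x y ⟨h1, h2⟩ ⟨h3, h4⟩
    exact ⟨mul_mem h1 h3, by rw [AA.mul_apply, h4, h2]⟩
  inv_mem' := by
    rintro x ⟨h1, h2⟩
    refine ⟨inv_mem h1, ?_⟩
    apply x.inj
    rw [AA.apply_inv_self, h2]

theorem mem_Fx {g : AA V} : g ∈ Fx h t v ↔ g ∈ U h t ∧ g v = v := Iff.rfl

include H in
theorem Fx_nrm {c : AA V} (hc : Anti h t c) (hv : c v = v) : Nrm (Fx h t v) c := by
  have := hc.nrm H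
  refine ⟨this.sq, fun g hg => ⟨this.mem g hg.1, ?_⟩⟩
  rw [this.inv_eq, AA.mul_apply, AA.mul_apply, hv, hg.2, hv]

/-- transvection-type formula -/
def Ef (h : V → V → L) (v u : V) (s : L) (x : V) : V := x + h x u • v + h x v • u + (s * h x v) • v

include H y

theorem Ef_comp {u u' : V} (hu : h u v = 0) (hu' : h u' v = 0) (s s' : L) (x : V) :
    Ef h v u s (Ef h v u' s' x) = Ef h v (u + u') (s + s' + h u' u) x := by
  have hvu : h v u = 0 := by rw [H.herm u v, hu, star_zero]
  simp only [Ef, H.add_left, H.add_right, H.smul_left, y.vv, hu, hu', hvu]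
  simp only [mul_zero, add_zero, add_smul, smul_add, add_mul]
  rw [mul_comm (h x v) (h u' u)]
  abel

omit y in
theorem Ef_zero (x : V) : Ef h v 0 0 x = x := by
  simp [Ef, H.zero_right]

/-- the transvection-type element -/
def Et (u : LinearMap.ker (hP H v f)) (s : L) : AA V :=
  ((⟨⟨Ef h v u s, Ef h v (-u) (h u u - s), by
      intro x
      have hu := ((hP_ker H y).1 u.2).1
      rw [Ef_comp H y (by rw [H.neg_left, hu, neg_zero]) hu]
      have : h u u - s + s + h (u : V) (-u) = 0 := by rw [H.neg_right]; ring
      rw [this, neg_add_cancel, Ef_zero H], by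
      intro x
      have hu := ((hP_ker H y).1 u.2).1
      rw [Ef_comp H y hu (by rw [H.neg_left, hu, neg_zero])]
      have : s + (h u u - s) + h (-u : V) (u) = 0 := by rw [H.neg_left]; ring
      rw [this, add_neg_cancel, Ef_zero H]⟩, by
      intro a b
      simp only [Ef, H.add_left, add_smul, mul_add]; abel⟩ : V ≃+ V) : AA V)

theorem Et_apply (u : LinearMap.ker (hP H v f)) (s : L) (x : V) :
    Et H y u s x = x + h x u • v + h x v • (u : V) + (s * h x v) • v := rfl

theorem Et_mul (u u' : LinearMap.ker (hP H v f)) (s s' : L) :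
    Et H y u s * Et H y u' s' = Et H y (u + u') (s + s' + h u' u) := by
  apply AA.ext
  intro x
  exact Ef_comp H y ((hP_ker H y).1 u.2).1 ((hP_ker H y).1 u'.2).1 s s' x

theorem Et_zero : Et H y 0 0 = 1 := AA.ext fun x => Ef_zero H x

theorem Et_v (u : LinearMap.ker (hP H v f)) (s : L) : Et H y u s v = v := by
  have hu := ((hP_ker H y).1 u.2).1
  have hvu : h v u = 0 := by rw [H.herm u v, hu, star_zero]
  rw [Et_apply, y.vv, hvu]; simp

theorem Et_mem {q : ℕ} (hL : LR q L) {u : LinearMap.ker (hP H v f)} {s : L}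
    (hs : s + star s + h u u = 0) : Et H y u s ∈ Fx h t v := by
  have hu := ((hP_ker H y).1 u.2).1
  have hvu : h v u = 0 := by rw [H.herm u v, hu, star_zero]
  refine ⟨⟨?_, ?_, fun i => i.elim⟩, Et_v H y u s⟩
  · intro a x
    simp only [Et_apply, H.smul_left, smul_add, smul_smul]
    rw [show s * (a * h x v) = a * (s * h x v) by ring]
  · intro x z
    simp only [Et_apply, H.add_left, H.add_right, H.smul_left, H.smul_right, y.vv, hu, hvu,
      star_mul', ← H.herm z v, ← H.herm z u]
    linear_combination (h x v * h v z) * hs + hL.add_self (h x u * h v z) +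
      hL.add_self (h x v * h u z)

theorem Et_conj {k : AA V} (hk : k ∈ Fx h t v) {u u' : LinearMap.ker (hP H v f)}
    (e : k u = u') (s : L) : k * Et H y u s * k⁻¹ = Et H y u' s := by
  rw [mul_inv_eq_iff_eq_mul]
  apply AA.ext
  intro x
  have e1 : h (k x) v = h x v := by rw [← hk.1.2.1 x v, hk.2]
  rw [AA.mul_apply, AA.mul_apply, Et_apply, Et_apply, map_add, map_add, map_add, hk.1.1, hk.1.1,
    hk.1.1, hk.2, e, ← e, hk.1.2.1, e1]

theorem Et_anti {k : AA V} (hk : Anti h t k) (hv : k v = v) {u u' : LinearMap.ker (hP H v f)}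
    (e : k u = u') (s : L) : k * Et H y u s * k⁻¹ = Et H y u' (star s) := by
  rw [mul_inv_eq_iff_eq_mul]
  apply AA.ext
  intro x
  have e1 : h (k x) v = star (h x v) := by rw [← hk.iso x v, hv]
  rw [AA.mul_apply, AA.mul_apply, Et_apply, Et_apply, map_add, map_add, map_add, hk.smul, hk.smul,
    hk.smul, hv, e, ← e, hk.iso, e1, star_mul']

theorem glue_fx {g : AA (LinearMap.ker (hP H v f))} (hg : g ∈ U (rs _ h) (rt (y.spl H).st')) :
    glue (y.spl H).compl 1 g ∈ Fx h t v :=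
  ⟨((y.spl H).glue_mem H).2 ⟨one_mem _, hg⟩, glue_left (y.spl H).compl 1 g ⟨v, v, hP_v H y⟩⟩

theorem Fx_factor [Finite V] {g : AA V} (hg : g ∈ Fx h t v) {q : ℕ} (hL : LR q L) :
    ∃ (u : LinearMap.ker (hP H v f)) (s : L) (g0 : AA (LinearMap.ker (hP H v f))),
    s + star s + h u u = 0 ∧ g0 ∈ U (rs _ h) (rt (y.spl H).st') ∧
    g = Et H y u s * glue (y.spl H).compl 1 g0 := by
  set s := h (g f) f with hs
  have e1 : h (g f) v = 1 := by
    have := hg.1.2.1 f v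
    rwa [hg.2, y.fv H] at this
  have e0 : h (g f) (g f) = 0 := by rw [hg.1.2.1, y.ff]
  have hu : g f - (s • v + f) ∈ LinearMap.ker (hP H v f) := by
    rw [hP_ker H y, H.sub_left, H.sub_left, H.add_left, H.add_left, H.smul_left, H.smul_left,
      y.vv, y.ff, y.vf, y.fv H, e1]
    constructor <;> ring
  set u : LinearMap.ker (hP H v f) := ⟨_, hu⟩ with hud
  have e2 : g f = s • v + f + u := (add_sub_cancel (s • v + f) (g f)).symm
  have huv := ((hP_ker H y).1 u.2).1
  have huf := ((hP_ker H y).1 u.2).2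
  have hvu : h v u = 0 := by rw [H.herm u v, huv, star_zero]
  have hfu : h f u = 0 := by rw [H.herm u f, huf, star_zero]
  have hsu : s + star s + h u u = 0 := by
    rw [e2] at e0
    simp only [H.add_left, H.add_right, H.smul_left, H.smul_right, y.vv, y.ff, y.vf, y.fv H, huv,
      huf, hvu, hfu] at e0
    rw [← e0]; ring
  have hE := Et_mem H y hL hsu
  have hk : (Et H y u s)⁻¹ * g ∈ Fx h t v := mul_mem (inv_mem hE) hg
  have hkf : ((Et H y u s)⁻¹ * g) f = f := by
    apply (Et H y u s).inj
    rw [AA.mul_apply, AA.apply_inv_self, e2, Et_apply, hfu, y.fv H]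
    simp only [zero_smul, one_smul, mul_one, add_zero]; abel
  set k := (Et H y u s)⁻¹ * g with hkd
  have hkw : ∀ w ∈ LinearMap.range (hP H v f), k w = w := by
    rintro _ ⟨x, rfl⟩
    rw [hP_apply, map_add, hk.1.1, hk.1.1, hk.2, hkf]
  obtain ⟨f1, f2, e⟩ := exists_glue (y.spl H).compl k (fun w hw => by rwa [hkw w hw]) (by
    intro w hw
    rw [hP_ker H y] at hw ⊢
    have a1 := hk.1.2.1 w v
    have a2 := hk.1.2.1 w f
    rw [hk.2] at a1
    rw [hkf] at a2
    rw [a1, a2]; exact hw)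
  have hf1 : f1 = 1 := by
    apply AA.ext
    intro w
    apply Subtype.ext
    rw [← glue_left (y.spl H).compl f1 f2, ← e, hkw w w.2]; rfl
  subst hf1
  refine ⟨u, s, f2, hsu, ?_, ?_⟩
  · have := hk.1
    rw [e, (y.spl H).glue_mem H] at this
    exact this.2
  · rw [← e, hkd]; group

end Et
end UCS

set_option linter.unusedSectionVars false
namespace UCS

theorem eq_zero_of_gen_top {A : Type} [Group A] {G : Subgroup A} {c : A} {X : Type} [AddCommGroup X]
    [Module ℂ X] {R : A → X →ₗ[ℂ] X} (hR : IsRepOn G R) (hc : Nrm G c) (B : X →ₗ[ℂ] X →ₗ[ℂ] ℂ)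
    (hB : Inv G c R B) (Y : Submodule ℂ X) (htop : gen G R Y = ⊤)
    (h : ∀ g ∈ G, ∀ x ∈ Y, ∀ y ∈ Y, B (R g x) y = 0) : B = 0 := by
  have h1 : ∀ x ∈ gen G R Y, ∀ y ∈ Y, B x y = 0 := by
    intro x hx y hy
    unfold gen at hx
    induction hx using Submodule.span_induction with
    | mem x hx => obtain ⟨k, hk, x, hx, rfl⟩ := hx; exact h k hk x hx y hy
    | zero => simp
    | add x z _ _ hx hz => rw [map_add, LinearMap.add_apply, hx, hz, add_zero]
    | smul a x _ hx => rw [map_smul, LinearMap.smul_apply, hx, smul_zero]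
  rw [htop] at h1
  have h2 : ∀ x, ∀ y ∈ gen G R Y, B x y = 0 := by
    intro x y hy
    unfold gen at hy
    induction hy using Submodule.span_induction with
    | mem y hy =>
      obtain ⟨k, hk, y, hy, rfl⟩ := hy
      rw [hB.right hR hc hk]; exact h1 _ trivial y hy
    | zero => simp
    | add x z _ _ hx hz => rw [map_add, hx, hz, add_zero]
    | smul a x _ hx => rw [map_smul, hx, smul_zero]
  rw [htop] at h2
  ext x y
  exact h2 x y trivial

/-- abstract package: Heisenberg group extended by a unitary group -/
structure HPk {L : Type} [CommRing L] [StarRing L] {V : Type} [AddCommGroup V] [Module L V]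
    (h : V → V → L) (t : Empty → Module.End L V) (b : L) {X : Type} [AddCommGroup X] [Module ℂ X]
    (ψ : L → ℂ) (ρ : V → Module.End ℂ X) (T : AA V → Module.End ℂ X) : Prop where
  hb : b + star b = 1
  zero : ρ 0 = 1
  mul : ∀ u v, ρ u * ρ v = ψ (b * h u v + star b * h v u) • ρ (u + v)
  add : ∀ s s', star s = s → star s' = s' → ψ (s + s') = ψ s * ψ s'
  sq : ∀ s, star s = s → ψ s = 1 ∨ ψ s = -1
  rep : IsRepOn (U h t) T
  comm : ∀ g ∈ U h t, ∀ u, T g * ρ u = ρ (g u) * T g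
  irr : ∀ W : Submodule ℂ X, (∀ u, ∀ x ∈ W, ρ u x ∈ W) → Stab (U h t) T W → W = ⊥ ∨ W = ⊤

section HPk
variable {q : ℕ} {L : Type} [CommRing L] [StarRing L] [Finite L] (hL : LR q L) {V : Type} [AddCommGroup V]
  [Module L V] [Finite V]
  {h : V → V → L} {t : Empty → Module.End L V} (H : Sp h t) {b : L} {X : Type} [AddCommGroup X]
  [Module ℂ X] [FiniteDimensional ℂ X] [Nontrivial X] {ψ : L → ℂ} {ρ : V → Module.End ℂ X} 
  {T : AA V → Module.End ℂ X} (K : HPk h t b ψ ρ T) {c : AA V} (hc : Anti h t c) 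
  {B : X →ₗ[ℂ] X →ₗ[ℂ] ℂ}
  (hB1 : ∀ u x y, B (ρ u x) (ρ (c u) y) = ψ (h u u) * B x y)
  (hBT : Inv (U h t) c T B) (hs : ∀ x y, B x y = - B y x)

include hL H K hc hB1 hBT hs in
theorem HPk.kill1 (hNS : NoSkew (U h t) c) {k : L} (hk : star k = k) (hψ : ψ k ≠ 1) : B = 0 := by
  obtain ⟨N, hN1, hN2, hN3⟩ := hL.N
  have sa : ∀ u v, star (b * h u v + star b * h v u) = b * h u v + star b * h v u := by
    intro u v
    rw [star_add, star_mul', star_mul', star_star, ← H.herm u v, ← H.herm v u, add_comm]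
  let κ : V → V → ℂ := fun u v => ψ (b * h u v + star b * h v u)
  have hH : Hs ρ κ := by
    refine ⟨hL.add_self', K.zero, K.mul, fun u v => K.sq _ (sa u v), ?_⟩
    intro w hw
    obtain ⟨z, hz⟩ : ∃ z, h w z ≠ 0 := by
      by_contra! hcon; exact hw (H.nd w hcon)
    obtain ⟨l, hl⟩ := hL.tr_nd hz
    refine ⟨star (k * l) • z, fun e => hψ ?_⟩
    have e1 : h w (star (k * l) • z) = k * l * h w z := by rw [H.smul_right, star_star]
    have e2 : h (star (k * l) • z) w = k * star (l * h w z) := by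
      rw [H.herm w, e1, mul_assoc, star_mul', hk]
    set y := star (k * l) • z
    have e3 : k = (b * h y w + star b * h w y) + (b * h w y + star b * h y w) := by
      calc k = (b + star b) * (k * (l * h w z + star (l * h w z))) := by rw [K.hb, hl]; ring
        _ = _ := by rw [e1, e2]; ring
    rw [e3, K.add _ _ (sa _ _) (sa _ _)]
    change κ y w * κ w y = 1
    rw [← e]
    rcases K.sq _ (sa y w) with h1 | h1
    · change κ y w = 1 at h1; rw [h1]; ring
    · change κ y w = -1 at h1; rw [h1]; ring
  have hbb : ∀ r : L, b * r + star b * r = r := by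
    intro r; rw [← add_mul, K.hb, one_mul]
  have : Finite N := Nat.finite_of_card_ne_zero (by omega)
  have hun : ∀ (a : N) u v, h (a • u) (a • v) = h u v := by
    intro a u v
    show h (((a : Lˣ) : L) • u) (((a : Lˣ) : L) • v) = h u v
    rw [H.smul_left, H.smul_right, ← mul_assoc, hN2 a a.2, one_mul]
  refine hH.kill (q := q) (N := N) hL.hq hN1 ?_ ?_ hc.sq ?_ ?_ (U h t) ?_ (hc.nrm H) hNS T K.rep K.comm hBT hs 
    K.irr
  · intro a u v
    simp only [κ, hun]
  · intro a u hau hu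
    by_contra ha
    obtain ⟨y, hy⟩ := hN3 a a.2 (fun e => ha (Subtype.ext e))
    apply hu
    have : (((a : Lˣ) : L) - 1) • u = 0 := by
      rw [sub_smul, one_smul, sub_eq_zero]; exact hau
    rw [← one_smul L u, ← hy, mul_comm, mul_smul, this, smul_zero]
  · intro u v
    simp only [κ, hc.iso, ← H.herm u v, ← H.herm v u]
  · intro u x y
    rw [hB1]
    simp only [κ, hbb]
  · intro g hg
    refine ⟨?_, ?_, ?_⟩
    · intro u v
      simp only [κ, hg.2.1]
    · intro a u; exact hg.1 ((a : Lˣ) : L) u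
    · let W : Submodule L V :=
        { carrier := {u | g u = u}
          zero_mem' := map_zero g
          add_mem' := fun {a b} ha hb => by
            show g (a + b) = a + b
            rw [map_add, ha, hb]
          smul_mem' := fun a u hu => by
            show g (a • u) = a • u
            rw [hg.1, hu] }
      obtain ⟨k1, h1⟩ := hL.card V
      obtain ⟨k2, h2⟩ := hL.card W
      refine ⟨k1 + k2, ?_⟩
      rw [pow_add, ← h1, ← h2]; rfl

/-- characters of the underlying space -/
noncomputable def chw (H : Sp h t) (θ : AddChar L ℂ) (w : V) : AddChar V ℂ where
  toFun u := θ (h u w + h w u)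
  map_zero_eq_one' := by rw [H.zero_left, H.zero_right, add_zero, AddChar.map_zero_eq_one]
  map_add_eq_mul' u v := by
    rw [← AddChar.map_add_eq_mul, H.add_left, H.add_right]
    congr 1; ring

theorem chw_apply (θ : AddChar L ℂ) (w u : V) : chw H θ w u = θ (h u w + h w u) := rfl

include hL in
theorem chw_inj {θ : AddChar L ℂ} (hθ : θ 1 ≠ 1) : Function.Injective (chw (V := V) H θ) := by
  intro w w' e
  by_contra hne
  have hd : w - w' ≠ 0 := sub_ne_zero.2 hne
  obtain ⟨z, hz⟩ : ∃ z, h (w - w') z ≠ 0 := by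
    by_contra! hcon; exact hd (H.nd _ hcon)
  obtain ⟨l, hl⟩ := hL.tr_nd hz
  have e1 : h (w - w') (star l • z) = l * h (w - w') z := by rw [H.smul_right, star_star]
  have e2 : h (star l • z) (w - w') = star (l * h (w - w') z) := by rw [H.herm (w - w'), e1]
  have h1 : h (star l • z) w + h w (star l • z) = 1 + (h (star l • z) w' + h w' (star l • z)) := by
    rw [← hl, ← e2, ← e1, H.sub_left, H.sub_right]; ring
  have h2 := DFunLike.congr_fun e (star l • z)
  rw [chw_apply, chw_apply, h1, AddChar.map_add_eq_mul] at h2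
  apply hθ
  have h3 : θ (h (star l • z) w' + h w' (star l • z)) ≠ 0 := by
    intro h0
    have := AddChar.map_add_eq_mul θ (h (star l • z) w' + h w' (star l • z)) 
      (-(h (star l • z) w' + h w' (star l • z)))
    rw [add_neg_cancel, AddChar.map_zero_eq_one, h0, zero_mul] at this
    exact one_ne_zero this
  exact mul_right_cancel₀ h3 (h2.trans (one_mul _).symm)

include hL in
theorem chw_surj {θ : AddChar L ℂ} (hθ : θ 1 ≠ 1) : Function.Surjective (chw (V := V) H θ) := by
  classical
  have := Fintype.ofFinite V
  exact ((Fintype.bijective_iff_injective_and_card _).2 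
    ⟨chw_inj hL H hθ, AddChar.card_eq.symm⟩).2

/-- weight spaces -/
noncomputable def Xw (H : Sp h t) (θ : AddChar L ℂ) (ρ : V → Module.End ℂ X) (w : V) : Submodule ℂ X where
  carrier := {x | ∀ u, ρ u x = chw H θ w u • x}
  zero_mem' u := by rw [map_zero, smul_zero]
  add_mem' {x y} hx hy u := by rw [map_add, hx, hy, smul_add]
  smul_mem' a x hx u := by rw [map_smul, hx, smul_comm]

theorem mem_Xw {θ : AddChar L ℂ} {w : V} {x : X} :
    x ∈ Xw H θ ρ w ↔ ∀ u, ρ u x = chw H θ w u • x := Iff.rfl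

include H K in
theorem HPk.mul1 (h1 : ∀ s, star s = s → ψ s = 1) (u v : V) : ρ u * ρ v = ρ (u + v) := by
  rw [K.mul, h1, one_smul]
  rw [star_add, star_mul', star_mul', star_star, ← H.herm u v, ← H.herm v u, add_comm]

include hL H K in
theorem HPk.exists_w (h1 : ∀ s, star s = s → ψ s = 1) {θ : AddChar L ℂ} (hθ : θ 1 ≠ 1) :
    ∃ w, Xw H θ ρ w ≠ ⊥ := by
  classical
  have := Fintype.ofFinite V
  obtain ⟨l, x, hx, hl⟩ := exists_joint ρ (fun i j => by
    rw [K.mul1 H h1, K.mul1 H h1, add_comm]) Finset.univ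
  have hl' : ∀ u, ρ u x = l u • x := fun u => hl u (Finset.mem_univ u)
  let χ : AddChar V ℂ :=
    { toFun := l
      map_zero_eq_one' := by
        have := hl' 0
        rw [K.zero] at this
        have h2 : (l 0 - 1) • x = 0 := by rw [sub_smul, one_smul, ← this]; simp
        rcases smul_eq_zero.1 h2 with h3 | h3
        · exact sub_eq_zero.1 h3
        · exact absurd h3 hx
      map_add_eq_mul' := by
        intro u v
        have h0 := hl' (u + v)
        rw [← K.mul1 H h1, Module.End.mul_apply, hl' v, map_smul, hl' u, smul_smul] at h0
        have h2 : (l (u + v) - l u * l v) • x = 0 := by rw [sub_smul, ← h0, mul_comm, sub_self]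
        rcases smul_eq_zero.1 h2 with h3 | h3
        · exact sub_eq_zero.1 h3
        · exact absurd h3 hx }
  obtain ⟨w, hw⟩ := chw_surj hL H hθ χ
  refine ⟨w, fun h0 => hx ?_⟩
  have : x ∈ Xw H θ ρ w := by
    intro u; rw [hw, hl']; rfl
  rwa [h0, Submodule.mem_bot] at this

include K in
theorem HPk.T_Xw {θ : AddChar L ℂ} {w : V} {x : X} (hx : x ∈ Xw H θ ρ w) {g : AA V} 
    (hg : g ∈ U h t) : T g x ∈ Xw H θ ρ (g w) := by
  intro u
  have h1 := LinearMap.congr_fun (K.comm g hg (g⁻¹ u)) x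
  rw [AA.apply_inv_self, Module.End.mul_apply, Module.End.mul_apply, hx, map_smul] at h1
  rw [← h1]
  congr 1
  rw [chw_apply, chw_apply, ← hg.2.1 (g⁻¹ u), ← hg.2.1 w, AA.apply_inv_self]

include hL H K hc hB1 in
theorem HPk.B_Xw (h1 : ∀ s, star s = s → ψ s = 1) {θ : AddChar L ℂ} (hθ : θ 1 ≠ 1) {a a' : V} {x y : X}
    (hx : x ∈ Xw H θ ρ a) (hy : y ∈ Xw H θ ρ a') (ha : a ≠ c a') : B x y = 0 := by
  by_contra hne
  apply ha
  apply chw_inj hL H hθ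
  ext u
  have e := hB1 u x y
  rw [h1 _ (H.herm u u).symm, one_mul, hx u, hy (c u), map_smul, map_smul, LinearMap.smul_apply,
    smul_eq_mul, smul_eq_mul] at e
  have e2 : chw H θ a' (c u) = chw H θ (c a') u := by
    rw [chw_apply, chw_apply]
    have f1 : h (c u) a' = h (c a') u := by
      have := hc.iso u (c a')
      rw [hc.sq, ← H.herm] at this
      exact this
    have f2 : h a' (c u) = h u (c a') := by
      rw [H.herm (c u) a', f1, ← H.herm]
    rw [f1, f2, add_comm]
  have e3 : chw H θ (c a') u * chw H θ (c a') u = 1 := by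
    rw [← AddChar.map_add_eq_mul, hL.add_self', AddChar.map_zero_eq_one]
  rw [e2] at e
  have e4 : chw H θ (c a') u * chw H θ a u = 1 := by
    apply mul_right_cancel₀ hne
    rw [one_mul, mul_assoc]; exact e
  calc chw H θ a u = (chw H θ (c a') u * chw H θ (c a') u) * chw H θ a u := by rw [e3, one_mul]
    _ = chw H θ (c a') u * (chw H θ (c a') u * chw H θ a u) := by ring
    _ = _ := by rw [e4, mul_one]

include K in
theorem HPk.gen_top {θ : AddChar L ℂ} {w : V} {Y : Submodule ℂ X} (hY : Y ≤ Xw H θ ρ w)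
    (h0 : Y ≠ ⊥) : gen (U h t) T Y = ⊤ := by
  have hst : ∀ u, ∀ x ∈ gen (U h t) T Y, ρ u x ∈ gen (U h t) T Y := by
    intro u x hx
    unfold gen at hx ⊢
    induction hx using Submodule.span_induction with
    | mem x hx =>
      obtain ⟨k, hk, x, hx, rfl⟩ := hx
      rw [K.T_Xw H (hY hx) hk u]
      exact Submodule.smul_mem _ _ (Submodule.subset_span ⟨k, hk, x, hx, rfl⟩)
    | zero => simp
    | add x y _ _ hx hy => rw [map_add]; exact Submodule.add_mem _ hx hy
    | smul a x _ hx => rw [map_smul]; exact Submodule.smul_mem _ _ hx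
  rcases K.irr (gen (U h t) T Y) hst (gen_stab K.rep Y) with h1 | h1
  · exact absurd (le_bot_iff.1 (h1 ▸ le_gen K.rep Y)) h0
  · exact h1

include hL H K hc hB1 hBT hs in
theorem HPk.kill2 (h1 : ∀ s, star s = s → ψ s = 1) {θ : AddChar L ℂ} (hθ : θ 1 ≠ 1) {w : V}
    (hw : Xw H θ ρ w ≠ ⊥) (hcw : c w = w) (hNS : NoSkew (Fx h t w) c) : B = 0 := by
  have hle : Fx h t w ≤ U h t := fun g hg => hg.1
  obtain ⟨Y, hY, hm, hiso⟩ := hNS.exists_isotropic (K.rep.mono hle) (Fx_nrm H hc hcw) _ hw (by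
    intro g hg x hx
    have := K.T_Xw H hx hg.1
    rwa [hg.2] at this) B (fun g hg x _ y _ => hBT g hg.1 x y) (fun x _ y _ => hs x y)
  refine eq_zero_of_gen_top K.rep (hc.nrm H) B hBT Y (K.gen_top H hY hm.ne) ?_
  intro g hg x hx y hy
  by_cases e : g w = w
  · exact hiso _ (hm.stab g ⟨hg, e⟩ x hx) y hy
  · exact K.B_Xw hL H hc hB1 h1 hθ (K.T_Xw H (hY hx) hg) (hY hy) (by rw [hcw]; exact e)

include hL H K hc hB1 hBT hs in
theorem HPk.kill3 (h1 : ∀ s, star s = s → ψ s = 1)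
    (hF : ∀ w, (∃ g ∈ U h t, g w = c w) → ∃ c1, Anti h t c1 ∧ c1 w = w ∧ NoSkew (Fx h t w) c1) : 
    B = 0 := by
  obtain ⟨θ, hθ⟩ := AddChar.exists_apply_ne_zero.2 hL.nt
  obtain ⟨w, hw⟩ := K.exists_w hL H h1 hθ
  by_cases hg : ∃ g ∈ U h t, g w = c w
  · obtain ⟨c1, hc1, hw1, hN1⟩ := hF w hg
    have hz := hc1.mul_mem H hc
    set z := c * c1⁻¹ with hzd
    have n := hc.nrm H
    have n1 := hc1.nrm H
    have ec' : c = z * c1 := by rw [hzd]; group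
    have e1 : c * z * c⁻¹ = z⁻¹ := by
      rw [hzd, n.inv_eq, n1.inv_eq, mul_inv_rev, n.inv_eq, n1.inv_eq, ← mul_assoc, n.sq, one_mul]
    have hsw : ∀ x y, B (T z x) y = B x (T z y) := by
      intro x y
      have := hBT z hz x (T z y)
      rw [e1, K.rep.inv_apply hz] at this
      exact this
    have h0 := K.kill2 hL H hc1 (B := B.compl₂ (T z)) ?_ ?_ ?_ h1 hθ hw hw1 hN1
    · ext x y
      have := LinearMap.congr_fun₂ h0 x (T z⁻¹ y)
      rw [LinearMap.compl₂_apply, K.rep.apply_inv hz] at this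
      simpa using this
    · intro u x y
      rw [LinearMap.compl₂_apply, LinearMap.compl₂_apply, ← hB1]
      have := LinearMap.congr_fun (K.comm z hz (c1 u)) y
      rw [Module.End.mul_apply, Module.End.mul_apply] at this
      rw [this, ← AA.mul_apply, ← ec']
    · intro g hg x y
      rw [LinearMap.compl₂_apply, LinearMap.compl₂_apply, ← hBT g hg x,
        ← K.rep.mul_apply hz (n1.mem g hg), ← K.rep.mul_apply (n.mem g hg) hz]
      congr 3
      rw [ec']; group
    · intro x y
      rw [LinearMap.compl₂_apply, LinearMap.compl₂_apply, ← hsw x y, hs]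
  · push Not at hg
    refine eq_zero_of_gen_top K.rep (hc.nrm H) B hBT _ (K.gen_top H le_rfl hw) ?_
    intro g hg' x hx y hy
    exact K.B_Xw hL H hc hB1 h1 hθ (K.T_Xw H hx hg') hy (hg g hg')

end HPk
end UCS

set_option linter.unusedSectionVars false
namespace UCS

theorem IrrOn.scalar {A : Type} [Group A] {G : Subgroup A} {X : Type} [AddCommGroup X]
    [Module ℂ X] [FiniteDimensional ℂ X] [Nontrivial X] {R : A → X →ₗ[ℂ] X} (hI : IrrOn G R)
    (f : Module.End ℂ X) (hf : ∀ g ∈ G, f * R g = R g * f) : ∃ μ : ℂ, f = μ • 1 := by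
  obtain ⟨μ, x, -, hx, hμ⟩ := exists_eig f ⊤ top_ne_bot (fun _ _ => trivial)
  refine ⟨μ, ?_⟩
  have hst : Stab G R (LinearMap.ker (f - μ • 1)) := by
    intro g hg x hx
    have := LinearMap.congr_fun (hf g hg) x
    simp only [LinearMap.mem_ker, LinearMap.sub_apply, LinearMap.smul_apply, Module.End.one_apply,
      sub_eq_zero, Module.End.mul_apply] at this hx ⊢
    rw [this, hx, map_smul]
  rcases hI _ hst with h1 | h1
  · exfalso
    apply hx
    rw [← Submodule.mem_bot ℂ, ← h1]
    simp [hμ]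
  · rw [LinearMap.ker_eq_top] at h1
    exact sub_eq_zero.1 h1

section fx
variable {q : ℕ} {L : Type} [CommRing L] [StarRing L] (hL : LR q L) 
  {V : Type} [AddCommGroup V] [Module L V] [Finite V] {h : V → V → L} {t : Empty → Module.End L V}
  (H : Sp h t)

theorem fx_zero : Fx h t 0 = U h t := by
  ext g
  exact ⟨fun hg => hg.1, fun hg => ⟨hg, map_zero g⟩⟩

include hL H in
theorem LR.fx_aniso {w : V} (hw : h w w ≠ 0) {c : AA V} (hc : Anti h t c) (hcw : c w = w)
    (ih : ∀ (W : Type) [AddCommGroup W] [Module L W] [Finite W] (h' : W → W → L)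
      (t' : Empty → Module.End L W), Sp h' t' → Nat.card W < Nat.card V → ∀ c', Anti h' t' c' →
      NoSkew (U h' t') c') : NoSkew (Fx h t w) c := by
  obtain ⟨y, hy, hy'⟩ := hL.unit_hvv H hw
  have S := Spl.of_proj H (aP_adj H hy') (aP_idem H hy)
  have hker : ∀ x, x ∈ LinearMap.ker (aP H w y) ↔ h x w = 0 := by
    intro x
    rw [LinearMap.mem_ker, aP_apply]
    constructor
    · intro e
      have := congrArg (fun z => h z w) e
      simp only [H.smul_left, H.zero_left] at this
      rwa [mul_assoc, mul_comm y, hy, mul_one] at this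
    · intro e; rw [e, zero_mul, zero_smul]
  have hlt : Nat.card (LinearMap.ker (aP H w y)) < Nat.card V := card_lt_of_ne_top (by
    intro e
    have : w ∈ LinearMap.ker (aP H w y) := by rw [e]; trivial
    exact hw ((hker w).1 this))
  have hran : ∀ x ∈ LinearMap.range (aP H w y), ∃ a : L, x = a • w := by
    rintro _ ⟨x, rfl⟩; exact ⟨_, aP_apply H w y x⟩
  have hw' : w ∈ LinearMap.range (aP H w y) := ⟨w, aP_self H hy⟩
  obtain ⟨c1, c2, rfl⟩ := exists_glue S.compl c (by
    intro x hx
    obtain ⟨a, rfl⟩ := hran x hx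
    rw [hc.smul, hcw]; exact Submodule.smul_mem _ _ hw') (by
    intro x hx
    rw [hker] at hx ⊢
    have := hc.iso x w
    rwa [hcw, hx, star_zero] at this)
  have hc2 := S.anti_res' hc
  have hc1 := S.anti_res hc
  refine (ih _ _ _ ((S.symm H).sp H) hlt c2 hc2).transfer (fun g => glue S.compl 1 g)
    (glue_one _) ?_ ?_ ?_ ?_
  · intro x _ z _; show _ = glue S.compl 1 x * glue S.compl 1 z; rw [← glue_mul, mul_one]
  · intro g hg
    have hgr : ∀ x ∈ LinearMap.range (aP H w y), g x = x := by
      intro x hx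
      obtain ⟨a, rfl⟩ := hran x hx
      rw [hg.1.1, hg.2]
    obtain ⟨f1, f2, e⟩ := exists_glue S.compl g (fun x hx => by rwa [hgr x hx]) (by
      intro x hx
      rw [hker] at hx ⊢
      have := hg.1.2.1 x w
      rwa [hg.2, hx] at this)
    have hf1 : f1 = 1 := by
      apply AA.ext
      intro x
      apply Subtype.ext
      rw [← glue_left S.compl f1 f2, ← e, hgr x x.2]; rfl
    subst hf1
    refine ⟨f2, ?_, e.symm⟩
    have := hg.1
    rw [e, S.glue_mem H] at this
    exact this.2
  · intro x hx
    exact ⟨(S.glue_mem H).2 ⟨one_mem _, hx⟩, glue_left S.compl 1 x ⟨w, hw'⟩⟩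
  · intro x hx
    show _ = glue S.compl c1 c2 * glue S.compl 1 x * (glue S.compl c1 c2)⁻¹
    rw [glue_inv, ← glue_mul, ← glue_mul]; simp

include hL in
theorem LR.prim_of {w : V} (hw : w ≠ 0) (h1 : ∀ l : L, l • w = 0 → star l • w = 0) (l : L)
    (hl : l • w = 0) : l = 0 := by
  have key : ∀ k : L, star k = k → k • w = 0 → k = 0 := by
    intro k hk hkw
    rcases hL.qf k hk with h2 | ⟨y, hy⟩
    · exact h2
    · exfalso
      apply hw
      rw [← one_smul L w, ← hy, mul_comm, mul_smul, hkw, smul_zero]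
  apply key l _ hl
  have h2 := key (l + star l) (by rw [star_add, star_star, add_comm]) (by
    rw [add_smul, hl, h1 l hl, add_zero])
  rw [eq_neg_of_add_eq_zero_right h2, hL.neg]

end fx

section J
variable {q : ℕ} {L : Type} [CommRing L] [StarRing L] [Finite L] (hL : LR q L) 

include hL in
theorem LR.J : ∀ (n : ℕ) (V : Type) [AddCommGroup V] [Module L V] [Finite V] (h : V → V → L)
    (t : Empty → Module.End L V) (H : Sp h t) (hn : Nat.card V = n)
    (ih : ∀ (W : Type) [AddCommGroup W] [Module L W] [Finite W] (h' : W → W → L)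
      (t' : Empty → Module.End L W), Sp h' t' → Nat.card W < Nat.card V → ∀ c', Anti h' t' c' →
      NoSkew (U h' t') c') (v : V) (hv : h v v = 0) (hp : ∀ l : L, l • v = 0 → l = 0) (c : AA V)
    (hc : Anti h t c) (hcv : c v = v), NoSkew (Fx h t v) c := by
  intro n
  induction n using Nat.strong_induction_on with
  | _ n ihn =>
  intro V _ _ _ h t H hn ih v hv hp c hc hcv
  obtain ⟨f, y⟩ := hL.exists_hyp H hv hp
  obtain ⟨cW, c0, hc0, hc', hv', hf'⟩ := hL.exA_hyp H y
  have S : Spl h t (LinearMap.range (hP H v f)) (LinearMap.ker (hP H v f)) := y.spl H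
  have H0 : Sp (rs (LinearMap.ker (hP H v f)) h) (rt S.st') := (S.symm H).sp H
  have hlt : Nat.card (LinearMap.ker (hP H v f)) < Nat.card V := card_lt_of_ne_top (by
    intro e
    have : v ∈ (LinearMap.ker (hP H v f)) := by rw [e]; trivial
    have := ((hP_ker H y).1 this).2
    rw [y.vf] at this
    exact hL.nt this)
  obtain ⟨c', hcd⟩ : ∃ c', c' = glue (y.spl H).compl cW c0 := ⟨_, rfl⟩
  rw [← hcd] at hc' hv' hf'
  have nc' := Fx_nrm H hc' hv'
  refine NoSkew.twist (c := c') ?_ nc' (Fx_nrm H hc hcv) ⟨hc'.mul_mem H hc, by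
    rw [AA.mul_apply, nc'.inv_eq, hv', hcv]⟩
  intro X _ _ _ R hR hI B hB hs
  rcases subsingleton_or_nontrivial X with hX | hX
  · ext x; rw [Subsingleton.elim x 0]; simp
  obtain ⟨b, hb⟩ := hL.tr
  have hb' : star b = 1 + b := by rw [← hb]; linear_combination - hL.add_self b
  -- elements
  have zmem : ∀ s, star s = s → Et H y 0 s ∈ Fx h t v := by
    intro s hs
    apply Et_mem H y hL
    rw [hs, hL.add_self]; simp [H.zero_left]
  have emem : ∀ u : (LinearMap.ker (hP H v f)), Et H y u (b * h u u) ∈ Fx h t v := by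
    intro u
    apply Et_mem H y hL
    rw [star_mul', ← H.herm, ← add_mul, hb, one_mul, hL.add_self]
  have zE : ∀ s (u : (LinearMap.ker (hP H v f))) s', Et H y 0 s * Et H y u s' = Et H y u (s + s') := by
    intro s u s'
    rw [Et_mul, zero_add]; simp [H.zero_right]
  have Ez : ∀ s (u : (LinearMap.ker (hP H v f))) s', Et H y u s' * Et H y 0 s = Et H y u (s + s') := by
    intro s u s'
    rw [Et_mul, add_zero]; simp [H.zero_left, add_comm]
  have zc : ∀ s, star s = s → ∀ g ∈ Fx h t v, R (Et H y 0 s) * R g = R g * R (Et H y 0 s) := by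
    intro s hs g hg
    rw [← hR.mul _ (zmem s hs) _ hg, ← hR.mul _ hg _ (zmem s hs)]
    congr 1
    obtain ⟨u, s', g0, h1, h2, rfl⟩ := Fx_factor H y hg hL
    have e := Et_conj H y (glue_fx H y h2) (u := 0) (u' := 0) (by simp) s
    rw [mul_inv_eq_iff_eq_mul] at e
    rw [mul_assoc, e, ← mul_assoc, ← mul_assoc, zE, Ez]
  have hψ : ∀ s, ∃ μ : ℂ, star s = s → R (Et H y 0 s) = μ • 1 := by
    intro s
    by_cases hs : star s = s
    · obtain ⟨μ, hμ⟩ := hI.scalar _ (zc s hs)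
      exact ⟨μ, fun _ => hμ⟩
    · exact ⟨0, fun h => absurd h hs⟩
  choose ψ hψ using hψ
  have inj : ∀ a b : ℂ, a • (1 : Module.End ℂ X) = b • 1 → a = b := by
    intro a b hab
    obtain ⟨x, hx⟩ := exists_ne (0 : X)
    have := LinearMap.congr_fun hab x
    simp only [LinearMap.smul_apply, Module.End.one_apply] at this
    exact smul_left_injective ℂ hx this
  have ψadd : ∀ s s', star s = s → star s' = s' → ψ (s + s') = ψ s * ψ s' := by
    intro s s' hs hs'
    apply inj
    rw [← hψ _ (by rw [star_add, hs, hs']), ← zE, hR.mul _ (zmem s hs) _ (zmem s' hs'), hψ s hs,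
      hψ s' hs', smul_mul_smul_comm, mul_one]
  have ψ0 : ψ 0 = 1 := by
    apply inj
    rw [← hψ 0 (star_zero _), Et_zero, hR.one, one_smul]
  have ψsq : ∀ s, star s = s → ψ s = 1 ∨ ψ s = -1 := by
    intro s hs
    apply mul_self_eq_one_iff.1
    rw [← ψadd s s hs hs, hL.add_self, ψ0]
  have sa : ∀ u v : (LinearMap.ker (hP H v f)), star (b * h u v + star b * h v u) = b * h u v + star b * h v u := by
    intro u v
    rw [star_add, star_mul', star_mul', star_star, ← H.herm u v, ← H.herm v u, add_comm]
  let ρ : (LinearMap.ker (hP H v f)) → Module.End ℂ X := fun u => R (Et H y u (b * h u u))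
  let T : AA (LinearMap.ker (hP H v f)) → Module.End ℂ X := fun g => R (glue S.compl 1 g)
  have zR : ∀ s, star s = s → ∀ g ∈ Fx h t v, R (Et H y 0 s * g) = ψ s • R g := by
    intro s hs g hg
    rw [hR.mul _ (zmem s hs) _ hg, hψ s hs, smul_mul_assoc, one_mul]
  have K : HPk (rs (LinearMap.ker (hP H v f)) h) (rt S.st') b ψ ρ T := by
    refine ⟨hb, ?_, ?_, ψadd, ψsq, ⟨?_, ?_⟩, ?_, ?_⟩
    · show R (Et H y 0 (b * h (0 : (LinearMap.ker (hP H v f))) (0 : (LinearMap.ker (hP H v f))))) = 1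
      rw [show h ((0 : (LinearMap.ker (hP H v f))) : V) ((0 : (LinearMap.ker (hP H v f))) : V) = 0 from H.zero_left _, mul_zero, Et_zero, hR.one]
    · intro u w
      show R (Et H y u (b * h u u)) * R (Et H y w (b * h w w)) =
        ψ (b * h u w + star b * h w u) • R (Et H y ((u + w : (LinearMap.ker (hP H v f)))) (b * h ((u + w : (LinearMap.ker (hP H v f))) : V) ((u + w : (LinearMap.ker (hP H v f))) : V)))
      rw [← hR.mul _ (emem u) _ (emem w), ← zR _ (sa u w) _ (emem (u + w)), Et_mul, zE]
      congr 2
      simp only [Submodule.coe_add, H.add_left, H.add_right, hb']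
      linear_combination - hL.add_self (b * h u w + b * h w u)
    · show R _ = 1
      rw [glue_one, hR.one]
    · intro g hg k hk
      show R _ = R _ * R _
      rw [← hR.mul _ (glue_fx H y hg) _ (glue_fx H y hk), ← glue_mul, mul_one]
    · intro g hg u
      show R _ * R _ = R _ * R _
      rw [← hR.mul _ (glue_fx H y hg) _ (emem u), ← hR.mul _ (emem (g u)) _ (glue_fx H y hg)]
      have e := Et_conj H y (glue_fx H y hg) (u := u) (u' := g u) (glue_right _ _ _ _) (b * h u u)
      rw [mul_inv_eq_iff_eq_mul] at e
      rw [e]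
      have := hg.2.1 u u
      change h (g u : V) (g u) = h u u at this
      rw [this]
    · intro W hW1 hW2
      apply hI
      intro g hg x hx
      obtain ⟨u, s, g0, h1, h2, rfl⟩ := Fx_factor H y hg hL
      have hsa : star (s + b * h u u) = s + b * h u u := by
        rw [star_add, star_mul', ← H.herm, hb']
        linear_combination h1 - hL.add_self s
      have hE : Et H y u s = Et H y 0 (s + b * h u u) * Et H y u (b * h u u) := by
        rw [zE, add_assoc, hL.add_self, add_zero]
      rw [hE, hR.mul_apply (mul_mem (zmem _ hsa) (emem u)) (glue_fx H y h2), zR _ hsa _ (emem u)]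
      exact Submodule.smul_mem _ _ (hW1 u _ (hW2 g0 h2 x hx))
  have hB1 : ∀ u x z, B (ρ u x) (ρ (c0 u) z) = ψ (rs (LinearMap.ker (hP H v f)) h u u) * B x z := by
    intro u x z
    have hsa : star (h (u : V) u) = h (u : V) u := (H.herm _ _).symm
    have e1 := hB _ (emem u) x z
    rw [Et_anti H y hc' hv' (u := u) (u' := c0 u) (by rw [hcd]; exact glue_right _ _ _ _)] at e1
    have e2 : Et H y (c0 u) (star (b * h u u)) =
        Et H y 0 (h u u) * Et H y (c0 u) (b * h (c0 u : V) (c0 u)) := by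
      have := hc0.iso u u
      change h (c0 u : V) (c0 u) = star (h (u : V) u) at this
      rw [this, zE, star_mul', hsa, hb']
      congr 1; ring
    rw [e2, zR _ hsa _ (emem (c0 u)), LinearMap.smul_apply, map_smul, smul_eq_mul] at e1
    show B (R _ x) (R _ z) = ψ (h u u) * B x z
    rw [← e1, ← mul_assoc]
    rcases ψsq _ hsa with h3 | h3 <;> rw [h3] <;> ring
  have hBT : Inv (U (rs (LinearMap.ker (hP H v f)) h) (rt S.st')) c0 T B := by
    intro g hg x z
    have e1 := hB _ (glue_fx H y hg) x z
    rw [← e1]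
    show B (R _ x) (R _ z) = B (R _ x) (R _ z)
    congr 3
    rw [hcd, glue_inv, ← glue_mul, ← glue_mul]; simp
  by_cases hk : ∀ s, star s = s → ψ s = 1
  · refine K.kill3 hL H0 hc0 hB1 hBT hs hk ?_
    rintro w ⟨g, hg, hgw⟩
    by_cases hw0 : w = 0
    · subst hw0
      refine ⟨c0, hc0, map_zero _, ?_⟩
      rw [fx_zero]
      exact ih _ _ _ H0 hlt c0 hc0
    have ih' : ∀ (W : Type) [AddCommGroup W] [Module L W] [Finite W] (h' : W → W → L)
      (t' : Empty → Module.End L W), Sp h' t' → Nat.card W < Nat.card (LinearMap.ker (hP H v f)) → ∀ c', Anti h' t' c' →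
      NoSkew (U h' t') c' := by
      intro W _ _ _ h' t' H' hc
      exact ih W h' t' H' (hc.trans hlt)
    by_cases hww : rs (LinearMap.ker (hP H v f)) h w w = 0
    · have hpw := hL.prim_of hw0 (by
        intro l hl
        apply c0.inj
        rw [hc0.smul, star_star, ← hgw, ← hg.1, hl, map_zero, map_zero])
      obtain ⟨f1, y1⟩ := hL.exists_hyp H0 hww hpw
      obtain ⟨cW', c0', -, hc1, hv1, -⟩ := hL.exA_hyp H0 y1
      exact ⟨_, hc1, hv1, ihn _ (hn ▸ hlt) (LinearMap.ker (hP H v f)) _ _ H0 rfl ih' w hww hpw _ hc1 hv1⟩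
    · obtain ⟨c1, hc1, hv1⟩ := hL.exA_aniso H0 hww
      exact ⟨c1, hc1, hv1, hL.fx_aniso H0 hww hc1 hv1 ih'⟩
  · push Not at hk
    obtain ⟨k, hk1, hk2⟩ := hk
    exact K.kill1 hL H0 hc0 hB1 hBT hs (ih _ _ _ H0 hlt c0 hc0) hk1 hk2

end J
end UCS

set_option linter.unusedSectionVars false
namespace UCS

section step
variable {q : ℕ} {L : Type} [CommRing L] [StarRing L] [Finite L] (hL : LR q L)
  {V : Type} [AddCommGroup V] [Module L V] [Finite V] {h : V → V → L} {t : Empty → Module.End L V}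
  (H : Sp h t)

theorem exists_fixed {V : Type} [AddCommGroup V] [Finite V] (h2 : ∀ v : V, v + v = 0)
    (P : Subgroup (AA V)) (hP : IsPGroup 2 P) (W : AddSubgroup V)
    (hW : ∀ g ∈ P, ∀ w ∈ W, g w ∈ W) (h0 : ∃ w ∈ W, w ≠ 0) :
    ∃ w ∈ W, w ≠ 0 ∧ ∀ g ∈ P, g w = w := by
  let : MulAction P W :=
    { smul := fun g w => ⟨g.1 w, hW g.1 g.2 w w.2⟩
      one_smul := fun w => rfl
      mul_smul := fun a b w => rfl }
  have : Fact (Nat.Prime 2) := ⟨Nat.prime_two⟩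
  obtain ⟨w0, hw0, hw1⟩ := h0
  have hd : 2 ∣ Nat.card W := by
    have : addOrderOf (⟨w0, hw0⟩ : W) = 2 := by
      apply addOrderOf_eq_prime
      · rw [two_nsmul]; exact Subtype.ext (h2 w0)
      · intro e; exact hw1 (congrArg Subtype.val e)
    rw [← this]
    exact addOrderOf_dvd_natCard _
  obtain ⟨b, hb, hne⟩ := hP.exists_fixed_point_of_prime_dvd_card_of_fixed_point W hd
    (a := (0 : W)) (by
      intro g
      exact Subtype.ext (map_zero g.1))
  refine ⟨b, b.2, fun e => hne (Subtype.ext e.symm), ?_⟩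
  intro g hg
  exact congrArg Subtype.val (hb ⟨g, hg⟩)

include hL in
theorem LR.exists_prim (hreg : ∀ l : L, ∃ m : L, (m * l) * l = l)
    (hfaith : ∀ l : L, (∀ v : V, l • v = 0) → l = 0)
    (P : Subgroup (AA V)) (hP : IsPGroup 2 P) (hPU : P ≤ U h t) :
    ∃ v : V, (∀ g ∈ P, g v = v) ∧ ∀ l : L, l • v = 0 → l = 0 := by
  classical
  have hex : ∃ n : ℕ, ∃ v : V, (∀ g ∈ P, g v = v) ∧ {l : L | l • v = 0}.ncard = n :=
    ⟨_, 0, fun g _ => map_zero g, rfl⟩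
  obtain ⟨v, hv, hn⟩ := Nat.find_spec hex
  refine ⟨v, hv, ?_⟩
  by_contra! hcon
  obtain ⟨l, hl, hl0⟩ := hcon
  obtain ⟨m, hm⟩ := hreg l
  set e := m * l with he
  have hee : e * e = e := by rw [he]; linear_combination m * hm
  have hev : e • v = 0 := by rw [he, mul_smul, hl, smul_zero]
  have he0 : e ≠ 0 := fun h0 => hl0 (by rw [← hm, h0, zero_mul])
  let W : AddSubgroup V :=
    { carrier := {w | e • w = w}
      zero_mem' := smul_zero e
      add_mem' := fun {a b} ha hb => by
        show e • (a + b) = a + b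
        rw [smul_add, show e • a = a from ha, show e • b = b from hb]
      neg_mem' := fun {a} ha => by
        show e • (-a) = -a
        rw [smul_neg, show e • a = a from ha] }
  obtain ⟨w, hw, hw0, hw1⟩ := exists_fixed (hL.add_self' (V := V)) P hP W (by
      intro g hg w hw
      show e • g w = g w
      rw [← (hPU hg).1, show e • w = w from hw]) (by
      by_contra! h1
      apply he0
      apply hfaith
      intro x
      apply h1
      show e • e • x = e • x
      rw [← mul_smul, hee])
  have hew : e • w = w := hw
  have hlt : {l : L | l • (v + w) = 0}.ncard < {l : L | l • v = 0}.ncard := by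
    apply Set.ncard_lt_ncard _ (Set.toFinite _)
    refine ⟨?_, ?_⟩
    · intro k hk
      have hk : k • (v + w) = 0 := hk
      have h1 : k • w = 0 := by
        have := congrArg (fun x => e • x) hk
        simp only [smul_zero] at this
        rwa [smul_comm, smul_add, hev, zero_add, hew] at this
      show k • v = 0
      rwa [smul_add, h1, add_zero] at hk
    · intro h1
      have : e • (v + w) = 0 := h1 hev
      rw [smul_add, hev, zero_add, hew] at this
      exact hw0 this
  rw [hn] at hlt
  exact Nat.find_min hex hlt ⟨v + w, fun g hg => by rw [map_add, hv g hg, hw1 g hg], rfl⟩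

/-- scalar unitary operators -/
def Zs (h : V → V → L) (t : Empty → Module.End L V) : Subgroup (AA V) where
  carrier := {g | g ∈ U h t ∧ ∃ l : L, ∀ v, g v = l • v}
  one_mem' := ⟨one_mem _, 1, fun v => (one_smul L v).symm⟩
  mul_mem' := by
    rintro x y ⟨h1, l, hl⟩ ⟨h2, k, hk⟩
    exact ⟨mul_mem h1 h2, l * k, fun v => by rw [AA.mul_apply, hk, hl, mul_smul]⟩
  inv_mem' := by
    rintro x ⟨h1, l, hl⟩
    have hx : x⁻¹ = x ^ (orderOf x - 1) := by
      apply inv_eq_of_mul_eq_one_left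
      rw [← pow_succ, Nat.sub_add_cancel (orderOf_pos x), pow_orderOf_eq_one]
    refine ⟨inv_mem h1, l ^ (orderOf x - 1), ?_⟩
    rw [hx]
    generalize orderOf x - 1 = n
    induction n with
    | zero => intro v; rw [pow_zero, pow_zero, one_smul]; rfl
    | succ n ih => intro v; rw [pow_succ, pow_succ, AA.mul_apply, ih, hl, mul_smul]

theorem Zs_comm {x y : AA V} (hx : x ∈ Zs h t) (hy : y ∈ U h t) : x * y = y * x := by
  obtain ⟨_, l, hl⟩ := hx
  apply AA.ext
  intro v
  rw [AA.mul_apply, AA.mul_apply, hl, hl, hy.1]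

include H in
theorem Zs_inv {x c : AA V} (hx : x ∈ Zs h t) (hc : Anti h t c) : c * x * c⁻¹ = x⁻¹ := by
  obtain ⟨h1, l, hl⟩ := hx
  have hi : c⁻¹ = c := inv_eq_of_mul_eq_one_left (AA.ext hc.sq)
  rw [eq_inv_iff_mul_eq_one, hi]
  apply AA.ext
  intro v
  simp only [AA.mul_apply, AA.one_apply, hl, hc.smul, hc.sq]
  rw [← sub_eq_zero]
  apply H.nd_right
  intro w
  have := h1.2.1 w v
  rw [hl, hl] at this
  rw [H.sub_right, sub_eq_zero, ← this, H.smul_right, H.smul_right, star_star, H.smul_left,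
    H.smul_right]

include hL H in
theorem LR.step (hreg : ∀ l : L, ∃ m : L, (m * l) * l = l)
    (hfaith : ∀ l : L, (∀ v : V, l • v = 0) → l = 0)
    (ih : ∀ (W : Type) [AddCommGroup W] [Module L W] [Finite W] (h' : W → W → L)
      (t' : Empty → Module.End L W), Sp h' t' → Nat.card W < Nat.card V → ∀ c', Anti h' t' c' →
      NoSkew (U h' t') c')
    {c : AA V} (hc : Anti h t c) {g : AA V} (hg : g ∈ Zs h t)
    (P : Subgroup (AA V)) (hP : IsPGroup 2 P) (hPU : P ≤ U h t) :
    ∃ (K : Subgroup (AA V)) (c' : AA V), K ≤ U h t ∧ g ∈ K ∧ P ≤ K ∧ c' * c⁻¹ ∈ U h t ∧ Nrm K c' ∧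
        c' * g * c'⁻¹ = g⁻¹ ∧ NoSkew K c' := by
  obtain ⟨v, hv, hp⟩ := hL.exists_prim hreg hfaith P hP hPU
  have key : ∃ c', Anti h t c' ∧ c' v = v ∧ NoSkew (Fx h t v) c' := by
    by_cases hvv : h v v = 0
    · obtain ⟨f, y⟩ := hL.exists_hyp H hvv hp
      obtain ⟨_, _, -, hc1, hv1, -⟩ := hL.exA_hyp H y
      exact ⟨_, hc1, hv1, hL.J _ V h t H rfl ih v hvv hp _ hc1 hv1⟩
    · obtain ⟨c1, hc1, hv1⟩ := hL.exA_aniso H hvv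
      exact ⟨c1, hc1, hv1, hL.fx_aniso H hvv hc1 hv1 ih⟩
  obtain ⟨c', hc', hcv, hN⟩ := key
  have n1 : Nrm (Zs h t) c' := ⟨(hc'.nrm H).sq, fun x hx => by rw [Zs_inv H hx hc']; exact inv_mem hx⟩
  have n2 := Fx_nrm H hc' hcv
  let K : Subgroup (AA V) :=
    { carrier := {x | ∃ a ∈ Zs h t, ∃ b ∈ Fx h t v, x = a * b}
      one_mem' := ⟨1, one_mem _, 1, one_mem _, (mul_one _).symm⟩
      mul_mem' := by
        rintro _ _ ⟨a, ha, b, hb, rfl⟩ ⟨a', ha', b', hb', rfl⟩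
        refine ⟨a * a', mul_mem ha ha', b * b', mul_mem hb hb', ?_⟩
        have := Zs_comm ha' hb.1
        rw [mul_assoc, ← mul_assoc b, ← this]; simp only [mul_assoc]
      inv_mem' := by
        rintro _ ⟨a, ha, b, hb, rfl⟩
        refine ⟨a⁻¹, inv_mem ha, b⁻¹, inv_mem hb, ?_⟩
        rw [mul_inv_rev, Zs_comm (inv_mem ha) (inv_mem hb.1)] }
  have le1 : Zs h t ≤ K := fun x hx => ⟨x, hx, 1, one_mem _, (mul_one _).symm⟩
  have le2 : Fx h t v ≤ K := fun x hx => ⟨1, one_mem _, x, hx, (one_mul _).symm⟩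
  refine ⟨K, c', ?_, le1 hg, fun x hx => le2 ⟨hPU hx, hv x hx⟩, hc.mul_mem H hc', ⟨n1.sq, ?_⟩,
    Zs_inv H hg hc', ?_⟩
  · rintro _ ⟨a, ha, b, hb, rfl⟩
    exact mul_mem ha.1 hb.1
  · rintro _ ⟨a, ha, b, hb, rfl⟩
    refine ⟨_, n1.mem a ha, _, n2.mem b hb, by group⟩
  · exact noSkew_prod (noSkew_comm fun x hx y hy => Zs_comm hx hy.1) hN n1 n2 le1 le2
      (fun x hx y hy => Zs_comm hx hy.1) (fun x hx => hx)

end step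
end UCS

set_option linter.unusedSectionVars false
namespace UCS

/-- comparison of the coefficient field and the coefficient ring -/
structure LF {F L ι : Type} [Field F] [StarRing F] [CommRing L] [StarRing L] (α : F →+* L)
    (τ : ι → L) (lam : L →+ F) : Prop where
  smul : ∀ a l, lam (α a * l) = a * lam l
  str : ∀ l, lam (star l) = star (lam l)
  nd : ∀ l, (∀ k, lam (k * l) = 0) → l = 0
  αs : ∀ a, star (α a) = α (star a)
  un : ∀ i, τ i * star (τ i) = 1
  per : ∀ i, ∃ n : ℕ, (n : F) ≠ 0 ∧ τ i ^ n = 1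
  gen : ∀ S : Subring L, (∀ a, α a ∈ S) → (∀ i, τ i ∈ S) → ∀ l, l ∈ S

section compare
variable {F L ι : Type} [Field F] [StarRing F] [CommRing L] [StarRing L] {α : F →+* L}
    {τ : ι → L} {lam : L →+ F} (D : LF α τ lam)
  {W : Type} [AddCommGroup W] [Module F W] [Module L W] (hα : ∀ (a : F) (w : W), α a • w = a • w)
  {hF : W → W → F} {h : W → W → L} (hh : ∀ v w, hF v w = lam (h v w))
  {t : Empty → Module.End L W} {tt : ι → Module.End F W} (ht : ∀ i w, tt i w = τ i • w)

include D hα hh ht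

theorem LF.sp (H : Sp h t) : Sp hF tt where
  add_left v v' w := by rw [hh, hh, hh, H.add_left, map_add]
  smul_left a v w := by rw [hh, hh, ← hα, H.smul_left, D.smul]
  herm v w := by rw [hh, hh, H.herm, D.str]
  nd v hv := by
    apply H.nd
    intro w
    apply D.nd
    intro k
    have := hv (star k • w)
    rwa [hh, H.smul_right, star_star] at this
  tun i v w := by
    rw [hh, hh, ht, ht, H.smul_left, H.smul_right, ← mul_assoc, D.un, one_mul]
  tcomm i j := by
    ext w
    simp only [Module.End.mul_apply, ht]
    rw [smul_comm]
  tper i := by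
    obtain ⟨n, h0, h1⟩ := D.per i
    refine ⟨n, h0, ?_⟩
    have : ∀ (n : ℕ) (w : W), (tt i ^ n) w = τ i ^ n • w := by
      intro n
      induction n with
      | zero => intro w; simp
      | succ n ih => intro w; rw [pow_succ, pow_succ, Module.End.mul_apply, ih, ht, mul_smul]
    ext w
    rw [this, h1, one_smul]; rfl

theorem LF.hext (H : Sp h t) {v w : W} {r : L} (hr : ∀ l, hF (l • v) w = lam (l * r)) :
    h v w = r := by
  rw [← sub_eq_zero]
  apply D.nd
  intro k
  rw [mul_sub, map_sub, ← hr, hh, H.smul_left, sub_self]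

theorem LF.U_eq (H : Sp h t) : U hF tt = U h t := by
  ext g
  constructor
  · intro hg
    have hl : ∀ (l : L) v, g (l • v) = l • g v := by
      let S : Subring L :=
        { carrier := {l | ∀ v, g (l • v) = l • g v}
          one_mem' := fun v => by rw [one_smul, one_smul]
          zero_mem' := fun v => by rw [zero_smul, zero_smul, map_zero]
          mul_mem' := fun {a b} ha hb v => by rw [mul_smul, ha, hb, mul_smul]
          add_mem' := fun {a b} ha hb v => by rw [add_smul, map_add, ha, hb, add_smul]
          neg_mem' := fun {a} ha v => by rw [neg_smul, map_neg, ha, neg_smul] }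
      exact D.gen S (fun a v => by rw [hα, hα, hg.1]) (fun i v => by rw [← ht, hg.2.2, ht])
    refine ⟨hl, fun v w => ?_, fun i => i.elim⟩
    apply D.hext hα hh ht H
    intro l
    rw [← hl, hg.2.1, hh, H.smul_left]
  · intro hg
    exact ⟨fun a v => by rw [← hα, hg.1, hα], fun v w => by rw [hh, hg.2.1, hh],
      fun i v => by rw [ht, hg.1, ht]⟩

theorem LF.anti_iff (H : Sp h t) {c : AA W} : Anti hF tt c ↔ Anti h t c := by
  constructor
  · intro hc
    have hl : ∀ (l : L) v, c (l • v) = star l • c v := by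
      let S : Subring L :=
        { carrier := {l | ∀ v, c (l • v) = star l • c v}
          one_mem' := fun v => by rw [star_one, one_smul, one_smul]
          zero_mem' := fun v => by rw [star_zero, zero_smul, zero_smul, map_zero]
          mul_mem' := fun {a b} ha hb v => by rw [mul_smul, ha, hb, star_mul', mul_smul]
          add_mem' := fun {a b} ha hb v => by rw [add_smul, map_add, ha, hb, star_add, add_smul]
          neg_mem' := fun {a} ha v => by rw [neg_smul, map_neg, ha, star_neg, neg_smul] }
      refine D.gen S (fun a v => by rw [hα, D.αs, hα, hc.smul]) (fun i v => ?_)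
      have := hc.tinv i v
      rw [ht, ht] at this
      rw [← this, ← mul_smul, mul_comm, D.un, one_smul]
    refine ⟨hc.sq, hl, fun v w => ?_, fun i => i.elim⟩
    apply D.hext hα hh ht H
    intro l
    rw [← star_star l, ← hl, hc.iso, hh, H.smul_left, ← star_mul', D.str]
  · intro hc
    refine ⟨hc.sq, fun a v => by rw [← hα, hc.smul, D.αs, hα], fun v w => by
      rw [hh, hh, hc.iso, D.str], fun i v => ?_⟩
    rw [ht, ht, hc.smul, ← mul_smul, D.un, one_smul]

end compare

section build
variable {F : Type} [Field F] [StarRing F] [Finite F] {V : Type} [AddCommGroup V] [Module F V]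
  [Finite V] {ι : Type} {h : V → V → F} {t : ι → Module.End F V}

theorem exists_L (H : Sp h t) : ∃ (L : Type) (_ : CommRing L) (_ : StarRing L) (_ : Finite L)
    (φ : L →+* Module.End F V) (α : F →+* L), Function.Injective φ ∧
    (∀ x, x ∈ Alg t ↔ ∃ l, φ l = x) ∧ (∀ l, Adj h (φ l) (φ (star l))) ∧
    (∀ a v, φ (α a) v = a • v) := by
  have hfin : Finite (Module.End F V) := DFunLike.finite _
  let I1 : CommRing (Alg t) := { (inferInstance : Ring (Alg t)) with
    mul_comm := fun a b => Subtype.ext (alg_comm H a.2 b.2) }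
  choose s hs1 hs2 hs3 using fun x : Alg t => alg_adj H x.2
  let sg : Alg t → Alg t := fun x => ⟨s x, hs1 x⟩
  have us : ∀ (x : Alg t) (y : Module.End F V), Adj h x y → s x = y := fun x y hy =>
    Adj.unique H (hs2 x) hy
  let I2 : StarRing (Alg t) :=
    { star := sg
      star_involutive := fun x => Subtype.ext (us (sg x) _ (Adj.symm H (hs2 x)))
      star_mul := fun x y => Subtype.ext (us (x * y) _ (Adj.mul (hs2 x) (hs2 y)))
      star_add := fun x y => Subtype.ext (us (x + y) _ (Adj.add H (hs2 x) (hs2 y))) }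
  exact ⟨Alg t, I1, I2, Subtype.finite, (Alg t).val.toRingHom, algebraMap F (Alg t),
    Subtype.val_injective, fun x => ⟨fun hx => ⟨⟨x, hx⟩, rfl⟩, fun ⟨l, hl⟩ => hl ▸ l.2⟩,
    fun l => hs2 l, fun a v => rfl⟩

theorem exists_lam {F L : Type} [Field F] [StarRing F] [CommRing L] [StarRing L] [Nontrivial L]
    (α : F →+* L) (αs : ∀ a, star (α a) = α (star a)) (hb : ∃ b : F, b + star b = 1)
    (h2 : (1 : F) + 1 = 0) (qf : ∀ x : L, star x = x → x = 0 ∨ ∃ y, x * y = 1) :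
    ∃ lam : L →+ F, (∀ a l, lam (α a * l) = a * lam l) ∧ (∀ l, lam (star l) = star (lam l)) ∧
      ∀ l, (∀ k, lam (k * l) = 0) → l = 0 := by
  let M : Module F L := Module.compHom L α
  have hM : ∀ (a : F) (l : L), a • l = α a * l := fun a l => rfl
  have h2' : ∀ x : F, x + x = 0 := fun x => by
    have : x + x = (1 + 1) * x := by ring
    rw [this, h2, zero_mul]
  have h2L : ∀ x : L, x + x = 0 := fun x => by
    have : x + x = α (1 + 1) * x := by rw [map_add, map_one]; ring
    rw [this, h2, map_zero, zero_mul]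
  let mk : (L →ₗ[F] F) → (L →+ F) := fun f =>
    { toFun := fun l => f l + star (f (star l))
      map_zero' := by simp
      map_add' := fun x y => by simp only [map_add, star_add]; ring }
  have mk_apply : ∀ f l, mk f l = f l + star (f (star l)) := fun f l => rfl
  have fl : ∀ (f : L →ₗ[F] F) a l, f (α a * l) = a * f l := fun f a l => by
    rw [← hM, map_smul, smul_eq_mul]
  have mk1 : ∀ f a l, mk f (α a * l) = a * mk f l := by
    intro f a l
    rw [mk_apply, mk_apply, star_mul', αs, fl, fl, star_mul', star_star, mul_add]
  have mk2 : ∀ f l, mk f (star l) = star (mk f l) := by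
    intro f l
    rw [mk_apply, mk_apply, star_add, star_star, star_star, add_comm]
  have hne : ∃ f, mk f ≠ 0 := by
    by_contra! hcon
    obtain ⟨f, hf⟩ : ∃ f : L →ₗ[F] F, f 1 ≠ 0 := by
      by_contra! h1
      exact one_ne_zero ((Module.forall_dual_apply_eq_zero_iff F (1 : L)).1 h1)
    obtain ⟨b, hb⟩ := hb
    have e1 := DFunLike.congr_fun (hcon f) 1
    have e2 := DFunLike.congr_fun (hcon (b • f)) 1
    rw [mk_apply, star_one] at e1 e2
    rw [LinearMap.smul_apply, smul_eq_mul, star_mul'] at e2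
    simp only [AddMonoidHom.zero_apply] at e1 e2
    have e3 : star (f 1) = f 1 := by linear_combination e1 - h2' (f 1)
    rw [e3, ← add_mul, hb, one_mul] at e2
    exact hf e2
  obtain ⟨f, hf⟩ := hne
  refine ⟨mk f, mk1 f, mk2 f, ?_⟩
  intro l hl
  have hu : ∀ x : L, star x = x → (∀ k, mk f (k * x) = 0) → x = 0 := by
    intro x hx hk
    rcases qf x hx with h0 | ⟨y, hy⟩
    · exact h0
    · exfalso
      apply hf
      ext z
      have := hk (z * y)
      rwa [mul_assoc, mul_comm y, hy, mul_one] at this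
  have hl' : ∀ k, mk f (k * star l) = 0 := by
    intro k
    have := hl (star k)
    rw [← star_star (star k * l), mk2, star_eq_zero, star_mul', star_star] at this
    exact this
  have hs := hu (l + star l) (by rw [star_add, star_star, add_comm]) (fun k => by
    rw [mul_add, map_add, hl, hl', add_zero])
  exact hu l (by linear_combination hs - h2L l) hl

theorem LF.exists_form {F L ι : Type} [Field F] [StarRing F] [CommRing L] [StarRing L] [Finite L]
    {α : F →+* L} {τ : ι → L} {lam : L →+ F} (D : LF α τ lam) {V : Type} [AddCommGroup V]
    [Module F V] [Module L V] (hα : ∀ (a : F) (w : V), α a • w = a • w) {h : V → V → F}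
    {t : ι → Module.End F V} (H : Sp h t) (had : ∀ (l : L) v w, h (l • v) w = h v (star l • w)) :
    ∃ hL : V → V → L, Sp hL (fun i : Empty => (i.elim : Module.End L V)) ∧
      ∀ v w, h v w = lam (hL v w) := by
  let M : Module F L := Module.compHom L α
  have hM : ∀ (a : F) (l : L), a • l = α a * l := fun a l => rfl
  let B : L → Module.Dual F L := fun r =>
    { toFun := fun l => lam (l * r)
      map_add' := fun x y => by rw [add_mul, map_add]
      map_smul' := fun a l => by rw [hM, mul_assoc, D.smul]; rfl }
  have inj : ∀ r r' : L, (∀ l, lam (l * r) = lam (l * r')) → r = r' := by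
    intro r r' hr
    rw [← sub_eq_zero]
    apply D.nd
    intro k
    rw [mul_sub, map_sub, hr, sub_self]
  let e : L ≃ₗ[F] Module.Dual F L := (Module.finBasis F L).toDualEquiv
  have hsurj : ∀ f : Module.Dual F L, ∃ r, B r = f := by
    have hinj : Function.Injective (fun r : L => e.symm (B r)) := by
      intro a b hab
      have h1 : B a = B b := e.symm.injective hab
      exact inj _ _ fun l => LinearMap.congr_fun h1 l
    intro f
    obtain ⟨w, hw⟩ := (Finite.injective_iff_surjective.1 hinj) (e.symm f)
    exact ⟨w, e.symm.injective hw⟩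
  have hex : ∀ v w, ∃ r, ∀ l : L, lam (l * r) = h (l • v) w := by
    intro v w
    obtain ⟨r, hr⟩ := hsurj
      { toFun := fun l => h (l • v) w
        map_add' := fun x y => by rw [add_smul, H.add_left]
        map_smul' := fun a l => by rw [hM, mul_smul, hα, H.smul_left]; rfl }
    exact ⟨r, fun l => LinearMap.congr_fun hr l⟩
  choose hL hhL using hex
  have h1 : ∀ v w, h v w = lam (hL v w) := fun v w => by
    have := hhL v w 1
    rw [one_mul, one_smul] at this
    exact this.symm
  refine ⟨hL, ⟨?_, ?_, ?_, ?_, fun i => i.elim, fun i => i.elim, fun i => i.elim⟩, h1⟩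
  · intro v v' w
    apply inj
    intro l
    rw [hhL, mul_add, map_add, hhL, hhL, smul_add, H.add_left]
  · intro a v w
    apply inj
    intro l
    rw [hhL, ← mul_assoc, hhL, mul_smul]
  · intro v w
    apply inj
    intro l
    have e : l * star (hL v w) = star (star l * hL v w) := by rw [star_mul', star_star]
    rw [hhL, e, D.str, hhL, had, H.herm (star l • v)]
  · intro v hv
    apply H.nd
    intro w
    rw [h1, hv, map_zero]

theorem exists_LF {q : ℕ} (hcard : Nat.card F = q ^ 2) (hstar : ∀ x : F, star x = x ^ q)
    (h2 : (1 : F) + 1 = 0) (hst : ∃ a : F, star a ≠ a) (hq : 2 ≤ q) (H : Sp h t)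
    (hN : NoIdem h t) [Nontrivial V] :
    ∃ (L : Type) (_ : CommRing L) (_ : StarRing L) (_ : Finite L) (_ : Module L V) (α : F →+* L)
      (τ : ι → L) (lam : L →+ F), LF α τ lam ∧ LR q L ∧ (∀ (a : F) (v : V), α a • v = a • v) ∧
      (∀ i v, t i v = τ i • v) ∧ (∃ hL : V → V → L, Sp hL (fun i : Empty => (i.elim : Module.End L V)) ∧
      ∀ v w, h v w = lam (hL v w)) ∧ (∀ l : L, ∃ m : L, (m * l) * l = l) ∧
      (∀ l : L, (∀ v : V, l • v = 0) → l = 0) ∧ (∀ x ∈ Alg t, ∃ l : L, ∀ v, x v = l • v) := by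
  obtain ⟨L, _, _, _, φ, α, inj, hφ, had, hα⟩ := exists_L H
  have us : ∀ l l', Adj h (φ l) (φ l') → star l = l' := fun l l' hl =>
    inj (Adj.unique H (had l) hl)
  have αs : ∀ a, star (α a) = α (star a) := by
    intro a
    apply us
    intro v w
    rw [hα, hα, H.smul_left, H.smul_right, star_star]
  have hnt : Nontrivial L := by
    refine ⟨0, 1, fun e => ?_⟩
    obtain ⟨v, hv⟩ := exists_ne (0 : V)
    apply hv
    have := congrArg (fun l => φ l v) e
    simpa using this.symm
  have qf : ∀ x : L, star x = x → x = 0 ∨ ∃ y, x * y = 1 := by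
    intro x hx
    have h1 := had x
    rw [hx] at h1
    rcases NoIdem.qe H hN ((hφ _).2 ⟨x, rfl⟩) h1 with h0 | ⟨y, hy, -, hxy, -⟩
    · left; apply inj; rw [h0, map_zero]
    · right
      obtain ⟨y, rfl⟩ := (hφ _).1 hy
      exact ⟨y, inj (by rw [map_mul, hxy, map_one])⟩
  obtain ⟨b, hb⟩ := exists_tr_one hst
  obtain ⟨lam, l1, l2, l3⟩ := exists_lam α αs ⟨b, hb⟩ h2 qf
  choose τ hτ using fun i => (hφ (t i)).1 (mem_alg i)
  let M : Module L V := Module.compHom V φ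
  have hM : ∀ (l : L) (v : V), l • v = φ l v := fun l v => rfl
  have D : LF α τ lam := by
    refine ⟨l1, l2, l3, αs, ?_, ?_, ?_⟩
    · intro i
      obtain ⟨n, -, h3, h4⟩ := H.tpos i
      have : star (τ i) = τ i ^ n := by
        apply us
        intro v w
        rw [map_pow, hτ, ← H.tun i v, ← Module.End.mul_apply, h4]; rfl
      apply inj
      rw [this, map_mul, map_pow, hτ, h4, map_one]
    · intro i
      obtain ⟨n, h3, h4⟩ := H.tper i
      exact ⟨n, h3, inj (by rw [map_pow, hτ, h4, map_one])⟩
    · intro S hS1 hS2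
      have : ∀ x ∈ Alg t, ∃ l ∈ S, φ l = x := by
        intro x hx
        induction hx using Algebra.adjoin_induction with
        | mem x hx => obtain ⟨i, rfl⟩ := hx; exact ⟨_, hS2 i, hτ i⟩
        | algebraMap r => exact ⟨α r, hS1 r, by ext v; rw [hα]; rfl⟩
        | add x y _ _ hx hy =>
          obtain ⟨a, ha, rfl⟩ := hx
          obtain ⟨b, hb, rfl⟩ := hy
          exact ⟨a + b, S.add_mem ha hb, map_add _ _ _⟩
        | mul x y _ _ hx hy =>
          obtain ⟨a, ha, rfl⟩ := hx
          obtain ⟨b, hb, rfl⟩ := hy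
          exact ⟨a * b, S.mul_mem ha hb, map_mul _ _ _⟩
      intro l
      obtain ⟨k, hk, e⟩ := this (φ l) ((hφ _).2 ⟨l, rfl⟩)
      rwa [← inj e]
  have αinj : Function.Injective α := α.injective
  have R : LR q L := by
    refine ⟨by rw [← map_one α, ← map_add, h2, map_zero], one_ne_zero, qf,
      ⟨α b, by rw [αs, ← map_add, hb, map_one]⟩, hq, ?_, ?_⟩
    · classical
      have : Fintype F := Fintype.ofFinite F
      refine ⟨(powMonoidHom (q + 1) : Fˣ →* Fˣ).ker.map (Units.map (α : F →* L)), ?_, ?_, ?_⟩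
      · refine (Nat.card_congr (Subgroup.equivMapOfInjective _ (Units.map (α : F →* L))
          (Units.map_injective αinj)).toEquiv).symm.trans ?_
        rw [IsCyclic.card_powMonoidHom_ker,
          Nat.card_units, hcard]
        have : q ^ 2 - 1 = (q - 1) * (q + 1) := by
          obtain ⟨k, rfl⟩ := Nat.exists_eq_add_of_le hq
          simp only [show 2 + k - 1 = k + 1 by omega]
          apply Nat.sub_eq_of_eq_add
          ring
        rw [this]
        exact Nat.gcd_eq_right (dvd_mul_left _ _)
      · rintro _ ⟨a, ha, rfl⟩
        have ha : a ^ (q + 1) = 1 := ha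
        show α a * star (α a) = 1
        rw [αs, hstar, ← map_mul, ← pow_succ', ← Units.val_pow_eq_pow_val, ha, Units.val_one, map_one]
      · rintro _ ⟨a, ha, rfl⟩ hne
        have : (a : F) - 1 ≠ 0 := by
          intro e
          apply hne
          have : a = 1 := Units.ext (sub_eq_zero.1 e)
          rw [this, map_one]
        refine ⟨α ((a : F) - 1)⁻¹, ?_⟩
        show (α a - 1) * _ = 1
        rw [← map_one α, ← map_sub, ← map_mul, mul_inv_cancel₀ this]
    · intro W _ _ _
      let M : Module F W := Module.compHom W α
      exact ⟨Module.finrank F W, by rw [← hcard]; exact Module.natCard_eq_pow_finrank⟩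
  refine ⟨L, _, _, inferInstance, M, α, τ, lam, D, R, hα, fun i v => ?_, ?_, ?_, ?_, ?_⟩
  · rw [hM, hτ]
  · exact D.exists_form hα H (fun l v w => had l v w)
  · intro l
    obtain ⟨p, hp⟩ := CharP.exists F
    have : Fact p.Prime := ⟨CharP.char_is_prime F p⟩
    obtain ⟨k, hk, h1⟩ := alg_per H p ((hφ (φ l)).2 ⟨l, rfl⟩)
    have hge : 2 ≤ p ^ k := le_trans (Fact.out : p.Prime).two_le (Nat.le_self_pow hk.ne' p)
    obtain ⟨n, hn⟩ := Nat.exists_eq_add_of_le hge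
    refine ⟨l ^ n, inj ?_⟩
    rw [← pow_succ, ← pow_succ, map_pow, show n + 1 + 1 = p ^ k by omega, h1]
  · intro l hl
    apply inj
    ext v
    rw [map_zero]; exact hl v
  · intro x hx
    obtain ⟨l, rfl⟩ := (hφ x).1 hx
    exact ⟨l, fun v => rfl⟩

end build
end UCS

set_option linter.unusedSectionVars false
namespace UCS

section main
variable {F : Type} [Field F] [StarRing F] [Finite F] {V : Type} [AddCommGroup V] [Module F V]
  [Finite V] {ι : Type} {h : V → V → F} {t : ι → Module.End F V}

/-- conclusion of the step of the induction -/
def Stp (G : Subgroup (AA V)) (c g : AA V) (P : Subgroup (AA V)) : Prop :=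
  ∃ (K : Subgroup (AA V)) (c' : AA V), K ≤ G ∧ g ∈ K ∧ P ≤ K ∧ c' * c⁻¹ ∈ G ∧ Nrm K c' ∧
        c' * g * c'⁻¹ = g⁻¹ ∧ NoSkew K c'

theorem alg_le_ad (s : Module.End F V) : Alg t ≤ Alg (ad t s) := by
  apply Algebra.adjoin_mono
  rintro _ ⟨i, rfl⟩
  exact ⟨some i, rfl⟩

theorem card_alg_lt {s : Module.End F V} (hs : s ∉ Alg t) :
    Nat.card (Module.End F V) - Nat.card (Alg (ad t s)) <
      Nat.card (Module.End F V) - Nat.card (Alg t) := by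
  have hfin : Finite (Module.End F V) := DFunLike.finite _
  have h1 : Nat.card (Alg t) < Nat.card (Alg (ad t s)) := by
    have : ((Alg t : Set (Module.End F V))).ncard < (Alg (ad t s) : Set (Module.End F V)).ncard := by
      apply Set.ncard_lt_ncard _ (Set.toFinite _)
      exact ⟨alg_le_ad s, fun h1 => hs (h1 (mem_alg (t := ad t s) none))⟩
    exact this
  have h2 : Nat.card (Alg (ad t s)) ≤ Nat.card (Module.End F V) := by
    exact Nat.card_le_card_of_injective _ Subtype.val_injective
  omega

/-- unitary elements of the algebra -/
theorem alg_inv (H : Sp h t) {x c : AA V} (hx : x ∈ U h t) (hxA : toE x hx.1 ∈ Alg t)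
    (hc : Anti h t c) : c * x * c⁻¹ = x⁻¹ := by
  obtain ⟨x', hx', ha, hcx⟩ := alg_adj H hxA
  have h1 : ∀ v, x' (x v) = v := by
    intro v
    rw [← sub_eq_zero]
    apply H.nd_right
    intro w
    rw [H.sub_right, ← ha, sub_eq_zero]
    exact hx.2.1 w v
  rw [eq_inv_iff_mul_eq_one, (hc.nrm H).inv_eq]
  apply AA.ext
  intro v
  simp only [AA.mul_apply, AA.one_apply]
  have := hcx c hc (c (x v))
  rw [hc.sq] at this
  exact this.trans (h1 v)

theorem alg_cen {x y : AA V} (hx : x ∈ U h t) (hxA : toE x hx.1 ∈ Alg t) (hy : y ∈ U h t) :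
    x * y = y * x := AA.ext fun v => (U.comm hy hxA v).symm

variable (hst : ∃ a : F, star a ≠ a) (H : Sp h t) {c : AA V} (hc : Anti h t c)
include hst H hc

theorem stp1 {g s : AA V} (hg : g ∈ U h t) (hs : s ∈ U h t)
    (hgs : g * s = s * g) (hn : ∃ n : ℕ, (n : F) ≠ 0 ∧ s ^ n = 1)
    (P : Subgroup (AA V)) (hP : P ≤ U h t) (hPs : ∀ x ∈ P, x * s = s * x)
    (ih : ∀ c', Anti h (ad t (toE s hs.1)) c' → NoSkew (U h (ad t (toE s hs.1))) c') :
    Stp (U h t) c g P := by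
  have H' := H.ad hs hn
  obtain ⟨c', hc', hi⟩ := exists_inverting hst H' ((mem_U_ad hs.1).2 ⟨hg, hgs⟩)
  refine ⟨U h (ad t (toE s hs.1)), c', fun x hx => ((mem_U_ad hs.1).1 hx).1,
    (mem_U_ad hs.1).2 ⟨hg, hgs⟩, fun x hx => (mem_U_ad hs.1).2 ⟨hP hx, hPs x hx⟩,
    hc.mul_mem H ((anti_ad hs.1).1 hc').1, hc'.nrm H', hi, ih c' hc'⟩

theorem stp2 {g : AA V} (hg : g ∈ U h t) (P : Subgroup (AA V)) (hP : P ≤ U h t)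
    (hPA : ∀ x, ∀ hx : x ∈ P, toE x (hP hx).1 ∈ Alg t) : Stp (U h t) c g P := by
  obtain ⟨c', hc', hi⟩ := exists_inverting hst H hg
  have hcl : ∀ x ∈ (insert g (P : Set (AA V))), ∀ y ∈ (insert g (P : Set (AA V))), x * y = y * x := by
    rintro x (rfl | hx) y (rfl | hy)
    · rfl
    · exact (alg_cen (hP hy) (hPA y hy) hg).symm
    · exact alg_cen (hP hx) (hPA x hx) hg
    · exact alg_cen (hP hx) (hPA x hx) (hP hy)
  refine ⟨Subgroup.closure (insert g (P : Set (AA V))), c', ?_, Subgroup.subset_closure (Or.inl rfl),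
    fun x hx => Subgroup.subset_closure (Or.inr hx), hc.mul_mem H hc', ⟨(hc'.nrm H).sq, ?_⟩, hi, ?_⟩
  · rw [Subgroup.closure_le]
    rintro x (rfl | hx)
    · exact hg
    · exact hP hx
  · intro x hx
    induction hx using Subgroup.closure_induction with
    | mem x hx =>
      have : c' * x * c'⁻¹ = x⁻¹ := by
        rcases hx with rfl | hx
        · exact hi
        · exact alg_inv H (hP hx) (hPA x hx) hc'
      rw [this]
      exact inv_mem (Subgroup.subset_closure hx)
    | one => simp [one_mem]
    | mul x y _ _ hx hy =>
      have := mul_mem hx hy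
      rwa [show c' * x * c'⁻¹ * (c' * y * c'⁻¹) = c' * (x * y) * c'⁻¹ by group] at this
    | inv x _ hx =>
      have := inv_mem hx
      rwa [show (c' * x * c'⁻¹)⁻¹ = c' * x⁻¹ * c'⁻¹ by group] at this
  · have := Subgroup.isMulCommutative_closure hcl
    apply noSkew_comm
    intro x hx y hy
    exact congrArg Subtype.val (mul_comm' (⟨x, hx⟩ : Subgroup.closure (insert g (P : Set (AA V)))) ⟨y, hy⟩)

omit hst H hc in
/-- unitary operators in the algebra -/
def Zt (h : V → V → F) (t : ι → Module.End F V) : Subgroup (AA V) where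
  carrier := {g | g ∈ U h t ∧ ∃ l ∈ Alg t, ∀ v, g v = l v}
  one_mem' := ⟨one_mem _, 1, Subalgebra.one_mem _, fun v => rfl⟩
  mul_mem' := by
    rintro x y ⟨h1, l, hl', hl⟩ ⟨h2, k, hk', hk⟩
    exact ⟨mul_mem h1 h2, l * k, Subalgebra.mul_mem _ hl' hk', fun v => by
      rw [AA.mul_apply, hk, hl, Module.End.mul_apply]⟩
  inv_mem' := by
    rintro x ⟨h1, l, hl', hl⟩
    have hx : x⁻¹ = x ^ (orderOf x - 1) := by
      apply inv_eq_of_mul_eq_one_left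
      rw [← pow_succ, Nat.sub_add_cancel (orderOf_pos x), pow_orderOf_eq_one]
    refine ⟨inv_mem h1, l ^ (orderOf x - 1), Subalgebra.pow_mem _ hl' _, ?_⟩
    rw [hx]
    generalize orderOf x - 1 = n
    induction n with
    | zero => intro v; rfl
    | succ n ih => intro v; rw [pow_succ, pow_succ, AA.mul_apply, ih, hl, Module.End.mul_apply]

omit hst H hc in
theorem mem_Zt {x : AA V} (hx : x ∈ U h t) : x ∈ Zt h t ↔ toE x hx.1 ∈ Alg t := by
  constructor
  · rintro ⟨_, l, hl, e⟩
    have : toE x hx.1 = l := LinearMap.ext e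
    rwa [this]
  · intro h1
    exact ⟨hx, _, h1, fun v => rfl⟩

omit hst H hc in
theorem Zt_comm {x y : AA V} (hx : x ∈ Zt h t) (hy : y ∈ U h t) : x * y = y * x :=
  alg_cen hx.1 ((mem_Zt hx.1).1 hx) hy

omit hst hc in
theorem Zt_sq (h2 : (2 : F) ≠ 0) (hN : NoIdem h t) {x : AA V} (hx : x ∈ Zt h t) (hxx : x * x = 1) :
    (∀ v, x v = v) ∨ ∀ v, x v = -v := by
  obtain ⟨hxU, a, ha, hxa⟩ := hx
  have haa : a * a = 1 := by
    ext v
    rw [Module.End.mul_apply, ← hxa, ← hxa, ← AA.mul_apply, hxx]; rfl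
  have had : Adj h a a := by
    intro v w
    rw [← hxa, ← hxU.2.1, ← AA.mul_apply, hxx, ← hxa]; rfl
  have hs : star (2⁻¹ : F) = 2⁻¹ := by
    rw [star_inv₀, star_ofNat]
  rcases hN ((2⁻¹ : F) • (1 + a)) (Subalgebra.smul_mem _ (Subalgebra.add_mem _ (Subalgebra.one_mem _) ha) _)
    (by
      have := Adj.smul H (Adj.add H Adj.one had) (2⁻¹ : F)
      rwa [hs] at this) (by
      rw [smul_mul_smul_comm, add_mul, mul_add, mul_add, haa, one_mul, mul_one, one_mul,
        show (1 : Module.End F V) + a + (a + 1) = (2 : F) • (1 + a) by rw [two_smul]; abel, smul_smul,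
        mul_assoc, inv_mul_cancel₀ h2, mul_one]) with h0 | h0
  · right
    intro v
    have e := LinearMap.congr_fun ((smul_eq_zero.1 h0).resolve_left (inv_ne_zero h2)) v
    rw [hxa]
    exact (neg_eq_of_add_eq_zero_right e).symm
  · left
    intro v
    have e1 : (1 : Module.End F V) + a = (2 : F) • 1 := by
      have := congrArg (fun z => (2 : F) • z) h0
      rwa [smul_smul, mul_inv_cancel₀ h2, one_smul] at this
    have e := LinearMap.congr_fun e1 v
    rw [two_smul] at e
    rw [hxa]
    exact add_left_cancel e

omit hst H hc in
theorem exists_t0 (P : Subgroup (AA V)) (hPU : P ≤ U h t) (hP : IsPGroup 2 P)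
    (hx : ∃ x ∈ P, x ∉ Zt h t) : ∃ t0 ∈ P, t0 ∉ Zt h t ∧ t0 * t0 ∈ Zt h t ∧
    ∀ x ∈ P, t0 * x * t0⁻¹ * x⁻¹ ∈ Zt h t := by
  have : Fact (Nat.Prime 2) := ⟨Nat.prime_two⟩
  let N : Subgroup P := (Zt h t).subgroupOf P
  have hN : N.Normal := ⟨fun n hn g => by
    rw [Subgroup.mem_subgroupOf] at hn ⊢
    have := Zt_comm hn (hPU g.2)
    rw [Subgroup.coe_mul, Subgroup.coe_mul, ← this]
    simpa using hn⟩
  have hq : IsPGroup 2 (P ⧸ N) := hP.to_quotient N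
  have hnt : Nontrivial (P ⧸ N) := by
    obtain ⟨x, hx, hxZ⟩ := hx
    refine ⟨(QuotientGroup.mk (⟨x, hx⟩ : P)), 1, fun e => hxZ ?_⟩
    exact Subgroup.mem_subgroupOf.1 ((QuotientGroup.eq_one_iff _).1 e)
  have hz : Nontrivial (Subgroup.center (P ⧸ N)) := hq.center_nontrivial
  have hd : 2 ∣ Nat.card (Subgroup.center (P ⧸ N)) := by
    rcases (hq.to_subgroup (Subgroup.center (P ⧸ N))).card_eq_or_dvd with h1 | h1
    · exact absurd h1 (Finite.one_lt_card).ne'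
    · exact h1
  obtain ⟨⟨z, hzc⟩, hzo⟩ := exists_prime_orderOf_dvd_card' 2 hd
  obtain ⟨t0, rfl⟩ := QuotientGroup.mk_surjective z
  have h1 : (⟨(t0 : P ⧸ N), hzc⟩ : Subgroup.center (P ⧸ N)) ^ 2 = 1 := by rw [← hzo, pow_orderOf_eq_one]
  refine ⟨t0, t0.2, ?_, ?_, ?_⟩
  · intro e
    have h2 : (t0 : P ⧸ N) = 1 := (QuotientGroup.eq_one_iff _).2 (Subgroup.mem_subgroupOf.2 e)
    have : (⟨(t0 : P ⧸ N), hzc⟩ : Subgroup.center (P ⧸ N)) = 1 := Subtype.ext h2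
    rw [this, orderOf_one] at hzo
    norm_num at hzo
  · have h2 : ((t0 * t0 : P) : P ⧸ N) = 1 := by
      have := congrArg Subtype.val h1
      rw [pow_two] at this
      exact this
    exact Subgroup.mem_subgroupOf.1 ((QuotientGroup.eq_one_iff _).1 h2)
  · intro x hx
    have h2 : ((t0 * ⟨x, hx⟩ * t0⁻¹ * ⟨x, hx⟩⁻¹ : P) : P ⧸ N) = 1 := by
      have := Subgroup.mem_center_iff.1 hzc ((⟨x, hx⟩ : P) : P ⧸ N)
      rw [QuotientGroup.mk_mul, QuotientGroup.mk_mul, QuotientGroup.mk_mul, ← this,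
        QuotientGroup.mk_inv, QuotientGroup.mk_inv]
      group
    exact Subgroup.mem_subgroupOf.1 ((QuotientGroup.eq_one_iff _).1 h2)

omit hst H hc in
/-- minus the identity -/
def mn (V : Type) [AddCommGroup V] : AA V :=
  AA.ofInvol (fun v => -v) (fun v w => neg_add v w) neg_neg

omit hst H hc in
theorem mn_comm (x : AA V) : mn V * x = x * mn V := AA.ext fun v => (map_neg x v).symm

omit hst H hc in
theorem mn_sq : mn V * mn V = 1 := AA.ext fun v => neg_neg v

omit hst H hc in
/-- elements commuting with `t0` up to sign -/
def Cpm (G : Subgroup (AA V)) (t0 : AA V) : Subgroup (AA V) where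
  carrier := {x | x ∈ G ∧ (x * t0 = t0 * x ∨ x * t0 = mn V * (t0 * x))}
  one_mem' := ⟨one_mem _, Or.inl (by simp)⟩
  mul_mem' := by
    rintro x y ⟨h1, h2⟩ ⟨h3, h4⟩
    refine ⟨mul_mem h1 h3, ?_⟩
    rcases h2 with h2 | h2 <;> rcases h4 with h4 | h4
    · left; rw [mul_assoc, h4, ← mul_assoc, h2, mul_assoc]
    · right; rw [mul_assoc, h4, ← mul_assoc, ← mn_comm, mul_assoc, ← mul_assoc x, h2, mul_assoc]
    · right; rw [mul_assoc, h4, ← mul_assoc, h2]; simp only [mul_assoc]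
    · left; rw [mul_assoc, h4, ← mul_assoc, ← mn_comm, mul_assoc, ← mul_assoc x, h2, mul_assoc,
        ← mul_assoc, mn_sq, one_mul, mul_assoc]
  inv_mem' := by
    rintro x ⟨h1, h2⟩
    refine ⟨inv_mem h1, ?_⟩
    rcases h2 with h2 | h2
    · left
      rw [inv_mul_eq_iff_eq_mul, ← mul_assoc, h2, mul_assoc, mul_inv_cancel, mul_one]
    · right
      rw [inv_mul_eq_iff_eq_mul, ← mul_assoc, ← mn_comm, mul_assoc, ← mul_assoc x, h2, mul_assoc,
        mul_assoc, mul_inv_cancel, mul_one, ← mul_assoc, mn_sq, one_mul]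

theorem stp3 (h2 : (2 : F) ≠ 0) (hN : NoIdem h t) {g : AA V} (hg : g ∈ U h t) (P : Subgroup (AA V))
    (hPU : P ≤ U h t) (hP : IsPGroup 2 P) (hPg : ∀ x ∈ P, x * g = g * x)
    (hx : ∃ x ∈ P, x ∉ Zt h t)
    (ih : ∀ s, ∀ hs : s ∈ U h t, s ∉ Zt h t → Sp h (ad t (toE s hs.1)) → ∀ c',
      Anti h (ad t (toE s hs.1)) c' → NoSkew (U h (ad t (toE s hs.1))) c') :
    Stp (U h t) c g P := by
  obtain ⟨t0, ht0, ht1, ht2, ht3⟩ := exists_t0 P hPU hP hx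
  have hU := hPU ht0
  have H' : Sp h (ad t (toE t0 hU.1)) := by
    apply H.ad hU
    obtain ⟨k, hk⟩ := hP ⟨t0, ht0⟩
    exact ⟨2 ^ k, by push_cast; exact pow_ne_zero _ h2, congrArg Subtype.val hk⟩
  have hgK := (mem_U_ad (h := h) (t := t) hU.1).2 ⟨hg, (hPg t0 ht0).symm⟩
  obtain ⟨c', hc', hi⟩ := exists_inverting hst H' hgK
  obtain ⟨hc1, hct⟩ := (anti_ad hU.1).1 hc'
  have nK := hc'.nrm H'
  have nU := hc1.nrm H
  have hKle : U h (ad t (toE t0 hU.1)) ≤ Cpm (U h t) t0 := by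
    intro x hx
    have := (mem_U_ad hU.1).1 hx
    exact ⟨this.1, Or.inl this.2⟩
  have hcc : c' * c' = 1 := nU.sq
  have nH : Nrm (Cpm (U h t) t0) c' := by
    refine ⟨nU.sq, ?_⟩
    rintro x ⟨hx, h3⟩
    refine ⟨nU.mem x hx, ?_⟩
    have e1 : c' * t0⁻¹ * c'⁻¹ = t0 := by
      rw [← hct, nU.inv_eq, show c' * (c' * t0 * c') * c' = (c' * c') * t0 * (c' * c') by
        simp only [mul_assoc], hcc, one_mul, mul_one]
    rcases h3 with h3 | h3
    · left
      have h4 : x * t0⁻¹ = t0⁻¹ * x := by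
        rw [mul_inv_eq_iff_eq_mul, mul_assoc, h3, inv_mul_cancel_left]
      calc c' * x * c'⁻¹ * t0 = c' * x * c'⁻¹ * (c' * t0⁻¹ * c'⁻¹) := by rw [e1]
        _ = c' * (x * t0⁻¹) * c'⁻¹ := by group
        _ = (c' * t0⁻¹ * c'⁻¹) * (c' * x * c'⁻¹) := by rw [h4]; group
        _ = t0 * (c' * x * c'⁻¹) := by rw [e1]
    · right
      have h4 : x * t0⁻¹ = mn V * (t0⁻¹ * x) := by
        rw [mul_inv_eq_iff_eq_mul, mul_assoc, mul_assoc, h3, ← mul_assoc t0⁻¹, ← mn_comm, mul_assoc,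
          inv_mul_cancel_left, ← mul_assoc, mn_sq, one_mul]
      calc c' * x * c'⁻¹ * t0 = c' * x * c'⁻¹ * (c' * t0⁻¹ * c'⁻¹) := by rw [e1]
        _ = c' * (x * t0⁻¹) * c'⁻¹ := by group
        _ = mn V * ((c' * t0⁻¹ * c'⁻¹) * (c' * x * c'⁻¹)) := by
          rw [h4, ← mul_assoc c', ← mn_comm]; group
        _ = mn V * (t0 * (c' * x * c'⁻¹)) := by rw [e1]
  refine ⟨Cpm (U h t) t0, c', fun x hx => hx.1, hKle hgK, ?_, hc.mul_mem H hc1, nH, hi, ?_⟩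
  · intro x hx
    refine ⟨hPU hx, ?_⟩
    set l := t0 * x * t0⁻¹ * x⁻¹ with hl
    have hlZ := ht3 x hx
    have e1 : t0 * x = l * (x * t0) := by rw [hl]; group
    have e2 : t0 * t0 * x = (l * l) * (x * (t0 * t0)) := by
      have := Zt_comm hlZ hU
      calc t0 * t0 * x = t0 * (t0 * x) := by group
        _ = (t0 * l) * x * t0 := by rw [e1]; group
        _ = l * (t0 * x) * t0 := by rw [show t0 * l = l * t0 from this.symm]; group
        _ = _ := by rw [e1]; group
    rw [Zt_comm ht2 (hPU hx)] at e2
    have e3 : l * l = 1 := mul_eq_right.1 e2.symm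
    rcases Zt_sq H h2 hN hlZ e3 with h4 | h4
    · left
      have : l = 1 := AA.ext h4
      rw [e1, this, one_mul]
    · right
      have : l = mn V := AA.ext h4
      rw [e1, this, ← mul_assoc, mn_sq, one_mul]
  · by_cases hall : ∃ x0 ∈ Cpm (U h t) t0, x0 ∉ U h (ad t (toE t0 hU.1))
    · obtain ⟨x0, hx0, hx0'⟩ := hall
      refine noSkew_index2 hKle (ih t0 hU ht1 H' c' hc') nK nH ?_ x0 hx0 ?_
        (fun k hk => exists_real hst H' hc' hk)
      · rintro y ⟨hy, h3⟩ k hk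
        rw [mem_U_ad] at hk ⊢
        refine ⟨mul_mem (mul_mem hy hk.1) (inv_mem hy), ?_⟩
        have h4 : t0⁻¹ * y * t0 = y ∨ t0⁻¹ * y * t0 = mn V * y := by
          rcases h3 with h3 | h3
          · left; rw [mul_assoc, h3, inv_mul_cancel_left]
          · right; rw [mul_assoc, h3, ← mul_assoc, ← mn_comm, mul_assoc, inv_mul_cancel_left]
        have h5 : t0⁻¹ * k * t0 = k := by rw [mul_assoc, hk.2, inv_mul_cancel_left]
        have h6 : t0⁻¹ * (y * k * y⁻¹) * t0 = y * k * y⁻¹ := by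
          have : t0⁻¹ * (y * k * y⁻¹) * t0 = (t0⁻¹ * y * t0) * (t0⁻¹ * k * t0) * (t0⁻¹ * y * t0)⁻¹ := by
            group
          rw [this, h5]
          rcases h4 with h4 | h4
          · rw [h4]
          · rw [h4, mul_inv_rev, show (mn V)⁻¹ = mn V from inv_eq_of_mul_eq_one_left mn_sq]
            rw [← mul_assoc, mul_assoc (mn V), mul_assoc (mn V), mn_comm, mul_assoc, mn_sq, mul_one]
        rw [mul_assoc, inv_mul_eq_iff_eq_mul] at h6
        exact h6
      · rintro y hy
        by_cases hyK : y ∈ U h (ad t (toE t0 hU.1))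
        · exact Or.inl hyK
        · right
          rw [mem_U_ad] at hyK hx0' ⊢
          refine ⟨mul_mem (inv_mem hx0.1) hy.1, ?_⟩
          have a1 : x0 * t0 = mn V * (t0 * x0) := hx0.2.resolve_left fun e => hx0' ⟨hx0.1, e⟩
          have a2 : y * t0 = mn V * (t0 * y) := hy.2.resolve_left fun e => hyK ⟨hy.1, e⟩
          rw [mul_assoc, inv_mul_eq_iff_eq_mul, a2, ← mul_assoc x0, a1]
          simp only [mul_assoc, mul_inv_cancel_left]
    · push Not at hall
      have : U h (ad t (toE t0 hU.1)) = Cpm (U h t) t0 := le_antisymm hKle hall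
      rw [← this]
      exact ih t0 hU ht1 H' c' hc'

end main
end UCS

set_option linter.unusedSectionVars false
namespace UCS

section main2
variable {F : Type} [Field F] [StarRing F] [Finite F] {q : ℕ} (hcard : Nat.card F = q ^ 2)
  (hstar : ∀ x : F, star x = x ^ q) (hq : 2 ≤ q) (hst : ∃ a : F, star a ≠ a)
include hcard hstar hq hst

theorem stp4 {V : Type} [AddCommGroup V] [Module F V]
    [Finite V] {ι : Type} {h : V → V → F} {t : ι → Module.End F V}
    (H : Sp h t) {c : AA V} (hc : Anti h t c) [Nontrivial V] (h2 : (1 : F) + 1 = 0) (hN : NoIdem h t)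
    (ih : ∀ (W : Type) [AddCommGroup W] [Module F W] [Finite W] (ι : Type) (h' : W → W → F)
      (t' : ι → Module.End F W), Nat.card W < Nat.card V → Sp h' t' → ∀ c', Anti h' t' c' →
      NoSkew (U h' t') c') {g : AA V} (hg : g ∈ Zt h t)
    (P : Subgroup (AA V)) (hP : IsPGroup 2 P) (hPU : P ≤ U h t) : Stp (U h t) c g P := by
  obtain ⟨L, _, _, _, _, α, τ, lam, D, hL, hα, ht, ⟨h', H', hh⟩, hreg, hfaith, hx⟩ :=
    exists_LF hcard hstar h2 hst hq H hN
  have e := D.U_eq hα hh ht H'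
  unfold Stp
  rw [e] at hPU ⊢
  refine hL.step H' hreg hfaith ?_ ((D.anti_iff hα hh ht H').1 hc) ?_ P hP hPU
  · intro W _ _ _ k t' K hlt c' hc'
    letI : Module F W := Module.compHom W α
    have hα' : ∀ (a : F) (w : W), α a • w = a • w := fun a w => rfl
    let tt : ι → Module.End F W := fun i =>
      { toFun := fun w => τ i • w
        map_add' := smul_add _
        map_smul' := fun a w => by
          rw [← hα', ← hα', RingHom.id_apply, smul_smul, smul_smul, mul_comm] }
    have ht' : ∀ i w, tt i w = τ i • w := fun i w => rfl
    have hk : ∀ v w, (fun v w => lam (k v w)) v w = lam (k v w) := fun v w => rfl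
    have := ih W ι (fun v w => lam (k v w)) tt hlt (D.sp hα' hk ht' K) c'
      ((D.anti_iff hα' hk ht' K).2 hc')
    rwa [D.U_eq hα' hk ht' K] at this
  · obtain ⟨hg1, l, hl, hgl⟩ := hg
    obtain ⟨m, hm⟩ := hx l hl
    exact ⟨e ▸ hg1, m, fun v => by rw [hgl, hm]⟩

theorem MAIN (n : ℕ) : ∀ (V : Type) [AddCommGroup V] [Module F V]
    [Finite V] (ι : Type) (h : V → V → F) (t : ι → Module.End F V), Nat.card V = n →
    Sp h t → ∀ c, Anti h t c → NoSkew (U h t) c := by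
  induction n using Nat.strong_induction_on with
  | _ n IH =>
  intro V _ _ _
  have key : ∀ k : ℕ, ∀ (ι : Type) (h : V → V → F) (t : ι → Module.End F V), Nat.card V = n →
    Nat.card (Module.End F V) - Nat.card (Alg t) = k →
    Sp h t → ∀ c, Anti h t c → NoSkew (U h t) c := by
    intro k
    induction k using Nat.strong_induction_on with
    | _ k IHk =>
    intro ι h t hn hk H c hc
    by_cases hN : NoIdem h t
    swap
    · unfold NoIdem at hN
      push Not at hN
      obtain ⟨e, he, ha, hi, e0, e1⟩ := hN
      have S := Spl.of_idem H he ha hi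
      refine noSkew_idem H he ha S (IH _ ?_ _ _ _ _ rfl (S.sp H)) (IH _ ?_ _ _ _ _ rfl ((S.symm H).sp H)) hc
      · rw [← hn]
        apply card_lt_of_ne_top
        intro hr
        apply e1
        ext v
        obtain ⟨w, rfl⟩ := (LinearMap.range_eq_top.1 hr) v
        rw [← Module.End.mul_apply, hi]; rfl
      · rw [← hn]
        apply card_lt_of_ne_top
        intro hr
        exact e0 (LinearMap.ker_eq_top.1 hr)
    by_cases hV : Subsingleton V
    · apply noSkew_comm
      intro x _ y _
      exact AA.ext fun v => Subsingleton.elim _ _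
    rw [not_subsingleton_iff_nontrivial] at hV
    apply noSkew_brauer (hc.nrm H)
    intro g hg hodd P hPC hP
    change Stp (U h t) c g P
    have hPU : P ≤ U h t := fun x hx => (mem_Cen.1 (hPC hx)).1
    have hPg : ∀ x ∈ P, x * g = g * x := fun x hx => (mem_Cen.1 (hPC hx)).2
    have ih : ∀ s, ∀ hs : s ∈ U h t, s ∉ Zt h t → Sp h (ad t (toE s hs.1)) → ∀ c',
      Anti h (ad t (toE s hs.1)) c' → NoSkew (U h (ad t (toE s hs.1))) c' := by
      intro s hs hsZ H' c' hc'
      rw [mem_Zt hs] at hsZ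
      exact IHk _ (hk ▸ card_alg_lt hsZ) _ _ _ hn rfl H' c' hc'
    obtain ⟨p, hp⟩ := CharP.exists F
    have hpp : Fact p.Prime := ⟨CharP.char_is_prime F p⟩
    obtain ⟨i, j, a, m, hgs, hm, hsm, huj⟩ := jordan p g
    have hmF : (m : F) ≠ 0 := by rwa [Ne, CharP.cast_eq_zero_iff F p]
    have hsU : g ^ i ∈ U h t := pow_mem hg i
    have hgs' : g * g ^ i = g ^ i * g := (Commute.self_pow g i)
    by_cases hsZ : g ^ i ∈ Zt h t
    swap
    · refine stp1 hst H hc hg hsU hgs' ⟨m, hmF, hsm⟩ P hPU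
        (fun x hx => (Commute.pow_right (show Commute x g from hPg x hx) i))
        (ih _ hsU hsZ (H.ad hsU ⟨m, hmF, hsm⟩))
    by_cases h2 : (2 : F) = 0
    swap
    · by_cases hPZ : ∃ x ∈ P, x ∉ Zt h t
      · exact stp3 hst H hc h2 hN hg P hPU hP hPg hPZ ih
      · push Not at hPZ
        exact stp2 hst H hc hg P hPU fun x hx => (mem_Zt (hPU hx)).1 (hPZ x hx)
    have hp2 : p = 2 := by
      have : ((2 : ℕ) : F) = 0 := by exact_mod_cast h2
      rw [CharP.cast_eq_zero_iff F p] at this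
      exact (Nat.prime_dvd_prime_iff_eq hpp.out Nat.prime_two).1 this
    have hu : g ^ j = 1 := by
      rw [← orderOf_eq_one_iff]
      have h1 : orderOf (g ^ j) ∣ 2 ^ a := orderOf_dvd_of_pow_eq_one (hp2 ▸ huj)
      have h3 : orderOf (g ^ j) ∣ orderOf g := orderOf_pow_dvd j
      exact Nat.eq_one_of_dvd_coprimes (Nat.Coprime.pow_right a (Nat.coprime_two_right.2 hodd)) h3 h1
    rw [hu, mul_one] at hgs
    rw [← hgs] at hsZ
    exact stp4 hcard hstar hq hst H hc (by rw [one_add_one_eq_two]; exact h2) hN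
      (fun W _ _ _ ι h' t' hlt => IH _ (hn ▸ hlt) W ι h' t' rfl) hsZ P hP hPU
  intro ι h t hn
  exact key _ ι h t hn rfl

end main2
end UCS

set_option linter.unusedSectionVars false
namespace UCS

section count
variable {F : Type} [Field F] [StarRing F] [Finite F] {V : Type} [AddCommGroup V] [Module F V]
  [Finite V] {h : V → V → F} {t : Empty → Module.End F V} (H : Sp h t)
include H

/-- the form as a linear functional -/
def Sp.lin (w : V) : V →ₗ[F] F where
  toFun v := h v w
  map_add' v v' := H.add_left v v' w
  map_smul' a v := H.smul_left a v w

theorem Sp.sum_sum {κ : Type} [Fintype κ] (b : κ → V) (a a' : κ → F) :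
    h (∑ i, a i • b i) (∑ j, a' j • b j) = ∑ i, ∑ j, a i * (star (a' j) * h (b i) (b j)) := by
  have h1 : ∀ w, h (∑ i, a i • b i) w = ∑ i, a i * h (b i) w := by
    intro w
    have := map_sum (H.lin w) (fun i => a i • b i) Finset.univ
    refine this.trans (Finset.sum_congr rfl fun i _ => H.smul_left _ _ _)
  rw [h1]
  refine Finset.sum_congr rfl fun i _ => ?_
  rw [H.herm, ← Finset.mul_sum]
  congr 1
  have := map_sum (H.lin (b i)) (fun j => a' j • b j) Finset.univ
  have h2 : h (∑ j, a' j • b j) (b i) = ∑ j, a' j * h (b j) (b i) :=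
    this.trans (Finset.sum_congr rfl fun i _ => H.smul_left _ _ _)
  rw [h2, star_sum]
  refine Finset.sum_congr rfl fun j _ => ?_
  rw [star_mul', ← H.herm]

theorem gram {κ : Type} [Fintype κ] [DecidableEq κ] (b : κ → V)
    (hr : ∀ i j, star (h (b i) (b j)) = h (b i) (b j))
    (hnd : ∀ a : κ → F, (∀ j, ∑ i, a i * h (b i) (b j) = 0) → a = 0) :
    ∃ (W' : Submodule F V) (t' : Empty → Module.End F W'), Sp (rs W' h) t' ∧
      (∀ i, ∀ w ∈ W', h (b i) w = 0) ∧
      Function.Bijective (fun p : (κ → F) × W' => ∑ i, p.1 i • b i + (p.2 : V)) ∧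
      Nat.card V = Nat.card F ^ Fintype.card κ * Nat.card W' ∧
      Nat.card {c : AA V // Anti h t c ∧ ∀ i, c (b i) = b i} =
        Nat.card {c : AA W' // Anti (rs W' h) t' c} := by
  have h1 : ∀ (a : κ → F) w, h (∑ i, a i • b i) w = ∑ i, a i * h (b i) w := by
    intro a w
    have := map_sum (H.lin w) (fun i => a i • b i) Finset.univ
    exact this.trans (Finset.sum_congr rfl fun i _ => H.smul_left _ _ _)
  have hli : LinearIndependent F b := by
    rw [Fintype.linearIndependent_iff]
    intro a ha
    have := hnd a fun j => by rw [← h1, ha, H.zero_left]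
    exact fun i => congrFun this i
  let W := Submodule.span F (Set.range b)
  let B : Module.Basis κ F W := Module.Basis.span hli
  have hB : ∀ i, (B i : V) = b i := fun i => congrArg Subtype.val (Module.Basis.span_apply hli i)
  have hx : ∀ x : W, (x : V) = ∑ i, B.equivFun x i • b i := by
    intro x
    have := congrArg Subtype.val (B.sum_equivFun x)
    rw [AddSubmonoidClass.coe_finsetSum] at this
    rw [← this]
    exact Finset.sum_congr rfl fun i _ => by rw [Submodule.coe_smul, hB]
  have hbW : ∀ i, b i ∈ W := fun i => Submodule.subset_span ⟨i, rfl⟩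
  have S : Spl h t W (H.perp W) := by
    apply Spl.of_nondeg H (fun i => i.elim)
    intro v hv hw
    have e := hx ⟨v, hv⟩
    have := hnd (B.equivFun ⟨v, hv⟩) fun j => by
      rw [← h1, ← e, H.herm, hw _ (hbW j), star_zero]
    rw [this] at e
    simpa using e
  have hinv : ∀ v : W, (B.equivFun.symm fun i => star (B.equivFun (B.equivFun.symm fun i =>
      star (B.equivFun v i)) i)) = v := by
    intro v
    rw [LinearEquiv.apply_symm_apply, LinearEquiv.symm_apply_eq]
    ext i; exact star_star _
  let c1 : AA W := AA.ofInvol (fun x => B.equivFun.symm fun i => star (B.equivFun x i))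
    (fun v w => by
      rw [← map_add]; congr 1; ext i; simp) hinv
  have hc1 : ∀ x : W, (c1 x : V) = ∑ i, star (B.equivFun x i) • b i := by
    intro x
    rw [hx (c1 x), AA.ofInvol_apply, LinearEquiv.apply_symm_apply]
  have A1 : Anti (rs W h) (rt S.st) c1 := by
    refine ⟨fun v => ?_, fun a v => ?_, fun v w => ?_, fun i => i.elim⟩
    · exact hinv v
    · apply Subtype.ext
      rw [hc1, Submodule.coe_smul, hc1, Finset.smul_sum]
      refine Finset.sum_congr rfl fun i _ => ?_
      rw [map_smul, Pi.smul_apply, smul_eq_mul, star_mul', mul_smul]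
    · show h (c1 v) (c1 w) = star (h v w)
      rw [hc1, hc1, hx v, hx w, H.sum_sum, H.sum_sum, star_sum]
      refine Finset.sum_congr rfl fun i _ => ?_
      rw [star_sum]
      refine Finset.sum_congr rfl fun j _ => ?_
      rw [star_mul', star_mul', hr]
  refine ⟨H.perp W, rt S.st', (S.symm H).sp H, fun i w hw => S.orth _ (hbW i) w hw, ?_, ?_, ?_⟩
  · have := ((B.equivFun.symm.toEquiv.prodCongr (Equiv.refl _)).trans
      (W.prodEquivOfIsCompl _ S.compl).toEquiv).bijective
    convert this using 1
    ext p
    simp [hB]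
  · rw [← Nat.card_congr (W.prodEquivOfIsCompl _ S.compl).toEquiv, Nat.card_prod,
      Nat.card_congr B.equivFun.toEquiv, Nat.card_fun, Nat.card_eq_fintype_card (α := κ)]
  · symm
    refine Nat.card_congr (Equiv.ofBijective (fun c' => ⟨glue S.compl c1 c'.1, S.glue_anti H A1 c'.2, ?_⟩) ⟨?_, ?_⟩)
    · intro i
      rw [← hB, glue_left]
      congr 1
      rw [AA.ofInvol_apply, LinearEquiv.symm_apply_eq]
      ext j
      rw [B.equivFun_self]
      split_ifs <;> simp
    · intro x y hxy
      apply Subtype.ext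
      apply AA.ext
      intro w
      apply Subtype.ext
      have := congrArg (fun c => c.1 (w : V)) hxy
      simpa only [glue_right] using this
    · rintro ⟨c, hc, hcb⟩
      have hcW : ∀ w : W, c w = c1 w := by
        intro w
        rw [hc1, hx w, map_sum]
        exact Finset.sum_congr rfl fun i _ => by rw [hc.smul, hcb]
      obtain ⟨f, f', rfl⟩ := exists_glue S.compl c (fun w hw => by
        rw [hcW ⟨w, hw⟩]; exact (c1 _).2) (by
        intro w hw x hxW
        have := hc.iso (c x) w
        rw [hc.sq] at this
        rw [this, hw _ (by rw [hcW ⟨x, hxW⟩]; exact (c1 _).2), star_zero])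
      refine ⟨⟨f', S.anti_res' hc⟩, ?_⟩
      have : c1 = f := AA.ext fun w => Subtype.ext (by rw [← hcW, glue_left])
      exact Subtype.ext (congrArg (fun z => glue S.compl z f') this)

end count
end UCS

set_option linter.unusedSectionVars false
namespace UCS

theorem dcount {A B : Type} [Fintype A] [Fintype B] (r : A → B → Prop) :
    ∑ a, Nat.card {b // r a b} = ∑ b, Nat.card {a // r a b} := by
  classical
  simp only [Nat.card_eq_fintype_card, Fintype.card_subtype]
  exact Finset.sum_card_bipartiteAbove_eq_sum_card_bipartiteBelow r

theorem card_pairs {A B : Type} [Finite A] [Fintype B] (r : A → B → Prop) :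
    Nat.card {p : A × B // r p.1 p.2} = ∑ b, Nat.card {a // r a b} := by
  have : Fintype A := Fintype.ofFinite A
  rw [← dcount, Nat.card_congr (Equiv.subtypeProdEquivSigmaSubtype r), Nat.card_sigma]

theorem sum_dich {W : Type} [Fintype W] (p : W → Prop) (f : W → ℤ) (a b : ℤ)
    (h1 : ∀ w, p w → f w = a) (h2 : ∀ w, ¬ p w → f w = b) :
    ∑ w, f w = Nat.card {w // p w} * a + (Nat.card W - Nat.card {w // p w}) * b := by
  classical
  have h3 : ∑ w, f w = ∑ w, (b + if p w then a - b else 0) := by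
    refine Finset.sum_congr rfl fun w _ => ?_
    split_ifs with h
    · rw [h1 w h]; ring
    · rw [h2 w h]; ring
  rw [h3, Finset.sum_add_distrib, ← Finset.sum_filter, Finset.sum_const, Finset.sum_const,
    Nat.card_eq_fintype_card, Nat.card_eq_fintype_card, Fintype.card_subtype, Finset.card_univ,
    nsmul_eq_mul, nsmul_eq_mul]
  ring

section count
variable {F : Type} [Field F] [StarRing F] [Finite F] {q : ℕ} (hcard : Nat.card F = q ^ 2)
  (hstar : ∀ x : F, star x = x ^ q) (hq : 2 ≤ q) (hst : ∃ a : F, star a ≠ a)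

include hcard hstar hq in
theorem normfib {a : F} (ha : a ≠ 0) (hs : star a = a) : Nat.card {x : F // x * star x = a} = q + 1 := by
  have hG : Nat.card Fˣ = (q - 1) * (q + 1) := by
    rw [Nat.card_units, hcard]
    obtain ⟨k, rfl⟩ : ∃ k, q = k + 1 := ⟨q - 1, by omega⟩
    rw [Nat.add_sub_cancel]
    have : (k + 1) ^ 2 = k * (k + 1 + 1) + 1 := by ring
    omega
  have k1 : Nat.card (powMonoidHom (q + 1) : Fˣ →* Fˣ).ker = q + 1 := by
    rw [IsCyclic.card_powMonoidHom_ker, hG, Nat.gcd_eq_right (Dvd.intro_left _ rfl)]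
  have k2 : Nat.card (powMonoidHom (q - 1) : Fˣ →* Fˣ).ker = q - 1 := by
    rw [IsCyclic.card_powMonoidHom_ker, hG, Nat.gcd_eq_right (Dvd.intro _ rfl)]
  have k3 : Nat.card (powMonoidHom (q + 1) : Fˣ →* Fˣ).range = q - 1 := by
    rw [IsCyclic.card_powMonoidHom_range, hG, Nat.gcd_eq_right (Dvd.intro_left _ rfl),
      Nat.mul_div_cancel _ (by omega)]
  have hle : (powMonoidHom (q + 1) : Fˣ →* Fˣ).range ≤ (powMonoidHom (q - 1) : Fˣ →* Fˣ).ker := by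
    rintro _ ⟨x, rfl⟩
    rw [MonoidHom.mem_ker, powMonoidHom_apply, powMonoidHom_apply, ← pow_mul, mul_comm, ← hG,
      pow_card_eq_one']
  have heq := Subgroup.eq_of_le_of_card_ge hle (by rw [k2, k3])
  obtain ⟨x0, hx0⟩ : Units.mk0 a ha ∈ (powMonoidHom (q + 1) : Fˣ →* Fˣ).range := by
    rw [heq, MonoidHom.mem_ker, powMonoidHom_apply]
    apply Units.ext
    rw [Units.val_pow_eq_pow_val, Units.val_mk0, Units.val_one]
    apply mul_right_cancel₀ ha
    rw [← pow_succ, Nat.sub_add_cancel (by omega), one_mul, ← hstar, hs]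
  have hx0' : (x0 : F) ^ (q + 1) = a := by
    have := congrArg Units.val hx0
    simpa using this
  rw [← k1]
  symm
  refine Nat.card_congr (Equiv.ofBijective (fun k => ⟨x0 * (k.1 : F), ?_⟩) ⟨?_, ?_⟩)
  · have := congrArg Units.val (MonoidHom.mem_ker.1 k.2)
    rw [powMonoidHom_apply, Units.val_pow_eq_pow_val, Units.val_one] at this
    rw [hstar, ← pow_succ', mul_pow, this, hx0', mul_one]
  · intro x y hxy
    have := congrArg Subtype.val hxy
    exact Subtype.ext (Units.ext (mul_left_cancel₀ x0.ne_zero this))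
  · rintro ⟨x, hx⟩
    rw [hstar, ← pow_succ'] at hx
    have hx1 : x ≠ 0 := by rintro rfl; apply ha; rw [← hx, zero_pow (by omega)]
    refine ⟨⟨x0⁻¹ * Units.mk0 x hx1, ?_⟩, ?_⟩
    · rw [MonoidHom.mem_ker, powMonoidHom_apply]
      apply Units.ext
      rw [Units.val_pow_eq_pow_val, Units.val_mul, Units.val_mk0, mul_pow, hx, Units.val_inv_eq_inv_val,
        inv_pow, hx0', inv_mul_cancel₀ ha, Units.val_one]
    · apply Subtype.ext
      simp

variable {V : Type} [AddCommGroup V] [Module F V]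
  [Finite V] {h : V → V → F} {t : Empty → Module.End F V} (H : Sp h t)

include hst in
theorem fix_card {c : AA V} (hc : Anti h t c) (K : Submodule F V) (hK : ∀ v ∈ K, c v ∈ K) :
    Nat.card {v : V // v ∈ K ∧ c v = v} ^ 2 = Nat.card K := by
  obtain ⟨a, ha⟩ := hst
  have hd : a - star a ≠ 0 := sub_ne_zero.2 ha.symm
  have hcf : ∀ x, c x = x → c (a • x) = star a • x := fun x hx => by rw [hc.smul, hx]
  have hsub : ∀ x y, c (x - y) = c x - c y := fun x y => map_sub c x y
  rw [pow_two, ← Nat.card_prod]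
  refine Nat.card_congr (Equiv.ofBijective (fun p => ⟨p.1.1 + a • p.2.1,
    K.add_mem p.1.2.1 (K.smul_mem _ p.2.2.1)⟩) ⟨?_, ?_⟩)
  · rintro ⟨⟨x, hx, hx'⟩, ⟨y, hy, hy'⟩⟩ ⟨⟨x1, hx1, hx1'⟩, ⟨y1, hy1, hy1'⟩⟩ e
    have e1 : x + a • y = x1 + a • y1 := congrArg Subtype.val e
    have e2 := congrArg c e1
    rw [map_add, map_add, hcf _ hy', hcf _ hy1', hx', hx1'] at e2
    have e3 : (a - star a) • (y - y1) = 0 := by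
      have : (a - star a) • (y - y1) = (x + a • y) - (x + star a • y) - ((x1 + a • y1) - (x1 + star a • y1)) := by
        module
      rw [this, e1, e2, sub_self]
    have e4 : y = y1 := sub_eq_zero.1 ((smul_eq_zero.1 e3).resolve_left hd)
    subst e4
    have e5 : x = x1 := add_right_cancel e1
    subst e5
    rfl
  · rintro ⟨v, hv⟩
    have sd : star (a - star a)⁻¹ = -(a - star a)⁻¹ := by
      rw [star_inv₀, star_sub, star_star, ← neg_sub, inv_neg]
    have hy : c ((a - star a)⁻¹ • (v - c v)) = (a - star a)⁻¹ • (v - c v) := by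
      rw [hc.smul, hsub, hc.sq, sd]
      module
    set y := (a - star a)⁻¹ • (v - c v) with hyd
    have hyv : (a - star a) • y = v - c v := by rw [hyd, smul_smul, mul_inv_cancel₀ hd, one_smul]
    have hyK : y ∈ K := K.smul_mem _ (K.sub_mem hv (hK v hv))
    refine ⟨⟨⟨v - a • y, K.sub_mem hv (K.smul_mem _ hyK), ?_⟩, ⟨y, hyK, hy⟩⟩, ?_⟩
    · rw [hsub, hcf _ hy, ← sub_eq_zero]
      have : c v - star a • y - (v - a • y) = (a - star a) • y - (v - c v) := by module
      rw [this, hyv, sub_self]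
    · exact Subtype.ext (sub_add_cancel _ _)

include hst H in
theorem exists_aniso [Nontrivial V] : ∃ e, h e e ≠ 0 := by
  by_contra hcon
  push Not at hcon
  obtain ⟨v, hv⟩ := exists_ne (0 : V)
  obtain ⟨b, hb⟩ := exists_tr_one hst
  apply hv
  apply H.nd
  intro w
  by_contra hvw
  have := hcon ((b / h v w) • v + w)
  rw [H.add_left, H.add_right, H.add_right, hcon, hcon, H.herm ((b / h v w) • v) w, H.smul_left,
    div_mul_cancel₀ _ hvw] at this
  rw [zero_add, add_zero, hb] at this
  exact one_ne_zero this

end count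

theorem Zcount {F : Type} [Field F] [StarRing F] [Finite F] {q : ℕ} (hcard : Nat.card F = q ^ 2)
    (hstar : ∀ x : F, star x = x ^ q) (hq : 2 ≤ q) (hst : ∃ a : F, star a ≠ a) (n : ℕ) :
    ∀ (V : Type) [AddCommGroup V] [Module F V] [Finite V] (h : V → V → F)
    (t : Empty → Module.End F V), Sp h t → Nat.card V = (q ^ 2) ^ n →
    (q : ℤ) * Nat.card {v // h v v = 0} = q ^ (2 * n) + (q - 1) * (-q) ^ n := by
  induction n with
  | zero =>
    intro V _ _ _ h t H hV
    rw [pow_zero, Nat.card_eq_one_iff_unique] at hV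
    obtain ⟨hs, -⟩ := hV
    have : Nat.card {v // h v v = 0} = 1 := by
      rw [Nat.card_eq_one_iff_unique]
      exact ⟨inferInstance, ⟨0, H.zero_left 0⟩⟩
    rw [this]; simp
  | succ n ih =>
    intro V _ _ _ h t H hV
    have hq1 : 1 < q ^ 2 := by nlinarith
    have hnt : Nontrivial V := by
      rw [← Finite.one_lt_card_iff_nontrivial, hV]
      exact Nat.one_lt_pow (by omega) hq1
    obtain ⟨e, he⟩ := exists_aniso hst H
    have hre : ∀ v, star (h v v) = h v v := fun v => (H.herm v v).symm
    obtain ⟨W, t', H', ho, hb, hc, -⟩ := gram H (fun _ : Unit => e) (fun _ _ => hre e) (by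
      intro a ha
      ext i
      have := ha ()
      rw [Fintype.sum_unique] at this
      exact (mul_eq_zero.1 this).resolve_right he)
    rw [hV, hcard, Fintype.card_unit, pow_one, pow_succ'] at hc
    have hW : Nat.card W = (q ^ 2) ^ n := (Nat.eq_of_mul_eq_mul_left (by omega) hc).symm
    have IH := ih W (rs W h) t' H' hW
    have : Fintype W := Fintype.ofFinite W
    let φ := Equiv.ofBijective _ hb
    have hφ : ∀ p : (Unit → F) × W, h (φ p) (φ p) = p.1 () * star (p.1 ()) * h e e + rs W h p.2 p.2 := by
      rintro ⟨a, w⟩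
      show h (∑ i, a i • e + (w : V)) (∑ i, a i • e + (w : V)) = _
      rw [Fintype.sum_unique, H.add_left, H.add_right, H.add_right, H.smul_left, H.smul_right,
        H.smul_left, ho () w w.2, H.herm (a default • e) w, H.smul_left, ho () w w.2]
      rw [mul_zero, star_zero, add_zero, zero_add, mul_assoc]
      rfl
    have hZ : (Nat.card {v // h v v = 0} : ℤ) = Nat.card {w // rs W h w w = 0} * 1 +
        (Nat.card W - Nat.card {w // rs W h w w = 0}) * (q + 1) := by
      rw [← Nat.card_congr (Equiv.subtypeEquiv φ (p := fun p : (Unit → F) × W =>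
        p.1 () * star (p.1 ()) * h e e + rs W h p.2 p.2 = 0) (fun p => by rw [hφ])),
        card_pairs (fun (a : Unit → F) (w : W) => a () * star (a ()) * h e e + rs W h w w = 0),
        Nat.cast_sum]
      have hc1 : ∀ w : W, Nat.card {a : Unit → F // a () * star (a ()) * h e e + rs W h w w = 0} =
          Nat.card {x : F // x * star x = - rs W h w w / h e e} := fun w =>
        Nat.card_congr (Equiv.subtypeEquiv (Equiv.funUnique Unit F) fun a => by
          rw [eq_div_iff he, eq_neg_iff_add_eq_zero]; rfl)
      apply sum_dich
      · intro w hw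
        rw [hc1, hw, neg_zero, zero_div]
        norm_cast
        rw [Nat.card_eq_one_iff_unique]
        refine ⟨⟨fun x y => ?_⟩, ⟨0, by simp⟩⟩
        have h0 : ∀ x : {x : F // x * star x = 0}, x.1 = 0 := fun x => by
          rcases mul_eq_zero.1 x.2 with h | h
          · exact h
          · exact star_eq_zero.1 h
        exact Subtype.ext ((h0 x).trans (h0 y).symm)
      · intro w hw
        rw [hc1, normfib hcard hstar hq (div_ne_zero (neg_ne_zero.2 hw) he)]
        · push_cast; rfl
        · rw [star_div₀, star_neg, hre, rs, hre]
    rw [hZ, hW]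
    push_cast
    have : (q : ℤ) ^ (2 * (n + 1)) = q ^ 2 * q ^ (2 * n) := by ring
    rw [this, ← pow_mul, pow_succ]
    linear_combination (-q : ℤ) * IH
end UCS

set_option linter.unusedSectionVars false
namespace UCS

section count
variable {F : Type} [Field F] [StarRing F] [Finite F] {q : ℕ} (hcard : Nat.card F = q ^ 2)
  (hq : 2 ≤ q) (hst : ∃ a : F, star a ≠ a)
variable {V : Type} [AddCommGroup V] [Module F V]
  [Finite V] {h : V → V → F} {t : Empty → Module.End F V} (H : Sp h t)
include hcard hq hst H

theorem iso_card {k : ℕ} (hV : Nat.card V = (q ^ 2) ^ (k + 1)) {v : V} (hv : v ≠ 0) (hvv : h v v = 0) {N : ℕ}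
    (ih : ∀ (W : Type) [AddCommGroup W] [Module F W] [Finite W] (h' : W → W → F)
      (t' : Empty → Module.End F W), Sp h' t' → Nat.card V = (q ^ 2) ^ 2 * Nat.card W →
      Nat.card {c // Anti h' t' c} = N) :
    Nat.card {c // Anti h t c ∧ c v = v} = q ^ k * N := by
  have hsurj : Function.Surjective (H.lin v) := by
    apply LinearMap.surjective
    intro h0
    apply hv
    apply H.nd_right
    intro w
    exact LinearMap.congr_fun h0 w
  let K := LinearMap.ker (H.lin v)
  have hK : Nat.card K = (q ^ k) ^ 2 := by
    have h1 := Submodule.card_eq_card_quotient_mul_card K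
    rw [Nat.card_congr ((H.lin v).quotKerEquivOfSurjective hsurj).toEquiv, hcard, hV, pow_succ] at h1
    have h2 : q ^ 2 * (q ^ 2) ^ k = q ^ 2 * Nat.card K := by
      rw [mul_comm, h1]; ring
    rw [← Nat.eq_of_mul_eq_mul_left (by positivity) h2, ← pow_mul, ← pow_mul, mul_comm]
  obtain ⟨w1, hw1⟩ := hsurj 1
  have hw1 : h w1 v = 1 := hw1
  have : Fintype {c // Anti h t c ∧ c v = v} := Fintype.ofFinite _
  have : Fintype {w // h w v = 1} := Fintype.ofFinite _
  have key := dcount (fun (c : {c // Anti h t c ∧ c v = v}) (w : {w // h w v = 1}) => c.1 w.1 = w.1)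
  have hA : ∀ c : {c // Anti h t c ∧ c v = v}, Nat.card {w : {w // h w v = 1} // c.1 w.1 = w.1} = q ^ k := by
    rintro ⟨c, hc, hcv⟩
    have hcK : ∀ x, h (c x) v = star (h x v) := fun x => by
      conv_lhs => rw [← hcv]
      exact hc.iso x v
    obtain ⟨b, hb⟩ := exists_tr_one hst
    let w0 := b • w1 + c (b • w1)
    have hw0 : h w0 v = 1 := by
      rw [H.add_left, hcK, H.smul_left, hw1, mul_one, hb]
    have hcw0 : c w0 = w0 := by rw [map_add, hc.sq, add_comm]
    have h1 := fix_card hst hc K (fun x hx => by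
      show h (c x) v = 0
      rw [hcK, show h x v = 0 from hx, star_zero])
    rw [hK] at h1
    have h2 := Nat.pow_left_injective (n := 2) two_ne_zero h1
    rw [← h2]
    refine Nat.card_congr
      { toFun := fun w => ⟨w.1.1 - w0, ?_, ?_⟩
        invFun := fun x => ⟨⟨x.1 + w0, ?_⟩, ?_⟩
        left_inv := fun w => ?_
        right_inv := fun x => ?_ }
    · show h (w.1.1 - w0) v = 0
      rw [H.sub_left, w.1.2, hw0, sub_self]
    · rw [map_sub, w.2, hcw0]
    · rw [H.add_left, hw0, show h x.1 v = 0 from x.2.1, zero_add]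
    · show c (x.1 + w0) = x.1 + w0
      rw [map_add, hcw0, x.2.2]
    · exact Subtype.ext (Subtype.ext (sub_add_cancel _ _))
    · exact Subtype.ext (add_sub_cancel_right _ _)
  have hB : ∀ w : {w // h w v = 1}, Nat.card {c : {c // Anti h t c ∧ c v = v} // c.1 w.1 = w.1} = N := by
    rintro ⟨w, hw⟩
    have hw' : h v w = 1 := by rw [H.herm, hw, star_one]
    obtain ⟨W, t', H', -, -, hc, hN⟩ := gram H (fun i : Bool => cond i v w) (by
      intro i j
      cases i <;> cases j <;> simp [hvv, hw, hw', ← H.herm w w]) (by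
      intro a ha
      have h1 := ha true
      have h2 := ha false
      simp only [Fintype.sum_bool, cond_true, cond_false, hvv, hw, hw', mul_zero, mul_one, zero_add] at h1 h2
      rw [h1, zero_mul, add_zero] at h2
      ext i
      cases i
      · exact h1
      · exact h2)
    rw [hcard, Fintype.card_bool] at hc
    rw [← ih W _ t' H' hc, ← hN]
    refine Nat.card_congr
      { toFun := fun c => ⟨c.1.1, c.1.2.1, fun i => ?_⟩
        invFun := fun c => ⟨⟨c.1, c.2.1, c.2.2 true⟩, c.2.2 false⟩
        left_inv := fun c => rfl
        right_inv := fun c => rfl }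
    cases i
    · exact c.2
    · exact c.1.2.2
  have hBc : Nat.card {w // h w v = 1} = (q ^ k) ^ 2 := by
    rw [← hK]
    refine Nat.card_congr
      { toFun := fun w => ⟨w.1 - w1, ?_⟩
        invFun := fun x => ⟨x.1 + w1, ?_⟩
        left_inv := fun w => Subtype.ext (sub_add_cancel _ _)
        right_inv := fun x => Subtype.ext (add_sub_cancel_right _ _) }
    · show h (w.1 - w1) v = 0
      rw [H.sub_left, w.2, hw1, sub_self]
    · rw [H.add_left, hw1, show h x.1 v = 0 from x.2, zero_add]
  simp only [hA, hB, Finset.sum_const, Finset.card_univ, ← Nat.card_eq_fintype_card, hBc, smul_eq_mul] at key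
  have hp : 0 < q ^ k := by positivity
  apply Nat.eq_of_mul_eq_mul_right hp
  rw [key]; ring

theorem aniso_card {v : V} (hv : h v v ≠ 0) {N : ℕ}
    (ih : ∀ (W : Type) [AddCommGroup W] [Module F W] [Finite W] (h' : W → W → F)
      (t' : Empty → Module.End F W), Sp h' t' → Nat.card V = q ^ 2 * Nat.card W →
      Nat.card {c // Anti h' t' c} = N) :
    Nat.card {c // Anti h t c ∧ c v = v} = N := by
  obtain ⟨W, t', H', -, -, hc, hN⟩ := gram H (fun _ : Unit => v) (fun _ _ => (H.herm v v).symm) (by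
      intro a ha
      ext i
      have := ha ()
      rw [Fintype.sum_unique] at this
      exact (mul_eq_zero.1 this).resolve_right hv)
  rw [hcard, Fintype.card_unit, pow_one] at hc
  rw [← ih W _ t' H' hc, ← hN]
  exact Nat.card_congr (Equiv.subtypeEquivRight fun c => by simp)

end count

/-- the expected number -/
def TT (q n : ℕ) : ℕ := ∏ i ∈ Finset.Icc 1 n, if Odd i then q ^ i + 1 else q ^ i

theorem TT_succ (q n : ℕ) : TT q (n + 1) = TT q n * if Odd (n + 1) then q ^ (n + 1) + 1 else q ^ (n + 1) :=
  Finset.prod_Icc_succ_top (by omega) _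

theorem COUNT {F : Type} [Field F] [StarRing F] [Finite F] {q : ℕ} (hcard : Nat.card F = q ^ 2)
    (hstar : ∀ x : F, star x = x ^ q) (hq : 2 ≤ q) (hst : ∃ a : F, star a ≠ a) (n : ℕ) :
    ∀ (V : Type) [AddCommGroup V] [Module F V] [Finite V] (h : V → V → F)
    (t : Empty → Module.End F V), Sp h t → Nat.card V = (q ^ 2) ^ n →
    Nat.card {c // Anti h t c} = TT q n := by
  induction n using Nat.strong_induction_on with
  | _ n ih =>
  intro V _ _ _ h t H hV
  have hq2 : 1 < q ^ 2 := by nlinarith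
  rcases n with _ | k
  · rw [pow_zero, Nat.card_eq_one_iff_unique] at hV
    obtain ⟨hs, -⟩ := hV
    have : TT q 0 = 1 := rfl
    rw [this, Nat.card_eq_one_iff_unique]
    exact ⟨⟨fun x y => Subtype.ext (AA.ext fun v => Subsingleton.elim _ _)⟩,
      ⟨1, fun v => rfl, fun a v => Subsingleton.elim _ _, fun v w => by
        rw [Subsingleton.elim v 0, AA.one_apply, AA.one_apply, H.zero_left, star_zero], fun i => i.elim⟩⟩
  have : Fintype V := Fintype.ofFinite V
  have : Fintype {c // Anti h t c} := Fintype.ofFinite _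
  have key := dcount (fun (c : {c // Anti h t c}) (v : V) => c.1 v = v)
  have hA : ∀ c : {c // Anti h t c}, Nat.card {v : V // c.1 v = v} = q ^ (k + 1) := by
    rintro ⟨c, hc⟩
    have h1 := fix_card hst hc ⊤ (fun _ _ => trivial)
    rw [Nat.card_congr (Submodule.topEquiv (R := F) (M := V)).toEquiv, hV, ← pow_mul, mul_comm,
      pow_mul] at h1
    rw [← Nat.pow_left_injective (n := 2) two_ne_zero h1]
    exact Nat.card_congr (Equiv.subtypeEquivRight fun v => by simp)
  have hB : ∀ v, Nat.card {c : {c // Anti h t c} // c.1 v = v} = Nat.card {c // Anti h t c ∧ c v = v} :=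
    fun v => Nat.card_congr (Equiv.subtypeSubtypeEquivSubtypeInter _ fun c : AA V => c v = v)
  simp only [hA, hB, Finset.sum_const, Finset.card_univ, ← Nat.card_eq_fintype_card, smul_eq_mul] at key
  set N := Nat.card {c // Anti h t c} with hN
  set X := q ^ k * TT q (k - 1) with hX
  have h0 : Nat.card {c // Anti h t c ∧ c 0 = 0} = N :=
    Nat.card_congr (Equiv.subtypeEquivRight fun c => by simp)
  have hiso : ∀ v, v ≠ 0 → h v v = 0 → Nat.card {c // Anti h t c ∧ c v = v} = X := by
    intro v hv hvv
    refine iso_card hcard hq hst H hV hv hvv ?_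
    intro W _ _ _ h' t' H' hW
    rw [hV] at hW
    have hk : 1 ≤ k := by
      by_contra hk
      have : k = 0 := by omega
      subst this
      have hp : 0 < Nat.card W := Nat.card_pos
      have : q ^ 2 * 1 = q ^ 2 * (q ^ 2 * Nat.card W) := by rw [← mul_assoc, ← pow_two, ← hW]; ring
      have := Nat.eq_of_mul_eq_mul_left (by omega) this
      nlinarith
    obtain ⟨j, rfl⟩ : ∃ j, k = j + 1 := ⟨k - 1, by omega⟩
    refine ih j (by omega) W h' t' H' ?_
    rw [show j + 1 + 1 = 2 + j by omega, pow_add] at hW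
    exact (Nat.eq_of_mul_eq_mul_left (by positivity) hW).symm
  have han : ∀ v, h v v ≠ 0 → Nat.card {c // Anti h t c ∧ c v = v} = TT q k := by
    intro v hv
    refine aniso_card hcard hq hst H hv ?_
    intro W _ _ _ h' t' H' hW
    refine ih k (by omega) W h' t' H' ?_
    rw [hV, pow_succ'] at hW
    exact (Nat.eq_of_mul_eq_mul_left (by omega) hW).symm
  classical
  have hsum := sum_dich (fun v => h v v = 0) (fun v => (Nat.card {c // Anti h t c ∧ c v = v} : ℤ) -
    if v = 0 then (N : ℤ) - X else 0) X (TT q k) (by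
      intro v hv
      split_ifs with hv0
      · subst hv0; rw [h0]; ring
      · rw [hiso v hv0 hv]; ring) (by
      intro v hv
      rw [han v hv, if_neg, sub_zero]
      rintro rfl
      exact hv (H.zero_left 0))
  rw [Finset.sum_sub_distrib, Finset.sum_ite_eq' Finset.univ (0 : V), if_pos (Finset.mem_univ _),
    ← Nat.cast_sum, ← key, hV] at hsum
  have hZ := Zcount hcard hstar hq hst (k + 1) V h t H hV
  set Z := Nat.card {v // h v v = 0}
  have hq0 : (q : ℤ) ≠ 0 := by positivity
  have hn : (q : ℤ) ^ (k + 1) - 1 ≠ 0 := by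
    have : (1 : ℤ) < q ^ (k + 1) := by exact_mod_cast Nat.one_lt_pow (by omega) (by omega)
    omega
  have goal : (q : ℤ) * ((q : ℤ) ^ (k + 1) - 1) * N = (q : ℤ) * ((q : ℤ) ^ (k + 1) - 1) * TT q (k + 1) := by
    rcases k with _ | j
    · have t0 : TT q 0 = 1 := rfl
      rw [TT_succ, t0]
      simp only [hX, t0] at hsum
      rw [if_pos (by decide)]
      push_cast at hsum ⊢
      linear_combination (q : ℤ) * hsum
    · rw [TT_succ, TT_succ]
      simp only [hX, Nat.add_sub_cancel, TT_succ] at hsum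
      have e1 : Odd (j + 1 + 1) ↔ Odd j := by simp [Nat.odd_add_one]
      rcases Nat.even_or_odd j with hj | hj
      · rw [if_pos hj.add_one] at hsum
        rw [if_pos hj.add_one, if_neg (by rwa [e1, Nat.not_odd_iff_even])]
        rw [Even.neg_pow (by rwa [← Nat.not_odd_iff_even, e1, Nat.not_odd_iff_even])] at hZ
        push_cast at hsum ⊢
        linear_combination (q : ℤ) * hsum - (TT q j : ℤ) * hZ
      · have e2 : ¬ Odd (j + 1) := by rwa [Nat.odd_add_one, not_not]
        rw [if_neg e2] at hsum
        rw [if_neg e2, if_pos (e1.2 hj)]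
        rw [Odd.neg_pow (e1.2 hj)] at hZ
        push_cast at hsum ⊢
        linear_combination (q : ℤ) * hsum
  exact_mod_cast mul_left_cancel₀ (mul_ne_zero hq0 hn) goal
end UCS

set_option linter.unusedSectionVars false
namespace UCS

section final
open Matrix
variable {F : Type} [Field F] [StarRing F] {m : ℕ}

/-- the standard hermitian form -/
def h0 (v w : Fin m → F) : F := v ⬝ᵥ star w

/-- the empty family -/
def t0 : Empty → Module.End F (Fin m → F) := fun i => i.elim

theorem sp0 : Sp (h0 (F := F) (m := m)) t0 where
  add_left v v' w := add_dotProduct _ _ _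
  smul_left a v w := smul_dotProduct _ _ _
  herm v w := by
    simp [h0, dotProduct, star_sum, mul_comm]
  nd v hv := by
    funext i
    have := hv (Pi.single i 1)
    rw [h0, ← Pi.single_star, star_one, dotProduct_single, mul_one] at this
    exact this
  tun i := i.elim
  tcomm i := i.elim
  tper i := i.elim

/-- entrywise conjugation -/
def c0 : AA (Fin m → F) := AA.ofInvol star star_add star_star

theorem anti0 : Anti (h0 (F := F) (m := m)) t0 c0 where
  sq v := star_star v
  smul a v := star_smul a v
  iso v w := by
    show star v ⬝ᵥ star (star w) = star (v ⬝ᵥ star w)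
    rw [star_dotProduct_star, dotProduct_comm]
  tinv i := i.elim

theorem h0_mulVec (A : Matrix (Fin m) (Fin m) F) (v w : Fin m → F) :
    h0 (A *ᵥ v) (A *ᵥ w) = h0 ((Aᴴ * A) *ᵥ v) w := by
  rw [h0, h0, star_mulVec, dotProduct_comm, ← dotProduct_mulVec, mulVec_mulVec, dotProduct_comm]

/-- matrices as operators -/
def toAA : unitaryGroup (Fin m) F →* AA (Fin m → F) where
  toFun A := (⟨⟨fun v => A.1 *ᵥ v, fun v => (star A).1 *ᵥ v,
    fun v => by
      show star A.1 *ᵥ (A.1 *ᵥ v) = v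
      rw [mulVec_mulVec, mem_unitaryGroup_iff'.1 A.2, one_mulVec],
    fun v => by
      show A.1 *ᵥ (star A.1 *ᵥ v) = v
      rw [mulVec_mulVec, mem_unitaryGroup_iff.1 A.2, one_mulVec]⟩,
    fun v w => mulVec_add _ v w⟩ : (Fin m → F) ≃+ (Fin m → F))
  map_one' := AA.ext fun v => one_mulVec v
  map_mul' A B := AA.ext fun v => (mulVec_mulVec v A.1 B.1).symm

theorem toAA_apply (A : unitaryGroup (Fin m) F) (v : Fin m → F) : toAA A v = A.1 *ᵥ v := rfl

theorem toAA_inj : Function.Injective (toAA (F := F) (m := m)) := by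
  intro A B hAB
  exact Subtype.ext (Matrix.toLin'.injective (LinearMap.ext fun v => by
    rw [toLin'_apply, toLin'_apply]
    exact congrArg (fun f : AA _ => f v) hAB))

theorem toAA_range : (toAA (F := F) (m := m)).range = U h0 t0 := by
  ext g
  constructor
  · rintro ⟨A, rfl⟩
    refine ⟨fun a v => mulVec_smul _ a v, fun v w => ?_, fun i => i.elim⟩
    rw [toAA_apply, toAA_apply, h0_mulVec, ← star_eq_conjTranspose, mem_unitaryGroup_iff'.1 A.2, one_mulVec]
  · intro hg
    let A := LinearMap.toMatrix' (toE g hg.1)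
    have hA : ∀ v, A *ᵥ v = g v := fun v => LinearMap.toMatrix'_mulVec _ v
    have hAA : Aᴴ * A = 1 := by
      apply Matrix.toLin'.injective
      apply LinearMap.ext
      intro v
      rw [toLin'_apply, toLin'_apply, one_mulVec, ← sub_eq_zero]
      apply sp0.nd
      intro w
      rw [sp0.sub_left, ← h0_mulVec, hA, hA, hg.2.1, sub_self]
    exact ⟨⟨A, mem_unitaryGroup_iff'.2 hAA⟩, AA.ext hA⟩

theorem card_anti {V : Type} [AddCommGroup V] [Module F V] {h : V → V → F}
    {t : Empty → Module.End F V} (H : Sp h t) {c : AA V} (hc : Anti h t c) :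
    Nat.card {g // g ∈ U h t ∧ (c * g * c⁻¹) * g = 1} = Nat.card {c // Anti h t c} := by
  have hcc : c * c = 1 := (hc.nrm H).sq
  have hci : c⁻¹ = c := (hc.nrm H).inv_eq
  rw [hci]
  refine Nat.card_congr
    { toFun := fun g => ⟨c * g.1, fun v => ?_, fun a v => ?_, fun v w => ?_, fun i => i.elim⟩
      invFun := fun c' => ⟨c * c'.1, ⟨fun a v => ?_, fun v w => ?_, fun i => i.elim⟩, ?_⟩
      left_inv := fun g => Subtype.ext (by
        show c * (c * g.1) = g.1
        rw [← mul_assoc, hcc, one_mul])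
      right_inv := fun g => Subtype.ext (by
        show c * (c * g.1) = g.1
        rw [← mul_assoc, hcc, one_mul]) }
  · rw [← AA.mul_apply, ← mul_assoc, g.2.2]; rfl
  · rw [AA.mul_apply, AA.mul_apply, g.2.1.1, hc.smul]
  · rw [AA.mul_apply, AA.mul_apply, hc.iso, g.2.1.2.1]
  · rw [AA.mul_apply, AA.mul_apply, c'.2.smul, hc.smul, star_star]
  · rw [AA.mul_apply, AA.mul_apply, hc.iso, c'.2.iso, star_star]
  · have : c'.1 * c'.1 = 1 := (c'.2.nrm H).sq
    rw [← mul_assoc c, hcc, one_mul, mul_assoc, ← mul_assoc c, hcc, one_mul, this]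

end final
end UCS

/-- The sum of the degrees of the complex irreducible characters of the finite unitary
group `U(m, F_{q²})` (realized as `Matrix.unitaryGroup` over the field with `q²` elements,
with star operation the Frobenius `x ↦ x^q`) equals
`(q+1)·q²·(q³+1)·q⁴ ⋯`, i.e. `Π_{i=1}^{m} (q^i + 1 if i odd, q^i if i even)`. -/
theorem unitary_character_degree_sum (q m : ℕ)
    (hq : ∃ p k, Nat.Prime p ∧ 0 < k ∧ q = p ^ k)
    (F : Type) [Field F] [Fintype F] [StarRing F]
    (hF : Fintype.card F = q ^ 2) (hstar : ∀ x : F, star x = x ^ q) :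
    ∑ᶠ f ∈ {f : Matrix.unitaryGroup (Fin m) F → ℂ |
        ∃ V : FDRep ℂ (Matrix.unitaryGroup (Fin m) F),
          CategoryTheory.Simple V ∧ f = V.character}, f 1
      = ∏ i ∈ Finset.Icc 1 m, (if Odd i then (q : ℂ) ^ i + 1 else (q : ℂ) ^ i) := by
  have hq2 : 2 ≤ q := by
    obtain ⟨p, k, hp, hk, rfl⟩ := hq
    exact hp.two_le.trans (Nat.le_self_pow hk.ne' p)
  have hcard : Nat.card F = q ^ 2 := by rw [Nat.card_eq_fintype_card, hF]
  have hst : ∃ a : F, star a ≠ a := by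
    by_contra hcon
    push Not at hcon
    have h1 : (Polynomial.X ^ q - Polynomial.X : Polynomial F) ≠ 0 :=
      FiniteField.X_pow_card_sub_X_ne_zero F (by omega)
    have h2 := Polynomial.card_roots' (Polynomial.X ^ q - Polynomial.X : Polynomial F)
    rw [FiniteField.X_pow_card_sub_X_natDegree_eq F (by omega)] at h2
    have h3 : (Finset.univ : Finset F).val ≤ (Polynomial.X ^ q - Polynomial.X : Polynomial F).roots := by
      rw [Multiset.le_iff_subset Finset.univ.nodup]
      intro x _
      rw [Polynomial.mem_roots h1]
      simp [Polynomial.IsRoot, ← hstar, hcon]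
    have h4 := Multiset.card_le_card h3
    rw [Finset.card_val, Finset.card_univ, hF] at h4
    nlinarith
  have H := UCS.sp0 (F := F) (m := m)
  have hc := UCS.anti0 (F := F) (m := m)
  have hG := UCS.degree_sum
    ((MonoidHom.ofInjective UCS.toAA_inj).trans (MulEquiv.subgroupCongr (UCS.toAA_range (F := F) (m := m))))
    (hc.nrm H) (fun g hg => UCS.exists_real hst H hc hg)
    (UCS.MAIN hcard hstar hq2 hst _ _ _ _ _ rfl H _ hc)
  rw [UCS.card_anti H hc, UCS.COUNT hcard hstar hq2 hst m _ _ _ H (by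
    rw [Nat.card_fun, hcard, Nat.card_eq_fintype_card, Fintype.card_fin])] at hG
  refine hG.trans ?_
  rw [UCS.TT, Nat.cast_prod]
  refine Finset.prod_congr rfl fun i _ => ?_
  split_ifs <;> push_cast <;> rfl
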